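/- Let f, g ∈ ℂ[x, y, z] be nonconstant squarefree polynomials. Suppose there exist compact subsets K, K̃ ⊆ ℂ³ and a bijection φ : ℂ³ \ K → ℂ³ \ K̃ such that φ and φ⁻¹ are Lipschitz for the Euclidean distance and φ(V(f) \ K) = V(g) \ K̃. Then the total degree of f equals the total degree of g. (That is, the degree of complex algebraic surfaces in ℂ³ is an embedded bi-Lipschitz invariant at infinity.) -/

import Mathlib

open Filter Topology MvPolynomial

/-- The tangent cone at infinity of a subset `A` of a normed space: `v` is a tangent
vector at infinity if there are points `x i ∈ A` with `‖x i‖ → ∞` and positive reals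
`t i` with `x i / t i → v`. -/
def TangentConeAtInfty {E : Type*} [NormedAddCommGroup E] [NormedSpace ℝ E]
    (A : Set E) : Set E :=
  {v | ∃ (x : ℕ → E) (t : ℕ → ℝ), (∀ i, x i ∈ A) ∧ (∀ i, 0 < t i) ∧
    Tendsto (fun i => ‖x i‖) atTop atTop ∧
    Tendsto (fun i => (t i)⁻¹ • x i) atTop (𝓝 v)}

/-- `X` and `Y` are outer bi-Lipschitz homeomorphic at infinity: there are compact sets
`K`, `K'` and a bijection `φ : X \ K → Y \ K'` which is Lipschitz with Lipschitz inverse,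
with respect to the Euclidean (outer) distance. -/
def OuterBiLipAtInfty {E F : Type*} [NormedAddCommGroup E] [NormedAddCommGroup F]
    (X : Set E) (Y : Set F) : Prop :=
  ∃ (K : Set E) (K' : Set F) (φ : E → F),
    IsCompact K ∧ IsCompact K' ∧ Set.BijOn φ (X \ K) (Y \ K') ∧
    (∃ C > (0:ℝ), ∀ a ∈ X \ K, ∀ b ∈ X \ K, dist (φ a) (φ b) ≤ C * dist a b) ∧
    (∃ c > (0:ℝ), ∀ a ∈ X \ K, ∀ b ∈ X \ K, dist a b ≤ c * dist (φ a) (φ b))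

/-- The germs `(X,0)` and `(Y,0)` are outer bi-Lipschitz homeomorphic: there are
`ε, δ > 0` and a bijection `φ : X ∩ B̄_ε(0) → Y ∩ B̄_δ(0)` with `φ 0 = 0` which is
Lipschitz with Lipschitz inverse for the Euclidean (outer) distance. -/
def OuterBiLipGerm {E F : Type*} [NormedAddCommGroup E] [NormedAddCommGroup F]
    (X : Set E) (Y : Set F) : Prop :=
  ∃ ε > (0:ℝ), ∃ δ > (0:ℝ), ∃ φ : E → F,
    Set.BijOn φ (X ∩ Metric.closedBall 0 ε) (Y ∩ Metric.closedBall 0 δ) ∧ φ 0 = 0 ∧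
    (∃ C > (0:ℝ), ∀ a ∈ X ∩ Metric.closedBall 0 ε, ∀ b ∈ X ∩ Metric.closedBall 0 ε,
      dist (φ a) (φ b) ≤ C * dist a b) ∧
    (∃ c > (0:ℝ), ∀ a ∈ X ∩ Metric.closedBall 0 ε, ∀ b ∈ X ∩ Metric.closedBall 0 ε,
      dist a b ≤ c * dist (φ a) (φ b))

/-- The zero set in `ℂⁿ` (with the Euclidean norm) of a polynomial. -/
noncomputable def mvZeroSet {n : ℕ} (f : MvPolynomial (Fin n) ℂ) :
    Set (EuclideanSpace ℂ (Fin n)) :=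
  {x | MvPolynomial.eval (x : Fin n → ℂ) f = 0}

section Lifting

variable {E X A : Type*} [TopologicalSpace E] [TopologicalSpace X] [TopologicalSpace A]

/-- A map lifts through a covering map as soon as it does so after a homotopy of its source. -/
theorem IsCoveringMap.exists_lift_of_homotopy {p : E → X} (cov : IsCoveringMap p)
    (Θ : C(A, X)) (H : C(unitInterval × A, A)) (H_one : ∀ a, H (1, a) = a) (f : C(A, E))
    (hf : ∀ a, Θ (H (0, a)) = p (f a)) : ∃ g : C(A, E), ∀ a, p (g a) = Θ a := by
  refine ⟨(cov.liftHomotopy (Θ.comp H) f hf).comp ⟨fun a => (1, a), by fun_prop⟩, fun a => ?_⟩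
  have := congrFun (cov.liftHomotopy_lifts (Θ.comp H) f hf) (1, a)
  simpa [H_one] using this

theorem IsCoveringMap.exists_lift_of_convex {F : Type*} [NormedAddCommGroup F] [NormedSpace ℝ F]
    {p : E → X} (cov : IsCoveringMap p) (hp : Function.Surjective p) {C : Set F}
    (hC : Convex ℝ C) (hne : C.Nonempty) {G : F → X} (hG : ContinuousOn G C) :
    ∃ g : F → E, ContinuousOn g C ∧ ∀ x ∈ C, p (g x) = G x := by
  classical
  obtain ⟨x₀, hx₀⟩ := hne
  obtain ⟨e₀, he₀⟩ := hp (G x₀)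
  let H : C(unitInterval × C, C) :=
    ⟨fun q => ⟨x₀ + (q.1 : ℝ) • ((q.2 : F) - x₀), hC.add_smul_sub_mem hx₀ q.2.2 q.1.2⟩,
      by fun_prop⟩
  obtain ⟨g, hg⟩ := cov.exists_lift_of_homotopy ⟨C.domRestrict G, hG.domRestrict⟩ H
    (fun a => by ext; simp [H]) (ContinuousMap.const _ e₀)
    (fun a => by change G (x₀ + (0 : ℝ) • ((a : F) - x₀)) = p e₀; simp [he₀])
  refine ⟨fun x => if h : x ∈ C then g ⟨x, h⟩ else e₀, ?_, fun x hx => ?_⟩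
  · rw [continuousOn_iff_continuous_domRestrict]
    convert g.continuous using 1
    ext x; simp
  · simp only [hx, dite_true]; exact hg ⟨x, hx⟩

end Lifting

theorem Complex.exists_log_of_convex {F : Type*} [NormedAddCommGroup F] [NormedSpace ℝ F]
    {C : Set F} (hC : Convex ℝ C) {G : F → ℂ} (hG : ContinuousOn G C) (h0 : ∀ x ∈ C, G x ≠ 0) :
    ∃ g : F → ℂ, ContinuousOn g C ∧ ∀ x ∈ C, exp (g x) = G x := by
  classical
  rcases C.eq_empty_or_nonempty with rfl | hne
  · exact ⟨fun _ => 0, by simp, by simp⟩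
  let G' : F → {z : ℂ // z ≠ 0} := fun x => if h : G x ≠ 0 then ⟨G x, h⟩ else ⟨1, one_ne_zero⟩
  have hG' : ContinuousOn G' C := by
    rw [continuousOn_iff_continuous_domRestrict] at hG ⊢
    refine Topology.IsInducing.subtypeVal.continuous_iff.2 ?_
    convert hG using 1
    ext x; simp [G', h0 x x.2]
  obtain ⟨g, hg, hg'⟩ := Complex.isCoveringMap_exp.exists_lift_of_convex
    (fun z => ⟨log z, Subtype.ext (exp_log z.2)⟩) hC hne hG'
  refine ⟨g, hg, fun x hx => ?_⟩
  have := congrArg Subtype.val (hg' x hx)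
  simpa [G', h0 x hx] using this

/-- `HasWind γ n`: the loop `γ|[0,1]` in `ℂ \ {0}` has winding number `n` around `0`. -/
def HasWind (γ : ℝ → ℂ) (n : ℤ) : Prop :=
  ∃ g : ℝ → ℂ, Continuous g ∧ (∀ t, Complex.exp (g t) = γ t) ∧
    g 1 = g 0 + n * (2 * Real.pi * Complex.I)

theorem exp_continuous_const_of_preconnected {A : Type*} [TopologicalSpace A] {s : Set A}
    (hs : IsPreconnected s) {g g' : A → ℂ} (hg : ContinuousOn g s) (hg' : ContinuousOn g' s)
    (h : ∀ x ∈ s, Complex.exp (g x) = Complex.exp (g' x)) {x y : A} (hx : x ∈ s) (hy : y ∈ s) :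
    g x - g' x = g y - g' y := by
  have := Complex.isCoveringMap_exp.constOn_of_comp hs (hg.sub hg') (fun a ha a' ha' => by
    ext; simp [Complex.exp_sub, h _ ha, h _ ha', Complex.exp_ne_zero]) hx hy
  exact this

namespace HasWind

variable {γ δ : ℝ → ℂ} {m n : ℤ}

theorem continuous (h : HasWind γ n) : Continuous γ := by
  obtain ⟨g, hg, he, -⟩ := h
  rw [← funext he]; fun_prop

theorem unique (h : HasWind γ m) (h' : HasWind γ n) : m = n := by
  obtain ⟨g, hg, he, h1⟩ := h
  obtain ⟨g', hg', he', h1'⟩ := h'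
  have := exp_continuous_const_of_preconnected isPreconnected_univ hg.continuousOn hg'.continuousOn
    (fun x _ => (he x).trans (he' x).symm) (Set.mem_univ (0 : ℝ)) (Set.mem_univ (1 : ℝ))
  rw [h1, h1'] at this
  have h2 : ((m : ℂ) - n) * (2 * Real.pi * Complex.I) = 0 := by linear_combination -this
  have h3 := (mul_eq_zero.1 h2).resolve_right Complex.two_pi_I_ne_zero
  exact_mod_cast sub_eq_zero.1 h3

theorem mul (h : HasWind γ m) (h' : HasWind δ n) : HasWind (fun t => γ t * δ t) (m + n) := by
  obtain ⟨g, hg, he, h1⟩ := h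
  obtain ⟨g', hg', he', h1'⟩ := h'
  refine ⟨fun t => g t + g' t, by fun_prop, fun t => by rw [Complex.exp_add, he, he'], ?_⟩
  simp only [h1, h1']; push_cast; ring

theorem zpow (h : HasWind γ m) (k : ℤ) : HasWind (fun t => γ t ^ k) (k * m) := by
  obtain ⟨g, hg, he, h1⟩ := h
  refine ⟨fun t => k * g t, by fun_prop, fun t => by rw [Complex.exp_int_mul, he], ?_⟩
  simp only [h1]; push_cast; ring

theorem exp {g : ℝ → ℂ} (hg : Continuous g) (h : g 1 = g 0) :
    HasWind (fun t => Complex.exp (g t)) 0 := ⟨g, hg, fun _ => rfl, by simp [h]⟩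

theorem const {c : ℂ} (hc : c ≠ 0) : HasWind (fun _ => c) 0 := by
  simpa [Complex.exp_log hc] using HasWind.exp (g := fun _ => Complex.log c) continuous_const rfl

theorem prod {ι : Type*} (s : Finset ι) {γ : ι → ℝ → ℂ} {m : ι → ℤ}
    (h : ∀ i ∈ s, HasWind (γ i) (m i)) : HasWind (fun t => ∏ i ∈ s, γ i t) (∑ i ∈ s, m i) := by
  classical
  induction s using Finset.induction_on with
  | empty => simpa using HasWind.const one_ne_zero
  | insert a s ha ih =>
    simp only [Finset.prod_insert ha, Finset.sum_insert ha]
    exact (h a (by simp)).mul (ih fun i hi => h i (by simp [hi]))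

end HasWind

theorem exists_hasWind {γ : ℝ → ℂ} (hγ : Continuous γ) (h0 : ∀ t, γ t ≠ 0) (h1 : γ 1 = γ 0) :
    ∃ n, HasWind γ n := by
  obtain ⟨g, hg, he⟩ := Complex.exists_log_of_convex convex_univ hγ.continuousOn (fun t _ => h0 t)
  have : Complex.exp (g 1) = Complex.exp (g 0) := by rw [he _ trivial, he _ trivial, h1]
  obtain ⟨n, hn⟩ := Complex.exp_eq_exp_iff_exists_int.1 this
  exact ⟨n, g, continuousOn_univ.1 hg, fun t => he t trivial, hn⟩

/-- Homotopic loops have equal winding numbers. -/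
theorem HasWind.homotopy {H : ℝ → ℝ → ℂ} (hH : ContinuousOn H.uncurry (Set.Icc 0 1 ×ˢ Set.univ))
    (h0 : ∀ s ∈ Set.Icc (0 : ℝ) 1, ∀ t, H s t ≠ 0) (h1 : ∀ s ∈ Set.Icc (0 : ℝ) 1, H s 1 = H s 0)
    {n : ℤ} (hn : HasWind (H 0) n) : HasWind (H 1) n := by
  have hC : Convex ℝ (Set.Icc (0 : ℝ) 1 ×ˢ (Set.univ : Set ℝ)) := (convex_Icc 0 1).prod convex_univ
  obtain ⟨g, hg, he⟩ := Complex.exists_log_of_convex hC hH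
    (fun x hx => h0 _ hx.1 _)
  have hslice : ∀ s ∈ Set.Icc (0 : ℝ) 1, Continuous fun t => g (s, t) := fun s hs =>
    continuousOn_univ.1 (hg.comp (by fun_prop) fun t _ => ⟨hs, trivial⟩)
  have i0 : (0 : ℝ) ∈ Set.Icc (0 : ℝ) 1 := by simp
  have i1 : (1 : ℝ) ∈ Set.Icc (0 : ℝ) 1 := by simp
  have hb : ∀ t, ContinuousOn (fun s => g (s, t)) (Set.Icc 0 1) := fun t =>
    hg.comp (by fun_prop) fun s hs => ⟨hs, trivial⟩
  have key := exp_continuous_const_of_preconnected isPreconnected_Icc (hb 1) (hb 0)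
    (fun s hs => by
      rw [he _ ⟨hs, trivial⟩, he _ ⟨hs, trivial⟩]; exact h1 s hs) i0 i1
  have h00 : Complex.exp (g (0, 1)) = Complex.exp (g (0, 0)) := by
    rw [he _ ⟨i0, trivial⟩, he _ ⟨i0, trivial⟩]; exact h1 0 i0
  obtain ⟨m, hm⟩ := Complex.exp_eq_exp_iff_exists_int.1 h00
  have hm' : HasWind (H 0) m := ⟨fun t => g (0, t), hslice 0 i0, fun t => he _ ⟨i0, trivial⟩, hm⟩
  obtain rfl := hn.unique hm'
  exact ⟨fun t => g (1, t), hslice 1 i1, fun t => he _ ⟨i1, trivial⟩, by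
    linear_combination hm - key⟩

/-- A loop that stays closer to another loop than that one to the origin has the same
winding number. -/
theorem HasWind.of_dist_lt {γ δ : ℝ → ℂ} {n : ℤ} (h : HasWind γ n) (hδ : Continuous δ)
    (h1 : δ 1 = δ 0) (hd : ∀ t, ‖δ t - γ t‖ < ‖γ t‖) : HasWind δ n := by
  have hγ := h.continuous
  have hγ1 : γ 1 = γ 0 := by
    obtain ⟨g, -, he, hg⟩ := h
    rw [← he, ← he, Complex.exp_eq_exp_iff_exists_int]; exact ⟨n, hg⟩
  have := HasWind.homotopy (H := fun s t => γ t + s * (δ t - γ t)) (n := n)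
    (by apply Continuous.continuousOn; unfold Function.uncurry; fun_prop) (fun s hs t h0 => by
      have h2 : ‖γ t‖ = ‖(s : ℂ) * (δ t - γ t)‖ := by
        rw [← norm_neg (γ t), ← eq_neg_of_add_eq_zero_right h0]
      rw [norm_mul, Complex.norm_real, Real.norm_of_nonneg hs.1] at h2
      have := hd t
      nlinarith [hs.2, norm_nonneg (δ t - γ t)])
    (fun s _ => by simp [h1, hγ1]) (by simpa using h)
  simpa using this

/-- The loop running once counterclockwise around the circle with centre `c` and radius `r`. -/
noncomputable def circ (c : ℂ) (r : ℝ) (t : ℝ) : ℂ := c + r * Complex.exp (2 * Real.pi * Complex.I * t)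

@[fun_prop] theorem continuous_circ (c : ℂ) (r : ℝ) : Continuous (circ c r) := by
  unfold circ; fun_prop

theorem circ_one (c : ℂ) (r : ℝ) : circ c r 1 = circ c r 0 := by
  simp [circ, Complex.exp_two_pi_mul_I]

theorem norm_circ_sub (c : ℂ) {r : ℝ} (hr : 0 ≤ r) (t : ℝ) : ‖circ c r t - c‖ = r := by
  have : (2 * Real.pi * Complex.I * t : ℂ) = ((2 * Real.pi * t : ℝ) : ℂ) * Complex.I := by
    push_cast; ring
  simp only [circ, add_sub_cancel_left, norm_mul, Complex.norm_real, Real.norm_of_nonneg hr, this,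
    Complex.norm_exp_ofReal_mul_I, mul_one]

theorem hasWind_circ_sub_self (c : ℂ) {r : ℝ} (hr : 0 < r) :
    HasWind (fun t => circ c r t - c) 1 := by
  have hr' : (r : ℂ) ≠ 0 := by exact_mod_cast hr.ne'
  refine ⟨fun t => Complex.log r + 2 * Real.pi * Complex.I * t, by fun_prop, fun t => ?_, ?_⟩
  · rw [Complex.exp_add, Complex.exp_log hr']; simp [circ]
  · simp

theorem hasWind_circ_sub {c a : ℂ} {r : ℝ} (h : ‖a - c‖ < r) :
    HasWind (fun t => circ c r t - a) 1 := by
  have hr := (norm_nonneg _).trans_lt h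
  refine (hasWind_circ_sub_self c hr).of_dist_lt (by fun_prop) (by simp [circ_one]) fun t => ?_
  rw [norm_circ_sub c hr.le]
  convert h using 1
  rw [← norm_neg]; congr 1; ring

/-- The set of nonzero complex numbers whose absolute value lies in `J`. -/
def annulus (J : Set ℝ) : Set ℂ := {ζ | ζ ≠ 0 ∧ ‖ζ‖ ∈ J}

/-- A nonvanishing continuous function on the product of a convex set and an annulus is
a power of the coordinate of the annulus times an exponential. -/
theorem exists_zpow_mul_exp {F : Type*} [NormedAddCommGroup F] [NormedSpace ℝ F]
    {C : Set F} (hC : Convex ℝ C) {J : Set ℝ} (hJ : J.OrdConnected) {G : F × ℂ → ℂ}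
    (hG : ContinuousOn G (C ×ˢ annulus J)) (h0 : ∀ p ∈ C ×ˢ annulus J, G p ≠ 0) :
    ∃ (k : ℤ) (g : F × ℂ → ℂ), ContinuousOn g (C ×ˢ annulus J) ∧
      ∀ p ∈ C ×ˢ annulus J, G p = p.2 ^ k * Complex.exp (g p) := by
  rcases (C ×ˢ annulus J).eq_empty_or_nonempty with he | ⟨⟨w₁, ζ₁⟩, hw₁, hζ₁⟩
  · exact ⟨0, fun _ => 0, by simp [he], by simp [he]⟩
  have hmono : ((fun s : ℝ => Real.exp s) ⁻¹' J).OrdConnected :=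
    hJ.preimage_mono Real.exp_monotone
  set T : Set ℂ := {s | Real.exp s.re ∈ J} with hT
  have hTc : Convex ℝ T := hmono.convex.linear_preimage Complex.reLm
  have hmem : ∀ s, Complex.exp s ∈ annulus J ↔ s ∈ T := fun s => by
    simp [annulus, hT, Complex.norm_exp, Complex.exp_ne_zero]
  have hlog : ∀ ζ ∈ annulus J, Complex.log ζ ∈ T := fun ζ hζ => by
    rw [← hmem, Complex.exp_log hζ.1]; exact hζ
  obtain ⟨g, hg, hge⟩ := Complex.exists_log_of_convex (hC.prod hTc)
    (G := fun p => G (p.1, Complex.exp p.2))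
    (hG.comp (by fun_prop) fun p hp => ⟨hp.1, (hmem _).2 hp.2⟩)
    (fun p hp => h0 _ ⟨hp.1, (hmem _).2 hp.2⟩)
  have hshift : ∀ s (n : ℤ), s ∈ T → s + n * (2 * Real.pi * Complex.I) ∈ T := fun s n hs => by
    simpa [hT] using hs
  have hper : ∀ p ∈ C ×ˢ T, ∀ q ∈ C ×ˢ T,
      g (p.1, p.2 + 2 * Real.pi * Complex.I) - g p = g (q.1, q.2 + 2 * Real.pi * Complex.I) - g q :=
    fun p hp q hq => by
      refine exp_continuous_const_of_preconnected (hC.prod hTc).isPreconnected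
        (g := fun p => g (p.1, p.2 + 2 * Real.pi * Complex.I)) (g' := g)
        (hg.comp (by fun_prop) fun p hp => ⟨hp.1, by simpa using hshift p.2 1 hp.2⟩) hg
        (fun p hp => ?_) hp hq
      rw [hge p hp, hge (p.1, p.2 + 2 * Real.pi * Complex.I)
        ⟨hp.1, by simpa using hshift p.2 1 hp.2⟩]
      simp [Complex.exp_add, Complex.exp_two_pi_mul_I]
  have hp₁ : (w₁, Complex.log ζ₁) ∈ C ×ˢ T := ⟨hw₁, hlog _ hζ₁⟩
  obtain ⟨k, hk⟩ : ∃ k : ℤ, ∀ p ∈ C ×ˢ T,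
      g (p.1, p.2 + 2 * Real.pi * Complex.I) = g p + k * (2 * Real.pi * Complex.I) := by
    have : Complex.exp (g (w₁, Complex.log ζ₁ + 2 * Real.pi * Complex.I)) =
        Complex.exp (g (w₁, Complex.log ζ₁)) := by
      rw [hge _ hp₁, hge (w₁, Complex.log ζ₁ + 2 * Real.pi * Complex.I)
        ⟨hw₁, by simpa using hshift _ 1 (hlog _ hζ₁)⟩]
      simp [Complex.exp_add, Complex.exp_two_pi_mul_I]
    obtain ⟨k, hk⟩ := Complex.exp_eq_exp_iff_exists_int.1 this
    exact ⟨k, fun p hp => by linear_combination hper p hp _ hp₁ + hk⟩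
  set P : F × ℂ → ℂ := fun p => g p - k * p.2 with hP
  have hPc : ContinuousOn P (C ×ˢ T) := hg.sub (by fun_prop)
  have hPnat : ∀ (n : ℕ), ∀ w ∈ C, ∀ s ∈ T, P (w, s + n * (2 * Real.pi * Complex.I)) = P (w, s) := by
    intro n w hw s hs
    induction n with
    | zero => simp
    | succ n ih =>
      rw [← ih]
      have := hk (w, s + n * (2 * Real.pi * Complex.I)) ⟨hw, by simpa using hshift s n hs⟩
      simp only [hP, Nat.cast_succ]
      rw [show s + (n + 1 : ℂ) * (2 * Real.pi * Complex.I)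
        = s + n * (2 * Real.pi * Complex.I) + 2 * Real.pi * Complex.I by ring, this]
      ring
  have hPint : ∀ (n : ℤ), ∀ w ∈ C, ∀ s ∈ T,
      P (w, s + n * (2 * Real.pi * Complex.I)) = P (w, s) := by
    intro n w hw s hs
    obtain ⟨m, rfl | rfl⟩ := n.eq_nat_or_neg
    · exact_mod_cast hPnat m w hw s hs
    · rw [← hPnat m w hw _ (hshift s _ hs)]
      congr 2; push_cast; ring
  refine ⟨k, fun p => P (p.1, Complex.log p.2), ?_, ?_⟩
  · rintro ⟨w₀, ζ₀⟩ ⟨hw₀, hζ₀⟩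
    have hcongr : ∀ p ∈ C ×ˢ annulus J, P (p.1, Complex.log p.2) =
        P (p.1, Complex.log (p.2 / ζ₀) + Complex.log ζ₀) := by
      rintro ⟨w, ζ⟩ ⟨hw, hζ⟩
      have : Complex.exp (Complex.log (ζ / ζ₀) + Complex.log ζ₀) = Complex.exp (Complex.log ζ) := by
        rw [Complex.exp_add, Complex.exp_log (div_ne_zero hζ.1 hζ₀.1), Complex.exp_log hζ₀.1,
          Complex.exp_log hζ.1, div_mul_cancel₀ _ hζ₀.1]
      obtain ⟨n, hn⟩ := Complex.exp_eq_exp_iff_exists_int.1 this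
      simp only
      rw [hn, hPint n w hw _ (hlog _ hζ)]
    refine ContinuousWithinAt.congr ?_ hcongr (hcongr _ ⟨hw₀, hζ₀⟩)
    have h1 : ContinuousWithinAt P (C ×ˢ T)
        (w₀, Complex.log (ζ₀ / ζ₀) + Complex.log ζ₀) := by
      rw [div_self hζ₀.1, Complex.log_one, zero_add]; exact hPc _ ⟨hw₀, hlog _ hζ₀⟩
    refine ContinuousWithinAt.comp (x := (w₀, ζ₀)) (f := fun p : F × ℂ =>
      (p.1, Complex.log (p.2 / ζ₀) + Complex.log ζ₀)) h1 ?_ ?_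
    · apply ContinuousAt.continuousWithinAt
      refine continuousAt_fst.prodMk ((ContinuousAt.clog (by fun_prop) ?_).add continuousAt_const)
      simp [div_self hζ₀.1, Complex.slitPlane]
    · rintro ⟨w, ζ⟩ ⟨hw, hζ⟩
      refine ⟨hw, (hmem _).1 ?_⟩
      rw [Complex.exp_add, Complex.exp_log (div_ne_zero hζ.1 hζ₀.1), Complex.exp_log hζ₀.1,
          div_mul_cancel₀ _ hζ₀.1]
      exact hζ
  · rintro ⟨w, ζ⟩ ⟨hw, hζ⟩
    have := hge (w, Complex.log ζ) ⟨hw, hlog _ hζ⟩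
    simp only [hP, Complex.exp_sub, this, Complex.exp_log hζ.1, Complex.exp_int_mul]
    rw [mul_div_cancel₀ _ (zpow_ne_zero _ hζ.1)]

/-- The one-variable case of `exists_zpow_mul_exp`, around an arbitrary centre. -/
theorem exists_sub_zpow_mul_exp (c : ℂ) {J : Set ℝ} (hJ : J.OrdConnected) {G : ℂ → ℂ}
    (hG : ContinuousOn G {x | x - c ∈ annulus J}) (h0 : ∀ x, x - c ∈ annulus J → G x ≠ 0) :
    ∃ (k : ℤ) (g : ℂ → ℂ), ContinuousOn g {x | x - c ∈ annulus J} ∧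
      ∀ x, x - c ∈ annulus J → G x = (x - c) ^ k * Complex.exp (g x) := by
  obtain ⟨k, g, hg, h⟩ := exists_zpow_mul_exp (F := ℝ) convex_univ hJ
    (G := fun p => G (p.2 + c)) (hG.comp (by fun_prop) fun p hp => by simpa using hp.2)
    (fun p hp => h0 _ (by simpa using hp.2))
  refine ⟨k, fun x => g (0, x - c), hg.comp (by fun_prop) fun x hx => ⟨trivial, hx⟩, fun x hx => ?_⟩
  simpa using h (0, x - c) ⟨trivial, hx⟩

theorem HasWind.zpow_mul_exp {ζ g : ℝ → ℂ} {l : ℤ} (h : HasWind ζ l) (k : ℤ) (hg : Continuous g)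
    (h1 : g 1 = g 0) : HasWind (fun t => ζ t ^ k * Complex.exp (g t)) (k * l) := by
  simpa using (h.zpow k).mul (HasWind.exp hg h1)

/-- `HasRes G b k`: the function `G` winds `k` times around `0` along small circles
around `b`. -/
def HasRes (G : ℂ → ℂ) (b : ℂ) (k : ℤ) : Prop :=
  ∀ᶠ r in 𝓝[>] (0 : ℝ), HasWind (fun t => G (circ b r t)) k

theorem HasRes.unique {G : ℂ → ℂ} {b : ℂ} {k l : ℤ} (h : HasRes G b k) (h' : HasRes G b l) :
    k = l := by
  obtain ⟨r, hr, hr'⟩ := (h.and h').exists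
  exact hr.unique hr'

theorem HasRes.congr {G G' : ℂ → ℂ} {b : ℂ} {k : ℤ} (h : HasRes G b k)
    (hG : ∀ᶠ x in 𝓝[≠] b, G' x = G x) : HasRes G' b k := by
  obtain ⟨ε, hε, hball⟩ := Metric.mem_nhdsWithin_iff.1 hG
  filter_upwards [h, Ioo_mem_nhdsGT hε] with r hr hr'
  convert hr using 2 with t
  have := norm_circ_sub b hr'.1.le t
  refine hball ⟨by rw [Metric.mem_ball, dist_eq_norm, this]; exact hr'.2, fun h => ?_⟩
  rw [Set.mem_singleton_iff.1 h, sub_self, norm_zero] at this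
  exact hr'.1.ne this

theorem HasRes.mul {G G' : ℂ → ℂ} {b : ℂ} {k l : ℤ} (h : HasRes G b k) (h' : HasRes G' b l) :
    HasRes (fun x => G x * G' x) b (k + l) := by
  filter_upwards [h, h'] with r hr hr' using hr.mul hr'

theorem HasRes.zpow {G : ℂ → ℂ} {b : ℂ} {k : ℤ} (h : HasRes G b k) (n : ℤ) :
    HasRes (fun x => G x ^ n) b (n * k) := by
  filter_upwards [h] with r hr using hr.zpow n

theorem HasRes.prod {ι : Type*} (s : Finset ι) {G : ι → ℂ → ℂ} {b : ℂ} {m : ι → ℤ}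
    (h : ∀ i ∈ s, HasRes (G i) b (m i)) : HasRes (fun x => ∏ i ∈ s, G i x) b (∑ i ∈ s, m i) := by
  filter_upwards [(eventually_all_finset s).2 h] with r hr using HasWind.prod s hr

theorem hasRes_sub_self (b : ℂ) : HasRes (fun x => x - b) b 1 := by
  filter_upwards [self_mem_nhdsWithin] with r hr using hasWind_circ_sub_self b hr

theorem mem_punctured {b x : ℂ} {ε : ℝ} :
    x - b ∈ annulus (Set.Iio ε) ↔ x ∈ Metric.ball b ε \ {b} := by
  simp [annulus, sub_eq_zero, dist_eq_norm, and_comm]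

theorem circ_mem_punctured (b : ℂ) {r ε : ℝ} (h0 : 0 < r) (h : r < ε) (t : ℝ) :
    circ b r t ∈ Metric.ball b ε \ {b} := by
  have := norm_circ_sub b h0.le t
  refine ⟨by rwa [Metric.mem_ball, dist_eq_norm, this], fun h => ?_⟩
  rw [Set.mem_singleton_iff.1 h, sub_self, norm_zero] at this
  exact h0.ne this

theorem hasRes_of_eq_exp {G g : ℂ → ℂ} {b : ℂ} {ε : ℝ} (hε : 0 < ε)
    (hg : ContinuousOn g (Metric.ball b ε \ {b}))
    (h : ∀ x ∈ Metric.ball b ε \ {b}, G x = Complex.exp (g x)) : HasRes G b 0 := by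
  filter_upwards [Ioo_mem_nhdsGT hε] with r hr
  simp only [h _ (circ_mem_punctured b hr.1 hr.2 _)]
  refine HasWind.exp (hg.comp_continuous (by fun_prop) (circ_mem_punctured b hr.1 hr.2)) ?_
  rw [circ_one]

/-- On a punctured disc, a nonvanishing function with residue `k` is `(x - b) ^ k` times an
exponential. -/
theorem HasRes.exists_eq_zpow_mul_exp {G : ℂ → ℂ} {b : ℂ} {ε : ℝ} (hε : 0 < ε) {k : ℤ}
    (hG : ContinuousOn G (Metric.ball b ε \ {b})) (h0 : ∀ x ∈ Metric.ball b ε \ {b}, G x ≠ 0)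
    (hk : HasRes G b k) : ∃ g : ℂ → ℂ, ContinuousOn g (Metric.ball b ε \ {b}) ∧
      ∀ x ∈ Metric.ball b ε \ {b}, G x = (x - b) ^ k * Complex.exp (g x) := by
  simp only [← mem_punctured] at h0
  have hset : {x | x - b ∈ annulus (Set.Iio ε)} = Metric.ball b ε \ {b} :=
    Set.ext fun _ => mem_punctured
  rw [← hset] at hG
  obtain ⟨l, g, hg, h⟩ := exists_sub_zpow_mul_exp b Set.ordConnected_Iio hG h0
  rw [hset] at hg
  simp only [mem_punctured] at h
  have hl : HasRes G b l := by
    filter_upwards [Ioo_mem_nhdsGT hε] with r hr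
    simp only [h _ (circ_mem_punctured b hr.1 hr.2 _)]
    simpa using (hasWind_circ_sub_self b hr.1).zpow_mul_exp l
      (hg.comp_continuous (by fun_prop) (circ_mem_punctured b hr.1 hr.2)) (by simp [circ_one])
  obtain rfl := hk.unique hl
  exact ⟨g, hg, h⟩

/-- A continuous function equal to `0` on `(-∞, a]` and to `1` on `[b, ∞)`. -/
noncomputable def ramp (a b s : ℝ) : ℝ := max 0 (min 1 ((s - a) / (b - a)))

@[fun_prop] theorem continuous_ramp (a b : ℝ) : Continuous (ramp a b) := by
  unfold ramp; fun_prop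

theorem ramp_of_le {a b s : ℝ} (hab : a < b) (h : s ≤ a) : ramp a b s = 0 := by
  have : (s - a) / (b - a) ≤ 0 := div_nonpos_of_nonpos_of_nonneg (by linarith) (by linarith)
  exact max_eq_left ((min_le_right _ _).trans this)

theorem ramp_of_ge {a b s : ℝ} (hab : a < b) (h : b ≤ s) : ramp a b s = 1 := by
  have : 1 ≤ (s - a) / (b - a) := by rw [le_div_iff₀ (by linarith)]; linarith
  rw [ramp, min_eq_left this]; simp

/-- A puncture with residue zero can be filled in, changing the function only near it. -/
theorem exists_fill {G : ℂ → ℂ} {b : ℂ} {ε : ℝ} (hε : 0 < ε)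
    (hG : ContinuousOn G (Metric.ball b ε \ {b})) (h0 : ∀ x ∈ Metric.ball b ε \ {b}, G x ≠ 0)
    (hk : HasRes G b 0) : ∃ G' : ℂ → ℂ, ContinuousOn G' (Metric.ball b ε) ∧
      (∀ x ∈ Metric.ball b ε, G' x ≠ 0) ∧ ∀ x ∉ Metric.ball b (ε / 2), G' x = G x := by
  classical
  obtain ⟨g, hg, h⟩ := hk.exists_eq_zpow_mul_exp hε hG h0
  simp only [zpow_zero, one_mul] at h
  let G' : ℂ → ℂ := fun x => if x ∈ Metric.ball b (ε / 2) then
    Complex.exp (ramp (ε / 4) (ε / 2) ‖x - b‖ * g x) else G x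
  have hG'1 : ∀ x ∈ Metric.ball b ε,
      G' x = Complex.exp (ramp (ε / 4) (ε / 2) ‖x - b‖ * g x) := by
    intro x hx
    by_cases hx' : x ∈ Metric.ball b (ε / 2)
    · simp only [G', hx', if_true]
    · have hxb : x ≠ b := by rintro rfl; simp at hx'; linarith
      simp only [G', hx', if_false]
      rw [h x ⟨hx, hxb⟩, ramp_of_ge (by linarith) (by simpa [dist_eq_norm] using hx')]
      simp
  refine ⟨G', ?_, fun x hx => by rw [hG'1 x hx]; exact Complex.exp_ne_zero _,
    fun x hx => by simp only [G', hx, if_false]⟩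
  intro x hx
  apply ContinuousAt.continuousWithinAt
  by_cases hxb : x = b
  · subst hxb
    have : G' =ᶠ[𝓝 x] fun _ => 1 := by
      filter_upwards [Metric.ball_mem_nhds x (show 0 < ε / 4 by linarith)] with y hy
      rw [hG'1 y (Metric.ball_subset_ball (by linarith) hy), ramp_of_le (by linarith)
        (by rw [Metric.mem_ball, dist_eq_norm] at hy; exact hy.le)]
      simp
    exact continuousAt_const.congr this.symm
  · have hopen : IsOpen (Metric.ball b ε \ {b}) := Metric.isOpen_ball.sdiff isClosed_singleton
    have hmem := hopen.mem_nhds ⟨hx, hxb⟩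
    have : G' =ᶠ[𝓝 x] fun x => Complex.exp (ramp (ε / 4) (ε / 2) ‖x - b‖ * g x) := by
      filter_upwards [hmem] with y hy using hG'1 y hy.1
    refine ContinuousAt.congr ?_ this.symm
    have hgx := hg.continuousAt hmem
    have : Continuous fun x => ramp (ε / 4) (ε / 2) ‖x - b‖ := by fun_prop
    fun_prop

/-- Finitely many punctures with residue zero of a function on an open set can be filled in. -/
theorem exists_fill_finset {U V : Set ℂ} (hU : IsOpen U) (hV : IsOpen V) (hVU : V ⊆ U)
    (B : Finset ℂ) : ∀ {G : ℂ → ℂ}, (∀ b ∈ B, b ∈ V) →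
    ContinuousOn G (U \ B) → (∀ x ∈ U \ B, G x ≠ 0) → (∀ b ∈ B, HasRes G b 0) →
    ∃ G' : ℂ → ℂ, ContinuousOn G' U ∧ (∀ x ∈ U, G' x ≠ 0) ∧ ∀ x ∉ V, G' x = G x := by
  classical
  induction B using Finset.induction_on with
  | empty => intro G _ hG h0 _; exact ⟨G, by simpa using hG, by simpa using h0, fun _ _ => rfl⟩
  | insert a B ha ih =>
    intro G hB hG h0 hres
    have hO : IsOpen (V \ (B : Set ℂ)) := hV.sdiff B.finite_toSet.isClosed
    obtain ⟨ε, hε, hball⟩ := Metric.isOpen_iff.1 hO a ⟨hB a (by simp), by simpa using ha⟩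
    have hsub : Metric.ball a ε \ {a} ⊆ U \ (insert a B : Finset ℂ) := fun x hx => by
      have := hball hx.1
      exact ⟨hVU this.1, by simpa using ⟨hx.2, by simpa using this.2⟩⟩
    obtain ⟨G₁, hG₁, h₁0, h₁⟩ := exists_fill hε (hG.mono hsub) (fun x hx => h0 x (hsub hx))
      (hres a (by simp))
    have hout : ∀ x, x ∉ Metric.closedBall a (ε / 2) → G₁ =ᶠ[𝓝 x] G := fun x hx => by
      filter_upwards [Metric.isClosed_closedBall.isOpen_compl.mem_nhds hx] with y hy
      exact h₁ y fun h => hy (Metric.ball_subset_closedBall h)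
    have hUB : IsOpen (U \ (insert a B : Finset ℂ)) := hU.sdiff (Finset.finite_toSet _).isClosed
    have hcb : Metric.closedBall a (ε / 2) ⊆ Metric.ball a ε :=
      Metric.closedBall_subset_ball (by linarith)
    obtain ⟨G', hG', h'0, h'⟩ := ih (G := G₁) (fun b hb => hB b (by simp [hb]))
      (fun x hx => by
        apply ContinuousAt.continuousWithinAt
        by_cases hxa : x ∈ Metric.ball a ε
        · exact hG₁.continuousAt (Metric.isOpen_ball.mem_nhds hxa)
        · have hx' : x ∈ U \ (insert a B : Finset ℂ) :=
            ⟨hx.1, by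
              have : x ≠ a := by rintro rfl; exact hxa (Metric.mem_ball_self hε)
              simpa using ⟨this, by simpa using hx.2⟩⟩
          exact (hG.continuousAt (hUB.mem_nhds hx')).congr (hout x fun h => hxa (hcb h)).symm)
      (fun x hx => by
        by_cases hxa : x ∈ Metric.ball a ε
        · exact h₁0 x hxa
        · have hx' : x ∈ U \ (insert a B : Finset ℂ) :=
            ⟨hx.1, by
              have : x ≠ a := by rintro rfl; exact hxa (Metric.mem_ball_self hε)
              simpa using ⟨this, by simpa using hx.2⟩⟩
          rw [h₁ x fun h => hxa (Metric.ball_subset_ball (by linarith) h)]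
          exact h0 x hx')
      (fun b hb => by
        have hb' : b ∉ Metric.closedBall a (ε / 2) := fun h => (hball (hcb h)).2 (by simpa using hb)
        exact (hres b (by simp [hb])).congr ((hout b hb').filter_mono nhdsWithin_le_nhds))
    refine ⟨G', hG', h'0, fun x hx => ?_⟩
    rw [h' x hx, h₁ x fun h => hx (hball (Metric.ball_subset_ball (by linarith) h)).1]

theorem circ_mem_ball (c : ℂ) {r ρ : ℝ} (h0 : 0 ≤ r) (h : r < ρ) (t : ℝ) :
    circ c r t ∈ Metric.ball c ρ := by
  rw [Metric.mem_ball, dist_eq_norm, norm_circ_sub c h0]; exact h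

/-- Argument principle: the winding number along a circle is the sum of the residues inside. -/
theorem hasWind_circ_of_hasRes {c : ℂ} {r ρ : ℝ} (h0 : 0 < r) (hr : r < ρ) {B : Finset ℂ}
    (hB : ∀ b ∈ B, b ∈ Metric.ball c r) {G : ℂ → ℂ} (hG : ContinuousOn G (Metric.ball c ρ \ B))
    (hG0 : ∀ x ∈ Metric.ball c ρ \ B, G x ≠ 0) {k : ℂ → ℤ} (hres : ∀ b ∈ B, HasRes G b (k b)) :
    HasWind (fun t => G (circ c r t)) (∑ b ∈ B, k b) := by
  classical
  set D : ℂ → ℂ := fun x => ∏ b ∈ B, (x - b) ^ (k b) with hD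
  have hne : ∀ x ∉ B, D x ≠ 0 := fun x hx => Finset.prod_ne_zero_iff.2 fun b hb =>
    zpow_ne_zero _ (sub_ne_zero.2 (by rintro rfl; exact hx hb))
  have hDc : ContinuousOn D ((B : Set ℂ)ᶜ) := by
    refine continuousOn_finsetProd _ fun b hb => ?_
    refine ContinuousOn.zpow₀ (by fun_prop) _ fun x hx => Or.inl (sub_ne_zero.2 ?_)
    rintro rfl; exact hx hb
  have hDres : ∀ b ∈ B, HasRes D b (k b) := by
    intro b hb
    have : ∀ b' ∈ B, HasRes (fun x => (x - b') ^ (k b')) b (if b' = b then k b else 0) := by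
      intro b' hb'
      split_ifs with h
      · subst h; simpa using (hasRes_sub_self b').zpow (k b')
      · have h' : b - b' ≠ 0 := sub_ne_zero.2 (Ne.symm h)
        have : HasRes (fun x => x - b') b 0 := by
          filter_upwards [Ioo_mem_nhdsGT (norm_pos_iff.2 h')] with r hr
          refine (HasWind.const h').of_dist_lt (by fun_prop) (by simp [circ_one]) fun t => ?_
          simpa [norm_circ_sub b hr.1.le] using hr.2
        simpa using this.zpow (k b')
    have h2 := HasRes.prod B this
    simpa [hb] using h2
  have hDw : HasWind (fun t => D (circ c r t)) (∑ b ∈ B, k b) := by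
    refine HasWind.prod B fun b hb => ?_
    simpa using (hasWind_circ_sub (c := c) (a := b) (r := r)
      (by simpa [dist_eq_norm] using hB b hb)).zpow (k b)
  have hcirc : ∀ t, circ c r t ∉ Metric.ball c r := fun t h => by
    rw [Metric.mem_ball, dist_eq_norm, norm_circ_sub c h0.le] at h; exact h.false
  obtain ⟨G', hG', h'0, h'⟩ := exists_fill_finset (Metric.isOpen_ball (x := c) (ε := ρ))
    (Metric.isOpen_ball (x := c) (ε := r)) (Metric.ball_subset_ball hr.le) B
    (G := fun x => G x * (D x)⁻¹) hB (hG.mul ((hDc.mono fun x hx => hx.2).inv₀ fun x hx =>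
      hne x hx.2)) (fun x hx => mul_ne_zero (hG0 x hx) (inv_ne_zero (hne x hx.2)))
    (fun b hb => by
      simpa using (hres b hb).mul ((hDres b hb).zpow (-1)))
  obtain ⟨g, hg, hge⟩ := Complex.exists_log_of_convex (convex_ball c ρ) hG' h'0
  have hw := HasWind.exp (g := fun t => g (circ c r t))
    (hg.comp_continuous (by fun_prop) (circ_mem_ball c h0.le hr)) (by simp [circ_one])
  have := hw.mul hDw
  rw [zero_add] at this
  convert this using 2 with t
  rw [hge _ (circ_mem_ball c h0.le hr t), h' _ (hcirc t), inv_mul_cancel_right₀]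
  exact hne _ fun h => hcirc t (hB _ h)

/-- Over `O`, the set `S` is the disjoint union of the graphs of the `N` continuous
functions `r i`. -/
structure Sheets {X : Type*} [TopologicalSpace X] (S : Set (X × ℂ)) (N : ℕ) (O : Set X)
    (r : Fin N → X → ℂ) : Prop where
  cont : ∀ i, ContinuousOn (r i) O
  inj : ∀ x ∈ O, Function.Injective fun i => r i x
  mem_iff : ∀ x ∈ O, ∀ y, (x, y) ∈ S ↔ ∃ i, r i x = y

/-- Locally over `O`, the set `S` is the disjoint union of `N` graphs. -/
def LocSheets {X : Type*} [TopologicalSpace X] (S : Set (X × ℂ)) (N : ℕ) (O : Set X) : Prop :=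
  ∀ x ∈ O, ∃ U, IsOpen U ∧ x ∈ U ∧ ∃ r, Sheets S N U r

namespace Sheets

variable {X : Type*} [TopologicalSpace X] {S : Set (X × ℂ)} {N : ℕ} {O : Set X}
  {r : Fin N → X → ℂ}

theorem mem (h : Sheets S N O r) {x : X} (hx : x ∈ O) (i : Fin N) : (x, r i x) ∈ S :=
  (h.mem_iff x hx _).2 ⟨i, rfl⟩

theorem mono (h : Sheets S N O r) {O' : Set X} (hO : O' ⊆ O) : Sheets S N O' r :=
  ⟨fun i => (h.cont i).mono hO, fun x hx => h.inj x (hO hx), fun x hx => h.mem_iff x (hO hx)⟩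

/-- Near a point of the `i`-th sheet, the set `S` coincides with the `i`-th sheet. -/
theorem eventually_eq (h : Sheets S N O r) (hO : IsOpen O) {p : X × ℂ} (hp : p.1 ∈ O) {i : Fin N}
    (hi : r i p.1 = p.2) : ∀ᶠ q in 𝓝[S] p, q.1 ∈ O ∧ r i q.1 = q.2 := by
  have h1 : ∀ᶠ q : X × ℂ in 𝓝 p, q.1 ∈ O := continuousAt_fst (hO.mem_nhds hp)
  have h2 : ∀ j, j ≠ i → ∀ᶠ q : X × ℂ in 𝓝 p, r j q.1 ≠ q.2 := fun j hj => by
    have hc : ContinuousAt (fun q : X × ℂ => r j q.1) p :=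
      ContinuousAt.comp (f := Prod.fst) ((h.cont j).continuousAt (hO.mem_nhds hp)) continuousAt_fst
    have hne : r j p.1 - p.2 ≠ 0 := by
      rw [← hi]; exact sub_ne_zero.2 fun e => hj (h.inj _ hp e)
    exact ((hc.sub continuousAt_snd).eventually_ne hne).mono fun q hq => sub_ne_zero.1 hq
  have h3 : ∀ᶠ q : X × ℂ in 𝓝 p, ∀ j, j ≠ i → r j q.1 ≠ q.2 :=
    eventually_all.2 fun j => by
      by_cases hj : j = i
      · simp [hj]
      · filter_upwards [h2 j hj] with q hq _ using hq
  filter_upwards [h1.filter_mono nhdsWithin_le_nhds, h3.filter_mono nhdsWithin_le_nhds,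
    self_mem_nhdsWithin] with q hq1 hq3 hqS
  obtain ⟨j, hj⟩ := (h.mem_iff q.1 hq1 q.2).1 hqS
  by_cases hji : j = i
  · exact ⟨hq1, hji ▸ hj⟩
  · exact absurd hj (hq3 j hji)

/-- A function given on each sheet by continuous functions of the base is continuous. -/
theorem continuousOn {Y : Type*} [TopologicalSpace Y] (h : Sheets S N O r) (hO : IsOpen O)
    {F : X × ℂ → Y} (hF : ∀ i, ContinuousOn (fun x => F (x, r i x)) O) :
    ContinuousOn F (S ∩ {p | p.1 ∈ O}) := by
  rintro ⟨x, y⟩ ⟨hS, hx : x ∈ O⟩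
  obtain ⟨i, hi : r i x = y⟩ := (h.mem_iff x hx y).1 hS
  have h1 : ContinuousAt (fun p : X × ℂ => F (p.1, r i p.1)) (x, y) :=
    ContinuousAt.comp (f := Prod.fst) (g := fun x => F (x, r i x))
      ((hF i).continuousAt (hO.mem_nhds hx)) continuousAt_fst
  refine (h1.continuousWithinAt.congr_of_eventuallyEq ?_ (by simp [hi])).mono Set.inter_subset_left
  filter_upwards [h.eventually_eq hO (p := (x, y)) hx hi] with q hq
  rw [hq.2]

end Sheets

section Covering

variable {X : Type*} [TopologicalSpace X] {S : Set (X × ℂ)} {N : ℕ} {O : Set X}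

/-- The projection of `S` to the base, over `O`. -/
def sheetProj (S : Set (X × ℂ)) (O : Set X) (p : {p : X × ℂ // p ∈ S ∧ p.1 ∈ O}) : O :=
  ⟨p.1.1, p.2.2⟩

theorem LocSheets.isCoveringMap (h : LocSheets S N O) : IsCoveringMap (sheetProj S O) := by
  rintro ⟨x, hx⟩
  suffices IsEvenlyCovered (sheetProj S O) ⟨x, hx⟩ (Fin N) from this.to_isEvenlyCovered_preimage
  obtain ⟨U, hU, hxU, r, hr⟩ := h x hx
  have hcont : Continuous (sheetProj S O) := by unfold sheetProj; fun_prop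
  have hUO : IsOpen ((↑) ⁻¹' U : Set O) := hU.preimage continuous_subtype_val
  have hex : ∀ e : sheetProj S O ⁻¹' ((↑) ⁻¹' U : Set O), ∃ i, r i e.1.1.1 = e.1.1.2 := fun e =>
    (hr.mem_iff _ e.2 _).1 e.1.2.1
  choose idx hidx using hex
  have hidxc : Continuous idx := by
    rw [continuous_discrete_rng]
    intro i
    rw [isOpen_iff_mem_nhds]
    rintro e rfl
    have h1 := hr.eventually_eq hU (p := e.1.1) e.2 (hidx e)
    have h2 : Tendsto (fun e : sheetProj S O ⁻¹' ((↑) ⁻¹' U : Set O) => e.1.1) (𝓝 e)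
        (𝓝[S] e.1.1) := by
      refine tendsto_nhdsWithin_iff.2 ⟨?_, Eventually.of_forall fun e => e.1.2.1⟩
      exact (continuous_subtype_val.comp continuous_subtype_val).continuousAt
    filter_upwards [h2 h1] with e' he'
    exact hr.inj _ he'.1 ((hidx e').trans he'.2.symm)
  refine ⟨inferInstance, (Subtype.val ⁻¹' U : Set O), hxU, hUO, hUO.preimage hcont, ?_⟩
  refine ⟨⟨⟨fun e => (⟨sheetProj S O e.1, e.2⟩, idx e),
    fun q => ⟨⟨(q.1.1.1, r q.2 q.1.1.1), hr.mem q.1.2 _, q.1.1.2⟩, q.1.2⟩, ?_, ?_⟩, ?_, ?_⟩, ?_⟩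
  · intro e
    apply Subtype.ext; apply Subtype.ext
    exact Prod.ext rfl (hidx e)
  · intro q
    refine Prod.ext rfl (hr.inj q.1.1.1 q.1.2 ?_)
    exact hidx _
  · exact ((hcont.comp continuous_subtype_val).subtype_mk _).prodMk hidxc
  · refine continuous_prod_of_discrete_right.2 fun i => ?_
    refine Continuous.subtype_mk (Continuous.subtype_mk ?_ _) _
    refine Continuous.prodMk (by fun_prop) ?_
    exact (hr.cont i).comp_continuous (by fun_prop) fun q => q.2
  · intro e; rfl

/-- Over a convex set, local sheets are global. -/
theorem LocSheets.exists_sheets {X : Type*} [NormedAddCommGroup X] [NormedSpace ℝ X]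
    {S : Set (X × ℂ)} {O : Set X} (h : LocSheets S N O) (hO : Convex ℝ O) :
    ∃ r, Sheets S N O r := by
  classical
  rcases O.eq_empty_or_nonempty with rfl | ⟨x₀, hx₀⟩
  · exact ⟨fun _ _ => 0, by constructor <;> simp⟩
  have cov := h.isCoveringMap
  have hcard : ∀ x ∈ O, ∃ r : Fin N → ℂ, Function.Injective r ∧ ∀ y, (x, y) ∈ S ↔ ∃ i, r i = y :=
    fun x hx => by
      obtain ⟨U, -, hxU, r, hr⟩ := h x hx
      exact ⟨fun i => r i x, hr.inj x hxU, hr.mem_iff x hxU⟩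
  obtain ⟨r₀, hr₀, hr₀m⟩ := hcard x₀ hx₀
  have hlift : ∀ i, ∃ g : C(O, {p : X × ℂ // p ∈ S ∧ p.1 ∈ O}),
      (∀ x, sheetProj S O (g x) = x) ∧ (g ⟨x₀, hx₀⟩).1.2 = r₀ i := fun i => by
    let H : C(unitInterval × O, O) :=
      ⟨fun q => ⟨x₀ + (q.1 : ℝ) • ((q.2 : X) - x₀), hO.add_smul_sub_mem hx₀ q.2.2 q.1.2⟩,
        by fun_prop⟩
    let e₀ : {p : X × ℂ // p ∈ S ∧ p.1 ∈ O} := ⟨(x₀, r₀ i), (hr₀m _).2 ⟨i, rfl⟩, hx₀⟩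
    have h0 : ∀ a, H (0, a) = sheetProj S O (ContinuousMap.const O e₀ a) := fun a => by
      ext; simp [H, e₀, sheetProj]
    refine ⟨(cov.liftHomotopy H (.const O e₀) h0).comp ⟨fun a => (1, a), by fun_prop⟩,
      fun a => ?_, ?_⟩
    · have := congrFun (cov.liftHomotopy_lifts H (.const O e₀) h0) (1, a)
      refine this.trans ?_
      ext; simp [H]
    · have hconst : ∀ t, cov.liftHomotopy H (.const O e₀) h0 (t, ⟨x₀, hx₀⟩) = e₀ := fun t => by
        refine (cov.const_of_comp
          (g := fun t => cov.liftHomotopy H (.const O e₀) h0 (t, ⟨x₀, hx₀⟩))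
          (by fun_prop) (fun t t' => ?_) t 0).trans (cov.liftHomotopy_zero H (.const O e₀) h0 _)
        have h1 := congrFun (cov.liftHomotopy_lifts H (.const O e₀) h0) (t, ⟨x₀, hx₀⟩)
        have h2 := congrFun (cov.liftHomotopy_lifts H (.const O e₀) h0) (t', ⟨x₀, hx₀⟩)
        refine h1.trans (Eq.trans ?_ h2.symm)
        ext; simp [H]
      have := congrArg (fun e => e.1.2) (hconst 1)
      exact this
  choose g hg hg₀ using hlift
  have hpc : PreconnectedSpace O := Subtype.preconnectedSpace hO.isPreconnected
  have hginj : ∀ i j, ∀ x, g i x = g j x → i = j := fun i j x hx => by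
    have := cov.eq_of_comp_eq (g i).continuous (g j).continuous
      (funext fun x => (hg i x).trans (hg j x).symm) x hx
    apply hr₀
    rw [← hg₀, ← hg₀, this]
  have hgx : ∀ i x, (g i x).1.1 = x := fun i x => congrArg Subtype.val (hg i x)
  refine ⟨fun i x => if hx : x ∈ O then (g i ⟨x, hx⟩).1.2 else 0, ?_, ?_, ?_⟩
  · intro i
    rw [continuousOn_iff_continuous_domRestrict]
    have : Continuous fun x : O => (g i x).1.2 := by fun_prop
    convert this using 1
    ext x; simp
  · intro x hx i j hij
    simp only [hx, dite_true] at hij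
    refine hginj i j ⟨x, hx⟩ (Subtype.ext (Prod.ext ?_ hij))
    rw [hgx, hgx]
  · intro x hx y
    obtain ⟨r, hr, hrm⟩ := hcard x hx
    simp only [hx, dite_true]
    have hmem : ∀ i, (x, (g i ⟨x, hx⟩).1.2) ∈ S := fun i => by
      have h1 := (g i ⟨x, hx⟩).2.1
      have h2 : (g i ⟨x, hx⟩).1 = (x, (g i ⟨x, hx⟩).1.2) := Prod.ext (hgx i _) rfl
      rwa [h2] at h1
    constructor
    · intro hy
      choose σ hσ using fun i => (hrm _).1 (hmem i)
      have hσi : Function.Injective σ := fun i j hij => by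
        refine hginj i j ⟨x, hx⟩ (Subtype.ext (Prod.ext ?_ ?_))
        · rw [hgx, hgx]
        · rw [← hσ, ← hσ, hij]
      obtain ⟨j, hj⟩ := (hrm y).1 hy
      obtain ⟨i, rfl⟩ := (Finite.injective_iff_surjective.1 hσi) j
      exact ⟨i, by rw [← hσ, hj]⟩
    · rintro ⟨i, rfl⟩
      exact hmem i

end Covering

section FibreProduct

variable {X : Type*} [TopologicalSpace X] {S : Set (X × ℂ)} {N : ℕ} {O : Set X}

/-- The product of a function over a fibre is the product over the sheets. -/
@[to_additive]
theorem Sheets.finprod_fibre {M : Type*} [CommMonoid M] {r : Fin N → X → ℂ}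
    (h : Sheets S N O r) (F : X × ℂ → M) {x : X} (hx : x ∈ O) :
    ∏ᶠ y ∈ {y | (x, y) ∈ S}, F (x, y) = ∏ i, F (x, r i x) := by
  have : {y | (x, y) ∈ S} = Set.range fun i => r i x := by
    ext y; exact h.mem_iff x hx y
  rw [this, finprod_mem_range (h.inj x hx), finprod_eq_prod_of_fintype]

@[to_additive]
theorem LocSheets.continuousOn_finprod_fibre {M : Type*} [CommMonoid M] [TopologicalSpace M]
    [ContinuousMul M] (h : LocSheets S N O) {F : X × ℂ → M} (hO : IsOpen O)
    (hF : ContinuousOn F (S ∩ {p | p.1 ∈ O})) :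
    ContinuousOn (fun x => ∏ᶠ y ∈ {y | (x, y) ∈ S}, F (x, y)) O := by
  intro x hx
  obtain ⟨U, hU, hxU, r, hr⟩ := h x hx
  have hc : ContinuousOn (fun x => ∏ i, F (x, r i x)) (U ∩ O) :=
    continuousOn_finsetProd _ fun i _ => hF.comp
      (continuousOn_id.prodMk ((hr.cont i).mono Set.inter_subset_left))
      fun x hx => ⟨hr.mem hx.1 i, hx.2⟩
  refine ((hc.continuousAt ((hU.inter hO).mem_nhds ⟨hxU, hx⟩)).congr ?_).continuousWithinAt
  filter_upwards [hU.mem_nhds hxU] with x' hx'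
  exact (hr.finprod_fibre F hx').symm

end FibreProduct

/-- A closed subset of `ℂ × ℂ` which is finite over the first coordinate, and which over the
complement of the finite set `B` is locally a disjoint union of `N` graphs. -/
structure BranchedCurve (S : Set (ℂ × ℂ)) (N : ℕ) (B : Finset ℂ) : Prop where
  closed : IsClosed S
  bound : ∃ M, ∀ p ∈ S, ‖p.2‖ ≤ M * (1 + ‖p.1‖)
  finite : ∀ x, {p | p ∈ S ∧ p.1 = x}.Finite
  loc : LocSheets S N (B : Set ℂ)ᶜ

/-- Outside the disc of radius `ρ`, which contains the branch points, the set `S` consists of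
the `N` graphs of the functions `y i`. -/
structure CurveEnds (S : Set (ℂ × ℂ)) (N : ℕ) (B : Finset ℂ) (ρ : ℝ) (y : Fin N → ℂ → ℂ) :
    Prop where
  pos : 0 < ρ
  branch : ∀ b ∈ B, ‖b‖ < ρ
  sheets : Sheets S N {x | ρ < ‖x‖} y

namespace BranchedCurve

variable {S : Set (ℂ × ℂ)} {N : ℕ} {B : Finset ℂ}

/-- Local sections near the points of a fibre give a section over a neighbourhood of the
base point. -/
theorem exists_local_section (hS : BranchedCurve S N B) (b : ℂ) {Y : Type*} [TopologicalSpace Y]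
    [Nonempty Y] {P : ℂ × ℂ → Y → Prop}
    (h : ∀ p ∈ S, p.1 = b → ∃ U ∈ 𝓝 p, ∃ s : ℂ × ℂ → Y,
      ContinuousOn s (S ∩ U) ∧ ∀ q ∈ S ∩ U, P q (s q)) :
    ∃ δ > 0, ∃ s : ℂ × ℂ → Y, ContinuousOn s (S ∩ {p | p.1 ∈ Metric.ball b δ}) ∧
      ∀ q ∈ S ∩ {p | p.1 ∈ Metric.ball b δ}, P q (s q) := by
  classical
  obtain ⟨W, hW, hWd⟩ := (hS.finite b).t2_separation
  choose! U hU s hs hP using h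
  let V : ℂ × ℂ → Set (ℂ × ℂ) := fun p => W p ∩ interior (U p)
  have hVo : ∀ p, IsOpen (V p) := fun p => (hW p).2.inter isOpen_interior
  have hVd : ∀ p ∈ S, p.1 = b → ∀ p' ∈ S, p'.1 = b → ∀ q, q ∈ V p → q ∈ V p' → p = p' :=
    fun p hp hpb p' hp' hpb' q hq hq' =>
      hWd.elim_set ⟨hp, hpb⟩ ⟨hp', hpb'⟩ q hq.1 hq'.1
  let V' : Set (ℂ × ℂ) := ⋃ p ∈ {p | p ∈ S ∧ p.1 = b}, V p
  have hV' : IsOpen V' := isOpen_biUnion fun p _ => hVo p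
  obtain ⟨M, hM⟩ := hS.bound
  have hK : IsCompact ((S ∩ {p | p.1 ∈ Metric.closedBall b 1}) \ V') := by
    refine Metric.isCompact_of_isClosed_isBounded
      ((hS.closed.inter (Metric.isClosed_closedBall.preimage continuous_fst)).sdiff hV') ?_
    refine ((Metric.isBounded_closedBall (x := b) (r := 1)).prod
      (Metric.isBounded_closedBall (x := (0 : ℂ)) (r := |M| * (1 + (‖b‖ + 1))))).subset ?_
    rintro ⟨x, y⟩ ⟨⟨hp, hx⟩, -⟩
    refine ⟨hx, ?_⟩
    have h1 : ‖x‖ ≤ ‖b‖ + 1 := by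
      have := norm_le_norm_add_norm_sub' x b
      rw [← dist_eq_norm] at this
      have h2 : dist x b ≤ 1 := hx
      linarith
    have h3 : ‖y‖ ≤ M * (1 + ‖x‖) := hM _ hp
    rw [mem_closedBall_zero_iff]
    calc ‖y‖ ≤ M * (1 + ‖x‖) := h3
      _ ≤ |M| * (1 + ‖x‖) := by gcongr; exact le_abs_self M
      _ ≤ |M| * (1 + (‖b‖ + 1)) := by gcongr
  have hb : b ∉ Prod.fst '' ((S ∩ {p | p.1 ∈ Metric.closedBall b 1}) \ V') := by
    rintro ⟨p, ⟨⟨hp, -⟩, hpV⟩, hpb⟩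
    exact hpV (Set.mem_biUnion (show p ∈ {p | p ∈ S ∧ p.1 = b} from ⟨hp, hpb⟩)
      ⟨(hW p).1, mem_interior_iff_mem_nhds.2 (hU p hp hpb)⟩)
  obtain ⟨δ, hδ, hδK⟩ := Metric.isOpen_iff.1
    ((hK.image continuous_fst).isClosed.isOpen_compl) b hb
  have hcov : ∀ q ∈ S ∩ {p | p.1 ∈ Metric.ball b (min δ 1)}, ∃ p, (p ∈ S ∧ p.1 = b) ∧ q ∈ V p := by
    rintro q ⟨hq, hqb⟩
    by_contra hcon
    refine hδK (Metric.ball_subset_ball (min_le_left _ _) hqb) ⟨q, ⟨⟨hq, ?_⟩, ?_⟩, rfl⟩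
    · exact Metric.ball_subset_closedBall (Metric.ball_subset_ball (min_le_right _ _) hqb)
    · intro hqV
      obtain ⟨p, hp, hqp⟩ := Set.mem_iUnion₂.1 hqV
      exact hcon ⟨p, hp, hqp⟩
  choose! c hc hcV using hcov
  refine ⟨min δ 1, by positivity, fun q => s (c q) q, ?_, fun q hq =>
    hP _ (hc q hq).1 (hc q hq).2 _ ⟨hq.1, interior_subset (hcV q hq).2⟩⟩
  intro q hq
  have h1 : ContinuousWithinAt (s (c q)) (S ∩ {p | p.1 ∈ Metric.ball b (min δ 1)}) q := by
    have := (hs _ (hc q hq).1 (hc q hq).2).continuousWithinAt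
      ⟨hq.1, interior_subset (hcV q hq).2⟩
    exact (this.mono_of_mem_nhdsWithin (inter_mem self_mem_nhdsWithin (mem_nhdsWithin_of_mem_nhds
      (mem_interior_iff_mem_nhds.1 (hcV q hq).2)))).mono Set.inter_subset_left
  refine h1.congr_of_eventuallyEq ?_ rfl
  filter_upwards [self_mem_nhdsWithin, mem_nhdsWithin_of_mem_nhds ((hVo (c q)).mem_nhds (hcV q hq))]
    with q' hq' hq'V
  rw [hVd _ (hc q' hq').1 (hc q' hq').2 _ (hc q hq).1 (hc q hq).2 q' (hcV q' hq') hq'V]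

/-- A nonvanishing function has a logarithm near every fibre. -/
theorem exists_local_log (hS : BranchedCurve S N B) (b : ℂ) {F : ℂ × ℂ → ℂ}
    (hF : ContinuousOn F S) (h0 : ∀ p ∈ S, F p ≠ 0) :
    ∃ δ > 0, ∃ l : ℂ × ℂ → ℂ, ContinuousOn l (S ∩ {p | p.1 ∈ Metric.ball b δ}) ∧
      ∀ q ∈ S ∩ {p | p.1 ∈ Metric.ball b δ}, Complex.exp (l q) = F q := by
  refine hS.exists_local_section b (P := fun q l => Complex.exp l = F q) fun p hp _ => ?_
  have hcont : ContinuousWithinAt (fun q => F q / F p) S p := (hF p hp).div_const _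
  have hev : ∀ᶠ q in 𝓝[S] p, F q / F p ∈ Complex.slitPlane :=
    hcont (Complex.isOpen_slitPlane.mem_nhds (by simp [h0 p hp]))
  obtain ⟨U, hU, hUS⟩ := mem_nhdsWithin_iff_exists_mem_nhds_inter.1 hev
  refine ⟨U, hU, fun q => Complex.log (F q / F p) + Complex.log (F p), ?_, ?_⟩
  · refine ContinuousOn.add (ContinuousOn.clog ?_ fun q hq => hUS hq.symm) continuousOn_const
    exact (hF.mono Set.inter_subset_left).div_const _
  · rintro q ⟨hq, -⟩
    rw [Complex.exp_add, Complex.exp_log (div_ne_zero (h0 q hq) (h0 p hp)),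
      Complex.exp_log (h0 p hp), div_mul_cancel₀ _ (h0 p hp)]

/-- The winding numbers at the ends of a nonvanishing function add up to zero. -/
theorem sum_wind_eq_zero (hS : BranchedCurve S N B) {ρ : ℝ} {y : Fin N → ℂ → ℂ}
    (hy : CurveEnds S N B ρ y) {F : ℂ × ℂ → ℂ} (hF : ContinuousOn F S) (h0 : ∀ p ∈ S, F p ≠ 0)
    {R : ℝ} (hR : ρ < R) {n : Fin N → ℤ}
    (hn : ∀ i, HasWind (fun t => F (circ 0 R t, y i (circ 0 R t))) (n i)) : ∑ i, n i = 0 := by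
  have hR0 : 0 < R := hy.pos.trans hR
  let G : ℂ → ℂ := fun x => ∏ᶠ y ∈ {y | (x, y) ∈ S}, F (x, y)
  have hBo : IsOpen (B : Set ℂ)ᶜ := B.finite_toSet.isClosed.isOpen_compl
  have hG : ContinuousOn G (B : Set ℂ)ᶜ :=
    hS.loc.continuousOn_finprod_fibre hBo (hF.mono Set.inter_subset_left)
  have hG0 : ∀ x ∈ (B : Set ℂ)ᶜ, G x ≠ 0 := fun x hx => by
    obtain ⟨U, -, hxU, r, hr⟩ := hS.loc x hx
    simp only [G]
    rw [hr.finprod_fibre F hxU]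
    exact Finset.prod_ne_zero_iff.2 fun i _ => h0 _ (hr.mem hxU i)
  have hres : ∀ b ∈ B, HasRes G b 0 := fun b hb => by
    obtain ⟨δ, hδ, l, hl, hlF⟩ := hS.exists_local_log b hF h0
    have hBb : IsOpen ((B.erase b : Finset ℂ) : Set ℂ)ᶜ :=
      (B.erase b).finite_toSet.isClosed.isOpen_compl
    obtain ⟨ε, hε, hεB⟩ := Metric.isOpen_iff.1 (hBb.inter (Metric.isOpen_ball (x := b) (ε := δ))) b
      ⟨by simp, by simpa using hδ⟩
    have hsub : ∀ x ∈ Metric.ball b ε \ {b}, x ∈ Metric.ball b δ ∧ x ∈ (B : Set ℂ)ᶜ :=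
      fun x hx => ⟨(hεB hx.1).2, fun hxB => (hεB hx.1).1 (by
        simpa using ⟨hxB, hx.2⟩)⟩
    have hloc : LocSheets S N (Metric.ball b ε \ {b}) := fun x hx => hS.loc x (hsub x hx).2
    refine hasRes_of_eq_exp hε (g := fun x => ∑ᶠ y ∈ {y | (x, y) ∈ S}, l (x, y)) ?_ fun x hx => ?_
    · refine hloc.continuousOn_finsum_fibre (Metric.isOpen_ball.sdiff isClosed_singleton)
        (hl.mono ?_)
      exact fun p hp => ⟨hp.1, (hsub _ hp.2).1⟩
    · obtain ⟨U, -, hxU, r, hr⟩ := hloc x hx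
      simp only [G]
      rw [hr.finprod_fibre F hxU, hr.finsum_fibre l hxU, Complex.exp_sum]
      exact Finset.prod_congr rfl fun i _ => (hlF _ ⟨hr.mem hxU i, (hsub x hx).1⟩).symm
  have h1 := hasWind_circ_of_hasRes hR0 (lt_add_one R) (c := 0) (B := B) (G := G)
    (fun b hb => by simpa using (hy.branch b hb).trans hR)
    (hG.mono fun x hx => hx.2) (fun x hx => hG0 x hx.2) (k := fun _ => 0) hres
  have h2 := HasWind.prod Finset.univ fun i _ => hn i
  have h3 : (fun t => G (circ 0 R t)) = fun t => ∏ i, F (circ 0 R t, y i (circ 0 R t)) := by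
    ext t
    refine hy.sheets.finprod_fibre F ?_
    have := norm_circ_sub 0 hR0.le t
    rw [sub_zero] at this
    simpa [this] using hR
  rw [h3] at h1
  simpa using h2.unique h1

end BranchedCurve

/-- A family `T` of orbits of the `m`-th roots of unity on `ℂ² \ {0}`, indexed by the points of
`Z`, which locally is the orbit of a continuous function. -/
def RootBundle {V : Type*} [TopologicalSpace V] (m : ℕ) (Z : Set V) (T : V → Set (ℂ × ℂ)) : Prop :=
  ∀ z₀ ∈ Z, ∃ U ∈ 𝓝 z₀, ∃ s : V → ℂ × ℂ, ContinuousOn s (Z ∩ U) ∧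
    ∀ z ∈ Z ∩ U, s z ≠ 0 ∧ T z = {v | ∃ ζ : ℂ, ζ ^ m = 1 ∧ v = ζ • s z}

namespace RootBundle

variable {V V' : Type*} [TopologicalSpace V] [TopologicalSpace V'] {m : ℕ} {Z : Set V}
  {T : V → Set (ℂ × ℂ)}

theorem comp (h : RootBundle m Z T) {Z' : Set V'} {f : V' → V} (hf : ContinuousOn f Z')
    (hZ : Set.MapsTo f Z' Z) : RootBundle m Z' (T ∘ f) := by
  intro z hz
  obtain ⟨U, hU, s, hs, hsT⟩ := h (f z) (hZ hz)
  obtain ⟨U', hU', hUU⟩ := mem_nhdsWithin_iff_exists_mem_nhds_inter.1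
    ((hf z hz).preimage_mem_nhdsWithin hU)
  refine ⟨U', hU', s ∘ f, hs.comp (hf.mono Set.inter_subset_left) fun q hq =>
    ⟨hZ hq.1, hUU hq.symm⟩, fun q hq => hsT _ ⟨hZ hq.1, hUU hq.symm⟩⟩

theorem mono (h : RootBundle m Z T) {Z' : Set V} (hZ : Z' ⊆ Z) : RootBundle m Z' T :=
  h.comp continuousOn_id hZ

theorem ne_zero (h : RootBundle m Z T) (hm : 0 < m) {z : V} (hz : z ∈ Z) {v : ℂ × ℂ}
    (hv : v ∈ T z) : v ≠ 0 := by
  obtain ⟨U, hU, s, -, hsT⟩ := h z hz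
  obtain ⟨h0, hT⟩ := hsT z ⟨hz, mem_of_mem_nhds hU⟩
  rw [hT] at hv
  obtain ⟨ζ, hζ, rfl⟩ := hv
  refine smul_ne_zero (fun h => ?_) h0
  simp [h, hm.ne'] at hζ

theorem mem_iff (h : RootBundle m Z T) (hm : 0 < m) {z : V} (hz : z ∈ Z) {v : ℂ × ℂ}
    (hv : v ∈ T z) {v' : ℂ × ℂ} : v' ∈ T z ↔ ∃ ζ : ℂ, ζ ^ m = 1 ∧ v' = ζ • v := by
  obtain ⟨U, hU, s, -, hsT⟩ := h z hz
  obtain ⟨h0, hT⟩ := hsT z ⟨hz, mem_of_mem_nhds hU⟩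
  rw [hT] at hv ⊢
  obtain ⟨ζ, hζ, rfl⟩ := hv
  have hζ0 : ζ ≠ 0 := fun h => by simp [h, hm.ne'] at hζ
  constructor
  · rintro ⟨ξ, hξ, rfl⟩
    exact ⟨ξ / ζ, by rw [div_pow, hξ, hζ, div_one], by rw [smul_smul, div_mul_cancel₀ _ hζ0]⟩
  · rintro ⟨ξ, hξ, rfl⟩
    exact ⟨ξ * ζ, by rw [mul_pow, hξ, hζ, one_mul], by rw [smul_smul]⟩

end RootBundle

section Ratio

/-- The coefficient of the vector `v` along the vector `s`. -/
noncomputable def coefAlong (s v : ℂ × ℂ) : ℂ :=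
  (starRingEnd ℂ s.1 * v.1 + starRingEnd ℂ s.2 * v.2) /
    (starRingEnd ℂ s.1 * s.1 + starRingEnd ℂ s.2 * s.2)

theorem coefAlong_denom_ne_zero {s : ℂ × ℂ} (hs : s ≠ 0) :
    starRingEnd ℂ s.1 * s.1 + starRingEnd ℂ s.2 * s.2 ≠ 0 := by
  rw [mul_comm, Complex.mul_conj, mul_comm, Complex.mul_conj, ← Complex.ofReal_add]
  intro h
  have h1 := Complex.ofReal_eq_zero.1 h
  have h2 := (add_eq_zero_iff_of_nonneg (Complex.normSq_nonneg _) (Complex.normSq_nonneg _)).1 h1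
  exact hs (Prod.ext (Complex.normSq_eq_zero.1 h2.1) (Complex.normSq_eq_zero.1 h2.2))

theorem coefAlong_smul {s : ℂ × ℂ} (hs : s ≠ 0) (ζ : ℂ) : coefAlong s (ζ • s) = ζ := by
  rw [coefAlong, div_eq_iff (coefAlong_denom_ne_zero hs)]
  simp only [Prod.smul_fst, Prod.smul_snd, smul_eq_mul]
  ring

theorem ContinuousOn.coefAlong {A : Type*} [TopologicalSpace A] {C : Set A} {s v : A → ℂ × ℂ}
    (hs : ContinuousOn s C) (hv : ContinuousOn v C) (h0 : ∀ z ∈ C, s z ≠ 0) :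
    ContinuousOn (fun z => coefAlong (s z) (v z)) C := by
  unfold _root_.coefAlong
  refine ContinuousOn.div ?_ ?_ fun z hz => coefAlong_denom_ne_zero (h0 z hz)
  · exact ((Complex.continuous_conj.comp_continuousOn hs.fst).mul hv.fst).add
      ((Complex.continuous_conj.comp_continuousOn hs.snd).mul hv.snd)
  · exact ((Complex.continuous_conj.comp_continuousOn hs.fst).mul hs.fst).add
      ((Complex.continuous_conj.comp_continuousOn hs.snd).mul hs.snd)

theorem finite_rootsOfUnity_set {m : ℕ} (hm : 0 < m) : {ζ : ℂ | ζ ^ m = 1}.Finite := by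
  have := (Polynomial.nthRoots m (1 : ℂ)).toFinset.finite_toSet
  refine this.subset fun ζ hζ => ?_
  simpa [Polynomial.mem_nthRoots hm] using hζ

end Ratio

namespace RootBundle

variable {V : Type*} [TopologicalSpace V] {m : ℕ} {Z : Set V} {T : V → Set (ℂ × ℂ)}

/-- Two sections over a preconnected set differ by a root of unity. -/
theorem section_unique (h : RootBundle m Z T) (hm : 0 < m) (hZ : IsPreconnected Z)
    {s s' : V → ℂ × ℂ} (hs : ContinuousOn s Z) (hsT : ∀ z ∈ Z, s z ∈ T z)
    (hs' : ContinuousOn s' Z) (hsT' : ∀ z ∈ Z, s' z ∈ T z) :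
    ∃ ζ : ℂ, ζ ^ m = 1 ∧ ∀ z ∈ Z, s' z = ζ • s z := by
  rcases Z.eq_empty_or_nonempty with rfl | ⟨z₀, hz₀⟩
  · exact ⟨1, by simp, by simp⟩
  have h0 : ∀ z ∈ Z, s z ≠ 0 := fun z hz => h.ne_zero hm hz (hsT z hz)
  have hmem : ∀ z ∈ Z, coefAlong (s z) (s' z) ^ m = 1 ∧ s' z = coefAlong (s z) (s' z) • s z :=
    fun z hz => by
      obtain ⟨ζ, hζ, hv⟩ := (h.mem_iff hm hz (hsT z hz)).1 (hsT' z hz)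
      rw [hv, coefAlong_smul (h0 z hz)]
      exact ⟨hζ, rfl⟩
  refine ⟨coefAlong (s z₀) (s' z₀), (hmem z₀ hz₀).1, fun z hz => ?_⟩
  rw [hZ.constant_of_mapsTo (T := {ζ : ℂ | ζ ^ m = 1}) (finite_rootsOfUnity_set hm).isDiscrete
    (hs.coefAlong hs' h0)
    (fun z hz => (hmem z hz).1) hz₀ hz]
  exact (hmem z hz).2

/-- The projection of the total space of a root bundle. -/
def proj (Z : Set V) (T : V → Set (ℂ × ℂ)) (e : {q : V × (ℂ × ℂ) // q.1 ∈ Z ∧ q.2 ∈ T q.1}) : Z :=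
  ⟨e.1.1, e.2.1⟩

theorem isCoveringMap (h : RootBundle m Z T) (hm : 0 < m) : IsCoveringMap (proj Z T) := by
  rintro ⟨z, hz⟩
  have hd : DiscreteTopology {ζ : ℂ | ζ ^ m = 1} := by
    have := (finite_rootsOfUnity_set hm).to_subtype
    infer_instance
  suffices IsEvenlyCovered (proj Z T) ⟨z, hz⟩ {ζ : ℂ | ζ ^ m = 1} from
    this.to_isEvenlyCovered_preimage
  obtain ⟨U', hU', s, hs, hsT⟩ := h z hz
  obtain ⟨U, hUU, hU, hzU⟩ := mem_nhds_iff.1 hU'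
  replace hs := hs.mono (Set.inter_subset_inter_right Z hUU)
  replace hsT := fun z (hz : z ∈ Z ∩ U) => hsT z ⟨hz.1, hUU hz.2⟩
  have hcont : Continuous (proj Z T) := by unfold proj; fun_prop
  have hUO : IsOpen (Subtype.val ⁻¹' U : Set Z) := hU.preimage continuous_subtype_val
  have hex : ∀ e : proj Z T ⁻¹' (Subtype.val ⁻¹' U : Set Z),
      coefAlong (s e.1.1.1) e.1.1.2 ^ m = 1 ∧
        coefAlong (s e.1.1.1) e.1.1.2 • s e.1.1.1 = e.1.1.2 := fun e => by
    obtain ⟨h0, hT⟩ := hsT e.1.1.1 ⟨e.1.2.1, e.2⟩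
    have := e.1.2.2
    rw [hT] at this
    obtain ⟨ζ, hζ, hv⟩ := this
    rw [hv, coefAlong_smul h0]
    exact ⟨hζ, rfl⟩
  refine ⟨hd, (Subtype.val ⁻¹' U : Set Z), hzU, hUO, hUO.preimage hcont, ?_⟩
  refine ⟨⟨⟨fun e => (⟨proj Z T e.1, e.2⟩, ⟨coefAlong (s e.1.1.1) e.1.1.2, (hex e).1⟩),
    fun q => ⟨⟨(q.1.1.1, q.2.1 • s q.1.1.1), q.1.1.2, ?_⟩, q.1.2⟩, ?_, ?_⟩, ?_, ?_⟩, ?_⟩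
  · change q.2.1 • s q.1.1.1 ∈ T q.1.1.1
    rw [(hsT _ ⟨q.1.1.2, q.1.2⟩).2]
    exact ⟨q.2.1, q.2.2, rfl⟩
  · intro e
    apply Subtype.ext; apply Subtype.ext
    exact Prod.ext rfl (hex e).2
  · intro q
    refine Prod.ext rfl (Subtype.ext ?_)
    exact coefAlong_smul (hsT _ ⟨q.1.1.2, q.1.2⟩).1 _
  · refine ((hcont.comp continuous_subtype_val).subtype_mk _).prodMk (Continuous.subtype_mk ?_ _)
    rw [← continuousOn_univ]
    refine ContinuousOn.coefAlong ?_ (by fun_prop) fun e _ => (hsT _ ⟨e.1.2.1, e.2⟩).1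
    exact hs.comp (by fun_prop) fun e _ => ⟨e.1.2.1, e.2⟩
  · refine Continuous.subtype_mk (Continuous.subtype_mk ?_ _) _
    refine Continuous.prodMk (by fun_prop) (Continuous.smul
      (continuous_subtype_val.comp continuous_snd) ?_)
    exact hs.comp_continuous (by fun_prop) fun q => ⟨q.1.1.2, q.1.2⟩
  · intro e; rfl

/-- A root bundle has a section if it has one after a deformation. -/
theorem exists_section_of_homotopy (h : RootBundle m Z T) (hm : 0 < m)
    (H : C(unitInterval × Z, Z)) (H_one : ∀ a, H (1, a) = a) {f : Z → ℂ × ℂ} (hf : Continuous f)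
    (hfT : ∀ a, f a ∈ T (H (0, a))) :
    ∃ s : V → ℂ × ℂ, ContinuousOn s Z ∧ ∀ z ∈ Z, s z ∈ T z := by
  classical
  obtain ⟨g, hg⟩ := (h.isCoveringMap hm).exists_lift_of_homotopy (.id Z) H H_one
    ⟨fun a => ⟨(H (0, a), f a), (H (0, a)).2, hfT a⟩, by fun_prop⟩ (fun a => rfl)
  refine ⟨fun z => if hz : z ∈ Z then (g ⟨z, hz⟩).1.2 else 0, ?_, fun z hz => ?_⟩
  · rw [continuousOn_iff_continuous_domRestrict]
    have : Continuous fun z : Z => (g z).1.2 := by fun_prop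
    convert this using 1
    ext z <;> simp
  · simp only [hz, dite_true]
    have h1 : (g ⟨z, hz⟩).1.1 = z := congrArg Subtype.val (hg ⟨z, hz⟩)
    have h2 := (g ⟨z, hz⟩).2.2
    rwa [h1] at h2

theorem exists_section_of_convex {V : Type*} [NormedAddCommGroup V] [NormedSpace ℝ V] {Z : Set V}
    {T : V → Set (ℂ × ℂ)} (h : RootBundle m Z T) (hm : 0 < m) (hZ : Convex ℝ Z) :
    ∃ s : V → ℂ × ℂ, ContinuousOn s Z ∧ ∀ z ∈ Z, s z ∈ T z := by
  rcases Z.eq_empty_or_nonempty with rfl | ⟨z₀, hz₀⟩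
  · exact ⟨0, by simp, by simp⟩
  obtain ⟨U, hU, s, -, hsT⟩ := h z₀ hz₀
  refine h.exists_section_of_homotopy hm
    ⟨fun q => ⟨z₀ + (q.1 : ℝ) • ((q.2 : V) - z₀), hZ.add_smul_sub_mem hz₀ q.2.2 q.1.2⟩,
        by fun_prop⟩ (fun a => by ext; simp) (f := fun _ => s z₀) continuous_const fun a => ?_
  simp only [ContinuousMap.coe_mk, Set.Icc.coe_zero, zero_smul, add_zero]
  rw [(hsT z₀ ⟨hz₀, mem_of_mem_nhds hU⟩).2]
  exact ⟨1, by simp, by simp⟩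

end RootBundle

/-- The part of `S` over a star-shaped set with one branch point `b` deforms into the part
over a small disc around `b`. -/
theorem LocSheets.exists_shrink {S : Set (ℂ × ℂ)} {N : ℕ} {W : Set ℂ} {b : ℂ}
    (hW : Convex ℝ W) (hb : b ∈ W) (hloc : LocSheets S N (W \ {b})) {δ : ℝ} (hδ : 0 < δ) :
    ∃ H : C(unitInterval × ↥(S ∩ {p | p.1 ∈ W}), ↥(S ∩ {p | p.1 ∈ W})),
      (∀ a, H (1, a) = a) ∧ ∀ a, (H (0, a)).1.1 ∈ Metric.ball b δ := by
  classical
  have cov := hloc.isCoveringMap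
  let mu : ℂ → ℝ := fun x => min 1 (δ / 2 / max ‖x - b‖ (δ / 4))
  have hmuc : Continuous mu := by
    refine continuous_const.min (continuous_const.div (by fun_prop) fun x => ?_)
    have : 0 < max ‖x - b‖ (δ / 4) := lt_max_of_lt_right (by positivity)
    exact this.ne'
  have hmu0 : ∀ x, 0 < mu x := fun x => lt_min one_pos
    (div_pos (by positivity) (lt_max_of_lt_right (by positivity)))
  have hmu1 : ∀ x, mu x ≤ 1 := fun x => min_le_left _ _
  have hmueq : ∀ x, ‖x - b‖ ≤ δ / 2 → mu x = 1 := fun x hx => by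
    refine min_eq_left ((one_le_div (lt_max_of_lt_right (by positivity))).2 (max_le hx ?_))
    linarith
  have hmule : ∀ x, mu x * ‖x - b‖ ≤ δ / 2 := fun x => by
    have hp : 0 < max ‖x - b‖ (δ / 4) := lt_max_of_lt_right (by positivity)
    calc mu x * ‖x - b‖ ≤ (δ / 2 / max ‖x - b‖ (δ / 4)) * max ‖x - b‖ (δ / 4) := by
          gcongr
          · exact min_le_right _ _
          · exact le_max_left _ _
      _ = δ / 2 := div_mul_cancel₀ _ hp.ne'
  let lam : ℝ → ℂ → ℝ := fun t x => 1 + t * (mu x - 1)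
  have hlam0 : ∀ t ∈ Set.Icc (0 : ℝ) 1, ∀ x, 0 < lam t x ∧ lam t x ≤ 1 := fun t ht x => by
    have h1 := hmu0 x
    have h2 := hmu1 x
    constructor
    · simp only [lam]; nlinarith [ht.1, ht.2]
    · simp only [lam]; nlinarith [ht.1, ht.2]
  have hmem : ∀ t ∈ Set.Icc (0 : ℝ) 1, ∀ x ∈ W \ {b}, b + lam t x • (x - b) ∈ W \ {b} :=
    fun t ht x hx => by
      refine ⟨hW.add_smul_sub_mem hb hx.1 ⟨(hlam0 t ht x).1.le, (hlam0 t ht x).2⟩, fun h => ?_⟩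
      have h1 : lam t x • (x - b) = 0 := by simpa using h
      rcases smul_eq_zero.1 h1 with h2 | h2
      · exact (hlam0 t ht x).1.ne' h2
      · exact hx.2 (sub_eq_zero.1 h2)
  let h : C(unitInterval × {p : ℂ × ℂ // p ∈ S ∧ p.1 ∈ W \ {b}}, ↥(W \ {b})) :=
    ⟨fun q => ⟨b + lam q.1 q.2.1.1 • (q.2.1.1 - b), hmem _ q.1.2 _ q.2.2.2⟩, by
      simp only [lam]
      exact Continuous.subtype_mk (by fun_prop) _⟩
  have h0 : ∀ a, h (0, a) =
      sheetProj S (W \ {b}) (ContinuousMap.id {p : ℂ × ℂ // p ∈ S ∧ p.1 ∈ W \ {b}} a) := fun a => by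
    ext; simp [h, lam, sheetProj]
  let L := cov.liftHomotopy h (.id {p : ℂ × ℂ // p ∈ S ∧ p.1 ∈ W \ {b}}) h0
  have hL : ∀ t a, (L (t, a)).1.1 = b + lam t a.1.1 • (a.1.1 - b) := fun t a =>
    congrArg Subtype.val (congrFun
      (cov.liftHomotopy_lifts h (.id {p : ℂ × ℂ // p ∈ S ∧ p.1 ∈ W \ {b}}) h0) (t, a))
  have hL0 : ∀ a, L (0, a) = a := fun a =>
    cov.liftHomotopy_zero h (.id {p : ℂ × ℂ // p ∈ S ∧ p.1 ∈ W \ {b}}) h0 a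
  have hLc : ∀ a : {p : ℂ × ℂ // p ∈ S ∧ p.1 ∈ W \ {b}}, ‖a.1.1 - b‖ ≤ δ / 2 →
      ∀ t, L (t, a) = a := fun a ha t => by
    refine (cov.const_of_comp (g := fun t => L (t, a)) (by fun_prop) (fun t t' => ?_) t 0).trans
      (hL0 a)
    apply Subtype.ext
    change (L (t, a)).1.1 = (L (t', a)).1.1
    rw [hL, hL]
    simp [lam, hmueq _ ha]
  let K : unitInterval × ↥(S ∩ {p | p.1 ∈ W}) → ℂ × ℂ := fun q =>
    if hq : q.2.1.1 = b then q.2.1 else (L (unitInterval.symm q.1, ⟨q.2.1, q.2.2.1, q.2.2.2, hq⟩)).1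
  have hKmem : ∀ q, K q ∈ S ∩ {p | p.1 ∈ W} := fun q => by
    simp only [K]
    split_ifs with hq
    · exact q.2.2
    · exact ⟨(L _).2.1, (L _).2.2.1⟩
  have hKnear : ∀ q : unitInterval × ↥(S ∩ {p | p.1 ∈ W}), ‖q.2.1.1 - b‖ ≤ δ / 2 → K q = q.2.1 :=
    fun q hq => by
      simp only [K]
      split_ifs with hqb
      · rfl
      · rw [hLc]
        exact hq
  have hKc : Continuous K := by
    rw [← continuousOn_univ]
    refine continuousOn_of_locally_continuousOn fun q _ => ?_
    by_cases hq : q.2.1.1 = b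
    · refine ⟨{q | ‖q.2.1.1 - b‖ < δ / 2}, isOpen_lt (by fun_prop) continuous_const,
        by simp [hq, hδ], ?_⟩
      refine ContinuousOn.congr (f := fun q => q.2.1) (by fun_prop) fun q hq => ?_
      exact hKnear q (le_of_lt hq.2)
    · refine ⟨{q | q.2.1.1 ≠ b}, isOpen_ne_fun (by fun_prop) continuous_const, hq, ?_⟩
      rw [continuousOn_iff_continuous_domRestrict]
      have : Continuous fun q : ↥((Set.univ : Set (unitInterval × ↥(S ∩ {p | p.1 ∈ W}))) ∩
          {q | q.2.1.1 ≠ b}) =>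
          (L (unitInterval.symm q.1.1, ⟨q.1.2.1, q.1.2.2.1, q.1.2.2.2, q.2.2⟩)).1 := by
        refine continuous_subtype_val.comp (L.continuous.comp ?_)
        exact (unitInterval.continuous_symm.comp (by fun_prop)).prodMk
          (Continuous.subtype_mk (by fun_prop) _)
      refine this.congr fun q => ?_
      have hq' : ¬ q.1.2.1.1 = b := q.2.2
      simp only [Set.domRestrict_apply, K, hq', dite_false]
  refine ⟨⟨fun q => ⟨K q, hKmem q⟩, hKc.subtype_mk _⟩, fun a => Subtype.ext ?_, fun a => ?_⟩
  · change K (1, a) = a.1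
    simp only [K, unitInterval.symm_one]
    split_ifs with ha
    · rfl
    · rw [hL0]
  · change (K (0, a)).1 ∈ Metric.ball b δ
    simp only [K, unitInterval.symm_zero]
    split_ifs with ha
    · rw [ha]; exact Metric.mem_ball_self hδ
    · rw [hL, mem_ball_iff_norm]
      have : lam ((1 : unitInterval) : ℝ) a.1.1 = mu a.1.1 := by simp [lam]
      simp only [this, add_sub_cancel_left, norm_smul, Real.norm_of_nonneg (hmu0 _).le]
      linarith [hmule a.1.1]

/-- A root bundle is trivial over a convex set with at most one branch point. -/
theorem BranchedCurve.exists_section {S : Set (ℂ × ℂ)} {N : ℕ} {B : Finset ℂ}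
    (hS : BranchedCurve S N B) {m : ℕ} (hm : 0 < m) {T : ℂ × ℂ → Set (ℂ × ℂ)}
    (hT : RootBundle m S T) {W : Set ℂ} (hW : Convex ℝ W) {b : ℂ} (hb : b ∈ W)
    (hWB : ∀ x ∈ B, x ∈ W → x = b) :
    ∃ s : ℂ × ℂ → ℂ × ℂ, ContinuousOn s (S ∩ {p | p.1 ∈ W}) ∧
      ∀ p ∈ S ∩ {p | p.1 ∈ W}, s p ∈ T p := by
  obtain ⟨δ, hδ, s, hs, hsT⟩ := hS.exists_local_section b (P := fun q v => v ∈ T q) fun p hp _ => by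
    obtain ⟨U, hU, s, hs, hsT⟩ := hT p hp
    refine ⟨U, hU, s, hs, fun q hq => ?_⟩
    rw [(hsT q hq).2]
    exact ⟨1, by simp, by simp⟩
  have hloc : LocSheets S N (W \ {b}) := fun x hx => hS.loc x fun hxB => hx.2 (hWB x hxB hx.1)
  obtain ⟨H, H1, H0⟩ := hloc.exists_shrink hW hb hδ
  refine (hT.mono Set.inter_subset_left).exists_section_of_homotopy hm H H1
    (f := fun a => s (H (0, a)).1) ?_ fun a => hsT _ ⟨(H (0, a)).2.1, H0 a⟩
  exact hs.comp_continuous (by fun_prop) fun a => ⟨(H (0, a)).2.1, H0 a⟩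

/-- The multiples `c • v` of `v` with `c ^ m = F`. -/
def rootOrbit (m : ℕ) (F : ℂ) (v : ℂ × ℂ) : Set (ℂ × ℂ) := {u | ∃ c : ℂ, c ^ m = F ∧ u = c • v}

theorem rootOrbit_exp_smul {m : ℕ} (hm : 0 < m) (F a : ℂ) (v : ℂ × ℂ) :
    rootOrbit m F (Complex.exp (a / m) • v) = rootOrbit m (F * Complex.exp a) v := by
  have hexp : Complex.exp (a / m) ^ m = Complex.exp a := by
    rw [← Complex.exp_nat_mul, mul_div_cancel₀ _ (by exact_mod_cast hm.ne')]
  ext u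
  constructor
  · rintro ⟨c, hc, rfl⟩
    exact ⟨c * Complex.exp (a / m), by rw [mul_pow, hc, hexp], by rw [smul_smul]⟩
  · rintro ⟨c, hc, rfl⟩
    refine ⟨c / Complex.exp (a / m), ?_, ?_⟩
    · rw [div_pow, hc, hexp, mul_div_cancel_right₀ _ (Complex.exp_ne_zero _)]
    · rw [smul_smul, div_mul_cancel₀ _ (Complex.exp_ne_zero _)]

theorem exp_div_smul_mem_rootOrbit {m : ℕ} (hm : 0 < m) (a : ℂ) (v : ℂ × ℂ) :
    Complex.exp (a / m) • v ∈ rootOrbit m (Complex.exp a) v :=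
  ⟨_, by rw [← Complex.exp_nat_mul, mul_div_cancel₀ _ (by exact_mod_cast hm.ne')], rfl⟩

/-- The root bundle `T` is the bundle of `m`-th roots of `F`, times `v`, over `O`. -/
structure RootDecomp (S : Set (ℂ × ℂ)) (m : ℕ) (T : ℂ × ℂ → Set (ℂ × ℂ)) (O : Set ℂ)
    (F : ℂ × ℂ → ℂ) (v : ℂ × ℂ → ℂ × ℂ) : Prop where
  contF : ContinuousOn F (S ∩ {p | p.1 ∈ O})
  contv : ContinuousOn v (S ∩ {p | p.1 ∈ O})
  F_ne : ∀ p ∈ S ∩ {p | p.1 ∈ O}, F p ≠ 0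
  eq : ∀ p ∈ S ∩ {p | p.1 ∈ O}, T p = rootOrbit m (F p) (v p)

theorem ContinuousOn.of_sheets {S : Set (ℂ × ℂ)} {N : ℕ} {O : Set ℂ} {r : Fin N → ℂ → ℂ}
    {Y : Type*} [TopologicalSpace Y] {f : ℂ × ℂ → Y} (hf : ContinuousOn f (S ∩ {p | p.1 ∈ O}))
    (hr : Sheets S N O r) (i : Fin N) : ContinuousOn (fun x => f (x, r i x)) O :=
  hf.comp (continuousOn_id.prodMk (hr.cont i)) fun _ hx => ⟨hr.mem hx i, hx⟩

/-- Compatible logarithms of two decompositions over a convex set without branch points. -/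
theorem RootDecomp.exists_logs {S : Set (ℂ × ℂ)} {N : ℕ} {m : ℕ} (hm : 0 < m)
    {T : ℂ × ℂ → Set (ℂ × ℂ)} (hT : RootBundle m S T) {O : Set ℂ} (hO : Convex ℝ O)
    (hOo : IsOpen O) (hloc : LocSheets S N O) {F₁ F₂ : ℂ × ℂ → ℂ} {v₁ v₂ : ℂ × ℂ → ℂ × ℂ}
    (h₁ : RootDecomp S m T O F₁ v₁) (h₂ : RootDecomp S m T O F₂ v₂) :
    ∃ g₁ g₂ : ℂ × ℂ → ℂ, ContinuousOn g₁ (S ∩ {p | p.1 ∈ O}) ∧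
      ContinuousOn g₂ (S ∩ {p | p.1 ∈ O}) ∧ ∀ p ∈ S ∩ {p | p.1 ∈ O},
        Complex.exp (g₁ p) = F₁ p ∧ Complex.exp (g₂ p) = F₂ p ∧
        Complex.exp (g₁ p / m) • v₁ p = Complex.exp (g₂ p / m) • v₂ p := by
  classical
  obtain ⟨r, hr⟩ := hloc.exists_sheets hO
  have key : ∀ i, ∃ a₁ a₂ : ℂ → ℂ, ContinuousOn a₁ O ∧ ContinuousOn a₂ O ∧ ∀ x ∈ O,
      Complex.exp (a₁ x) = F₁ (x, r i x) ∧ Complex.exp (a₂ x) = F₂ (x, r i x) ∧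
      Complex.exp (a₁ x / m) • v₁ (x, r i x) = Complex.exp (a₂ x / m) • v₂ (x, r i x) := by
    intro i
    obtain ⟨a₁, ha₁, hF₁⟩ := Complex.exists_log_of_convex hO (h₁.contF.of_sheets hr i)
      fun x hx => h₁.F_ne _ ⟨hr.mem hx i, hx⟩
    obtain ⟨a₂, ha₂, hF₂⟩ := Complex.exists_log_of_convex hO (h₂.contF.of_sheets hr i)
      fun x hx => h₂.F_ne _ ⟨hr.mem hx i, hx⟩
    have hTi : RootBundle m O (T ∘ fun x => (x, r i x)) :=
      hT.comp (continuousOn_id.prodMk (hr.cont i)) fun x hx => hr.mem hx i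
    have hc : ∀ {a : ℂ → ℂ} {v : ℂ × ℂ → ℂ × ℂ}, ContinuousOn a O →
        ContinuousOn v (S ∩ {p | p.1 ∈ O}) →
        ContinuousOn (fun x => Complex.exp (a x / m) • v (x, r i x)) O := fun ha hv =>
      (Complex.continuous_exp.comp_continuousOn (ha.div_const _)).smul (hv.of_sheets hr i)
    obtain ⟨ζ, hζ, hs⟩ := hTi.section_unique hm hO.isPreconnected
      (hc ha₁ h₁.contv) (fun x hx => by
        simp only [Function.comp_apply]
        rw [h₁.eq _ ⟨hr.mem hx i, hx⟩, ← hF₁ x hx]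
        exact exp_div_smul_mem_rootOrbit hm _ _)
      (hc ha₂ h₂.contv) (fun x hx => by
        simp only [Function.comp_apply]
        rw [h₂.eq _ ⟨hr.mem hx i, hx⟩, ← hF₂ x hx]
        exact exp_div_smul_mem_rootOrbit hm _ _)
    have hm' : (m : ℂ) ≠ 0 := by exact_mod_cast hm.ne'
    have hζ0 : ζ ≠ 0 := fun h => by simp [h, hm.ne'] at hζ
    have hlog : Complex.exp (m * Complex.log ζ) = 1 := by
      rw [Complex.exp_nat_mul, Complex.exp_log hζ0, hζ]
    refine ⟨fun x => a₁ x + m * Complex.log ζ, a₂, ha₁.add continuousOn_const, ha₂,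
      fun x hx => ⟨?_, hF₂ x hx, ?_⟩⟩
    · rw [Complex.exp_add, hlog, mul_one, hF₁ x hx]
    · rw [hs x hx, add_div, mul_div_cancel_left₀ _ hm', Complex.exp_add, Complex.exp_log hζ0,
        smul_smul, mul_comm]
  choose a₁ a₂ ha₁ ha₂ ha using key
  have hidx : ∀ p : ℂ × ℂ, ∃ g : ℂ × ℂ, ∀ i, p.1 ∈ O → r i p.1 = p.2 →
      g = (a₁ i p.1, a₂ i p.1) := fun p => by
    by_cases hp : ∃ i, r i p.1 = p.2
    · obtain ⟨i, hi⟩ := hp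
      refine ⟨(a₁ i p.1, a₂ i p.1), fun j hpO hj => ?_⟩
      rw [hr.inj _ hpO (hi.trans hj.symm)]
    · exact ⟨0, fun i _ hi => absurd ⟨i, hi⟩ hp⟩
  choose g hg using hidx
  have hg' : ∀ i, ∀ x ∈ O, g (x, r i x) = (a₁ i x, a₂ i x) := fun i x hx => hg (x, r i x) i hx rfl
  refine ⟨fun p => (g p).1, fun p => (g p).2, hr.continuousOn hOo fun i => ?_,
    hr.continuousOn hOo fun i => ?_, ?_⟩
  · exact (ha₁ i).congr fun x hx => by simp only [hg' i x hx]
  · exact (ha₂ i).congr fun x hx => by simp only [hg' i x hx]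
  · rintro ⟨x, y⟩ ⟨hp, hx : x ∈ O⟩
    obtain ⟨i, rfl⟩ := (hr.mem_iff x hx y).1 hp
    simp only [hg' i x hx]
    exact ha i x hx

/-- Decompositions over the two sides of a strip without branch points glue. -/
theorem RootDecomp.glue {S : Set (ℂ × ℂ)} {N : ℕ} {m : ℕ} (hm : 0 < m)
    {T : ℂ × ℂ → Set (ℂ × ℂ)} (hT : RootBundle m S T) {O : Set ℂ} (hO : Convex ℝ O)
    (hOo : IsOpen O) (l : ℂ →L[ℝ] ℝ) {α β : ℝ} (hαβ : α < β)
    (hloc : LocSheets S N (O ∩ {x | l x ∈ Set.Ioo α β})) {F₁ F₂ : ℂ × ℂ → ℂ}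
    {v₁ v₂ : ℂ × ℂ → ℂ × ℂ} (h₁ : RootDecomp S m T (O ∩ {x | l x < β}) F₁ v₁)
    (h₂ : RootDecomp S m T (O ∩ {x | α < l x}) F₂ v₂) :
    ∃ F v, RootDecomp S m T O F v := by
  classical
  have hstrip : Convex ℝ (O ∩ {x | l x ∈ Set.Ioo α β}) :=
    hO.inter ((convex_Ioo α β).linear_preimage l.toLinearMap)
  have hstripo : IsOpen (O ∩ {x | l x ∈ Set.Ioo α β}) :=
    hOo.inter (isOpen_Ioo.preimage l.continuous)
  have hs₁ : S ∩ {p | p.1 ∈ O ∩ {x | l x ∈ Set.Ioo α β}} ⊆ S ∩ {p | p.1 ∈ O ∩ {x | l x < β}} :=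
    fun p hp => ⟨hp.1, hp.2.1, hp.2.2.2⟩
  have hs₂ : S ∩ {p | p.1 ∈ O ∩ {x | l x ∈ Set.Ioo α β}} ⊆ S ∩ {p | p.1 ∈ O ∩ {x | α < l x}} :=
    fun p hp => ⟨hp.1, hp.2.1, hp.2.2.1⟩
  obtain ⟨g₁, g₂, hg₁, hg₂, hg⟩ := RootDecomp.exists_logs hm hT hstrip hstripo hloc
    (F₁ := F₁) (F₂ := F₂) (v₁ := v₁) (v₂ := v₂)
    ⟨h₁.contF.mono hs₁, h₁.contv.mono hs₁, fun p hp => h₁.F_ne p (hs₁ hp),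
      fun p hp => h₁.eq p (hs₁ hp)⟩
    ⟨h₂.contF.mono hs₂, h₂.contv.mono hs₂, fun p hp => h₂.F_ne p (hs₂ hp),
      fun p hp => h₂.eq p (hs₂ hp)⟩
  obtain ⟨α', hα, hα'⟩ := exists_between hαβ
  obtain ⟨β', hβ, hβ'⟩ := exists_between hα'
  let χ : ℂ × ℂ → ℂ := fun p => (ramp α' β' (l p.1) : ℝ)
  have hχ : Continuous χ := by fun_prop
  let G : ℂ × ℂ → ℂ × (ℂ × ℂ) := fun p =>
    if l p.1 ∈ Set.Ioo α β then
      (Complex.exp ((1 - χ p) * g₁ p + χ p * g₂ p),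
        Complex.exp (χ p * (g₁ p - g₂ p) / m) • v₁ p)
    else if l p.1 < β then (F₁ p, v₁ p) else (F₂ p, v₂ p)
  have hGm : ∀ p, l p.1 ∈ Set.Ioo α β → G p = (Complex.exp ((1 - χ p) * g₁ p + χ p * g₂ p),
      Complex.exp (χ p * (g₁ p - g₂ p) / m) • v₁ p) := fun p hp => by simp only [G, hp, if_true]
  have hGl : ∀ p ∈ S, p.1 ∈ O → l p.1 ≤ α' → G p = (F₁ p, v₁ p) := fun p hp hpO hl => by
    by_cases hα : α < l p.1
    · have hmem : l p.1 ∈ Set.Ioo α β := ⟨hα, by linarith⟩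
      rw [hGm p hmem]
      simp [χ, ramp_of_le hβ hl, (hg p ⟨hp, hpO, hmem⟩).1]
    · have hmem : l p.1 ∉ Set.Ioo α β := fun h => hα h.1
      have hlt : l p.1 < β := by linarith
      simp only [G, hmem, if_false, hlt, if_true]
  have hGr : ∀ p ∈ S, p.1 ∈ O → β' ≤ l p.1 → G p = (F₂ p, v₂ p) := fun p hp hpO hl => by
    by_cases hβ : l p.1 < β
    · have hmem : l p.1 ∈ Set.Ioo α β := ⟨by linarith, hβ⟩
      obtain ⟨-, e₂, e₃⟩ := hg p ⟨hp, hpO, hmem⟩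
      have hc : χ p = 1 := by simp only [χ]; rw [ramp_of_ge ‹α' < β'› hl]; simp
      rw [hGm p hmem, hc, one_mul, one_mul, sub_div, Complex.exp_sub, div_eq_inv_mul, ← smul_smul, e₃,
        smul_smul, inv_mul_cancel₀ (Complex.exp_ne_zero _), one_smul, ← e₂]
      simp
    · have hmem : l p.1 ∉ Set.Ioo α β := fun h => hβ h.2
      simp only [G, hmem, if_false, hβ]
  have hGc : ContinuousOn G (S ∩ {p | p.1 ∈ O}) := by
    refine continuousOn_of_locally_continuousOn fun p hp => ?_
    rcases lt_or_ge (l p.1) α' with hl | hl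
    · refine ⟨{p | l p.1 < α'}, isOpen_lt (by fun_prop) continuous_const, hl, ?_⟩
      refine ContinuousOn.congr (f := fun p => (F₁ p, v₁ p)) ?_ fun q hq =>
        hGl q hq.1.1 hq.1.2 (le_of_lt hq.2)
      exact (h₁.contF.prodMk h₁.contv).mono fun q hq =>
        ⟨hq.1.1, hq.1.2, (lt_trans hq.2 hα' : l q.1 < β)⟩
    rcases lt_or_ge β' (l p.1) with hr | hr
    · refine ⟨{p | β' < l p.1}, isOpen_lt continuous_const (by fun_prop), hr, ?_⟩
      refine ContinuousOn.congr (f := fun p => (F₂ p, v₂ p)) ?_ fun q hq =>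
        hGr q hq.1.1 hq.1.2 (le_of_lt hq.2)
      exact (h₂.contF.prodMk h₂.contv).mono fun q hq =>
        ⟨hq.1.1, hq.1.2, (lt_trans (hα.trans hβ) hq.2 : α < l q.1)⟩
    · refine ⟨{p | l p.1 ∈ Set.Ioo α β}, isOpen_Ioo.preimage (by fun_prop : Continuous
        fun p : ℂ × ℂ => l p.1), ⟨by linarith, by linarith⟩, ?_⟩
      refine ContinuousOn.congr (f := fun p => (Complex.exp ((1 - χ p) * g₁ p + χ p * g₂ p),
        Complex.exp (χ p * (g₁ p - g₂ p) / m) • v₁ p)) ?_ fun q hq => hGm q hq.2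
      have hsub : (S ∩ {p | p.1 ∈ O}) ∩ {p | l p.1 ∈ Set.Ioo α β} ⊆
          S ∩ {p | p.1 ∈ O ∩ {x | l x ∈ Set.Ioo α β}} := fun q hq => ⟨hq.1.1, hq.1.2, hq.2⟩
      have k₁ := hg₁.mono hsub
      have k₂ := hg₂.mono hsub
      have k₃ := h₁.contv.mono (hsub.trans hs₁)
      have k₀ := hχ.continuousOn (s := (S ∩ {p | p.1 ∈ O}) ∩ {p | l p.1 ∈ Set.Ioo α β})
      exact (Complex.continuous_exp.comp_continuousOn
          (((continuousOn_const.sub k₀).mul k₁).add (k₀.mul k₂))).prodMk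
        ((Complex.continuous_exp.comp_continuousOn ((k₀.mul (k₁.sub k₂)).div_const _)).smul k₃)
  have hall : ∀ p ∈ S ∩ {p | p.1 ∈ O}, (G p).1 ≠ 0 ∧ T p = rootOrbit m (G p).1 (G p).2 := by
    rintro p ⟨hp, hpO⟩
    rcases le_or_gt (l p.1) α' with hl | hl
    · have hmem : p ∈ S ∩ {p | p.1 ∈ O ∩ {x | l x < β}} :=
        ⟨hp, hpO, (lt_of_le_of_lt hl hα' : l p.1 < β)⟩
      rw [hGl p hp hpO hl]
      exact ⟨h₁.F_ne p hmem, h₁.eq p hmem⟩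
    rcases le_or_gt β' (l p.1) with hr | hr
    · have hmem : p ∈ S ∩ {p | p.1 ∈ O ∩ {x | α < l x}} :=
        ⟨hp, hpO, (lt_of_lt_of_le (hα.trans hβ) hr : α < l p.1)⟩
      rw [hGr p hp hpO hr]
      exact ⟨h₂.F_ne p hmem, h₂.eq p hmem⟩
    · have hmem : l p.1 ∈ Set.Ioo α β := ⟨by linarith, by linarith⟩
      have hmem' : p ∈ S ∩ {p | p.1 ∈ O ∩ {x | l x ∈ Set.Ioo α β}} := ⟨hp, hpO, hmem⟩
      rw [hGm p hmem]
      refine ⟨Complex.exp_ne_zero _, ?_⟩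
      simp only
      rw [rootOrbit_exp_smul hm, h₁.eq p (hs₁ hmem'), ← (hg p hmem').1, ← Complex.exp_add]
      congr 2
      ring
  exact ⟨fun p => (G p).1, fun p => (G p).2, hGc.fst, hGc.snd, fun p hp => (hall p hp).1,
    fun p hp => (hall p hp).2⟩

/-- A root bundle over a branched curve is the bundle of `m`-th roots of a nonvanishing function,
times a nonvanishing vector. -/
theorem BranchedCurve.exists_rootDecomp {S : Set (ℂ × ℂ)} {N : ℕ} {B : Finset ℂ}
    (hS : BranchedCurve S N B) {m : ℕ} (hm : 0 < m) {T : ℂ × ℂ → Set (ℂ × ℂ)}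
    (hT : RootBundle m S T) : ∃ F v, RootDecomp S m T Set.univ F v := by
  classical
  suffices h : ∀ (k : ℕ) (O : Set ℂ), Convex ℝ O → IsOpen O → (B.filter (· ∈ O)).card ≤ k →
      ∃ F v, RootDecomp S m T O F v from
    h _ _ convex_univ isOpen_univ le_rfl
  intro k
  induction k using Nat.strong_induction_on with
  | _ k ih =>
  intro O hO hOo hk
  rcases O.eq_empty_or_nonempty with rfl | ⟨x₀, hx₀⟩
  · exact ⟨fun _ => 0, fun _ => 0, by constructor <;> simp⟩
  by_cases htwo : ∃ b ∈ B.filter (· ∈ O), ∃ b' ∈ B.filter (· ∈ O), b ≠ b'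
  · obtain ⟨b, hb, b', hb', hne⟩ := htwo
    let l : ℂ →L[ℝ] ℝ := innerSL ℝ (b' - b)
    have hl : l b < l b' := by
      have h1 : l b' - l b = ‖b' - b‖ ^ 2 := by
        rw [← map_sub, ← real_inner_self_eq_norm_sq]; rfl
      have h2 : 0 < ‖b' - b‖ := norm_pos_iff.2 (sub_ne_zero.2 hne.symm)
      nlinarith
    have hne' : ((B.filter (· ∈ O)).filter (fun x => l b < l x)).Nonempty :=
      ⟨b', by rw [Finset.mem_filter]; exact ⟨hb', hl⟩⟩
    obtain ⟨c, hc, hcmin⟩ := Finset.exists_min_image _ l hne'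
    rw [Finset.mem_filter] at hc
    have hcard : ∀ (O' : Set ℂ) (x : ℂ), O' ⊆ O → x ∈ B.filter (· ∈ O) → x ∉ O' →
        (B.filter (· ∈ O')).card < k := fun O' x hO' hx hx' => by
      refine lt_of_lt_of_le (Finset.card_lt_card ⟨fun y hy => ?_, fun h => hx' ?_⟩) hk
      · rw [Finset.mem_filter] at hy ⊢
        exact ⟨hy.1, hO' hy.2⟩
      · exact (Finset.mem_filter.1 (h hx)).2
    obtain ⟨F₁, v₁, h₁⟩ := ih _ (hcard (O ∩ {x | l x < l c}) c Set.inter_subset_left hc.1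
      (fun h => lt_irrefl (l c) h.2)) (O ∩ {x | l x < l c})
      (hO.inter ((convex_Iio (l c)).linear_preimage l.toLinearMap))
      (hOo.inter (isOpen_Iio.preimage l.continuous)) le_rfl
    obtain ⟨F₂, v₂, h₂⟩ := ih _ (hcard (O ∩ {x | l b < l x}) b Set.inter_subset_left hb
      (fun h => lt_irrefl (l b) h.2)) (O ∩ {x | l b < l x})
      (hO.inter ((convex_Ioi (l b)).linear_preimage l.toLinearMap))
      (hOo.inter (isOpen_Ioi.preimage l.continuous)) le_rfl
    refine RootDecomp.glue hm hT hO hOo l hc.2 (fun x hx => hS.loc x fun hxB => ?_) h₁ h₂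
    exact absurd (hcmin x (by
      rw [Finset.mem_filter, Finset.mem_filter]; exact ⟨⟨hxB, hx.1⟩, hx.2.1⟩)) (not_le.2 hx.2.2)
  · push Not at htwo
    obtain ⟨b, hbO, hb⟩ : ∃ b ∈ O, ∀ x ∈ B, x ∈ O → x = b := by
      by_cases hemp : ∃ b ∈ B, b ∈ O
      · obtain ⟨b, hb, hbO⟩ := hemp
        exact ⟨b, hbO, fun x hx hxO => htwo x (by simp [hx, hxO]) b (by simp [hb, hbO])⟩
      · exact ⟨x₀, hx₀, fun x hx hxO => absurd ⟨x, hx, hxO⟩ hemp⟩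
    obtain ⟨s, hs, hsT⟩ := hS.exists_section hm hT hO hbO hb
    refine ⟨fun _ => 1, s, continuousOn_const, hs, fun _ _ => one_ne_zero, fun p hp => ?_⟩
    ext u
    rw [hT.mem_iff hm hp.1 (hsT p hp)]
    rfl

/-- The function `F` has winding number `n s` along large circles on the `s`-th end. -/
def EndWind {N : ℕ} (y : Fin N → ℂ → ℂ) (F : ℂ × ℂ → ℂ) (n : Fin N → ℤ) : Prop :=
  ∀ s, ∀ᶠ R in atTop, HasWind (fun t => F (circ 0 R t, y s (circ 0 R t))) (n s)

theorem EndWind.mul {N : ℕ} {y : Fin N → ℂ → ℂ} {F G : ℂ × ℂ → ℂ} {m n : Fin N → ℤ}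
    (hF : EndWind y F m) (hG : EndWind y G n) : EndWind y (fun p => F p * G p) (m + n) := fun s => by
  filter_upwards [hF s, hG s] with R h h' using h.mul h'

theorem EndWind.zpow {N : ℕ} {y : Fin N → ℂ → ℂ} {F : ℂ × ℂ → ℂ} {n : Fin N → ℤ}
    (hF : EndWind y F n) (k : ℤ) : EndWind y (fun p => F p ^ k) (k • n) := fun s => by
  filter_upwards [hF s] with R h using h.zpow k

theorem EndWind.prod {N : ℕ} {y : Fin N → ℂ → ℂ} {ι : Type*} (I : Finset ι) {F : ι → ℂ × ℂ → ℂ}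
    {n : ι → Fin N → ℤ} (hF : ∀ i ∈ I, EndWind y (F i) (n i)) :
    EndWind y (fun p => ∏ i ∈ I, F i p) (∑ i ∈ I, n i) := fun s => by
  have : ∀ᶠ R in atTop, ∀ i ∈ I,
      HasWind (fun t => F i (circ 0 R t, y s (circ 0 R t))) (n i s) :=
    (Finset.eventually_all I).2 fun i hi => hF i hi s
  filter_upwards [this] with R h
  rw [Finset.sum_apply]
  exact HasWind.prod I h

theorem norm_circ_zero {R : ℝ} (hR : 0 ≤ R) (t : ℝ) : ‖circ 0 R t‖ = R := by
  simpa using norm_circ_sub 0 hR t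

/-- Replace the function `q` by `k` on the `i`-th sheet over `O`. -/
noncomputable def sheetUpdate {N : ℕ} (O : Set ℂ) (r : Fin N → ℂ → ℂ) (i : Fin N) (k : ℂ → ℂ)
    (q : ℂ × ℂ → ℂ) (p : ℂ × ℂ) : ℂ :=
  open Classical in if p.1 ∈ O ∧ r i p.1 = p.2 then k p.1 else q p

namespace Sheets

variable {S : Set (ℂ × ℂ)} {N : ℕ} {O : Set ℂ} {r : Fin N → ℂ → ℂ} {i : Fin N} {k : ℂ → ℂ}
  {q : ℂ × ℂ → ℂ} {C : Set ℂ}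

theorem sheetUpdate_of_notMem (hk : ∀ x ∈ O \ C, k x = q (x, r i x)) {p : ℂ × ℂ} (hp : p.1 ∉ C) :
    sheetUpdate O r i k q p = q p := by
  unfold sheetUpdate
  split_ifs with h
  · rw [hk p.1 ⟨h.1, hp⟩, h.2]
  · rfl

theorem continuousWithinAt_sheetUpdate (h : Sheets S N O r) (hO : IsOpen O) (hC : IsClosed C)
    (hCO : C ⊆ O) (hk : ∀ x ∈ O \ C, k x = q (x, r i x)) {p : ℂ × ℂ} (hp : p ∈ S)
    (hsheet : p.1 ∈ C → r i p.1 = p.2 → ContinuousAt k p.1)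
    (hq : (p.1 ∈ C → r i p.1 ≠ p.2) → ContinuousWithinAt q S p) :
    ContinuousWithinAt (sheetUpdate O r i k q) S p := by
  classical
  by_cases hpC : p.1 ∈ C
  · obtain ⟨j, hj⟩ := (h.mem_iff p.1 (hCO hpC) p.2).1 hp
    have hev := h.eventually_eq hO (hCO hpC) hj
    by_cases hij : j = i
    · subst hij
      have h1 : ContinuousWithinAt (fun p : ℂ × ℂ => k p.1) S p :=
        (ContinuousAt.comp (f := Prod.fst) (hsheet hpC hj) continuousAt_fst).continuousWithinAt
      refine h1.congr_of_eventuallyEq ?_ (by simp [sheetUpdate, hCO hpC, hj])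
      filter_upwards [hev] with p' hp'
      simp [sheetUpdate, hp'.1, hp'.2]
    · have hne : ∀ p' : ℂ × ℂ, p'.1 ∈ O ∧ r j p'.1 = p'.2 → sheetUpdate O r i k q p' = q p' :=
        fun p' hp' => if_neg fun h' => hij (h.inj _ hp'.1 (hp'.2.trans h'.2.symm))
      refine (hq fun _ h' => hij (h.inj _ (hCO hpC) (hj.trans h'.symm))).congr_of_eventuallyEq ?_
        (hne p ⟨hCO hpC, hj⟩)
      filter_upwards [hev] with p' hp' using hne p' hp'
  · refine (hq fun h' => absurd h' hpC).congr_of_eventuallyEq ?_ (sheetUpdate_of_notMem hk hpC)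
    have : ∀ᶠ p' : ℂ × ℂ in 𝓝 p, p'.1 ∈ Cᶜ := continuousAt_fst (hC.isOpen_compl.mem_nhds hpC)
    filter_upwards [this.filter_mono nhdsWithin_le_nhds] with p' hp'
      using sheetUpdate_of_notMem hk hp'

end Sheets

/-- The function `q` is continuous and nonvanishing on `S` away from `p`, with given winding
numbers at the ends. -/
structure ZeroAt {N : ℕ} (S : Set (ℂ × ℂ)) (y : Fin N → ℂ → ℂ) (p : ℂ × ℂ) (n : Fin N → ℤ)
    (q : ℂ × ℂ → ℂ) : Prop where
  cont : ∀ p' ∈ S, p' ≠ p → ContinuousWithinAt q S p'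
  ne_zero : ∀ p' ∈ S, p' ≠ p → q p' ≠ 0
  wind : EndWind y q n

/-- Inside a disc over which `S` is a union of graphs, the zero can be moved along a sheet. -/
theorem ZeroAt.exists_move {S : Set (ℂ × ℂ)} {N : ℕ} {y : Fin N → ℂ → ℂ} {n : Fin N → ℤ}
    {O : Set ℂ} {N' : ℕ} {r : Fin N' → ℂ → ℂ} (hr : Sheets S N' O r) (hO : IsOpen O) {c c' : ℂ}
    {ε : ℝ} (hball : Metric.closedBall c ε ⊆ O) (hc : c' ∈ Metric.ball c ε) {i : Fin N'}
    {q : ℂ × ℂ → ℂ} (hq : ZeroAt S y (c', r i c') n q) :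
    ∃ q', ZeroAt S y (c, r i c) n q' := by
  have hε : 0 < ε := dist_nonneg.trans_lt hc
  set u : ℂ := (c' - c) / ε with hu
  have hεC : (ε : ℂ) ≠ 0 := by exact_mod_cast hε.ne'
  have hu1 : ‖u‖ < 1 := by
    rw [hu, norm_div, Complex.norm_real, Real.norm_of_nonneg hε.le, div_lt_one hε, ← dist_eq_norm]
    exact hc
  have hc' : c' = c + ε * u := by rw [hu]; field_simp; ring
  let h : ℂ → ℂ := fun x => x + (max 0 (ε - ‖x - c‖) : ℝ) * u
  have hcont : Continuous h := by fun_prop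
  have hfar : ∀ x ∉ Metric.closedBall c ε, h x = x := fun x hx => by
    have : ε - ‖x - c‖ ≤ 0 := by
      rw [Metric.mem_closedBall, dist_eq_norm] at hx; linarith
    simp [h, max_eq_left this]
  have hmaps : ∀ x ∈ Metric.closedBall c ε, h x ∈ Metric.closedBall c ε := fun x hx => by
    rw [Metric.mem_closedBall, dist_eq_norm] at hx ⊢
    have h0 : 0 ≤ ε - ‖x - c‖ := by linarith
    calc ‖h x - c‖ = ‖(x - c) + ((ε - ‖x - c‖ : ℝ) : ℂ) * u‖ := by
          simp only [h, max_eq_right h0]; congr 1; ring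
      _ ≤ ‖x - c‖ + (ε - ‖x - c‖) * ‖u‖ := by
          refine (norm_add_le _ _).trans_eq ?_
          rw [norm_mul, Complex.norm_real, Real.norm_of_nonneg h0]
      _ ≤ ε := by nlinarith
  have hpre : ∀ x ∈ Metric.closedBall c ε, h x = c' → x = c := fun x hx he => by
    rw [Metric.mem_closedBall, dist_eq_norm] at hx
    have h0 : 0 ≤ ε - ‖x - c‖ := by linarith
    simp only [h, max_eq_right h0, hc'] at he
    have h1 : x - c = (‖x - c‖ : ℝ) * u := by
      push_cast at he
      linear_combination he
    have h2 : ‖x - c‖ = ‖x - c‖ * ‖u‖ := by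
      conv_lhs => rw [h1]
      rw [norm_mul, Complex.norm_real, norm_norm]
    have h3 : ‖x - c‖ = 0 := by
      by_contra h3
      have : 0 < ‖x - c‖ := lt_of_le_of_ne (norm_nonneg _) (Ne.symm h3)
      nlinarith
    exact sub_eq_zero.1 (norm_eq_zero.1 h3)
  have hO' : ∀ x ∈ O, h x ∈ O := fun x hx => by
    by_cases hxb : x ∈ Metric.closedBall c ε
    · exact hball (hmaps x hxb)
    · rw [hfar x hxb]; exact hx
  let k : ℂ → ℂ := fun x => q (h x, r i (h x))
  have hk : ∀ x ∈ O \ Metric.closedBall c ε, k x = q (x, r i x) := fun x hx => by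
    simp only [k, hfar x hx.2]
  have hcen : c ∈ Metric.closedBall c ε := Metric.mem_closedBall_self hε.le
  have hne : ∀ {p : ℂ × ℂ}, p ≠ (c, r i c) → p.1 ∈ Metric.closedBall c ε → r i p.1 = p.2 →
      ((h p.1, r i (h p.1)) : ℂ × ℂ) ≠ (c', r i c') := fun {p} hp h1 h2 he =>
    hp (by
      have := hpre _ h1 (congrArg Prod.fst he)
      exact Prod.ext this (by rw [← h2, this]))
  have hne' : ∀ {p : ℂ × ℂ}, (p.1 ∈ Metric.closedBall c ε → r i p.1 ≠ p.2) →
      p ≠ (c', r i c') := fun {p} hp he =>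
    hp (by rw [he]; exact Metric.ball_subset_closedBall hc) (by rw [he])
  refine ⟨sheetUpdate O r i k q, fun p hp hpc => ?_, fun p hp hpc => ?_, fun s => ?_⟩
  · refine hr.continuousWithinAt_sheetUpdate hO Metric.isClosed_closedBall hball hk hp
      (fun h1 h2 => ?_) (fun h' => hq.cont p hp (hne' h'))
    have hmem := hO' _ (hball h1)
    have h3 := hq.cont _ (hr.mem hmem i) (hne hpc h1 h2)
    have h4 : ContinuousAt (fun x => (h x, r i (h x))) p.1 :=
      hcont.continuousAt.prodMk (ContinuousAt.comp (f := h) ((hr.cont i).continuousAt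
        (hO.mem_nhds hmem)) hcont.continuousAt)
    refine ContinuousWithinAt.tendsto h3 |>.comp (tendsto_nhdsWithin_iff.2 ⟨h4.tendsto, ?_⟩)
    filter_upwards [hO.mem_nhds (hball h1)] with x hx using hr.mem (hO' x hx) i
  · by_cases h1 : p.1 ∈ O ∧ r i p.1 = p.2
    · rw [sheetUpdate, if_pos h1]
      by_cases h2 : p.1 ∈ Metric.closedBall c ε
      · exact hq.ne_zero _ (hr.mem (hO' _ h1.1) i) (hne hpc h2 h1.2)
      · rw [hk _ ⟨h1.1, h2⟩, h1.2]
        exact hq.ne_zero _ hp (hne' fun h => absurd h h2)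
    · rw [sheetUpdate, if_neg h1]
      exact hq.ne_zero _ hp (hne' fun h h' => h1 ⟨hball h, h'⟩)
  · filter_upwards [hq.wind s, eventually_gt_atTop (‖c‖ + ε), eventually_ge_atTop 0] with R h1 h2 h3
    have h4 : ∀ t, circ 0 R t ∉ Metric.closedBall c ε := fun t ht => by
      have := norm_circ_zero h3 t
      rw [Metric.mem_closedBall, dist_eq_norm] at ht
      linarith [norm_sub_norm_le (circ 0 R t) c]
    convert h1 using 2 with t
    exact Sheets.sheetUpdate_of_notMem hk (h4 t)

namespace BranchedCurve

variable {S : Set (ℂ × ℂ)} {N : ℕ} {B : Finset ℂ}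

/-- The zero can be moved anywhere in the unbranched part, if that is connected. -/
theorem exists_zeroAt_of_preconnected (hS : BranchedCurve S N B)
    (hconn : IsPreconnected (S ∩ {p | p.1 ∉ B})) {y : Fin N → ℂ → ℂ} {n : Fin N → ℤ}
    {p p' : ℂ × ℂ} (hp : p ∈ S ∩ {p | p.1 ∉ B}) (hp' : p' ∈ S ∩ {p | p.1 ∉ B})
    (h : ∃ q, ZeroAt S y p n q) : ∃ q, ZeroAt S y p' n q := by
  refine hconn.induction₂' (fun p p' => (∃ q, ZeroAt S y p n q) → ∃ q, ZeroAt S y p' n q)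
    (fun p hp => ?_) (fun _ _ _ _ _ _ h h' h'' => h' (h h'')) hp hp' h
  obtain ⟨U, hU, hpU, r, hr⟩ := hS.loc p.1 hp.2
  obtain ⟨i, hi⟩ := (hr.mem_iff _ hpU _).1 hp.1
  obtain ⟨ε, hε, hball⟩ := Metric.isOpen_iff.1 hU p.1 hpU
  have h1 : ∀ᶠ p' : ℂ × ℂ in 𝓝 p, p'.1 ∈ Metric.ball p.1 (ε / 4) :=
    continuousAt_fst (Metric.ball_mem_nhds _ (by positivity))
  have h2 := (hr.eventually_eq hU hpU hi).filter_mono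
    (nhdsWithin_mono p (Set.inter_subset_left (t := {p : ℂ × ℂ | p.1 ∉ B})))
  filter_upwards [h1.filter_mono nhdsWithin_le_nhds, h2] with p' hp' hri
  have hsub : Metric.closedBall p.1 (ε / 4) ⊆ U := fun x hx => hball (by
    rw [Metric.mem_closedBall] at hx; rw [Metric.mem_ball]; linarith)
  have hsub' : Metric.closedBall p'.1 (ε / 4) ⊆ U := fun x hx => hball (by
    rw [Metric.mem_closedBall] at hx; rw [Metric.mem_ball] at hp' ⊢
    linarith [dist_triangle x p'.1 p.1])
  constructor
  · rintro ⟨q, hq⟩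
    rw [show p = (p.1, r i p.1) by rw [hi]] at hq
    obtain ⟨q', h'⟩ := hq.exists_move hr hU hsub' (Metric.mem_ball_comm.1 hp')
    exact ⟨q', by rwa [hri.2] at h'⟩
  · rintro ⟨q, hq⟩
    rw [show p' = (p'.1, r i p'.1) by rw [hri.2]] at hq
    obtain ⟨q', h'⟩ := hq.exists_move hr hU hsub hp'
    exact ⟨q', by rwa [hi] at h'⟩

end BranchedCurve

theorem ramp_nonneg (a b s : ℝ) : 0 ≤ ramp a b s := le_max_left _ _

theorem ramp_le_one (a b s : ℝ) : ramp a b s ≤ 1 := max_le zero_le_one (min_le_left _ _)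

namespace CurveEnds

variable {S : Set (ℂ × ℂ)} {N : ℕ} {B : Finset ℂ} {ρ : ℝ} {y : Fin N → ℂ → ℂ}

theorem isOpen_ends (ρ : ℝ) : IsOpen {x : ℂ | ρ < ‖x‖} := isOpen_lt continuous_const continuous_norm

theorem isClosed_ends (R : ℝ) : IsClosed {x : ℂ | R ≤ ‖x‖} :=
  isClosed_le continuous_const continuous_norm

theorem sheetUpdate_apply (hy : CurveEnds S N B ρ y) {s s' : Fin N} {k : ℂ → ℂ} {q : ℂ × ℂ → ℂ}
    {x : ℂ} (hx : ρ < ‖x‖) : sheetUpdate {x | ρ < ‖x‖} y s k q (x, y s' x) =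
      if s' = s then k x else q (x, y s' x) := by
  unfold sheetUpdate
  by_cases h : s' = s
  · subst h; simp [hx]
  · rw [if_neg h, if_neg fun h' => h (hy.sheets.inj x hx h'.2.symm)]

/-- On a single end there is a function with a simple zero on that end. -/
theorem exists_zeroAt (hy : CurveEnds S N B ρ y) (s : Fin N) :
    ∃ q, ZeroAt S y (((ρ + 2 : ℝ) : ℂ), y s ((ρ + 2 : ℝ) : ℂ)) (Pi.single s 1) q := by
  have hρ := hy.pos
  set a : ℂ := ((ρ + 2 : ℝ) : ℂ) with ha
  have ha0 : a ≠ 0 := by rw [ha]; exact_mod_cast (by linarith : ρ + 2 ≠ 0)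
  have hna : ‖a‖ = ρ + 2 := by rw [ha, Complex.norm_real, Real.norm_of_nonneg (by linarith)]
  let k : ℂ → ℂ := fun x => 1 - (ramp (ρ + 1) (ρ + 2) ‖x‖ : ℝ) * x / a
  have hkc : Continuous k := by
    have := continuous_ramp (ρ + 1) (ρ + 2)
    fun_prop
  have hk0 : ∀ x, x ≠ a → k x ≠ 0 := fun x hx h0 => by
    have h1 : (ramp (ρ + 1) (ρ + 2) ‖x‖ : ℝ) * x = a := by
      have : (ramp (ρ + 1) (ρ + 2) ‖x‖ : ℝ) * x / a = 1 := (sub_eq_zero.1 h0).symm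
      rwa [div_eq_one_iff_eq ha0] at this
    rcases lt_or_ge ‖x‖ (ρ + 2) with h2 | h2
    · have h3 := congrArg norm h1
      rw [norm_mul, Complex.norm_real, Real.norm_of_nonneg (ramp_nonneg _ _ _), hna] at h3
      nlinarith [ramp_le_one (ρ + 1) (ρ + 2) ‖x‖, norm_nonneg x]
    · rw [ramp_of_ge (by linarith) h2] at h1
      exact hx (by simpa using h1)
  have hk : ∀ x ∈ {x : ℂ | ρ < ‖x‖} \ {x | ρ + 1 ≤ ‖x‖},
      k x = (fun _ : ℂ × ℂ => (1 : ℂ)) (x, y s x) := fun x hx => by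
    have : ‖x‖ ≤ ρ + 1 := (not_le.1 hx.2).le
    simp [k, ramp_of_le (by linarith : ρ + 1 < ρ + 2) this]
  refine ⟨sheetUpdate {x | ρ < ‖x‖} y s k fun _ => 1, fun p hp _ => ?_, fun p hp hpa => ?_,
    fun s' => ?_⟩
  · exact hy.sheets.continuousWithinAt_sheetUpdate (isOpen_ends ρ) (isClosed_ends (ρ + 1))
      (fun x (hx : ρ + 1 ≤ ‖x‖) => by simp only [Set.mem_ofPred_eq]; linarith) hk hp
      (fun _ _ => hkc.continuousAt) fun _ => continuousWithinAt_const
  · unfold sheetUpdate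
    split_ifs with h
    · exact hk0 _ fun he => hpa (Prod.ext he (by rw [← h.2, he]))
    · exact one_ne_zero
  · filter_upwards [eventually_gt_atTop (ρ + 2)] with R hR
    have hn : ∀ t, ‖circ 0 R t‖ = R := norm_circ_zero (by linarith)
    have hev : ∀ t, sheetUpdate {x | ρ < ‖x‖} y s k (fun _ => 1) (circ 0 R t, y s' (circ 0 R t)) =
        if s' = s then k (circ 0 R t) else 1 := fun t =>
      hy.sheetUpdate_apply (by rw [hn]; linarith)
    simp only [hev]
    by_cases hs : s' = s
    · subst hs
      simp only [if_true, Pi.single_eq_same]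
      have h1 := (hasWind_circ_sub (c := 0) (a := a) (r := R) (by simpa [hna] using hR)).mul
        (HasWind.const (c := -a⁻¹) (by simpa using ha0))
      rw [add_zero] at h1
      convert h1 using 2 with t
      simp only [k, hn, ramp_of_ge (by linarith : ρ + 1 < ρ + 2) hR.le]
      field_simp
      push_cast
      ring
    · simp only [hs, if_false, Pi.single_eq_of_ne hs]
      exact HasWind.const one_ne_zero

/-- A zero on an end can be pushed to infinity, changing the winding number of that end only. -/
theorem exists_push (hy : CurveEnds S N B ρ y) {n : Fin N → ℤ} (s : Fin N) {q : ℂ × ℂ → ℂ}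
    (hq : ZeroAt S y (((ρ + 2 : ℝ) : ℂ), y s ((ρ + 2 : ℝ) : ℂ)) n q) :
    ∃ q' : ℂ × ℂ → ℂ, ContinuousOn q' S ∧ (∀ p ∈ S, q' p ≠ 0) ∧
      ∃ l, EndWind y q' (Function.update n s l) := by
  have hρ := hy.pos
  set a : ℂ := ((ρ + 2 : ℝ) : ℂ) with ha
  have hna : ‖a‖ = ρ + 2 := by rw [ha, Complex.norm_real, Real.norm_of_nonneg (by linarith)]
  let h : ℂ → ℂ := fun x => ((ρ + 1) / max (ρ + 1) ‖x‖ : ℝ) * x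
  have hmax : ∀ x : ℂ, max (ρ + 1) ‖x‖ ≠ 0 := fun x =>
    (lt_of_lt_of_le (by linarith) (le_max_left _ _)).ne'
  have hc : Continuous h := by
    have : Continuous fun x : ℂ => (ρ + 1) / max (ρ + 1) ‖x‖ :=
      continuous_const.div (by fun_prop) hmax
    fun_prop
  have hnear : ∀ x : ℂ, ‖x‖ ≤ ρ + 1 → h x = x := fun x hx => by
    simp only [h, max_eq_left hx, div_self (by linarith : ρ + 1 ≠ 0)]; simp
  have hfar : ∀ x : ℂ, ρ + 1 ≤ ‖x‖ → ‖h x‖ = ρ + 1 := fun x hx => by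
    have : ‖x‖ ≠ 0 := by linarith
    simp only [h, max_eq_right hx]
    rw [norm_mul, Complex.norm_real, Real.norm_of_nonneg (by positivity)]
    field_simp
  have hO : ∀ x : ℂ, ρ < ‖x‖ → ρ < ‖h x‖ ∧ ‖h x‖ < ρ + 2 := fun x hx => by
    rcases le_total ‖x‖ (ρ + 1) with h1 | h1
    · rw [hnear x h1]; exact ⟨hx, by linarith⟩
    · rw [hfar x h1]; exact ⟨by linarith, by linarith⟩
  let k : ℂ → ℂ := fun x => q (h x, y s (h x))
  have hk : ∀ x ∈ {x : ℂ | ρ < ‖x‖} \ {x | ρ + 1 ≤ ‖x‖}, k x = q (x, y s x) := fun x hx => by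
    simp only [k, hnear x (not_le.1 hx.2).le]
  have hne : ∀ x : ℂ, ρ < ‖x‖ → ((h x, y s (h x)) : ℂ × ℂ) ≠ (a, y s a) := fun x hx he => by
    have := (hO x hx).2
    rw [show h x = a from congrArg Prod.fst he, hna] at this
    exact lt_irrefl _ this
  have hne' : ∀ {p : ℂ × ℂ}, (p.1 ∈ {x : ℂ | ρ + 1 ≤ ‖x‖} → y s p.1 ≠ p.2) → p ≠ (a, y s a) :=
    fun {p} hp he => hp (by rw [he]; simp only [Set.mem_ofPred_eq, hna]; linarith) (by rw [he])
  have hkc : ∀ x : ℂ, ρ < ‖x‖ → ContinuousAt k x := fun x hx => by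
    have h3 := hq.cont _ (hy.sheets.mem (hO x hx).1 s) (hne x hx)
    have h4 : ContinuousAt (fun x => (h x, y s (h x))) x :=
      hc.continuousAt.prodMk (ContinuousAt.comp (f := h) ((hy.sheets.cont s).continuousAt
        ((isOpen_ends ρ).mem_nhds (hO x hx).1)) hc.continuousAt)
    refine ContinuousWithinAt.tendsto h3 |>.comp (tendsto_nhdsWithin_iff.2 ⟨h4.tendsto, ?_⟩)
    filter_upwards [(isOpen_ends ρ).mem_nhds hx] with x hx using hy.sheets.mem (hO x hx).1 s
  have hk0 : ∀ x : ℂ, ρ < ‖x‖ → k x ≠ 0 := fun x hx =>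
    hq.ne_zero _ (hy.sheets.mem (hO x hx).1 s) (hne x hx)
  have hcirc : ∀ {R}, ρ + 1 ≤ R → ∀ t, h (circ 0 R t) = circ 0 (ρ + 1) t := fun {R} hR t => by
    have hR0 : (R : ℂ) ≠ 0 := by exact_mod_cast (by linarith : R ≠ 0)
    simp only [h]
    rw [norm_circ_zero (by linarith : 0 ≤ R), max_eq_right hR]
    simp only [circ]
    push_cast
    field_simp
    ring
  have hn : ∀ t, ‖circ 0 (ρ + 1) t‖ = ρ + 1 := norm_circ_zero (by linarith)
  obtain ⟨l, hl⟩ := exists_hasWind (γ := fun t => k (circ 0 (ρ + 1) t))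
    (continuous_iff_continuousAt.2 fun t => ContinuousAt.comp (f := circ 0 (ρ + 1))
      (hkc _ (by rw [hn]; linarith)) (continuous_circ _ _).continuousAt)
    (fun t => hk0 _ (by rw [hn]; linarith)) (by rw [circ_one])
  refine ⟨sheetUpdate {x | ρ < ‖x‖} y s k q, fun p hp => ?_, fun p hp => ?_, l, fun s' => ?_⟩
  · exact hy.sheets.continuousWithinAt_sheetUpdate (isOpen_ends ρ) (isClosed_ends (ρ + 1))
      (fun x (hx : ρ + 1 ≤ ‖x‖) => by simp only [Set.mem_ofPred_eq]; linarith) hk hp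
      (fun h1 _ => hkc _ (by simp only [Set.mem_ofPred_eq] at h1; linarith))
      fun h' => hq.cont p hp (hne' h')
  · by_cases h1 : p.1 ∈ {x : ℂ | ρ < ‖x‖} ∧ y s p.1 = p.2
    · rw [sheetUpdate, if_pos h1]
      exact hk0 _ h1.1
    · rw [sheetUpdate, if_neg h1]
      exact hq.ne_zero _ hp (hne' fun h h' => h1 ⟨by
        simp only [Set.mem_ofPred_eq] at h ⊢; linarith, h'⟩)
  · filter_upwards [hq.wind s', eventually_gt_atTop (ρ + 1)] with R hw hR
    have hnR : ∀ t, ‖circ 0 R t‖ = R := norm_circ_zero (by linarith)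
    have hev : ∀ t, sheetUpdate {x | ρ < ‖x‖} y s k q (circ 0 R t, y s' (circ 0 R t)) =
        if s' = s then k (circ 0 R t) else q (circ 0 R t, y s' (circ 0 R t)) := fun t =>
      hy.sheetUpdate_apply (by rw [hnR]; linarith)
    simp only [hev]
    by_cases hs : s' = s
    · subst hs
      simp only [if_true, Function.update_self]
      convert hl using 2 with t
      simp only [k, hcirc hR.le, hnear _ (hn t).le]
    · simpa only [hs, if_false, Function.update_of_ne hs] using hw

end CurveEnds

namespace BranchedCurve

variable {S : Set (ℂ × ℂ)} {N : ℕ} {B : Finset ℂ} {ρ : ℝ} {y : Fin N → ℂ → ℂ}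

theorem sum_endWind_eq_zero (hS : BranchedCurve S N B) (hy : CurveEnds S N B ρ y)
    {F : ℂ × ℂ → ℂ} (hF : ContinuousOn F S) (h0 : ∀ p ∈ S, F p ≠ 0) {n : Fin N → ℤ}
    (hn : EndWind y F n) : ∑ i, n i = 0 := by
  obtain ⟨R, hR, hR'⟩ := ((eventually_all.2 hn).and (eventually_gt_atTop ρ)).exists
  exact hS.sum_wind_eq_zero hy hF h0 hR' hR

/-- On a curve with connected unbranched part, every system of winding numbers at the ends with
sum zero is realized by a nonvanishing function. -/
theorem exists_endWind (hS : BranchedCurve S N B) (hy : CurveEnds S N B ρ y)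
    (hconn : IsPreconnected (S ∩ {p | p.1 ∉ B})) {n : Fin N → ℤ} (hn : ∑ i, n i = 0) :
    ∃ q : ℂ × ℂ → ℂ, ContinuousOn q S ∧ (∀ p ∈ S, q p ≠ 0) ∧ EndWind y q n := by
  rcases Nat.eq_zero_or_pos N with rfl | hN
  · exact ⟨fun _ => 1, continuousOn_const, fun _ _ => one_ne_zero, fun s => s.elim0⟩
  let s₀ : Fin N := ⟨0, hN⟩
  set a : ℂ := ((ρ + 2 : ℝ) : ℂ) with ha
  have hρ := hy.pos
  have hna : ‖a‖ = ρ + 2 := by rw [ha, Complex.norm_real, Real.norm_of_nonneg (by linarith)]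
  have hmem : ∀ s, (a, y s a) ∈ S ∩ {p | p.1 ∉ B} := fun s =>
    ⟨hy.sheets.mem (by simp only [Set.mem_ofPred_eq]; linarith) s, fun h => by
      have := hy.branch _ h; simp only at this; linarith⟩
  have key : ∀ s, ∃ q : ℂ × ℂ → ℂ, ContinuousOn q S ∧ (∀ p ∈ S, q p ≠ 0) ∧
      EndWind y q (Pi.single s 1 - Pi.single s₀ 1) := fun s => by
    by_cases hs : s = s₀
    · refine ⟨fun _ => 1, continuousOn_const, fun _ _ => one_ne_zero, fun s' => ?_⟩
      rw [hs, sub_self]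
      exact Eventually.of_forall fun _ => HasWind.const one_ne_zero
    obtain ⟨q, hq⟩ := hS.exists_zeroAt_of_preconnected hconn (hmem s) (hmem s₀)
      (hy.exists_zeroAt s)
    obtain ⟨q', hq', hq0, l, hl⟩ := hy.exists_push s₀ hq
    refine ⟨q', hq', hq0, ?_⟩
    have hsum := hS.sum_endWind_eq_zero hy hq' hq0 hl
    have hone : ∑ x ∈ Finset.univ \ {s₀}, (Pi.single s 1 : Fin N → ℤ) x = 1 := by
      simp [Pi.single_apply, hs]
    rw [Finset.sum_update_of_mem (Finset.mem_univ _), hone] at hsum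
    convert hl using 1
    ext s'
    by_cases hs' : s' = s₀
    · subst hs'
      rw [Function.update_self, Pi.sub_apply, Pi.single_eq_same, Pi.single_eq_of_ne (Ne.symm hs)]
      linarith
    · simp [Function.update_of_ne hs', Pi.single_eq_of_ne hs']
  choose q hqc hq0 hqw using key
  refine ⟨fun p => ∏ s, q s p ^ n s, continuousOn_finsetProd _ fun s _ =>
    (hqc s).zpow₀ _ fun p hp => Or.inl (hq0 s p hp), fun p hp =>
    Finset.prod_ne_zero_iff.2 fun s _ => zpow_ne_zero _ (hq0 s p hp), ?_⟩
  convert EndWind.prod Finset.univ fun s _ => (hqw s).zpow (n s) using 1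
  simp only [smul_sub, Finset.sum_sub_distrib, ← Finset.sum_smul, hn, zero_smul, sub_zero]
  ext s'
  simp [Finset.sum_apply, Pi.single_apply]

end BranchedCurve

/-- On each end of a curve, a nonvanishing function is a power of the coordinate times an
exponential. -/
theorem CurveEnds.exists_zpow_mul_exp {S : Set (ℂ × ℂ)} {N : ℕ} {B : Finset ℂ} {ρ : ℝ}
    {y : Fin N → ℂ → ℂ} (hy : CurveEnds S N B ρ y) {F : ℂ × ℂ → ℂ} (hF : ContinuousOn F S)
    (h0 : ∀ p ∈ S, F p ≠ 0) (s : Fin N) : ∃ (k : ℤ) (g : ℂ → ℂ), ContinuousOn g {x | ρ < ‖x‖} ∧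
      (∀ x, ρ < ‖x‖ → F (x, y s x) = x ^ k * Complex.exp (g x)) ∧
      ∀ R, ρ < R → HasWind (fun t => F (circ 0 R t, y s (circ 0 R t))) k := by
  have hann : {x : ℂ | x - 0 ∈ annulus (Set.Ioi ρ)} = {x : ℂ | ρ < ‖x‖} := by
    ext x
    simp only [annulus, sub_zero, Set.mem_ofPred_eq, Set.mem_Ioi, and_iff_right_iff_imp]
    intro hx h
    simp only [h, norm_zero] at hx
    exact lt_asymm hx hy.pos
  obtain ⟨k, g, hg, h⟩ := exists_sub_zpow_mul_exp 0 (Set.ordConnected_Ioi (a := ρ))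
    (G := fun x => F (x, y s x))
    (by rw [hann]; exact (hF.mono Set.inter_subset_left).of_sheets hy.sheets s)
    (fun x hx => h0 _ (hy.sheets.mem (hann.subset hx) s))
  rw [hann] at hg
  have h' : ∀ x, ρ < ‖x‖ → F (x, y s x) = x ^ k * Complex.exp (g x) := fun x hx => by
    simpa using h x (hann.symm.subset hx)
  refine ⟨k, g, hg, h', fun R hR => ?_⟩
  have hn : ∀ t, ρ < ‖circ 0 R t‖ := fun t => by rwa [norm_circ_zero (hy.pos.trans hR).le]
  have h1 := (hasWind_circ_sub_self 0 (hy.pos.trans hR)).zpow_mul_exp k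
    (g := fun t => g (circ 0 R t)) (hg.comp_continuous (continuous_circ _ _) hn) (by rw [circ_one])
  simpa only [sub_zero, mul_one, ← h' _ (hn _)] using h1

/-- A nonvanishing function on a curve can be multiplied by an exponential so as to become a power
of the coordinate on each end. -/
theorem CurveEnds.exists_normalize {S : Set (ℂ × ℂ)} {N : ℕ} {B : Finset ℂ} {ρ : ℝ}
    {y : Fin N → ℂ → ℂ} (hy : CurveEnds S N B ρ y) {F : ℂ × ℂ → ℂ} (hF : ContinuousOn F S)
    (h0 : ∀ p ∈ S, F p ≠ 0) {n : Fin N → ℤ} (hn : EndWind y F n) :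
    ∃ E : ℂ × ℂ → ℂ, ContinuousOn E S ∧
      ∀ s x, ρ + 2 ≤ ‖x‖ → F (x, y s x) * Complex.exp (E (x, y s x)) = x ^ n s := by
  classical
  have key : ∀ s, ∃ g : ℂ → ℂ, ContinuousOn g {x | ρ < ‖x‖} ∧
      ∀ x, ρ < ‖x‖ → F (x, y s x) = x ^ n s * Complex.exp (g x) := fun s => by
    obtain ⟨k, g, hg, h', hw⟩ := hy.exists_zpow_mul_exp hF h0 s
    obtain ⟨R, hR, hR'⟩ := ((hn s).and (eventually_gt_atTop ρ)).exists
    rw [hR.unique (hw R hR')]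
    exact ⟨g, hg, h'⟩
  choose g hg hgF using key
  let E : ℂ × ℂ → ℂ := fun p => if ρ < ‖p.1‖ then
    ∑ s, if y s p.1 = p.2 then -((ramp (ρ + 1) (ρ + 2) ‖p.1‖ : ℝ) * g s p.1) else 0 else 0
  have hE : ∀ s x, ρ < ‖x‖ → E (x, y s x) = -((ramp (ρ + 1) (ρ + 2) ‖x‖ : ℝ) * g s x) :=
    fun s x hx => by
      simp only [E, hx, if_true]
      rw [Finset.sum_eq_single s]
      · simp
      · exact fun s' _ hs => if_neg fun h => hs (hy.sheets.inj x hx h)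
      · simp
  have hr := continuous_ramp (ρ + 1) (ρ + 2)
  have hE1 : ContinuousOn E (S ∩ {p | p.1 ∈ {x : ℂ | ρ < ‖x‖}}) := by
    refine hy.sheets.continuousOn (isOpen_ends ρ) fun s => ?_
    have : ContinuousOn (fun x => -((ramp (ρ + 1) (ρ + 2) ‖x‖ : ℝ) * g s x)) {x : ℂ | ρ < ‖x‖} :=
      (ContinuousOn.mul (by fun_prop) (hg s)).neg
    exact this.congr fun x hx => hE s x hx
  refine ⟨E, fun p hp => ?_, fun s x hx => ?_⟩
  · rcases lt_or_ge ρ ‖p.1‖ with h1 | h1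
    · have hU : {p : ℂ × ℂ | p.1 ∈ {x : ℂ | ρ < ‖x‖}} ∈ 𝓝 p :=
        continuousAt_fst ((isOpen_ends ρ).mem_nhds h1)
      exact (continuousWithinAt_inter hU).1 (hE1 p ⟨hp, h1⟩)
    · have hU : ∀ᶠ p' : ℂ × ℂ in 𝓝 p, ‖p'.1‖ < ρ + 1 :=
        (continuous_fst.norm.continuousAt).eventually_lt_const (by linarith)
      have hz : ∀ p' ∈ S, ‖p'.1‖ < ρ + 1 → E p' = 0 := fun p' hp' h => by
        rcases lt_or_ge ρ ‖p'.1‖ with h2 | h2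
        · obtain ⟨s, hs⟩ := (hy.sheets.mem_iff p'.1 h2 p'.2).1 hp'
          have := hE s p'.1 h2
          rw [hs] at this
          rw [show p' = (p'.1, p'.2) from rfl, this, ramp_of_le (by linarith) h.le]
          simp
        · exact if_neg (not_lt.2 h2)
      refine (continuousWithinAt_const (b := (0 : ℂ))).congr_of_eventuallyEq ?_
        (hz p hp (by linarith))
      filter_upwards [hU.filter_mono nhdsWithin_le_nhds, self_mem_nhdsWithin] with p' h h'
        using hz p' h' h
  · have hx' : ρ < ‖x‖ := by linarith
    rw [hE s x hx', hgF s x hx', ramp_of_ge (by linarith) hx, mul_assoc, ← Complex.exp_add]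
    simp

section Holonomy

variable {V : Type*} {m : ℕ} {Z : Set V} {T : V → Set (ℂ × ℂ)} {c : ℝ → V} {h h' : ℤ}

/-- The root of unity with index `h`. -/
noncomputable def rootUnit (m : ℕ) (h : ℤ) : ℂ := Complex.exp (2 * Real.pi * Complex.I * h / m)

theorem rootUnit_add (m : ℕ) (h k : ℤ) : rootUnit m (h + k) = rootUnit m h * rootUnit m k := by
  rw [rootUnit, rootUnit, rootUnit, ← Complex.exp_add]
  congr 1
  push_cast
  ring

theorem rootUnit_mul (m : ℕ) (h k : ℤ) : rootUnit m (k * h) = rootUnit m h ^ k := by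
  rw [rootUnit, rootUnit, ← Complex.exp_int_mul]
  congr 1
  push_cast
  ring

theorem rootUnit_ne_zero (m : ℕ) (h : ℤ) : rootUnit m h ≠ 0 := Complex.exp_ne_zero _

theorem rootUnit_eq_iff (hm : 0 < m) {h h' : ℤ} :
    rootUnit m h = rootUnit m h' ↔ h ≡ h' [ZMOD m] := by
  have hm' : (m : ℂ) ≠ 0 := by exact_mod_cast hm.ne'
  rw [rootUnit, rootUnit, Complex.exp_eq_exp_iff_exists_int, Int.modEq_comm, Int.modEq_iff_dvd]
  refine exists_congr fun n => ?_
  have h2 := Complex.two_pi_I_ne_zero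
  constructor
  · intro e
    have : (2 * Real.pi * Complex.I) * (h : ℂ) = (2 * Real.pi * Complex.I) * (h' + m * n) := by
      field_simp at e ⊢
      linear_combination e
    have := mul_left_cancel₀ h2 this
    have : h = h' + m * n := by exact_mod_cast this
    linarith
  · intro e
    have : h = h' + m * n := by linarith
    rw [this]
    push_cast
    field_simp

theorem exists_rootUnit (hm : 0 < m) {ζ : ℂ} (hζ : ζ ^ m = 1) : ∃ h, ζ = rootUnit m h := by
  have : NeZero m := ⟨hm.ne'⟩
  obtain ⟨i, -, hi⟩ := (Complex.isPrimitiveRoot_exp m hm.ne').eq_pow_of_pow_eq_one hζ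
  refine ⟨i, ?_⟩
  rw [← hi, rootUnit, ← Complex.exp_nat_mul]
  congr 1
  push_cast
  ring

/-- The bundle `T` has holonomy `h` along the loop `c`. -/
def HasHol (m : ℕ) (T : V → Set (ℂ × ℂ)) (c : ℝ → V) (h : ℤ) : Prop :=
  ∃ θ : ℝ → ℂ × ℂ, Continuous θ ∧ (∀ t, θ t ∈ T (c t)) ∧ θ 1 = rootUnit m h • θ 0

theorem HasHol.congr (hm : 0 < m) (hh : HasHol m T c h) (e : h ≡ h' [ZMOD m]) :
    HasHol m T c h' := by
  obtain ⟨θ, h1, h2, h3⟩ := hh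
  exact ⟨θ, h1, h2, by rw [h3, (rootUnit_eq_iff hm).2 e]⟩

/-- A bundle of roots of a function has as holonomy the winding number of the function. -/
theorem HasWind.hasHol (hm : 0 < m) {F : V → ℂ} {v : V → ℂ × ℂ} (hv : Continuous fun t => v (c t))
    (hcl : c 1 = c 0) (hT : ∀ t, T (c t) = rootOrbit m (F (c t)) (v (c t)))
    (hw : HasWind (fun t => F (c t)) h) : HasHol m T c h := by
  obtain ⟨g, hg, hge, hg1⟩ := hw
  refine ⟨fun t => Complex.exp (g t / m) • v (c t), (hg.div_const _).cexp.smul hv,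
    fun t => ?_, ?_⟩
  · rw [hT, show F (c t) = Complex.exp (g t) from (hge t).symm]
    exact exp_div_smul_mem_rootOrbit hm _ _
  · simp only
    rw [hcl, hg1, smul_smul, rootUnit, ← Complex.exp_add]
    congr 2
    ring

variable [TopologicalSpace V]

theorem HasHol.unique (hm : 0 < m) (hT : RootBundle m Z T) (hc : Continuous c)
    (hcZ : ∀ t, c t ∈ Z) (hh : HasHol m T c h) (hh' : HasHol m T c h') : h ≡ h' [ZMOD m] := by
  obtain ⟨θ, h1, h2, h3⟩ := hh
  obtain ⟨θ', h1', h2', h3'⟩ := hh'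
  have hT' : RootBundle m Set.univ (T ∘ c) := hT.comp hc.continuousOn fun t _ => hcZ t
  obtain ⟨ζ, hζ, hs⟩ := hT'.section_unique hm isPreconnected_univ h1.continuousOn
    (fun t _ => h2 t) h1'.continuousOn fun t _ => h2' t
  have hζ0 : ζ ≠ 0 := fun h => by simp [h, hm.ne'] at hζ
  have hθ0 : θ 0 ≠ 0 := hT'.ne_zero hm trivial (h2 0)
  rw [hs 1 trivial, hs 0 trivial, h3, smul_smul, smul_smul] at h3'
  have := smul_left_injective ℂ hθ0 h3'
  rw [← rootUnit_eq_iff hm]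
  exact mul_left_cancel₀ hζ0 (this.trans (mul_comm _ _))

/-- The holonomy is trivial along a loop inside a convex set. -/
theorem HasHol.of_convex (hm : 0 < m) (hT : RootBundle m Z T) {F : Type*} [NormedAddCommGroup F]
    [NormedSpace ℝ F] {C : Set F} (hC : Convex ℝ C) {f : F → V} (hf : ContinuousOn f C)
    (hfZ : ∀ x ∈ C, f x ∈ Z) {b : ℝ → F} (hb : Continuous b) (hbC : ∀ t, b t ∈ C)
    (hcl : b 1 = b 0) : HasHol m T (fun t => f (b t)) 0 := by
  obtain ⟨s, hs, hsT⟩ := (hT.comp hf hfZ).exists_section_of_convex hm hC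
  exact ⟨fun t => s (b t), hs.comp_continuous hb hbC, fun t => hsT _ (hbC t), by
    simp [hcl, rootUnit]⟩

end Holonomy

section Orbit

variable {V : Type*} [TopologicalSpace V] [AddCommGroup V] [Module ℂ V] [ContinuousSMul ℂ V]
  {m : ℕ} {Z : Set V} {T : V → Set (ℂ × ℂ)}

/-- The circle orbit of a point of a cone. -/
noncomputable def orbit (p : V) (t : ℝ) : V := Complex.exp (2 * Real.pi * Complex.I * t) • p

@[fun_prop]
theorem continuous_orbit (p : V) : Continuous (orbit p) := by
  unfold orbit; fun_prop

/-- On a complex cone, the holonomy along a product of a loop of scalars and a loop. -/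
theorem HasHol.smul (hm : 0 < m) (hT : RootBundle m Z T) (hZ : ∀ c : ℂ, c ≠ 0 → ∀ p ∈ Z, c • p ∈ Z)
    {b : ℝ → V} (hb : Continuous b) (hbZ : ∀ t, b t ∈ Z) (hcl : b 1 = b 0) {h k l : ℤ}
    (hh : HasHol m T b h) (hk : HasHol m T (orbit (b 0)) k) {c : ℝ → ℂ} (hc : HasWind c l) :
    HasHol m T (fun t => c t • b t) (h + l * k) := by
  have hmem : ∀ q : ℂ × ℝ, Complex.exp q.1 • b q.2 ∈ Z := fun q =>
    hZ _ (Complex.exp_ne_zero _) _ (hbZ _)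
  have hT' : RootBundle m Set.univ (T ∘ fun q : ℂ × ℝ => Complex.exp q.1 • b q.2) :=
    hT.comp (by fun_prop) fun q _ => hmem q
  obtain ⟨θ, hθ, hθT⟩ := hT'.exists_section_of_convex hm convex_univ
  rw [continuousOn_univ] at hθ
  have hθT' : ∀ x t, θ (x, t) ∈ T (Complex.exp x • b t) := fun x t => hθT (x, t) trivial
  obtain ⟨ζ₁, hζ₁, h1⟩ := hT'.section_unique hm isPreconnected_univ hθ.continuousOn hθT
    (s' := fun q => θ (q.1 + 2 * Real.pi * Complex.I, q.2)) (by fun_prop) (fun q _ => by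
      have := hθT' (q.1 + 2 * Real.pi * Complex.I) q.2
      rwa [Complex.exp_periodic] at this)
  have hT₀ : RootBundle m Set.univ (T ∘ fun x : ℂ => Complex.exp x • b 0) :=
    hT.comp (by fun_prop) fun x _ => hmem (x, 0)
  obtain ⟨ζ₂, hζ₂, h2⟩ := hT₀.section_unique hm isPreconnected_univ
    (s := fun x => θ (x, 0)) (by fun_prop) (fun x _ => hθT' x 0) (s' := fun x => θ (x, 1))
    (by fun_prop) (fun x _ => by have := hθT' x 1; rwa [hcl] at this)
  obtain ⟨k', rfl⟩ := exists_rootUnit hm hζ₁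
  obtain ⟨h', rfl⟩ := exists_rootUnit hm hζ₂
  have hh' : HasHol m T b h' := ⟨fun t => θ (0, t), by fun_prop, fun t => by
    simpa using hθT' 0 t, h2 0 trivial⟩
  have hk' : HasHol m T (orbit (b 0)) k' := ⟨fun t => θ (2 * Real.pi * Complex.I * t, 0),
    by fun_prop, fun t => hθT' _ _, by simpa using h1 (0, 0) trivial⟩
  have e1 : h' ≡ h [ZMOD m] := hh'.unique hm hT hb hbZ hh
  have e2 : k' ≡ k [ZMOD m] := hk'.unique hm hT (continuous_orbit _)
    (fun t => hZ _ (Complex.exp_ne_zero _) _ (hbZ 0)) hk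
  refine HasHol.congr hm ?_ (e1.add (e2.mul_left l))
  obtain ⟨g, hg, hge, hg1⟩ := hc
  have hiter : ∀ (l : ℤ) (x : ℂ) (t : ℝ),
      θ (x + l * (2 * Real.pi * Complex.I), t) = rootUnit m k' ^ l • θ (x, t) := by
    intro l
    induction l using Int.induction_on with
    | zero => intro x t; simp
    | succ n ih =>
      intro x t
      rw [zpow_add_one₀ (rootUnit_ne_zero _ _), mul_comm (rootUnit m k' ^ _), mul_smul, ← ih x t]
      rw [← h1 (x + (n : ℤ) * (2 * Real.pi * Complex.I), t) trivial]
      congr 2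
      push_cast
      ring
    | pred n ih =>
      intro x t
      have := h1 (x + (-n - 1 : ℤ) * (2 * Real.pi * Complex.I), t) trivial
      have e : x + ((-n - 1 : ℤ) : ℂ) * (2 * Real.pi * Complex.I) + 2 * Real.pi * Complex.I =
          x + (-n : ℤ) * (2 * Real.pi * Complex.I) := by push_cast; ring
      simp only [e, ih x t] at this
      rw [zpow_sub_one₀ (rootUnit_ne_zero _ _), mul_comm (rootUnit m k' ^ _), mul_smul, this, smul_smul,
        inv_mul_cancel₀ (rootUnit_ne_zero _ _), one_smul]
  refine ⟨fun t => θ (g t, t), by fun_prop, fun t => ?_, ?_⟩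
  · simp only [← hge]
    exact hθT' _ _
  · simp only
    rw [h2 (g 1) trivial, hg1, hiter, smul_smul, rootUnit_add, rootUnit_mul]

end Orbit

/-- The nonzero vectors of the plane which are not proportional to a vector of `L`. -/
def coneBase (L : Set (ℂ × ℂ)) : Set (ℂ × ℂ) := {w | w ≠ 0 ∧ ∀ b ∈ L, w.1 * b.2 - w.2 * b.1 ≠ 0}

theorem mem_coneBase_insert {L : Set (ℂ × ℂ)} {b w : ℂ × ℂ} :
    w ∈ coneBase (insert b L) ↔ w ∈ coneBase L ∧ w.1 * b.2 - w.2 * b.1 ≠ 0 := by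
  simp only [coneBase, Set.mem_ofPred_eq, Set.forall_mem_insert]
  tauto

theorem smul_mem_coneBase {L : Set (ℂ × ℂ)} {w : ℂ × ℂ} (hw : w ∈ coneBase L) {c : ℂ}
    (hc : c ≠ 0) : c • w ∈ coneBase L := by
  refine ⟨smul_ne_zero hc hw.1, fun b hb h => hw.2 b hb ?_⟩
  simp only [Prod.smul_fst, Prod.smul_snd, smul_eq_mul] at h
  exact (mul_eq_zero_iff_left hc).1 (by linear_combination h)

theorem isOpen_coneBase {L : Set (ℂ × ℂ)} (hL : L.Finite) : IsOpen (coneBase L) := by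
  have : coneBase L = {w | w ≠ 0} ∩ ⋂ b ∈ L, {w | w.1 * b.2 - w.2 * b.1 ≠ 0} := by
    ext w; simp [coneBase]
  rw [this]
  refine isOpen_ne.inter (hL.isOpen_biInter fun b _ => isOpen_ne_fun (by fun_prop) (by fun_prop))

/-- A closed complex cone in `ℂ² × ℂ`, finite over `ℂ²`, which is a covering with `N` sheets
over the complement of finitely many lines, and which is connected and dense over this complement
even after removing a further line. -/
structure ConeCover (Z : Set ((ℂ × ℂ) × ℂ)) (N : ℕ) (L : Set (ℂ × ℂ)) : Prop where
  finite_lines : L.Finite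
  line_ne_zero : ∀ b ∈ L, b ≠ 0
  smul_mem : ∀ c : ℂ, c ≠ 0 → ∀ p ∈ Z, c • p ∈ Z
  base_ne_zero : ∀ p ∈ Z, p.1 ≠ 0
  closed : IsClosed (Z ∪ {0})
  bound : ∃ M, ∀ p ∈ Z, ‖p.2‖ ≤ M * ‖p.1‖
  finite : ∀ w, {p | p ∈ Z ∧ p.1 = w}.Finite
  loc : LocSheets Z N (coneBase L)
  conn : ∀ b : ℂ × ℂ, b ≠ 0 → IsPreconnected (Z ∩ {p | p.1 ∈ coneBase (insert b L)})
  dense : ∀ b : ℂ × ℂ, b ≠ 0 → Z ⊆ closure (Z ∩ {p | p.1 ∈ coneBase (insert b L)})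

/-- The inclusion of the affine slice. -/
def sliceIncl (q : ℂ × ℂ) : (ℂ × ℂ) × ℂ := ((q.1, 1), q.2)

@[fun_prop] theorem continuous_sliceIncl : Continuous sliceIncl := by
  unfold sliceIncl; fun_prop

/-- The affine slice of a cone. -/
def coneSlice (Z : Set ((ℂ × ℂ) × ℂ)) : Set (ℂ × ℂ) := sliceIncl ⁻¹' Z

/-- The projection of a cone to its affine slice. -/
noncomputable def toSlice (p : (ℂ × ℂ) × ℂ) : ℂ × ℂ := (p.1.1 / p.1.2, p.2 / p.1.2)

theorem smul_sliceIncl_toSlice {p : (ℂ × ℂ) × ℂ} (hp : p.1.2 ≠ 0) :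
    p.1.2 • sliceIncl (toSlice p) = p := by
  ext <;> simp [sliceIncl, toSlice, mul_div_cancel₀ _ hp]

theorem toSlice_smul {c : ℂ} (hc : c ≠ 0) (p : (ℂ × ℂ) × ℂ) : toSlice (c • p) = toSlice p := by
  simp [toSlice, mul_div_mul_left _ _ hc]

theorem continuousAt_toSlice {p : (ℂ × ℂ) × ℂ} (hp : p.1.2 ≠ 0) : ContinuousAt toSlice p :=
  ContinuousAt.prodMk
    (ContinuousAt.div (f := fun p : (ℂ × ℂ) × ℂ => p.1.1) (g := fun p : (ℂ × ℂ) × ℂ => p.1.2)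
      (by fun_prop) (by fun_prop) hp)
    (ContinuousAt.div (f := fun p : (ℂ × ℂ) × ℂ => p.2) (g := fun p : (ℂ × ℂ) × ℂ => p.1.2)
      (by fun_prop) (by fun_prop) hp)

/-- The branch points of the affine slice. -/
noncomputable def sliceBranch {L : Set (ℂ × ℂ)} (hL : L.Finite) : Finset ℂ :=
  hL.toFinset.image fun b => b.1 / b.2

namespace ConeCover

variable {Z : Set ((ℂ × ℂ) × ℂ)} {N : ℕ} {L : Set (ℂ × ℂ)}

theorem toSlice_mem (hZ : ConeCover Z N L) {p : (ℂ × ℂ) × ℂ} (hp : p ∈ Z) (h0 : p.1.2 ≠ 0) :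
    toSlice p ∈ coneSlice Z := by
  have := hZ.smul_mem (p.1.2)⁻¹ (inv_ne_zero h0) p hp
  rwa [← smul_sliceIncl_toSlice h0, Prod.smul_fst, Prod.smul_snd, smul_eq_mul, smul_smul,
    show (sliceIncl (toSlice p)).1.2 = 1 from rfl, mul_one, inv_mul_cancel₀ h0, one_smul] at this

theorem notMem_sliceBranch (hZ : ConeCover Z N L) (he : ((1, 0) : ℂ × ℂ) ∈ coneBase L) {x : ℂ} :
    x ∉ sliceBranch hZ.finite_lines ↔ ((x, 1) : ℂ × ℂ) ∈ coneBase L := by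
  have hb : ∀ b ∈ L, b.2 ≠ 0 := fun b hb => by simpa using he.2 b hb
  simp only [sliceBranch, Finset.mem_image, Set.Finite.mem_toFinset, not_exists, not_and, coneBase,
    Set.mem_ofPred_eq]
  constructor
  · refine fun h => ⟨fun h' => by simpa using congrArg Prod.snd h', fun b hbL h' => h b hbL ?_⟩
    rw [div_eq_iff (hb b hbL)]
    linear_combination -h'
  · rintro ⟨-, h⟩ b hbL h'
    rw [div_eq_iff (hb b hbL)] at h'
    exact h b hbL (by linear_combination -h')

theorem isBranchedCurve (hZ : ConeCover Z N L) (he : ((1, 0) : ℂ × ℂ) ∈ coneBase L) :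
    BranchedCurve (coneSlice Z) N (sliceBranch hZ.finite_lines) := by
  constructor
  · have : coneSlice Z = sliceIncl ⁻¹' (Z ∪ {0}) := by
      ext q
      simp only [coneSlice, Set.mem_preimage, Set.mem_union, Set.mem_singleton_iff, iff_self_or]
      intro h
      simpa [sliceIncl] using congrArg (fun p => p.1.2) h
    rw [this]
    exact hZ.closed.preimage continuous_sliceIncl
  · obtain ⟨M, hM⟩ := hZ.bound
    refine ⟨max M 0, fun q hq => ?_⟩
    refine (hM _ hq).trans (mul_le_mul (le_max_left _ _) ?_ (norm_nonneg _) (le_max_right _ _))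
    simp only [sliceIncl, Prod.norm_def, norm_one, max_le_iff]
    exact ⟨by linarith, by linarith [norm_nonneg q.1]⟩
  · intro x
    refine ((hZ.finite (x, 1)).preimage (f := sliceIncl) fun q _ q' _ h => ?_).subset
      fun q hq => ⟨hq.1, by rw [sliceIncl, hq.2]⟩
    have h1 : (sliceIncl q).1.1 = (sliceIncl q').1.1 := by rw [h]
    have h2 : (sliceIncl q).2 = (sliceIncl q').2 := by rw [h]
    exact Prod.ext h1 h2
  · intro x hx
    obtain ⟨U, hU, hxU, r, hr⟩ := hZ.loc (x, 1) ((hZ.notMem_sliceBranch he).1 hx)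
    have hc : Continuous fun x : ℂ => ((x, 1) : ℂ × ℂ) := by fun_prop
    exact ⟨_, hU.preimage hc, hxU, fun i x => r i (x, 1),
      fun i => (hr.cont i).comp hc.continuousOn fun _ h => h, fun x h => hr.inj _ h,
      fun x h y => hr.mem_iff _ h y⟩

theorem isPreconnected_slice (hZ : ConeCover Z N L) (he : ((1, 0) : ℂ × ℂ) ∈ coneBase L) :
    IsPreconnected (coneSlice Z ∩ {q | q.1 ∉ sliceBranch hZ.finite_lines}) := by
  have h := (hZ.conn (1, 0) (by simp)).image toSlice (fun p hp =>
    (continuousAt_toSlice (by simpa using (mem_coneBase_insert.1 hp.2).2)).continuousWithinAt)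
  convert h using 1
  ext q
  simp only [Set.mem_inter_iff, Set.mem_ofPred_eq, hZ.notMem_sliceBranch he, Set.mem_image]
  constructor
  · exact fun hq => ⟨sliceIncl q, ⟨hq.1, mem_coneBase_insert.2 ⟨hq.2, by simp [sliceIncl]⟩⟩,
      by simp [toSlice, sliceIncl]⟩
  · rintro ⟨p, ⟨hp, hp'⟩, rfl⟩
    rw [mem_coneBase_insert] at hp'
    have h0 : p.1.2 ≠ 0 := by simpa using hp'.2
    refine ⟨hZ.toSlice_mem hp h0, ?_⟩
    convert smul_mem_coneBase hp'.1 (inv_ne_zero h0) using 1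
    ext <;> simp [toSlice, h0, div_eq_inv_mul]

/-- The ends of the slice, in terms of the sheets over a neighbourhood of `(1, 0)`. -/
theorem exists_ends (hZ : ConeCover Z N L) (he : ((1, 0) : ℂ × ℂ) ∈ coneBase L) :
    ∃ (ρ : ℝ) (r : Fin N → ℂ × ℂ → ℂ), Metric.ball (1, 0) ρ⁻¹ ⊆ coneBase L ∧
      Sheets Z N (Metric.ball (1, 0) ρ⁻¹) r ∧
      CurveEnds (coneSlice Z) N (sliceBranch hZ.finite_lines) ρ fun s x => x * r s (1, x⁻¹) := by
  obtain ⟨U, hU, heU, r, hr⟩ := hZ.loc (1, 0) he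
  obtain ⟨ε, hε, hball⟩ := Metric.isOpen_iff.1 (hU.inter (isOpen_coneBase hZ.finite_lines)) (1, 0)
    ⟨heU, he⟩
  obtain ⟨M, hM⟩ := (sliceBranch hZ.finite_lines).finite_toSet.isBounded.exists_norm_le
  let ρ := max (M + 1) ε⁻¹
  have hρ : 0 < ρ := (inv_pos.2 hε).trans_le (le_max_right _ _)
  have hρε : ρ⁻¹ ≤ ε := inv_le_of_inv_le₀ hε (le_max_right _ _)
  have hsub := (Metric.ball_subset_ball hρε).trans hball
  have hr' := hr.mono (hsub.trans Set.inter_subset_left)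
  have hinv : ∀ x : ℂ, ρ < ‖x‖ → ((1, x⁻¹) : ℂ × ℂ) ∈ Metric.ball ((1, 0) : ℂ × ℂ) ρ⁻¹ :=
    fun x hx => by
      rw [Metric.mem_ball, Prod.dist_eq, dist_self, dist_zero_right, norm_inv,
        max_eq_right (by positivity)]
      exact inv_strictAnti₀ hρ hx
  have hx0 : ∀ x : ℂ, ρ < ‖x‖ → x ≠ 0 := fun x hx => norm_pos_iff.1 (hρ.trans hx)
  refine ⟨ρ, r, hsub.trans Set.inter_subset_right, hr', hρ, fun b hb => ?_, fun s => ?_,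
    fun x hx s s' h => ?_, fun x hx y => ?_⟩
  · exact lt_of_lt_of_le (by linarith [hM b hb]) (le_max_left _ _)
  · refine continuousOn_id.mul ((hr'.cont s).comp (continuousOn_const.prodMk
      (continuousOn_id.inv₀ fun x hx => hx0 x hx)) fun x hx => hinv x hx)
  · exact hr'.inj _ (hinv x hx) (mul_left_cancel₀ (hx0 x hx) h)
  · have h0 := hx0 x hx
    have h1 : (x, y) ∈ coneSlice Z ↔ ((1, x⁻¹), x⁻¹ * y) ∈ Z := by
      constructor
      · intro h
        have := hZ.smul_mem x⁻¹ (inv_ne_zero h0) _ h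
        rwa [show x⁻¹ • sliceIncl (x, y) = ((1, x⁻¹), x⁻¹ * y) by simp [sliceIncl, h0]] at this
      · intro h
        have := hZ.smul_mem x h0 _ h
        rwa [show x • (((1, x⁻¹), x⁻¹ * y) : (ℂ × ℂ) × ℂ) = sliceIncl (x, y) by
          simp [sliceIncl, h0]] at this
    rw [h1, hr'.mem_iff _ (hinv x hx)]
    refine exists_congr fun s => ?_
    rw [eq_inv_mul_iff_mul_eq₀ h0]

variable {m : ℕ} {T : (ℂ × ℂ) × ℂ → Set (ℂ × ℂ)}

theorem exists_hasHol_nhds (hZ : ConeCover Z N L) (hm : 0 < m) (hT : RootBundle m Z T)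
    {p : (ℂ × ℂ) × ℂ} (hp : p ∈ Z) (hpL : p.1 ∈ coneBase L) :
    ∃ k, ∀ᶠ p' in 𝓝[Z] p, HasHol m T (orbit p') k := by
  obtain ⟨U, hU, hpU, r, hr⟩ := hZ.loc p.1 hpL
  obtain ⟨i, hi⟩ := (hr.mem_iff _ hpU _).1 hp
  obtain ⟨ε, hε, hball⟩ := Metric.isOpen_iff.1 hU p.1 hpU
  set C : Set (ℂ × (ℂ × ℂ)) := Set.univ ×ˢ Metric.ball p.1 ε with hC
  have hCc : Convex ℝ C := convex_univ.prod (convex_ball _ _)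
  have hf : ContinuousOn (fun q : ℂ × (ℂ × ℂ) => Complex.exp q.1 • ((q.2, r i q.2) : (ℂ × ℂ) × ℂ)) C :=
    ContinuousOn.smul (f := fun q : ℂ × (ℂ × ℂ) => Complex.exp q.1)
      (g := fun q : ℂ × (ℂ × ℂ) => ((q.2, r i q.2) : (ℂ × ℂ) × ℂ)) (by fun_prop)
      (continuousOn_snd.prodMk ((hr.cont i).comp continuousOn_snd fun q hq => hball hq.2))
  have hT' := hT.comp hf fun q hq => hZ.smul_mem _ (Complex.exp_ne_zero _) _
    (hr.mem (hball hq.2) i)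
  obtain ⟨θ, hθ, hθT⟩ := hT'.exists_section_of_convex hm hCc
  obtain ⟨ζ, hζ, h1⟩ := hT'.section_unique hm hCc.isPreconnected hθ hθT
    (s' := fun q => θ (q.1 + 2 * Real.pi * Complex.I, q.2))
    (hθ.comp (by fun_prop) fun q hq => ⟨trivial, hq.2⟩) (fun q hq => by
      have := hθT (q.1 + 2 * Real.pi * Complex.I, q.2) ⟨trivial, hq.2⟩
      simpa only [Function.comp_apply, Complex.exp_periodic q.1] using this)
  obtain ⟨k, rfl⟩ := exists_rootUnit hm hζ
  refine ⟨k, ?_⟩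
  have h2 : ∀ᶠ p' : (ℂ × ℂ) × ℂ in 𝓝 p, p'.1 ∈ Metric.ball p.1 ε :=
    continuousAt_fst (Metric.ball_mem_nhds _ hε)
  filter_upwards [hr.eventually_eq hU hpU hi, h2.filter_mono nhdsWithin_le_nhds] with p' h3 h4
  refine ⟨fun t => θ (2 * Real.pi * Complex.I * t, p'.1), hθ.comp_continuous (by fun_prop)
    fun t => ⟨trivial, h4⟩, fun t => ?_, ?_⟩
  · have := hθT (2 * Real.pi * Complex.I * t, p'.1) ⟨trivial, h4⟩
    rw [Function.comp_apply, h3.2] at this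
    simpa only [orbit, mul_comm, mul_left_comm, mul_assoc] using this
  · simpa using h1 (0, p'.1) ⟨trivial, h4⟩

theorem orbit_mem (hZ : ConeCover Z N L) {p : (ℂ × ℂ) × ℂ} (hp : p ∈ Z) (t : ℝ) : orbit p t ∈ Z :=
  hZ.smul_mem _ (Complex.exp_ne_zero _) _ hp

/-- The holonomy along the circle orbits is constant. -/
theorem exists_orbit_hol (hZ : ConeCover Z N L) (hm : 0 < m) (hT : RootBundle m Z T)
    {b : ℂ × ℂ} (hb : b ≠ 0) : ∃ k, ∀ p ∈ Z ∩ {p | p.1 ∈ coneBase (insert b L)},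
      HasHol m T (orbit p) k := by
  rcases (Z ∩ {p | p.1 ∈ coneBase (insert b L)}).eq_empty_or_nonempty with h | ⟨p, hp⟩
  · exact ⟨0, by simp [h]⟩
  have hreg : ∀ {p}, p ∈ Z ∩ {p | p.1 ∈ coneBase (insert b L)} → p.1 ∈ coneBase L := fun hp =>
    (mem_coneBase_insert.1 hp.2).1
  obtain ⟨k, hk⟩ := hZ.exists_hasHol_nhds hm hT hp.1 (hreg hp)
  refine ⟨k, fun p' hp' => ?_⟩
  refine (hZ.conn b hb).induction₂' (fun p p' => ∀ k, HasHol m T (orbit p) k →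
    HasHol m T (orbit p') k) (fun p hp => ?_) (fun _ _ _ _ _ _ h h' k hk => h' k (h k hk)) hp hp' k
    (hk.self_of_nhdsWithin hp.1)
  obtain ⟨k', hk'⟩ := hZ.exists_hasHol_nhds hm hT hp.1 (hreg hp)
  have hpk := hk'.self_of_nhdsWithin hp.1
  filter_upwards [hk'.filter_mono (nhdsWithin_mono p Set.inter_subset_left),
    self_mem_nhdsWithin] with p' hp'k hp'
  constructor <;> intro k hk
  · exact hp'k.congr hm (hpk.unique hm hT (continuous_orbit _) (hZ.orbit_mem hp.1) hk)
  · exact hpk.congr hm (hp'k.unique hm hT (continuous_orbit _) (hZ.orbit_mem hp'.1) hk)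

/-- The holonomy along a large circle on an end of the slice is the holonomy of the orbits. -/
theorem hasHol_end (hZ : ConeCover Z N L) (hm : 0 < m) (hT : RootBundle m Z T) {k : ℤ}
    (hk : ∀ p ∈ Z ∩ {p | p.1 ∈ coneBase (insert (1, 0) L)}, HasHol m T (orbit p) k)
    {ρ : ℝ} (hρ : 0 < ρ) {r : Fin N → ℂ × ℂ → ℂ} (hball : Metric.ball (1, 0) ρ⁻¹ ⊆ coneBase L)
    (hr : Sheets Z N (Metric.ball (1, 0) ρ⁻¹) r) {R : ℝ} (hR : ρ < R) (s : Fin N) :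
    HasHol m T (fun t => sliceIncl (circ 0 R t, circ 0 R t * r s (1, (circ 0 R t)⁻¹))) k := by
  have hR0 : 0 < R := hρ.trans hR
  have hn : ∀ t, ‖circ 0 R t‖ = R := norm_circ_zero hR0.le
  have h0 : ∀ t, circ 0 R t ≠ 0 := fun t => norm_pos_iff.1 (by rw [hn]; exact hR0)
  have hβ : ∀ t, ((1, (circ 0 R t)⁻¹) : ℂ × ℂ) ∈ Metric.ball ((1, 0) : ℂ × ℂ) ρ⁻¹ := fun t => by
    rw [Metric.mem_ball, Prod.dist_eq, dist_self, dist_zero_right, norm_inv,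
      max_eq_right (by positivity), hn]
    exact inv_strictAnti₀ hρ hR
  have hβc : Continuous fun t => ((1, (circ 0 R t)⁻¹) : ℂ × ℂ) :=
    continuous_const.prodMk ((continuous_circ 0 R).inv₀ h0)
  have hf : ContinuousOn (fun w : ℂ × ℂ => (w, r s w)) (Metric.ball (1, 0) ρ⁻¹) :=
    continuousOn_id.prodMk (hr.cont s)
  have h1 := HasHol.of_convex hm hT (convex_ball _ _) hf (fun w hw => hr.mem hw s) hβc hβ
    (by rw [circ_one])
  have hw : HasWind (circ 0 R) 1 := by simpa using hasWind_circ_sub_self 0 hR0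
  have h2 := h1.smul hm hT hZ.smul_mem (hf.comp_continuous hβc hβ)
    (fun t => hr.mem (hβ t) s) (by simp only [Function.comp_apply, circ_one])
    (hk _ ⟨hr.mem (hβ 0) s, mem_coneBase_insert.2 ⟨hball (hβ 0), by simp [h0]⟩⟩) hw
  rw [zero_add, one_mul] at h2
  convert h2 using 2 with t
  simp [sliceIncl, h0]

end ConeCover

theorem rootOrbit_mul_pow {m : ℕ} {c : ℂ} (hc : c ≠ 0) (F : ℂ) (v : ℂ × ℂ) :
    rootOrbit m (F * c ^ m) v = rootOrbit m F (c • v) := by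
  ext u
  constructor
  · rintro ⟨a, ha, rfl⟩
    refine ⟨a / c, ?_, by rw [smul_smul, div_mul_cancel₀ _ hc]⟩
    rw [div_pow, ha, mul_div_cancel_right₀ _ (pow_ne_zero _ hc)]
  · rintro ⟨a, ha, rfl⟩
    exact ⟨a * c, by rw [mul_pow, ha], by rw [smul_smul]⟩

theorem RootBundle.of_rootOrbit {V : Type*} [TopologicalSpace V] {m : ℕ} (hm : 0 < m) {Z : Set V}
    {T : V → Set (ℂ × ℂ)} (h : ∀ z₀ ∈ Z, ∃ F : V → ℂ, ∃ v : V → ℂ × ℂ,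
      ∀ᶠ z in 𝓝[Z] z₀, ContinuousWithinAt F Z z ∧ ContinuousWithinAt v Z z ∧ F z ≠ 0 ∧ v z ≠ 0 ∧
        T z = rootOrbit m (F z) (v z)) : RootBundle m Z T := by
  intro z₀ hz₀
  obtain ⟨F, v, hev⟩ := h z₀ hz₀
  obtain ⟨hF₀, -, hF0, -⟩ := hev.self_of_nhdsWithin hz₀
  have hball : ∀ᶠ z in 𝓝[Z] z₀, F z ∈ Metric.ball (F z₀) ‖F z₀‖ :=
    hF₀ (Metric.ball_mem_nhds _ (norm_pos_iff.2 hF0))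
  obtain ⟨U, hU, hUZ⟩ := mem_nhdsWithin_iff_exists_mem_nhds_inter.1 (hev.and hball)
  obtain ⟨ℓ, hℓ, he⟩ := Complex.exists_log_of_convex (convex_ball (F z₀) ‖F z₀‖) continuousOn_id
    (fun x hx h0 => by simp only [id] at h0; simp [h0] at hx)
  have hUZ' : ∀ z ∈ Z ∩ U, _ := fun z hz => hUZ hz.symm
  refine ⟨U, hU, fun z => Complex.exp (ℓ (F z) / m) • v z, ?_, fun z hz => ?_⟩
  · have hFc : ContinuousOn F (Z ∩ U) := fun z hz => (hUZ' z hz).1.1.mono Set.inter_subset_left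
    have hvc : ContinuousOn v (Z ∩ U) := fun z hz => (hUZ' z hz).1.2.1.mono Set.inter_subset_left
    exact ((hℓ.comp hFc fun z hz => (hUZ' z hz).2).div_const _).cexp.smul hvc
  · obtain ⟨⟨-, -, hFz, hvz, hT⟩, hb⟩ := hUZ' z hz
    refine ⟨smul_ne_zero (Complex.exp_ne_zero _) hvz, ?_⟩
    have h1 := rootOrbit_exp_smul hm 1 (ℓ (F z)) (v z)
    rw [one_mul, he _ hb] at h1
    rw [hT]
    exact h1.symm

theorem HasWind.exp_mul_const {c : ℂ} (hc : c ≠ 0) :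
    HasWind (fun t => Complex.exp (2 * Real.pi * Complex.I * t) * c) 1 :=
  ⟨fun t => 2 * Real.pi * Complex.I * t + Complex.log c, by fun_prop, fun t => by
    rw [Complex.exp_add, Complex.exp_log hc], by push_cast; ring⟩

theorem orbit_one {V : Type*} [AddCommGroup V] [Module ℂ V] (p : V) : orbit p 1 = orbit p 0 := by
  simp [orbit]

namespace ConeCover

variable {Z : Set ((ℂ × ℂ) × ℂ)} {N : ℕ} {L : Set (ℂ × ℂ)} {m : ℕ}
  {T : (ℂ × ℂ) × ℂ → Set (ℂ × ℂ)}

/-- On the affine slice, a bundle of roots is given by a function whose windings at the ends are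
determined modulo `m` by the holonomy along the circle orbits. -/
theorem exists_slice_decomp (hZ : ConeCover Z N L) (he : ((1, 0) : ℂ × ℂ) ∈ coneBase L)
    (hm : 0 < m) (hT : RootBundle m Z T) {k : ℤ}
    (hk : ∀ p ∈ Z ∩ {p | p.1 ∈ coneBase (insert (1, 0) L)}, HasHol m T (orbit p) k) :
    ∃ (ρ : ℝ) (y : Fin N → ℂ → ℂ) (F : ℂ × ℂ → ℂ) (v : ℂ × ℂ → ℂ × ℂ) (n : Fin N → ℤ),
      CurveEnds (coneSlice Z) N (sliceBranch hZ.finite_lines) ρ y ∧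
      RootDecomp (coneSlice Z) m (T ∘ sliceIncl) Set.univ F v ∧ EndWind y F n ∧
      (∀ s, n s ≡ k [ZMOD m]) ∧ ∑ s, n s = 0 := by
  obtain ⟨ρ, r, hball, hr, hy⟩ := hZ.exists_ends he
  have hS := hZ.isBranchedCurve he
  have hTS : RootBundle m (coneSlice Z) (T ∘ sliceIncl) :=
    hT.comp continuous_sliceIncl.continuousOn fun q hq => hq
  obtain ⟨F, v, hd⟩ := hS.exists_rootDecomp hm hTS
  have hF : ContinuousOn F (coneSlice Z) := by simpa using hd.contF
  have hv : ContinuousOn v (coneSlice Z) := by simpa using hd.contv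
  have hF0 : ∀ p ∈ coneSlice Z, F p ≠ 0 := fun p hp => hd.F_ne p ⟨hp, trivial⟩
  choose n g hg hgF hw using hy.exists_zpow_mul_exp hF hF0
  have hn : EndWind (fun s x => x * r s (1, x⁻¹)) F n := fun s => (eventually_gt_atTop ρ).mono (hw s)
  refine ⟨ρ, _, F, v, n, hy, hd, hn, fun s => ?_, hS.sum_endWind_eq_zero hy hF hF0 hn⟩
  have hρ : ∀ t, circ 0 (ρ + 1) t ∈ {x : ℂ | ρ < ‖x‖} := fun t => by
    change ρ < ‖circ 0 (ρ + 1) t‖; rw [norm_circ_zero (by linarith [hy.pos])]; linarith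
  have hc : Continuous fun t => (circ 0 (ρ + 1) t, circ 0 (ρ + 1) t * r s (1, (circ 0 (ρ + 1) t)⁻¹)) :=
    (continuous_circ _ _).prodMk ((hy.sheets.cont s).comp_continuous (continuous_circ _ _) hρ)
  have hcS : ∀ t, _ ∈ coneSlice Z := fun t => hy.sheets.mem (hρ t) s
  have h1 := (hw s (ρ + 1) (by linarith)).hasHol (T := T ∘ sliceIncl) hm
    (v := v) (hv.comp_continuous hc hcS) (by simp only [circ_one]) fun t => hd.eq _ ⟨hcS t, trivial⟩
  have h2 := hZ.hasHol_end hm hT hk hy.pos hball hr (R := ρ + 1) (by linarith) s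
  exact HasHol.unique hm hT (continuous_sliceIncl.comp hc) hcS h1 h2

/-- A nonvanishing continuous function on the cone does not wind along the circle orbits. -/
theorem wind_orbit_eq_zero (hZ : ConeCover Z N L) (hN : 0 < N)
    (he : ((1, 0) : ℂ × ℂ) ∈ coneBase L) {u : (ℂ × ℂ) × ℂ → ℂ} (hu : ContinuousOn u Z)
    (hu0 : ∀ p ∈ Z, u p ≠ 0) {p : (ℂ × ℂ) × ℂ} (hp : p ∈ Z)
    (hpL : p.1 ∈ coneBase (insert (1, 0) L)) {k : ℤ} (hk : HasWind (fun t => u (orbit p t)) k) :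
    k = 0 := by
  set m := N * k.natAbs + 1 with hm'
  have hm : 0 < m := Nat.succ_pos _
  have hT : RootBundle m Z fun p => rootOrbit m (u p) (1, 0) :=
    .of_rootOrbit hm fun z _ => ⟨u, fun _ => (1, 0), by
      filter_upwards [self_mem_nhdsWithin] with z hz
      exact ⟨hu z hz, continuousWithinAt_const, hu0 z hz, by simp, rfl⟩⟩
  obtain ⟨k₀, hk₀⟩ := hZ.exists_orbit_hol hm hT (b := (1, 0)) (by simp)
  have h1 := (hk.hasHol (T := fun p => rootOrbit m (u p) (1, 0)) hm (v := fun _ => (1, 0))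
    continuous_const (orbit_one p) fun t => rfl).unique hm hT (continuous_orbit p)
      (hZ.orbit_mem hp) (hk₀ p ⟨hp, hpL⟩)
  obtain ⟨ρ, y, F, v, n, -, -, -, hn, hsum⟩ := hZ.exists_slice_decomp he hm hT hk₀
  have h2 : (N : ℤ) * k ≡ 0 [ZMOD m] := by
    have : ∑ s, n s ≡ ∑ _s : Fin N, k [ZMOD m] :=
      Int.ModEq.sum fun s _ => (hn s).trans h1.symm
    simpa [hsum] using this.symm
  have h3 : (N : ℤ) * k = 0 := by
    refine Int.eq_zero_of_abs_lt_dvd (Int.modEq_zero_iff_dvd.1 h2) ?_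
    rw [abs_mul, Nat.abs_cast, hm']
    push_cast
    exact lt_add_one _
  exact (mul_eq_zero.1 h3).resolve_left (by exact_mod_cast hN.ne')

theorem comp_toSlice (hZ : ConeCover Z N L) {u : ℂ × ℂ → ℂ} (hu : ContinuousOn u (coneSlice Z))
    {p : (ℂ × ℂ) × ℂ} (hp : p ∈ Z) (h0 : p.1.2 ≠ 0) :
    ContinuousWithinAt (fun p => u (toSlice p)) Z p := by
  have hev : ∀ᶠ p' : (ℂ × ℂ) × ℂ in 𝓝 p, p'.1.2 ≠ 0 := ContinuousAt.eventually_ne (by fun_prop) h0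
  refine (continuousWithinAt_inter hev).1 ?_
  exact (hu _ (hZ.toSlice_mem hp h0)).comp (continuousAt_toSlice h0).continuousWithinAt
    fun p' hp' => hZ.toSlice_mem hp'.1 hp'.2

/-- A function on the slice which is constant near infinity extends to the cone. -/
theorem exists_extend_slice (hZ : ConeCover Z N L) {u : ℂ × ℂ → ℂ}
    (hu : ContinuousOn u (coneSlice Z)) {R : ℝ} (hR : ∀ q ∈ coneSlice Z, R ≤ ‖q.1‖ → u q = 1) :
    ∃ û : (ℂ × ℂ) × ℂ → ℂ, ContinuousOn û Z ∧ (∀ p, p.1.2 ≠ 0 → û p = u (toSlice p)) ∧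
      ∀ p, p.1.2 = 0 → û p = 1 := by
  classical
  refine ⟨fun p => if p.1.2 = 0 then 1 else u (toSlice p), fun p hp => ?_, fun p hp => by
    simp [hp], fun p hp => by simp [hp]⟩
  by_cases h0 : p.1.2 = 0
  · have hx : p.1.1 ≠ 0 := fun h => hZ.base_ne_zero p hp (Prod.ext h h0)
    have hev : ∀ᶠ p' : (ℂ × ℂ) × ℂ in 𝓝 p, R * ‖p'.1.2‖ < ‖p'.1.1‖ :=
      ContinuousAt.eventually_lt (by fun_prop) (by fun_prop) (by simpa [h0] using hx)
    refine continuousWithinAt_const.congr_of_eventuallyEq (f := fun _ => (1 : ℂ)) ?_ (by simp [h0])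
    filter_upwards [self_mem_nhdsWithin, hev.filter_mono nhdsWithin_le_nhds] with p' hp' h
    split_ifs with h'
    · rfl
    · refine hR _ (hZ.toSlice_mem hp' h') ?_
      rw [toSlice, norm_div, le_div_iff₀ (norm_pos_iff.2 h')]
      exact h.le
  · have hev : ∀ᶠ p' : (ℂ × ℂ) × ℂ in 𝓝 p, p'.1.2 ≠ 0 :=
      ContinuousAt.eventually_ne (by fun_prop) h0
    refine (hZ.comp_toSlice hu hp h0).congr_of_eventuallyEq ?_ (by simp [h0])
    filter_upwards [hev.filter_mono nhdsWithin_le_nhds] with p' hp'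
    simp [hp']

end ConeCover

namespace ConeCover

variable {Z : Set ((ℂ × ℂ) × ℂ)} {N : ℕ} {L : Set (ℂ × ℂ)} {m : ℕ}
  {T : (ℂ × ℂ) × ℂ → Set (ℂ × ℂ)}

/-- Over a neighbourhood of the line at infinity, a connected cone is the union of `N` sheets, and
its points are described by the ends of the slice. -/
theorem eventually_sheet (hZ : ConeCover Z N L) {ρ : ℝ} (hρ : 0 < ρ) {r : Fin N → ℂ × ℂ → ℂ}
    (hr : Sheets Z N (Metric.ball (1, 0) ρ⁻¹) r) {p : (ℂ × ℂ) × ℂ} (hp : p ∈ Z) (h0 : p.1.2 = 0)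
    (R : ℝ) : ∃ s, ∀ᶠ p' in 𝓝[Z] p, p'.1.1 ≠ 0 ∧ (p'.1.2 = 0 → p'.2 = p'.1.1 * r s (1, 0)) ∧
      (p'.1.2 ≠ 0 → R < ‖p'.1.1 / p'.1.2‖ ∧ toSlice p' = (p'.1.1 / p'.1.2,
        p'.1.1 / p'.1.2 * r s (1, (p'.1.1 / p'.1.2)⁻¹))) := by
  have hx : p.1.1 ≠ 0 := fun h => hZ.base_ne_zero p hp (Prod.ext h h0)
  have hpe : (p.1.1)⁻¹ • p = ((1, 0), p.2 / p.1.1) := by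
    ext <;> simp [hx, h0, div_eq_inv_mul]
  have hmem : (p.1.1)⁻¹ • p ∈ Z := hZ.smul_mem _ (inv_ne_zero hx) _ hp
  have hball : ((p.1.1)⁻¹ • p).1 ∈ Metric.ball ((1, 0) : ℂ × ℂ) ρ⁻¹ := by
    rw [hpe]; exact Metric.mem_ball_self (inv_pos.2 hρ)
  obtain ⟨s, hs⟩ := (hr.mem_iff _ hball _).1 hmem
  have hcont : ContinuousAt (fun p : (ℂ × ℂ) × ℂ => (p.1.1)⁻¹ • p) p :=
    (ContinuousAt.inv₀ (f := fun p : (ℂ × ℂ) × ℂ => p.1.1) (by fun_prop) hx).smul continuousAt_id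
  have htend : Tendsto (fun p : (ℂ × ℂ) × ℂ => (p.1.1)⁻¹ • p) (𝓝[Z] p) (𝓝[Z] ((p.1.1)⁻¹ • p)) := by
    refine tendsto_nhdsWithin_iff.2 ⟨hcont.tendsto.mono_left nhdsWithin_le_nhds, ?_⟩
    have : ∀ᶠ p' : (ℂ × ℂ) × ℂ in 𝓝 p, p'.1.1 ≠ 0 := ContinuousAt.eventually_ne (by fun_prop) hx
    filter_upwards [self_mem_nhdsWithin, this.filter_mono nhdsWithin_le_nhds] with p' hp' h'
    exact hZ.smul_mem _ (inv_ne_zero h') _ hp'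
  have hev : ∀ᶠ p' : (ℂ × ℂ) × ℂ in 𝓝 p, R * ‖p'.1.2‖ < ‖p'.1.1‖ :=
    ContinuousAt.eventually_lt (by fun_prop) (by fun_prop) (by simpa [h0] using hx)
  have hev' : ∀ᶠ p' : (ℂ × ℂ) × ℂ in 𝓝 p, p'.1.1 ≠ 0 := ContinuousAt.eventually_ne (by fun_prop) hx
  refine ⟨s, ?_⟩
  filter_upwards [htend.eventually (hr.eventually_eq Metric.isOpen_ball hball hs),
    hev.filter_mono nhdsWithin_le_nhds, hev'.filter_mono nhdsWithin_le_nhds] with p' h1 h2 h3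
  have h4 : p'.2 = p'.1.1 * r s (1, (p'.1.1)⁻¹ * p'.1.2) := by
    have h5 : ((p'.1.1)⁻¹ • p').1 = (1, (p'.1.1)⁻¹ * p'.1.2) := by ext <;> simp [h3]
    rw [← h5, h1.2, Prod.smul_snd, smul_eq_mul, mul_inv_cancel_left₀ h3]
  refine ⟨h3, fun h => by rw [h4, h, mul_zero], fun h => ⟨?_, ?_⟩⟩
  · rwa [norm_div, lt_div_iff₀ (norm_pos_iff.2 h)]
  · rw [toSlice, h4, inv_div, div_eq_inv_mul p'.1.2]
    simp only [Prod.mk.injEq, true_and]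
    ring

/-- A bundle of `N`-th roots with holonomy one along the circle orbits. -/
theorem exists_rootBundle (hZ : ConeCover Z N L) (hN : 0 < N)
    (he : ((1, 0) : ℂ × ℂ) ∈ coneBase L) : ∃ T : (ℂ × ℂ) × ℂ → Set (ℂ × ℂ), RootBundle N Z T ∧
      ∀ p ∈ Z, p.1.2 ≠ 0 → HasHol N T (orbit p) 1 := by
  classical
  obtain ⟨ρ, r, hball, hr, hy⟩ := hZ.exists_ends he
  have hS := hZ.isBranchedCurve he
  let s₀ : Fin N := ⟨0, hN⟩
  let n : Fin N → ℤ := fun s => 1 - if s = s₀ then (N : ℤ) else 0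
  have hn : ∑ s, n s = 0 := by simp [n, Finset.sum_sub_distrib]
  obtain ⟨q, hq, hq0, hqn⟩ := hS.exists_endWind hy (hZ.isPreconnected_slice he) hn
  obtain ⟨E, hE, hqE⟩ := hy.exists_normalize hq hq0 hqn
  set y : Fin N → ℂ → ℂ := fun s x => x * r s (1, x⁻¹) with hyd
  let Q : ℂ × ℂ → ℂ := fun p => q p * Complex.exp (E p)
  have hQ : ContinuousOn Q (coneSlice Z) := hq.mul hE.cexp
  have hQ0 : ∀ p ∈ coneSlice Z, Q p ≠ 0 := fun p hp => mul_ne_zero (hq0 p hp) (Complex.exp_ne_zero _)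
  let κ : ℂ → ℂ := fun x => x * (ramp (ρ + 2) (ρ + 3) ‖x‖ : ℝ)
  have hκ : Continuous κ := by fun_prop
  let δ : ℂ × ℂ → ℂ := sheetUpdate {x | ρ < ‖x‖} y s₀ κ fun _ => 0
  have hδ : ContinuousOn δ (coneSlice Z) := fun p hp =>
    hy.sheets.continuousWithinAt_sheetUpdate (CurveEnds.isOpen_ends ρ)
      (CurveEnds.isClosed_ends (ρ + 2)) (fun x hx => (by linarith : ρ < ρ + 2).trans_le hx)
      (fun x hx => by
        have h : ‖x‖ ≤ ρ + 2 := (not_le.1 hx.2).le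
        simp only [κ, ramp_of_le (by linarith : ρ + 2 < ρ + 3) h]; simp) hp
      (fun _ _ => hκ.continuousAt) fun _ => continuousWithinAt_const
  let T : (ℂ × ℂ) × ℂ → Set (ℂ × ℂ) := fun p =>
    if p.1.2 ≠ 0 then rootOrbit N (p.1.2 * Q (toSlice p)) (1, δ (toSlice p))
    else if p.2 = p.1.1 * r s₀ (1, 0) then rootOrbit N p.1.1 (0, 1) else rootOrbit N p.1.1 (1, 0)
  have hT1 : ∀ p, p.1.2 ≠ 0 → T p = rootOrbit N (p.1.2 * Q (toSlice p)) (1, δ (toSlice p)) :=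
    fun p hp => by simp only [T, hp, ne_eq, not_false_eq_true, if_true]
  refine ⟨T, .of_rootOrbit hN fun p hp => ?_, fun p hp h0 => ?_⟩
  · by_cases h0 : p.1.2 = 0
    · obtain ⟨s, hs⟩ := hZ.eventually_sheet hy.pos hr hp h0 (ρ + 3)
      by_cases hss : s = s₀
      · refine ⟨fun p => p.1.1, fun p => (p.1.2 / p.1.1, 1), ?_⟩
        filter_upwards [hs] with p' h1
        refine ⟨by fun_prop, ContinuousWithinAt.prodMk (ContinuousWithinAt.div
          (f := fun p : (ℂ × ℂ) × ℂ => p.1.2) (g := fun p : (ℂ × ℂ) × ℂ => p.1.1)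
          (by fun_prop) (by fun_prop) h1.1) continuousWithinAt_const, h1.1, by simp, ?_⟩
        by_cases h : p'.1.2 = 0
        · simp only [T, h, ne_eq, not_true_eq_false, if_false, zero_div]
          rw [if_pos (by rw [h1.2.1 h, hss])]
        · obtain ⟨h2, h3⟩ := h1.2.2 h
          have hX : ρ < ‖p'.1.1 / p'.1.2‖ := by linarith
          have h4 : Q (toSlice p') = (p'.1.1 / p'.1.2) ^ n s := by
            rw [h3]; exact hqE s _ (by linarith)
          have h5 : δ (toSlice p') = p'.1.1 / p'.1.2 := by
            rw [h3]
            refine (hy.sheetUpdate_apply (s := s₀) (s' := s) hX).trans ?_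
            simp only [hss, if_true, κ, ramp_of_ge (by linarith : ρ + 2 < ρ + 3) h2.le]
            simp
          have h6 : p'.1.2 * (p'.1.1 / p'.1.2) ^ n s = p'.1.1 * (p'.1.2 / p'.1.1) ^ N := by
            simp only [n, hss, if_true]
            rw [zpow_sub₀ (div_ne_zero h1.1 h), zpow_one, zpow_natCast, div_pow, div_pow]
            field_simp
          rw [hT1 _ h, h4, h5, h6, rootOrbit_mul_pow (div_ne_zero h h1.1)]
          congr 1
          simp [h, h1.1]
      · refine ⟨fun p => p.1.1, fun p => (1, 0), ?_⟩
        filter_upwards [hs] with p' h1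
        refine ⟨by fun_prop, continuousWithinAt_const, h1.1, by simp, ?_⟩
        by_cases h : p'.1.2 = 0
        · simp only [T, h, ne_eq, not_true_eq_false, if_false]
          rw [if_neg]
          rw [h1.2.1 h]
          exact fun h' => hss (hr.inj _ (Metric.mem_ball_self (inv_pos.2 hy.pos))
            (mul_left_cancel₀ h1.1 h'))
        · obtain ⟨h2, h3⟩ := h1.2.2 h
          have hX : ρ < ‖p'.1.1 / p'.1.2‖ := by linarith
          have h4 : Q (toSlice p') = (p'.1.1 / p'.1.2) ^ n s := by
            rw [h3]; exact hqE s _ (by linarith)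
          have h5 : δ (toSlice p') = 0 := by
            rw [h3]
            refine (hy.sheetUpdate_apply (s := s₀) (s' := s) hX).trans ?_
            simp only [hss, if_false]
          rw [hT1 _ h, h4, h5]
          congr 1
          simp [n, hss, mul_div_cancel₀ _ h]
    · refine ⟨fun p => p.1.2 * Q (toSlice p), fun p => (1, δ (toSlice p)), ?_⟩
      have hev : ∀ᶠ p' : (ℂ × ℂ) × ℂ in 𝓝 p, p'.1.2 ≠ 0 :=
        ContinuousAt.eventually_ne (by fun_prop) h0
      filter_upwards [self_mem_nhdsWithin, hev.filter_mono nhdsWithin_le_nhds] with p' hp' h'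
      exact ⟨ContinuousWithinAt.mul (by fun_prop) (hZ.comp_toSlice hQ hp' h'),
        continuousWithinAt_const.prodMk (hZ.comp_toSlice hδ hp' h'),
        mul_ne_zero h' (hQ0 _ (hZ.toSlice_mem hp' h')), by simp, hT1 _ h'⟩
  · have hts : ∀ t, toSlice (orbit p t) = toSlice p := fun t => toSlice_smul (Complex.exp_ne_zero _) p
    have hz : ∀ t, (orbit p t).1.2 = Complex.exp (2 * Real.pi * Complex.I * t) * p.1.2 := fun t => rfl
    refine HasWind.hasHol hN (F := fun p => p.1.2 * Q (toSlice p)) (v := fun p => (1, δ (toSlice p)))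
      (by simp only [hts]; fun_prop) (orbit_one p) (fun t => hT1 _ ?_) ?_
    · rw [hz]; exact mul_ne_zero (Complex.exp_ne_zero _) h0
    · simp only [hts, hz, mul_assoc]
      simpa only [mul_assoc] using
        HasWind.exp_mul_const (mul_ne_zero h0 (hQ0 _ (hZ.toSlice_mem hp h0)))

end ConeCover

namespace ConeCover

variable {Z Z' : Set ((ℂ × ℂ) × ℂ)} {N N' : ℕ} {L L' : Set (ℂ × ℂ)}

/-- The number of sheets of a cone divides the number of sheets of a homeomorphic cone, in general
position with respect to the line spanned by `(1, 0)`. -/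
theorem dvd_of_generic (hZ : ConeCover Z N L) (hZ' : ConeCover Z' N' L') (hN : 0 < N)
    (he : ((1, 0) : ℂ × ℂ) ∈ coneBase L) (he' : ((1, 0) : ℂ × ℂ) ∈ coneBase L')
    {φ ψ : (ℂ × ℂ) × ℂ → (ℂ × ℂ) × ℂ} (hφ : ContinuousOn φ Z) (hψ : ContinuousOn ψ Z')
    (hφm : Set.MapsTo φ Z Z') (hψm : Set.MapsTo ψ Z' Z) (hψφ : ∀ p ∈ Z, ψ (φ p) = p)
    {P : (ℂ × ℂ) × ℂ} (hP : P ∈ Z) (hPL : P.1 ∈ coneBase (insert (1, 0) L))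
    (hPL' : (φ P).1 ∈ coneBase (insert (1, 0) L')) (ha : ∀ t, (φ (orbit P t)).1.2 ≠ 0) :
    N ∣ N' := by
  obtain ⟨T, hT, hT1⟩ := hZ.exists_rootBundle hN he
  have hP2 : P.1.2 ≠ 0 := by simpa using (mem_coneBase_insert.1 hPL).2
  have hT' : RootBundle N Z' (T ∘ ψ) := hT.comp hψ hψm
  obtain ⟨k, hk⟩ := hZ'.exists_orbit_hol hN hT' (b := (1, 0)) (by simp)
  obtain ⟨ρ, y, F, v, n, hy, hd, hFn, hnk, hsum⟩ := hZ'.exists_slice_decomp he' hN hT' hk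
  have hS := hZ'.isBranchedCurve he'
  have hF : ContinuousOn F (coneSlice Z') := by simpa using hd.contF
  have hv : ContinuousOn v (coneSlice Z') := by simpa using hd.contv
  have hF0 : ∀ p ∈ coneSlice Z', F p ≠ 0 := fun p hp => hd.F_ne p ⟨hp, trivial⟩
  have hN'k : (N' : ℤ) * k ≡ 0 [ZMOD N] := by
    have : ∑ s, n s ≡ ∑ _s : Fin N', k [ZMOD N] := Int.ModEq.sum fun s _ => hnk s
    simpa [hsum] using this.symm
  have hdvd : ∀ s, (N : ℤ) ∣ N' * n s := fun s =>
    Int.modEq_zero_iff_dvd.1 (((hnk s).mul_left _).trans hN'k)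
  choose j hj using hdvd
  have hj0 : ∑ s, j s = 0 := by
    have : (N : ℤ) * ∑ s, j s = 0 := by simp only [Finset.mul_sum, ← hj]; simp [← Finset.mul_sum, hsum]
    exact (mul_eq_zero.1 this).resolve_left (by exact_mod_cast hN.ne')
  obtain ⟨q, hq, hq0, hqn⟩ := hS.exists_endWind hy (hZ'.isPreconnected_slice he') hj0
  set G : ℂ × ℂ → ℂ := fun p => F p ^ (N' : ℤ) * q p ^ (-N : ℤ) with hG
  have hGc : ContinuousOn G (coneSlice Z') := (hF.zpow₀ _ fun p hp => .inl (hF0 p hp)).mul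
    (hq.zpow₀ _ fun p hp => .inl (hq0 p hp))
  have hG0 : ∀ p ∈ coneSlice Z', G p ≠ 0 := fun p hp =>
    mul_ne_zero (zpow_ne_zero _ (hF0 p hp)) (zpow_ne_zero _ (hq0 p hp))
  have hGn : EndWind y G 0 := by
    convert (hFn.zpow N').mul (hqn.zpow (-N)) using 1
    ext s
    simp [hj]
  obtain ⟨E, hE, hGE⟩ := hy.exists_normalize hGc hG0 hGn
  obtain ⟨û, hûc, hû1, hû2⟩ := hZ'.exists_extend_slice (u := fun p => G p * Complex.exp (E p))
    (hGc.mul hE.cexp) (R := ρ + 2) (fun p hp hR => by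
      obtain ⟨s, hs⟩ := (hy.sheets.mem_iff p.1 (by change ρ < ‖p.1‖; linarith) p.2).1 hp
      have := hGE s p.1 hR
      rw [hs] at this
      simpa using this)
  have hû0 : ∀ p ∈ Z', û p ≠ 0 := fun p hp => by
    by_cases h : p.1.2 = 0
    · rw [hû2 p h]; exact one_ne_zero
    · rw [hû1 p h]
      exact mul_ne_zero (hG0 _ (hZ'.toSlice_mem hp h)) (Complex.exp_ne_zero _)
  set a : ℝ → (ℂ × ℂ) × ℂ := fun t => φ (orbit P t) with had
  have hac : Continuous a := hφ.comp_continuous (continuous_orbit P) (hZ.orbit_mem hP)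
  have haZ : ∀ t, a t ∈ Z' := fun t => hφm (hZ.orbit_mem hP t)
  have ha1 : a 1 = a 0 := by simp only [had, orbit_one]
  set c : ℝ → ℂ × ℂ := fun t => toSlice (a t) with hcd
  have hcc : Continuous c := continuous_iff_continuousAt.2 fun t =>
    ContinuousAt.comp (f := a) (continuousAt_toSlice (ha t)) hac.continuousAt
  have hcS : ∀ t, c t ∈ coneSlice Z' := fun t => hZ'.toSlice_mem (haZ t) (ha t)
  have hc1 : c 1 = c 0 := by simp only [hcd, ha1]
  have hwind : ∀ {u : ℂ × ℂ → ℂ}, ContinuousOn u (coneSlice Z') → (∀ p ∈ coneSlice Z', u p ≠ 0) →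
      ∃ w, HasWind (fun t => u (c t)) w := fun hu hu0 =>
    exists_hasWind (hu.comp_continuous hcc hcS) (fun t => hu0 _ (hcS t)) (by rw [hc1])
  obtain ⟨w, hw⟩ := hwind hF hF0
  obtain ⟨w₂, hw₂⟩ := hwind hq hq0
  have h0 : (N' : ℤ) * w + -N * w₂ = 0 := by
    refine hZ.wind_orbit_eq_zero hN he (hûc.comp hφ hφm) (fun p hp => hû0 _ (hφm hp)) hP hPL ?_
    have h1 := ((hw.zpow N').mul (hw₂.zpow (-N))).mul
      (HasWind.exp (g := fun t => E (c t)) (hE.comp_continuous hcc hcS) (by rw [hc1]))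
    rw [add_zero] at h1
    convert h1 using 2 with t
    exact hû1 _ (ha t)
  obtain ⟨l, hl⟩ := exists_hasWind (γ := fun t => (a t).1.2) (by fun_prop) ha (by rw [ha1])
  have hhol : HasHol N (T ∘ ψ) a (w + l * k) := by
    have h1 : HasHol N (T ∘ ψ) (fun t => sliceIncl (c t)) w :=
      HasWind.hasHol (T := (T ∘ ψ) ∘ sliceIncl) (c := c) hN (v := v) (hv.comp_continuous hcc hcS) hc1
        (fun t => hd.eq _ ⟨hcS t, trivial⟩) hw
    have hreg : (sliceIncl (c 0)).1 ∈ coneBase (insert (1, 0) L') := by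
      have h2 : (a 0).1 ∈ coneBase (insert (1, 0) L') := by simpa [had, orbit] using hPL'
      convert smul_mem_coneBase h2 (inv_ne_zero (ha 0)) using 1
      ext <;> simp [hcd, toSlice, sliceIncl, ha 0, div_eq_inv_mul, had]
    have h3 := h1.smul hN hT' hZ'.smul_mem (continuous_sliceIncl.comp hcc) hcS (congrArg sliceIncl hc1)
      (hk _ ⟨hcS 0, hreg⟩) hl
    convert h3 using 2 with t
    exact (smul_sliceIncl_toSlice (ha t)).symm
  have hhol' : HasHol N (T ∘ ψ) a 1 := by
    obtain ⟨θ, hθ, hθT, hθ1⟩ := hT1 P hP hP2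
    refine ⟨θ, hθ, fun t => ?_, hθ1⟩
    rw [Function.comp_apply, had]
    simpa only [hψφ _ (hZ.orbit_mem hP t)] using hθT t
  have h2 := (hhol.unique hN hT' hac haZ hhol').mul_left (N' : ℤ)
  rw [mul_one, mul_add] at h2
  have h3 : (N' : ℤ) * w ≡ 0 [ZMOD N] :=
    Int.modEq_zero_iff_dvd.2 ⟨w₂, by linear_combination h0⟩
  have h4 : (N' : ℤ) * (l * k) ≡ 0 [ZMOD N] := by
    have := hN'k.mul_left l
    rwa [mul_zero, mul_left_comm] at this
  have h5 := h2.symm.trans (h3.add h4)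
  exact_mod_cast Int.modEq_zero_iff_dvd.1 h5

end ConeCover

/-- The shear of the plane along the second coordinate. -/
def planeShear (c : ℂ) : (ℂ × ℂ) ≃L[ℂ] (ℂ × ℂ) where
  toFun w := (w.1, w.2 + c * w.1)
  invFun w := (w.1, w.2 - c * w.1)
  map_add' w w' := by ext <;> simp; ring
  map_smul' a w := by ext <;> simp; ring
  left_inv w := by ext <;> simp
  right_inv w := by ext <;> simp
  continuous_toFun := by fun_prop
  continuous_invFun := by fun_prop

theorem planeShear_apply (c : ℂ) (w : ℂ × ℂ) : planeShear c w = (w.1, w.2 + c * w.1) := rfl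

/-- The shear of `ℂ² × ℂ` along the base. -/
noncomputable def baseShear (c : ℂ) : ((ℂ × ℂ) × ℂ) ≃L[ℂ] ((ℂ × ℂ) × ℂ) :=
  (planeShear c).prodCongr (.refl ℂ ℂ)

theorem baseShear_apply (c : ℂ) (p : (ℂ × ℂ) × ℂ) : baseShear c p = (planeShear c p.1, p.2) := rfl

theorem baseShear_symm_apply (c : ℂ) (p : (ℂ × ℂ) × ℂ) :
    (baseShear c).symm p = ((p.1.1, p.1.2 - c * p.1.1), p.2) := rfl

theorem planeShear_mem_coneBase {c : ℂ} {L : Set (ℂ × ℂ)} {w : ℂ × ℂ} :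
    planeShear c w ∈ coneBase L ↔ w ∈ coneBase (planeShear c ⁻¹' L) := by
  have hdet : ∀ w b : ℂ × ℂ, (planeShear c w).1 * (planeShear c b).2 -
      (planeShear c w).2 * (planeShear c b).1 = w.1 * b.2 - w.2 * b.1 := fun w b => by
    simp only [planeShear_apply]; ring
  refine and_congr (by simp) ⟨fun h b hb => by rw [← hdet]; exact h _ hb, fun h b hb => ?_⟩
  have := h ((planeShear c).symm b) (by simpa using hb)
  rwa [← hdet, ContinuousLinearEquiv.apply_symm_apply] at this

theorem planeShear_preimage_insert (c : ℂ) (L : Set (ℂ × ℂ)) (b : ℂ × ℂ) :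
    planeShear c ⁻¹' insert (planeShear c b) L = insert b (planeShear c ⁻¹' L) := by
  ext w
  simp

theorem ConeCover.shear {Z : Set ((ℂ × ℂ) × ℂ)} {N : ℕ} {L : Set (ℂ × ℂ)} (hZ : ConeCover Z N L)
    (c : ℂ) : ConeCover (baseShear c ⁻¹' Z) N (planeShear c ⁻¹' L) := by
  have hset : ∀ b, baseShear c ⁻¹' Z ∩ {p | p.1 ∈ coneBase (insert b (planeShear c ⁻¹' L))} =
      (baseShear c).toHomeomorph ⁻¹' (Z ∩ {p | p.1 ∈ coneBase (insert (planeShear c b) L)}) :=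
    fun b => by
      ext p
      rw [← planeShear_preimage_insert]
      exact and_congr Iff.rfl planeShear_mem_coneBase.symm
  refine ⟨hZ.finite_lines.preimage (planeShear c).injective.injOn, fun b hb h => ?_,
    fun a ha p hp => ?_, fun p hp h => ?_, ?_, ?_, fun w => ?_, fun w hw => ?_, fun b hb => ?_,
    fun b hb => ?_⟩
  · exact hZ.line_ne_zero _ hb (by simp [h])
  · rw [Set.mem_preimage, map_smul]
    exact hZ.smul_mem a ha _ hp
  · exact hZ.base_ne_zero _ hp (by simp [baseShear_apply, h])
  · have : baseShear c ⁻¹' Z ∪ {0} = baseShear c ⁻¹' (Z ∪ {0}) := by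
      ext p; simp
    rw [this]
    exact hZ.closed.preimage (baseShear c).continuous
  · obtain ⟨M, hM⟩ := hZ.bound
    refine ⟨max M 0 * ‖(planeShear c : (ℂ × ℂ) →L[ℂ] (ℂ × ℂ))‖, fun p hp => (hM _ hp).trans ?_⟩
    rw [mul_assoc]
    exact mul_le_mul (le_max_left _ _)
      ((planeShear c : (ℂ × ℂ) →L[ℂ] (ℂ × ℂ)).le_opNorm p.1) (norm_nonneg _) (le_max_right _ _)
  · refine ((hZ.finite (planeShear c w)).preimage (baseShear c).injective.injOn).subset ?_
    rintro p ⟨hp, rfl⟩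
    exact ⟨hp, rfl⟩
  · obtain ⟨U, hU, hwU, r, hr⟩ := hZ.loc _ (planeShear_mem_coneBase.2 hw)
    exact ⟨_, hU.preimage (planeShear c).continuous, hwU, fun i w => r i (planeShear c w),
      fun i => (hr.cont i).comp (planeShear c).continuous.continuousOn fun _ h => h,
      fun w h => hr.inj _ h, fun w h y => hr.mem_iff _ h y⟩
  · rw [hset, Homeomorph.isPreconnected_preimage]
    exact hZ.conn _ (by simpa using hb)
  · rw [hset, ← Homeomorph.preimage_closure]
    exact Set.preimage_mono (hZ.dense _ (by simpa using hb))

/-- Almost every direction avoids the base directions of a Lipschitz image of a circle orbit. -/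
theorem exists_slope_avoiding {Z : Set ((ℂ × ℂ) × ℂ)} {φ : (ℂ × ℂ) × ℂ → (ℂ × ℂ) × ℂ} {K : NNReal}
    (hφ : LipschitzOnWith K φ Z) {P : (ℂ × ℂ) × ℂ} (hP : ∀ t, orbit P t ∈ Z) {L : Set (ℂ × ℂ)}
    (hL : L.Finite) (hL0 : ∀ b ∈ L, b ≠ 0) (h0 : ∀ t, (φ (orbit P t)).1 ≠ 0) :
    ∃ c : ℂ, ((1, c) : ℂ × ℂ) ∈ coneBase L ∧
      ∀ t, (φ (orbit P t)).1.2 - c * (φ (orbit P t)).1.1 ≠ 0 := by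
  set S := φ '' Set.range (orbit P) with hS
  have hdS : dimH S ≤ 1 := by
    have h1 : ContDiff ℝ 1 (orbit P) := by
      have h2 : ContDiff ℝ 1 fun t : ℝ => (t : ℂ) := Complex.ofRealCLM.contDiff
      unfold orbit
      fun_prop
    refine ((hφ.mono (Set.range_subset_iff.2 hP)).dimH_image_le).trans ?_
    simpa using h1.dimH_range_le
  set f : (ℂ × ℂ) × ℂ → ℂ := fun p => p.1.2 / p.1.1 with hf
  have hdf : dimH (f '' (S ∩ {p | p.1.1 ≠ 0})) ≤ 1 := by
    refine (dimH_image_le_of_locally_lipschitzOn fun p hp => ?_).trans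
      ((dimH_mono Set.inter_subset_left).trans hdS)
    have h1 : ContDiffAt ℂ 1 f p := ContDiffAt.div (by fun_prop) (by fun_prop) hp.2
    obtain ⟨C, t, ht, h⟩ := h1.exists_lipschitzOnWith
    exact ⟨C, t, mem_nhdsWithin_of_mem_nhds ht, h⟩
  have hfin : ((fun b : ℂ × ℂ => b.2 / b.1) '' L).Finite := hL.image _
  have hd : dimH (f '' (S ∩ {p | p.1.1 ≠ 0}) ∪ (fun b : ℂ × ℂ => b.2 / b.1) '' L) <
      Module.finrank ℝ ℂ := by
    rw [dimH_union, dimH_finite hfin, Complex.finrank_real_complex]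
    refine (max_le hdf zero_le_one).trans_lt (by norm_num)
  obtain ⟨c, hc⟩ := (dense_compl_of_dimH_lt_finrank hd).nonempty
  simp only [Set.mem_compl_iff, Set.mem_union, not_or] at hc
  refine ⟨c, ⟨by simp, fun b hb h => ?_⟩, fun t h => ?_⟩
  · by_cases hb1 : b.1 = 0
    · have : b.2 = 0 := by simpa [hb1] using h
      exact hL0 b hb (Prod.ext hb1 this)
    · exact hc.2 ⟨b, hb, by simp only; rw [div_eq_iff hb1]; linear_combination h⟩
  · by_cases hx : (φ (orbit P t)).1.1 = 0
    · exact h0 t (Prod.ext hx (by simpa [hx] using h))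
    · refine hc.1 ⟨φ (orbit P t), ⟨⟨_, ⟨t, rfl⟩, rfl⟩, hx⟩, ?_⟩
      simp only [hf]
      rw [div_eq_iff hx]
      linear_combination h

/-- The number of sheets of a cone divides the number of sheets of a bi-Lipschitz cone. -/
theorem ConeCover.dvd {Z Z' : Set ((ℂ × ℂ) × ℂ)} {N N' : ℕ} {L L' : Set (ℂ × ℂ)}
    (hZ : ConeCover Z N L) (hZ' : ConeCover Z' N' L') (hne : Z.Nonempty)
    {φ ψ : (ℂ × ℂ) × ℂ → (ℂ × ℂ) × ℂ} {K : NNReal} (hφ : LipschitzOnWith K φ Z)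
    (hψ : ContinuousOn ψ Z') (hφm : Set.MapsTo φ Z Z') (hψm : Set.MapsTo ψ Z' Z)
    (hψφ : ∀ p ∈ Z, ψ (φ p) = p) (hφψ : ∀ p ∈ Z', φ (ψ p) = p) : N ∣ N' := by
  have he1 : ((1, 0) : ℂ × ℂ) ≠ 0 := by simp
  obtain ⟨P₀, hP₀, hP₀L⟩ : (Z ∩ {p | p.1 ∈ coneBase (insert (1, 0) L)}).Nonempty :=
    closure_nonempty_iff.1 (hne.mono (hZ.dense _ he1))
  have hopen : IsOpen {p : (ℂ × ℂ) × ℂ | p.1 ∈ coneBase L} :=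
    (isOpen_coneBase hZ.finite_lines).preimage continuous_fst
  have hev : ∀ᶠ p in 𝓝[Z'] φ P₀, (ψ p).1 ∈ coneBase L :=
    (hψ _ (hφm hP₀)).eventually (by
      rw [hψφ _ hP₀]; exact hopen.mem_nhds (mem_coneBase_insert.1 hP₀L).1)
  obtain ⟨U, hU, hUZ⟩ := mem_nhdsWithin_iff_exists_mem_nhds_inter.1 hev
  obtain ⟨P', hP'U, hP', hP'L⟩ := mem_closure_iff_nhds.1 (hZ'.dense _ he1 (hφm hP₀)) U hU
  have hP := hψm hP'
  have hPL : (ψ P').1 ∈ coneBase L := hUZ ⟨hP'U, hP'⟩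
  have hN : 0 < N := by
    obtain ⟨U, -, hxU, r, hr⟩ := hZ.loc _ hPL
    obtain ⟨i, -⟩ := (hr.mem_iff _ hxU _).1 hP
    exact i.pos
  obtain ⟨c, hcL, hc⟩ := exists_slope_avoiding (LipschitzWith.id.lipschitzOnWith (s := Z))
    (hZ.orbit_mem hP)
    hZ.finite_lines hZ.line_ne_zero fun t => hZ.base_ne_zero _ (hZ.orbit_mem hP t)
  obtain ⟨c', hcL', hc'⟩ := exists_slope_avoiding hφ (hZ.orbit_mem hP) hZ'.finite_lines
    hZ'.line_ne_zero fun t => hZ'.base_ne_zero _ (hφm (hZ.orbit_mem hP t))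
  have hid : ∀ c p, baseShear c ((baseShear c).symm p) = p := fun c p =>
    (baseShear c).apply_symm_apply p
  have hgen : ∀ (c : ℂ) (L : Set (ℂ × ℂ)), ((1, c) : ℂ × ℂ) ∈ coneBase L →
      ((1, 0) : ℂ × ℂ) ∈ coneBase (planeShear c ⁻¹' L) := fun c L h => by
    rw [← planeShear_mem_coneBase]; simpa [planeShear_apply] using h
  have hreg : ∀ (c : ℂ) (L : Set (ℂ × ℂ)) (p : (ℂ × ℂ) × ℂ), p.1 ∈ coneBase L →
      p.1.2 - c * p.1.1 ≠ 0 →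
      ((baseShear c).symm p).1 ∈ coneBase (insert (1, 0) (planeShear c ⁻¹' L)) :=
    fun c L p h h0 => by
      refine mem_coneBase_insert.2 ⟨?_, fun h1 => h0 ?_⟩
      · rw [← planeShear_mem_coneBase]
        have h2 : planeShear c ((baseShear c).symm p).1 = (baseShear c ((baseShear c).symm p)).1 :=
          rfl
        rwa [h2, hid]
      · simp [baseShear_symm_apply] at h1
        linear_combination -h1
  have horb : ∀ p t, baseShear c (orbit p t) = orbit (baseShear c p) t := fun p t => by
    simp [orbit]
  have horb0 : orbit (ψ P') 0 = ψ P' := by simp [orbit]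
  refine (hZ.shear c).dvd_of_generic (hZ'.shear c') hN (hgen c L hcL) (hgen c' L' hcL')
    (φ := fun p => (baseShear c').symm (φ (baseShear c p)))
    (ψ := fun p => (baseShear c).symm (ψ (baseShear c' p)))
    ((baseShear c').symm.continuous.comp_continuousOn (hφ.continuousOn.comp
      (baseShear c).continuous.continuousOn fun _ h => h))
    ((baseShear c).symm.continuous.comp_continuousOn (hψ.comp
      (baseShear c').continuous.continuousOn fun _ h => h))
    (fun p hp => ?_) (fun p hp => ?_) (fun p hp => ?_) (P := (baseShear c).symm (ψ P')) ?_ ?_ ?_ ?_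
  · rw [Set.mem_preimage, hid]; exact hφm hp
  · rw [Set.mem_preimage, hid]; exact hψm hp
  · simp only [hid]; rw [hψφ _ hp, ContinuousLinearEquiv.symm_apply_apply]
  · rw [Set.mem_preimage, hid]; exact hP
  · refine hreg _ _ _ hPL ?_
    simpa [horb0] using hc 0
  · simp only [hid]
    refine hreg _ _ _ ?_ ?_
    · rw [hφψ _ hP']; exact (mem_coneBase_insert.1 hP'L).1
    · simpa [horb0] using hc' 0
  · intro t
    simp only [horb, hid]
    exact hc' t

/-- A continuous family of monic complex polynomials of degree `d`. -/
structure MonicFamily {E : Type*} [TopologicalSpace E] (F : E → Polynomial ℂ) (d : ℕ) : Prop where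
  monic : ∀ e, (F e).Monic
  natDegree : ∀ e, (F e).natDegree = d
  cont : Continuous fun q : E × ℂ => (F q.1).eval q.2

theorem Polynomial.Monic.eval_eq_prod_sub {P : Polynomial ℂ} (hP : P.Monic) (y : ℂ) :
    P.eval y = (P.roots.map fun z => y - z).prod := by
  conv_lhs => rw [(IsAlgClosed.splits P).eq_prod_roots_of_monic hP]
  rw [Polynomial.eval_multiset_prod, Multiset.map_map]
  simp

theorem Polynomial.Monic.exists_root_norm_sub_pow_le {P : Polynomial ℂ} (hP : P.Monic)
    (hd : 0 < P.natDegree) (y : ℂ) : ∃ z, P.IsRoot z ∧ ‖y - z‖ ^ P.natDegree ≤ ‖P.eval y‖ := by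
  have hcard : P.roots.card = P.natDegree := IsAlgClosed.card_roots_eq_natDegree
  have hne : P.roots.toFinset.Nonempty := by
    rw [Multiset.toFinset_nonempty, ← Multiset.card_pos, hcard]
    exact hd
  obtain ⟨z, hz, hmin⟩ := P.roots.toFinset.exists_min_image (fun z => ‖y - z‖) hne
  refine ⟨z, Polynomial.isRoot_of_mem_roots (Multiset.mem_toFinset.1 hz), ?_⟩
  rw [hP.eval_eq_prod_sub, ← hcard]
  have hmin' : ∀ x ∈ P.roots, ‖y - z‖ ≤ ‖y - x‖ := fun x hx => hmin x (Multiset.mem_toFinset.2 hx)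
  generalize P.roots = s at hmin'
  induction s using Multiset.induction_on with
  | empty => simp
  | cons a s ih =>
    rw [Multiset.map_cons, Multiset.prod_cons, norm_mul, Multiset.card_cons, pow_succ']
    exact mul_le_mul (hmin' a (Multiset.mem_cons_self a s))
      (ih fun x hx => hmin' x (Multiset.mem_cons_of_mem hx)) (by positivity) (norm_nonneg _)

/-- The winding number of a polynomial along a circle counts the roots inside. -/
theorem Polynomial.Monic.hasWind_circ {P : Polynomial ℂ} (hP : P.Monic) {c : ℂ} {r : ℝ}
    (hr : 0 < r) (h : ∀ z, P.IsRoot z → ‖z - c‖ ≠ r) :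
    HasWind (fun t => P.eval (circ c r t)) (P.roots.countP fun z => ‖z - c‖ < r) := by
  simp only [hP.eval_eq_prod_sub]
  have h' : ∀ z ∈ P.roots, ‖z - c‖ ≠ r := fun z hz => h z (Polynomial.isRoot_of_mem_roots hz)
  generalize P.roots = s at h'
  induction s using Multiset.induction_on with
  | empty => simpa using HasWind.const one_ne_zero
  | cons a s ih =>
    simp only [Multiset.map_cons, Multiset.prod_cons]
    have ih := ih fun z hz => h' z (Multiset.mem_cons_of_mem hz)
    rcases lt_or_gt_of_ne (h' a (Multiset.mem_cons_self a s)) with ha | ha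
    · rw [Multiset.countP_cons_of_pos (p := fun z => ‖z - c‖ < r) s ha]
      simpa [add_comm] using (hasWind_circ_sub ha).mul ih
    · rw [Multiset.countP_cons_of_neg (p := fun z => ‖z - c‖ < r) s ha.not_gt]
      have h0 : c - a ≠ 0 := fun h0 => by
        rw [norm_sub_rev, h0, norm_zero] at ha; exact (hr.trans ha).false
      have h1 : HasWind (fun t => circ c r t - a) 0 :=
        (HasWind.const h0).of_dist_lt (by unfold circ; fun_prop) (by simp [circ_one]) fun t => by
          rw [sub_sub_sub_cancel_right, norm_circ_sub c hr.le, norm_sub_rev c a]; exact ha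
      simpa using h1.mul ih

namespace MonicFamily

variable {E : Type*} [TopologicalSpace E] {F : E → Polynomial ℂ} {d : ℕ}

theorem card_roots (hF : MonicFamily F d) (e : E) : (F e).roots.card = d := by
  rw [← hF.natDegree e]; exact IsAlgClosed.card_roots_eq_natDegree

theorem mem_roots (hF : MonicFamily F d) {e : E} {z : ℂ} : z ∈ (F e).roots ↔ (F e).eval z = 0 :=
  Polynomial.mem_roots (hF.monic e).ne_zero

theorem eventually_circ (hF : MonicFamily F d) {e₀ : E} {c : ℂ} {r : ℝ} (hr : 0 < r)
    (h : ∀ z, (F e₀).eval z = 0 → ‖z - c‖ ≠ r) :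
    ∀ᶠ e in 𝓝 e₀, (∀ z, (F e).eval z = 0 → ‖z - c‖ ≠ r) ∧
      (F e).roots.countP (fun z => ‖z - c‖ < r) = (F e₀).roots.countP fun z => ‖z - c‖ < r := by
  have hev : ∀ᶠ e in 𝓝 e₀, ∀ z ∈ Metric.sphere c r,
      ‖(F e).eval z - (F e₀).eval z‖ < ‖(F e₀).eval z‖ := by
    refine (isCompact_sphere c r).eventually_forall_of_forall_eventually fun z hz => ?_
    have h1 : Continuous fun q : E × ℂ => ‖(F q.1).eval q.2 - (F e₀).eval q.2‖ :=
      (hF.cont.sub ((F e₀).continuous.comp continuous_snd)).norm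
    have h2 : Continuous fun q : E × ℂ => ‖(F e₀).eval q.2‖ :=
      ((F e₀).continuous.comp continuous_snd).norm
    refine h1.continuousAt.eventually_lt h2.continuousAt ?_
    simpa using fun h0 => h z h0 (mem_sphere_iff_norm.1 hz)
  filter_upwards [hev] with e he
  have hsph : ∀ t, circ c r t ∈ Metric.sphere c r := fun t =>
    mem_sphere_iff_norm.2 (norm_circ_sub c hr.le t)
  have hroot : ∀ z, (F e).eval z = 0 → ‖z - c‖ ≠ r := fun z hz hzr => by
    have := he z (mem_sphere_iff_norm.2 hzr)
    rw [hz, zero_sub, norm_neg] at this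
    exact this.false
  refine ⟨hroot, ?_⟩
  have hc : Continuous (circ c r) := by unfold circ; fun_prop
  have h1 := ((hF.monic e₀).hasWind_circ hr h).of_dist_lt (δ := fun t => (F e).eval (circ c r t))
    ((F e).continuous.comp hc) (by simp only [circ_one]) fun t => he _ (hsph t)
  exact_mod_cast ((hF.monic e).hasWind_circ hr hroot).unique h1

theorem eventually_exists_root (hF : MonicFamily F d) {e₀ : E} {z₀ : ℂ}
    (h : (F e₀).eval z₀ = 0) {ε : ℝ} (hε : 0 < ε) :
    ∀ᶠ q in 𝓝 (e₀, z₀), ∃ z, (F q.1).eval z = 0 ∧ ‖q.2 - z‖ < ε := by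
  have hd : 0 < d := by
    rw [← hF.card_roots e₀, Multiset.card_pos_iff_exists_mem]
    exact ⟨z₀, hF.mem_roots.2 h⟩
  have h1 : ∀ᶠ q in 𝓝 (e₀, z₀), ‖(F q.1).eval q.2‖ < ε ^ d :=
    hF.cont.norm.continuousAt.eventually_lt continuousAt_const (by simp [h, hε])
  filter_upwards [h1] with q hq
  obtain ⟨z, hz, hle⟩ := (hF.monic q.1).exists_root_norm_sub_pow_le
    (by rwa [hF.natDegree]) q.2
  rw [hF.natDegree] at hle
  exact ⟨z, hz, lt_of_pow_lt_pow_left₀ d hε.le (hle.trans_lt hq)⟩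

theorem eventually_exists_root_near (hF : MonicFamily F d) {e₀ : E} {z₀ : ℂ}
    (h : (F e₀).eval z₀ = 0) {V : Set ℂ} (hV : V ∈ 𝓝 z₀) :
    ∀ᶠ e in 𝓝 e₀, ∃ z ∈ V, (F e).eval z = 0 := by
  obtain ⟨ε, hε, hεV⟩ := Metric.mem_nhds_iff.1 hV
  have h1 : Tendsto (fun e => (e, z₀)) (𝓝 e₀) (𝓝 (e₀, z₀)) :=
    (continuous_id.prodMk continuous_const).continuousAt
  filter_upwards [h1.eventually (hF.eventually_exists_root h hε)] with e he
  obtain ⟨z, hz, hlt⟩ := he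
  exact ⟨z, hεV (by rwa [mem_ball_iff_norm']), hz⟩

/-- Finitely many points have disjoint discs of a common radius. -/
theorem exists_radius (s : Finset ℂ) :
    ∃ ε > 0, ∀ a ∈ s, ∀ b ∈ s, a ≠ b → 2 * ε ≤ ‖a - b‖ := by
  by_cases hs : s.offDiag.Nonempty
  · obtain ⟨q, hq, hmin⟩ := s.offDiag.exists_min_image (fun q => ‖q.1 - q.2‖) hs
    have hq' := Finset.mem_offDiag.1 hq
    refine ⟨‖q.1 - q.2‖ / 2, half_pos (norm_pos_iff.2 (sub_ne_zero.2 hq'.2.2)),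
      fun a ha b hb hab => ?_⟩
    rw [mul_div_cancel₀ _ two_ne_zero]
    exact hmin (a, b) (Finset.mem_offDiag.2 ⟨ha, hb, hab⟩)
  · refine ⟨1, one_pos, fun a ha b hb hab => (hs ⟨(a, b), ?_⟩).elim⟩
    exact Finset.mem_offDiag.2 ⟨ha, hb, hab⟩

/-- Continuously chosen distinct roots near a given point of the parameter space. -/
theorem eventually_exists_roots (hF : MonicFamily F d) (e₀ : E) {ε : ℝ} (hε : 0 < ε) :
    ∀ᶠ e in 𝓝 e₀, ∃ r : ℂ → ℂ, ∀ a ∈ (F e₀).roots.toFinset,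
      (F e).eval (r a) = 0 ∧ ‖r a - a‖ < ε := by
  have h : ∀ᶠ e in 𝓝 e₀, ∀ a ∈ (F e₀).roots.toFinset, ∃ z, (F e).eval z = 0 ∧ ‖z - a‖ < ε := by
    refine (Finset.eventually_all _).2 fun a ha => ?_
    filter_upwards [hF.eventually_exists_root_near (hF.mem_roots.1 (Multiset.mem_toFinset.1 ha))
      (Metric.ball_mem_nhds a hε)] with e he
    obtain ⟨z, hz, h0⟩ := he
    exact ⟨z, h0, mem_ball_iff_norm.1 hz⟩
  filter_upwards [h] with e he
  choose! r hr using he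
  exact ⟨r, hr⟩

theorem injOn_of_near {s : Finset ℂ} {ε : ℝ}
    (hsep : ∀ a ∈ s, ∀ b ∈ s, a ≠ b → 2 * ε ≤ ‖a - b‖) {r : ℂ → ℂ}
    (hr : ∀ a ∈ s, ‖r a - a‖ < ε) : Set.InjOn r s := by
  intro a ha b hb hab
  by_contra hne
  have h1 := hsep a ha b hb hne
  have h2 := norm_sub_le_norm_sub_add_norm_sub a (r a) b
  have h3 := hr a ha
  have h4 := hr b hb
  rw [norm_sub_rev] at h3
  rw [← hab] at h4
  linarith

theorem eventually_card_le (hF : MonicFamily F d) (e₀ : E) :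
    ∀ᶠ e in 𝓝 e₀, (F e₀).roots.toFinset.card ≤ (F e).roots.toFinset.card := by
  obtain ⟨ε, hε, hsep⟩ := exists_radius (F e₀).roots.toFinset
  filter_upwards [hF.eventually_exists_roots e₀ hε] with e ⟨r, hr⟩
  refine Finset.card_le_card_of_injOn r (fun a ha => ?_)
    (injOn_of_near hsep fun a ha => (hr a ha).2)
  exact Multiset.mem_toFinset.2 (hF.mem_roots.2 (hr a ha).1)

theorem nodup_iff (hF : MonicFamily F d) (e : E) :
    (F e).roots.Nodup ↔ d ≤ (F e).roots.toFinset.card := by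
  rw [← Multiset.toFinset_card_eq_card_iff_nodup, hF.card_roots]
  have := (F e).roots.toFinset_card_le
  rw [hF.card_roots] at this
  exact ⟨fun h => h.ge, fun h => this.antisymm h⟩

theorem isOpen_nodup (hF : MonicFamily F d) : IsOpen {e | (F e).roots.Nodup} := by
  refine isOpen_iff_mem_nhds.2 fun e₀ h => ?_
  filter_upwards [hF.eventually_card_le e₀] with e he
  exact (hF.nodup_iff e).2 (((hF.nodup_iff e₀).1 h).trans he)

/-- Where the number of distinct roots is locally constant, the roots are locally continuous
functions with constant multiplicities. -/
theorem exists_sheets (hF : MonicFamily F d) {e₀ : E} {n : ℕ}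
    (hn : ∀ᶠ e in 𝓝 e₀, (F e).roots.toFinset.card = n) :
    ∃ U, IsOpen U ∧ e₀ ∈ U ∧ ∃ r, Sheets {p : E × ℂ | (F p.1).eval p.2 = 0} n U r ∧
      ∀ e ∈ U, ∀ i, (F e).roots.count (r i e) = (F e₀).roots.count (r i e₀) := by
  obtain ⟨ε, hε, hsep⟩ := exists_radius (F e₀).roots.toFinset
  have hz : Fintype.card (F e₀).roots.toFinset = n := by
    rw [Fintype.card_coe]; exact hn.self_of_nhds
  let z : Fin n ≃ (F e₀).roots.toFinset := (Fintype.equivFinOfCardEq hz).symm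
  have hz0 : ∀ i, (F e₀).eval (z i : ℂ) = 0 := fun i =>
    hF.mem_roots.1 (Multiset.mem_toFinset.1 (z i).2)
  have hsepz : ∀ i j, i ≠ j → 2 * ε ≤ ‖(z i : ℂ) - z j‖ := fun i j hij =>
    hsep _ (z i).2 _ (z j).2 fun h => hij (z.injective (Subtype.ext h))
  have honly : ∀ i w, (F e₀).eval w = 0 → ‖w - z i‖ < 2 * ε → w = z i := fun i w hw hlt => by
    by_contra hne
    exact (hsep w (Multiset.mem_toFinset.2 (hF.mem_roots.2 hw)) _ (z i).2 hne).not_gt hlt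
  have hcirc : ∀ i w, (F e₀).eval w = 0 → ‖w - z i‖ ≠ ε := fun i w hw h => by
    have := honly i w hw (by linarith)
    rw [this, sub_self, norm_zero] at h
    exact hε.ne h
  have hev : ∀ᶠ e in 𝓝 e₀, (F e).roots.toFinset.card = n ∧
      (∃ r : ℂ → ℂ, ∀ a ∈ (F e₀).roots.toFinset, (F e).eval (r a) = 0 ∧ ‖r a - a‖ < ε) ∧
      ∀ i, (F e).roots.countP (fun w => ‖w - (z i : ℂ)‖ < ε) =
        (F e₀).roots.countP fun w => ‖w - (z i : ℂ)‖ < ε := by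
    refine hn.and ((hF.eventually_exists_roots e₀ hε).and (eventually_all.2 fun i => ?_))
    filter_upwards [hF.eventually_circ hε (hcirc i)] with e he using he.2
  obtain ⟨U, hUsub, hU, he₀⟩ := eventually_nhds_iff.1 hev
  have hUr : ∀ e ∈ U, ∃ r : Fin n → ℂ, (∀ i, (F e).eval (r i) = 0 ∧ ‖r i - z i‖ < ε) ∧
      Function.Injective r ∧ ∀ w, (F e).eval w = 0 → ∃ i, r i = w := fun e he => by
    obtain ⟨hcard, ⟨r, hr⟩, -⟩ := hUsub e he
    have hinj := injOn_of_near hsep fun a ha => (hr a ha).2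
    have hinj' : Function.Injective fun i => r (z i) := fun i j hij =>
      z.injective (Subtype.ext (hinj (z i).2 (z j).2 hij))
    refine ⟨fun i => r (z i), fun i => hr _ (z i).2, hinj', fun w hw => ?_⟩
    have himg : Finset.univ.image (fun i => r (z i)) = (F e).roots.toFinset := by
      refine Finset.eq_of_subset_of_card_le (fun w hw => ?_) ?_
      · obtain ⟨i, -, rfl⟩ := Finset.mem_image.1 hw
        exact Multiset.mem_toFinset.2 (hF.mem_roots.2 (hr _ (z i).2).1)
      · rw [Finset.card_image_of_injective _ hinj', Finset.card_univ, Fintype.card_fin, hcard]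
    have := himg.symm ▸ Multiset.mem_toFinset.2 (hF.mem_roots.2 hw)
    obtain ⟨i, -, hi⟩ := Finset.mem_image.1 this
    exact ⟨i, hi⟩
  choose! r hr hrinj hrall using hUr
  have huniq : ∀ e ∈ U, ∀ i w, (F e).eval w = 0 → ‖w - z i‖ < ε → w = r e i :=
    fun e he i w hw hlt => by
      obtain ⟨j, rfl⟩ := hrall e he w hw
      by_contra hne
      have hij : j ≠ i := fun h => hne (by rw [h])
      have h1 := hsepz j i hij
      have h2 := norm_sub_le_norm_sub_add_norm_sub (z j : ℂ) (r e j) (z i)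
      have h3 := (hr e he j).2
      rw [norm_sub_rev] at h3
      linarith
  have hcount : ∀ e ∈ U, ∀ i, (F e).roots.count (r e i) =
      (F e).roots.countP fun w => ‖w - (z i : ℂ)‖ < ε := fun e he i => by
    rw [Multiset.count]
    refine Multiset.countP_congr rfl fun w hw => ?_
    rw [eq_iff_iff]
    exact ⟨fun h => h ▸ (hr e he i).2, fun h => (huniq e he i w (hF.mem_roots.1 hw) h).symm⟩
  refine ⟨U, hU, he₀, fun i e => r e i, ⟨fun i e he => ?_, fun e he => hrinj e he,
    fun e he y => ⟨hrall e he y, ?_⟩⟩, fun e he i => ?_⟩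
  · refine ContinuousAt.continuousWithinAt ?_
    rw [ContinuousAt, tendsto_def]
    intro V hV
    have hball : Metric.ball (z i : ℂ) ε ∈ 𝓝 (r e i) :=
      Metric.isOpen_ball.mem_nhds (mem_ball_iff_norm.2 (hr e he i).2)
    filter_upwards [hU.mem_nhds he,
      hF.eventually_exists_root_near (hr e he i).1 (inter_mem hV hball)] with e' he' h
    obtain ⟨w, ⟨hwV, hwb⟩, hw⟩ := h
    rw [Set.mem_preimage, ← huniq e' he' i w hw (mem_ball_iff_norm.1 hwb)]
    exact hwV
  · rintro ⟨i, rfl⟩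
    exact (hr e he i).1
  · rw [hcount e he, hcount e₀ he₀]
    exact (hUsub e he).2.2 i

end MonicFamily

/-- A dense subset of a connected set which is locally connected in a strong sense is connected. -/
theorem IsPreconnected.of_dense_of_nhds {X : Type*} [TopologicalSpace X] {A B : Set X}
    (hA : IsPreconnected A) (hBA : B ⊆ A) (hd : A ⊆ closure B)
    (h : ∀ p ∈ A, ∃ O ∈ 𝓝 p, IsPreconnected (O ∩ B)) : IsPreconnected B := by
  intro u v hu hv huv ⟨a, haB, hau⟩ ⟨b, hbB, hbv⟩
  let G : Set X → Set X := fun u => {p | ∃ O ∈ 𝓝 p, IsPreconnected (O ∩ B) ∧ (O ∩ B ∩ u).Nonempty}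
  have hG : ∀ u, IsOpen (G u) := fun u => isOpen_iff_mem_nhds.2 fun p ⟨O, hO, h1, h2⟩ =>
    (eventually_mem_nhds_iff.2 hO).mono fun q hq => ⟨O, hq, h1, h2⟩
  have hmem : ∀ w, ∀ p ∈ B, p ∈ w → p ∈ G w := fun w p hp hpw => by
    obtain ⟨O, hO, h1⟩ := h p (hBA hp)
    exact ⟨O, hO, h1, p, ⟨mem_of_mem_nhds hO, hp⟩, hpw⟩
  obtain ⟨p, hpA, ⟨O, hO, hO1, hO2⟩, ⟨O', hO', hO1', hO2'⟩⟩ :=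
    hA (G u) (G v) (hG u) (hG v) (fun p hp => by
      obtain ⟨O, hO, h1⟩ := h p hp
      obtain ⟨q, hqO, hqB⟩ := mem_closure_iff_nhds.1 (hd hp) O hO
      exact (huv hqB).imp (fun hq => ⟨O, hO, h1, q, ⟨hqO, hqB⟩, hq⟩)
        fun hq => ⟨O, hO, h1, q, ⟨hqO, hqB⟩, hq⟩)
      ⟨a, hBA haB, hmem u a haB hau⟩ ⟨b, hBA hbB, hmem v b hbB hbv⟩
  obtain ⟨q, ⟨hqO, hqO'⟩, hqB⟩ := mem_closure_iff_nhds.1 (hd hpA) _ (inter_mem hO hO')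
  have hsub : ∀ O, O ∩ B ⊆ u ∪ v := fun O => Set.inter_subset_right.trans huv
  rcases huv hqB with hq | hq
  · obtain ⟨x, hx, hxuv⟩ := hO1' u v hu hv (hsub _) ⟨q, ⟨hqO', hqB⟩, hq⟩ hO2'
    exact ⟨x, hx.2, hxuv⟩
  · obtain ⟨x, hx, hxuv⟩ := hO1 u v hu hv (hsub _) hO2 ⟨q, ⟨hqO, hqB⟩, hq⟩
    exact ⟨x, hx.2, hxuv⟩

theorem dense_compl_of_dimH_lt_three {S : Set (ℂ × ℂ)} (hS : dimH S < 3) : Dense Sᶜ := by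
  refine dense_compl_of_dimH_lt_finrank (hS.trans ?_)
  rw [Module.finrank_prod, Complex.finrank_real_complex]
  norm_num

/-- The point of the real hyperplane `re w.1 = h` on the real line through `p` and `x`. -/
noncomputable def centralProj (h : ℝ) (p x : ℂ × ℂ) : ℂ × ℂ :=
  p + ((h - p.1.re) / (x.1.re - p.1.re)) • (x - p)

theorem dimH_image_centralProj_le (h : ℝ) (p : ℂ × ℂ) (S : Set (ℂ × ℂ)) :
    dimH ((fun x => ((centralProj h p x).1.im, (centralProj h p x).2)) ''
      (S ∩ {x | x.1.re ≠ p.1.re})) ≤ dimH S := by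
  refine (dimH_image_le_of_locally_lipschitzOn fun x hx => ?_).trans
    (dimH_mono Set.inter_subset_left)
  have hre : ContDiff ℝ 1 fun x : ℂ × ℂ => x.1.re := Complex.reCLM.contDiff.comp contDiff_fst
  have h0 : ContDiffAt ℝ 1 (centralProj h p) x := by
    unfold centralProj
    exact contDiffAt_const.add ((contDiffAt_const.div (hre.contDiffAt.sub contDiffAt_const)
      (sub_ne_zero.2 hx.2)).smul (contDiffAt_id.sub contDiffAt_const))
  have h1 : ContDiffAt ℝ 1 (fun x => ((centralProj h p x).1.im, (centralProj h p x).2)) x :=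
    (Complex.imCLM.contDiff.contDiffAt.comp x (contDiffAt_fst.comp x h0)).prodMk
      (contDiffAt_snd.comp x h0)
  obtain ⟨C, t, ht, hC⟩ := h1.exists_lipschitzOnWith
  exact ⟨C, t, mem_nhdsWithin_of_mem_nhds ht, hC⟩

theorem centralProj_of_mem_segment {h : ℝ} {p m x : ℂ × ℂ} (hm : m.1.re = h) (hp : p.1.re ≠ h)
    (hx : x ∈ segment ℝ p m) (hxp : x ≠ p) : x.1.re ≠ p.1.re ∧ centralProj h p x = m := by
  rw [segment_eq_image'] at hx
  obtain ⟨s, -, rfl⟩ := hx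
  have hs : s ≠ 0 := fun h0 => hxp (by simp [h0])
  have hh : h - p.1.re ≠ 0 := sub_ne_zero.2 hp.symm
  have hre : (p + s • (m - p)).1.re - p.1.re = s * (h - p.1.re) := by simp [hm]
  refine ⟨fun h1 => mul_ne_zero hs hh (by rw [← hre, h1, sub_self]), ?_⟩
  rw [centralProj, hre, add_sub_cancel_left, smul_smul]
  have : (h - p.1.re) / (s * (h - p.1.re)) * s = 1 := by field_simp
  rw [this, one_smul, add_sub_cancel]

/-- A set of dimension less than three does not separate a convex open subset of `ℂ²`. -/
theorem Convex.isPreconnected_diff_of_dimH_lt {D S : Set (ℂ × ℂ)} (hD : Convex ℝ D)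
    (hDo : IsOpen D) (hS : dimH S < 3) : IsPreconnected (D \ S) := by
  refine isPreconnected_of_forall_pair fun p hp q hq => ?_
  obtain ⟨h, hph, hqh, a, haD, hah⟩ : ∃ h : ℝ, p.1.re ≠ h ∧ q.1.re ≠ h ∧ ∃ a ∈ D, a.1.re = h := by
    have hfin : ({p.1.re, q.1.re} : Set ℝ).Finite := by simp
    have hopen : IsOpen {t : ℝ | p + ((t : ℂ), (0 : ℂ)) ∈ D} :=
      hDo.preimage (by fun_prop)
    have h0 : (0 : ℝ) ∈ {t : ℝ | p + ((t : ℂ), (0 : ℂ)) ∈ D} := by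
      simpa [Prod.mk_zero_zero] using hp.1
    have hfin' : ((fun t : ℝ => p.1.re + t) ⁻¹' {p.1.re, q.1.re}).Finite :=
      hfin.preimage (add_right_injective _).injOn
    obtain ⟨t, htD, ht⟩ := (Set.Countable.dense_compl ℝ hfin'.countable).inter_open_nonempty _ hopen ⟨0, h0⟩
    simp only [Set.mem_compl_iff, Set.mem_preimage, Set.mem_insert_iff, Set.mem_singleton_iff,
      not_or] at ht
    exact ⟨p.1.re + t, fun h => ht.1 h.symm, fun h => ht.2 h.symm, _, htD, by simp⟩
  let T : Set (ℝ × ℂ) := (fun x => ((centralProj h p x).1.im, (centralProj h p x).2)) ''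
      (S ∩ {x | x.1.re ≠ p.1.re}) ∪ (fun x => ((centralProj h q x).1.im, (centralProj h q x).2)) ''
      (S ∩ {x | x.1.re ≠ q.1.re})
  have hT : Dense Tᶜ := by
    refine dense_compl_of_dimH_lt_finrank ?_
    rw [Module.finrank_prod, Complex.finrank_real_complex, Module.finrank_self, dimH_union]
    refine (max_le (dimH_image_centralProj_le h p S) (dimH_image_centralProj_le h q S)).trans_lt
      (hS.trans_le ?_)
    norm_num
  let e : ℝ × ℂ → ℂ × ℂ := fun b => (h + b.1 * Complex.I, b.2)
  have he : Continuous e := by fun_prop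
  have hea : e (a.1.im, a.2) = a := Prod.ext (by simp [e, ← hah, Complex.re_add_im]) rfl
  obtain ⟨b, hbD, hbT⟩ := hT.inter_open_nonempty _ (hDo.preimage he) ⟨(a.1.im, a.2), by
    rw [Set.mem_preimage, hea]; exact haD⟩
  have heb : (e b).1.re = h := by simp [e]
  have hebi : ((e b).1.im, (e b).2) = b := by simp [e]
  have hseg : ∀ r ∈ D \ S, r.1.re ≠ h → b ∉ (fun x => ((centralProj h r x).1.im,
      (centralProj h r x).2)) '' (S ∩ {x | x.1.re ≠ r.1.re}) → segment ℝ r (e b) ⊆ D \ S := by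
    refine fun r hr hrh hb x hx => ⟨hD.segment_subset hr.1 hbD hx, fun hxS => hb ?_⟩
    obtain ⟨h1, h2⟩ := centralProj_of_mem_segment heb hrh hx fun h => hr.2 (h ▸ hxS)
    exact ⟨x, ⟨hxS, h1⟩, by simp only [h2]; exact hebi⟩
  have hbT' := not_or.1 hbT
  refine ⟨segment ℝ p (e b) ∪ segment ℝ q (e b), Set.union_subset (hseg p hp hph hbT'.1)
    (hseg q hq hqh hbT'.2), .inl (left_mem_segment ℝ _ _), .inr (left_mem_segment ℝ _ _), ?_⟩
  exact IsPreconnected.union (e b) (right_mem_segment ℝ _ _) (right_mem_segment ℝ _ _)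
    (convex_segment _ _).isPreconnected (convex_segment _ _).isPreconnected

theorem exists_smul_eq_of_notMem_coneBase {L : Set (ℂ × ℂ)} (hL0 : ∀ b ∈ L, b ≠ 0) {w : ℂ × ℂ}
    (h0 : w ≠ 0) (hw : w ∉ coneBase L) : ∃ b ∈ L, ∃ c : ℂ, c • b = w := by
  simp only [coneBase, Set.mem_ofPred_eq, not_and] at hw
  push Not at hw
  obtain ⟨b, hb, h⟩ := hw h0
  refine ⟨b, hb, ?_⟩
  by_cases hb1 : b.1 = 0
  · have hb2 : b.2 ≠ 0 := fun h2 => hL0 b hb (Prod.ext hb1 h2)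
    refine ⟨w.2 / b.2, Prod.ext ?_ ?_⟩
    · have : w.1 = 0 := by simpa [hb1, hb2] using h
      simp [hb1, this]
    · simp [hb2]
  · refine ⟨w.1 / b.1, Prod.ext (by simp [hb1]) ?_⟩
    simp only [Prod.smul_snd, smul_eq_mul]
    field_simp
    linear_combination h

theorem dimH_range_smul_le {V : Type*} [NormedAddCommGroup V] [NormedSpace ℂ V] (b : V) :
    dimH (Set.range fun c : ℂ => c • b) ≤ 2 := by
  have h1 : ContDiff ℝ 1 fun c : ℂ => c • b := by fun_prop
  simpa [Complex.finrank_real_complex] using h1.dimH_range_le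

theorem dimH_compl_coneBase_le {L : Set (ℂ × ℂ)} (hL : L.Finite) (hL0 : ∀ b ∈ L, b ≠ 0) :
    dimH (coneBase L)ᶜ ≤ 2 := by
  have hsub : (coneBase L)ᶜ ⊆ {0} ∪ ⋃ b ∈ L, Set.range fun c : ℂ => c • b := by
    intro w hw
    by_cases h0 : w = 0
    · exact .inl h0
    · obtain ⟨b, hb, h⟩ := exists_smul_eq_of_notMem_coneBase hL0 h0 hw
      exact .inr (Set.mem_biUnion hb h)
  refine (dimH_mono hsub).trans ?_
  rw [dimH_union, dimH_singleton, dimH_bUnion hL.countable]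
  exact max_le zero_le (iSup₂_le fun b _ => dimH_range_smul_le b)

theorem isPreconnected_coneBase {L : Set (ℂ × ℂ)} (hL : L.Finite) (hL0 : ∀ b ∈ L, b ≠ 0) :
    IsPreconnected (coneBase L) := by
  have := convex_univ.isPreconnected_diff_of_dimH_lt isOpen_univ
    ((dimH_compl_coneBase_le hL hL0).trans_lt (by norm_num))
  rwa [← Set.compl_eq_univ_sdiff, compl_compl] at this

theorem dense_coneBase {L : Set (ℂ × ℂ)} (hL : L.Finite) (hL0 : ∀ b ∈ L, b ≠ 0) :
    Dense (coneBase L) := by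
  have := dense_compl_of_dimH_lt_three ((dimH_compl_coneBase_le hL hL0).trans_lt (by norm_num))
  rwa [compl_compl] at this

/-- Near each of its points, a set with local sheets is the graph of a continuous function. -/
theorem LocSheets.exists_graph {X : Type*} [PseudoMetricSpace X] {S : Set (X × ℂ)} {n : ℕ}
    {O : Set X} (h : LocSheets S n O) (hO : IsOpen O) {p : X × ℂ} (hp : p ∈ S) (hpO : p.1 ∈ O) :
    ∃ δ > 0, ∃ (r : X → ℂ) (W : Set (X × ℂ)), W ∈ 𝓝 p ∧ Metric.ball p.1 δ ⊆ O ∧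
      ContinuousOn r (Metric.ball p.1 δ) ∧ r p.1 = p.2 ∧
      W ∩ S = (fun w => (w, r w)) '' Metric.ball p.1 δ := by
  obtain ⟨U, hU, hpU, r, hr⟩ := h p.1 hpO
  obtain ⟨i, hi⟩ := (hr.mem_iff _ hpU p.2).1 hp
  obtain ⟨W, hW, hWS⟩ := mem_nhdsWithin_iff_exists_mem_nhds_inter.1 (hr.eventually_eq hU hpU hi)
  have hg : ContinuousAt (fun w => (w, r i w)) p.1 :=
    continuousAt_id.prodMk ((hr.cont i).continuousAt (hU.mem_nhds hpU))
  have hW' : W ∈ 𝓝 (p.1, r i p.1) := by rwa [hi]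
  obtain ⟨δ, hδ, hball⟩ := Metric.mem_nhds_iff.1
    (inter_mem (hg hW') (inter_mem (hU.mem_nhds hpU) (hO.mem_nhds hpO)))
  refine ⟨δ, hδ, r i, W ∩ {q | q.1 ∈ Metric.ball p.1 δ},
    inter_mem hW (continuousAt_fst (Metric.ball_mem_nhds _ hδ)), fun w hw => (hball hw).2.2,
    (hr.cont i).mono fun w hw => (hball hw).2.1, hi, ?_⟩
  ext q
  constructor
  · rintro ⟨⟨hqW, hqb⟩, hqS⟩
    exact ⟨q.1, hqb, Prod.ext rfl (hWS ⟨hqW, hqS⟩).2⟩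
  · rintro ⟨w, hw, rfl⟩
    exact ⟨⟨(hball hw).1, hw⟩, hr.mem (hball hw).2.1 i⟩

/-- A component of the part of `X` over `O`. -/
def IsSheetComp (X : Set ((ℂ × ℂ) × ℂ)) (O : Set (ℂ × ℂ)) (A : Set ((ℂ × ℂ) × ℂ)) : Prop :=
  ∃ p ∈ X ∩ {p | p.1 ∈ O}, A = connectedComponentIn (X ∩ {p | p.1 ∈ O}) p

namespace IsSheetComp

variable {X A B : Set ((ℂ × ℂ) × ℂ)} {O : Set (ℂ × ℂ)} {n : ℕ}

theorem subset (h : IsSheetComp X O A) : A ⊆ X ∩ {p | p.1 ∈ O} := by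
  obtain ⟨p, -, rfl⟩ := h
  exact connectedComponentIn_subset _ _

theorem isPreconnected (h : IsSheetComp X O A) : IsPreconnected A := by
  obtain ⟨p, -, rfl⟩ := h
  exact isPreconnected_connectedComponentIn

theorem nonempty (h : IsSheetComp X O A) : A.Nonempty := by
  obtain ⟨p, hp, rfl⟩ := h
  exact ⟨p, mem_connectedComponentIn hp⟩

theorem subset_of_isPreconnected (h : IsSheetComp X O A) {T : Set ((ℂ × ℂ) × ℂ)}
    (hT : IsPreconnected T) (hTX : T ⊆ X ∩ {p | p.1 ∈ O}) (hne : (T ∩ A).Nonempty) : T ⊆ A := by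
  obtain ⟨p, -, rfl⟩ := h
  obtain ⟨q, hqT, hqA⟩ := hne
  rw [connectedComponentIn_eq hqA]
  exact hT.subset_connectedComponentIn hqT hTX

theorem eq_of_nonempty (hA : IsSheetComp X O A) (hB : IsSheetComp X O B)
    (hne : (A ∩ B).Nonempty) : A = B :=
  (hB.subset_of_isPreconnected hA.isPreconnected hA.subset hne).antisymm
    (hA.subset_of_isPreconnected hB.isPreconnected hB.subset (Set.inter_comm A B ▸ hne))

theorem exists_mem {p : (ℂ × ℂ) × ℂ} (hp : p ∈ X) (hpO : p.1 ∈ O) :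
    ∃ A, IsSheetComp X O A ∧ p ∈ A :=
  ⟨_, ⟨p, ⟨hp, hpO⟩, rfl⟩, mem_connectedComponentIn ⟨hp, hpO⟩⟩

theorem exists_of_isPreconnected {T : Set ((ℂ × ℂ) × ℂ)} (hT : IsPreconnected T)
    (hne : T.Nonempty) (hTX : T ⊆ X ∩ {p | p.1 ∈ O}) : ∃ A, IsSheetComp X O A ∧ T ⊆ A := by
  obtain ⟨q, hq⟩ := hne
  obtain ⟨A, hA, hqA⟩ := exists_mem (hTX hq).1 (hTX hq).2
  exact ⟨A, hA, hA.subset_of_isPreconnected hT hTX ⟨q, hq, hqA⟩⟩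

theorem exists_graph (hA : IsSheetComp X O A) (hX : LocSheets X n O) (hO : IsOpen O)
    {p : (ℂ × ℂ) × ℂ} (hp : p ∈ A) :
    ∃ δ > 0, ∃ (r : ℂ × ℂ → ℂ) (W : Set ((ℂ × ℂ) × ℂ)), W ∈ 𝓝 p ∧ Metric.ball p.1 δ ⊆ O ∧
      ContinuousOn r (Metric.ball p.1 δ) ∧ r p.1 = p.2 ∧
      W ∩ X = (fun w => (w, r w)) '' Metric.ball p.1 δ ∧
      W ∩ A = (fun w => (w, r w)) '' Metric.ball p.1 δ := by
  obtain ⟨δ, hδ, r, W, hW, hb, hr, hrp, heq⟩ := hX.exists_graph hO (hA.subset hp).1 (hA.subset hp).2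
  refine ⟨δ, hδ, r, W, hW, hb, hr, hrp, heq, subset_antisymm
    (heq ▸ Set.inter_subset_inter_right _ fun q hq => (hA.subset hq).1) ?_⟩
  have hconn : IsPreconnected ((fun w => (w, r w)) '' Metric.ball p.1 δ) :=
    (convex_ball p.1 δ).isPreconnected.image _ (continuousOn_id.prodMk hr)
  have hpg : p ∈ (fun w => (w, r w)) '' Metric.ball p.1 δ :=
    ⟨p.1, Metric.mem_ball_self hδ, Prod.ext rfl hrp⟩
  have hsub : (fun w => (w, r w)) '' Metric.ball p.1 δ ⊆ X ∩ {p | p.1 ∈ O} := by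
    refine fun q hq => ⟨(heq.symm ▸ hq : q ∈ W ∩ X).2, ?_⟩
    obtain ⟨w, hw, rfl⟩ := hq
    exact hb hw
  exact fun q hq => ⟨(heq.symm ▸ hq : q ∈ W ∩ X).1,
    hA.subset_of_isPreconnected hconn hsub ⟨p, hpg, hp⟩ hq⟩

theorem subset_closure_diff (hA : IsSheetComp X O A) (hX : LocSheets X n O) (hO : IsOpen O)
    {T : Set ((ℂ × ℂ) × ℂ)} (hT : dimH (Prod.fst '' T) < 3) : A ⊆ closure (A \ T) := by
  intro p hp
  obtain ⟨δ, hδ, r, W, -, -, hr, hrp, -, hWA⟩ := hA.exists_graph hX hO hp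
  have h1 : p.1 ∈ closure (Metric.ball p.1 δ ∩ (Prod.fst '' T)ᶜ) :=
    (dense_compl_of_dimH_lt_three hT).open_subset_closure_inter Metric.isOpen_ball
      (Metric.mem_ball_self hδ)
  have h2 : ContinuousWithinAt (fun w => (w, r w)) (Metric.ball p.1 δ ∩ (Prod.fst '' T)ᶜ) p.1 :=
    ((continuousOn_id.prodMk hr) p.1 (Metric.mem_ball_self hδ)).mono Set.inter_subset_left
  have h3 := h2.mem_closure_image h1
  rw [show (p.1, r p.1) = p from Prod.ext rfl hrp] at h3
  refine closure_mono ?_ h3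
  rintro _ ⟨w, ⟨hw, hwT⟩, rfl⟩
  have : (w, r w) ∈ W ∩ A := hWA.symm ▸ ⟨w, hw, rfl⟩
  exact ⟨this.2, fun h => hwT ⟨_, h, rfl⟩⟩

/-- A component of a two-dimensional complex cover is not separated by a small set. -/
theorem isPreconnected_diff (hA : IsSheetComp X O A) (hX : LocSheets X n O) (hO : IsOpen O)
    {T : Set ((ℂ × ℂ) × ℂ)} (hT : dimH (Prod.fst '' T) < 3) : IsPreconnected (A \ T) := by
  refine hA.isPreconnected.of_dense_of_nhds Set.sdiff_subset (hA.subset_closure_diff hX hO hT)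
    fun p hp => ?_
  obtain ⟨δ, hδ, r, W, hW, -, hr, hrp, -, hWA⟩ := hA.exists_graph hX hO hp
  refine ⟨W, hW, ?_⟩
  have heq : W ∩ (A \ T) =
      (fun w => (w, r w)) '' (Metric.ball p.1 δ \ (fun w => (w, r w)) ⁻¹' T) := by
    rw [← Set.inter_sdiff_assoc, hWA]
    ext q
    constructor
    · rintro ⟨⟨w, hw, rfl⟩, h⟩
      exact ⟨w, ⟨hw, h⟩, rfl⟩
    · rintro ⟨w, ⟨hw, h⟩, rfl⟩
      exact ⟨⟨w, hw, rfl⟩, h⟩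
  rw [heq]
  refine ((convex_ball p.1 δ).isPreconnected_diff_of_dimH_lt Metric.isOpen_ball
    ((dimH_mono ?_).trans_lt hT)).image _ ((continuousOn_id.prodMk hr).mono Set.sdiff_subset)
  exact fun w hw => ⟨_, hw, rfl⟩

end IsSheetComp

/-- A homogeneous family of monic polynomials, with parameter `(s, w)`: the fibre over `s = 0` is a
cone whose number of distinct roots is `n` off finitely many lines, and the general member of every
other fibre has simple roots. -/
structure ConicFamily (H : ℂ × (ℂ × ℂ) → Polynomial ℂ) (d n : ℕ) (L : Set (ℂ × ℂ)) : Prop where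
  fam : MonicFamily H d
  hom : ∀ (c s : ℂ) (w : ℂ × ℂ) (y : ℂ),
    (H (c * s, c • w)).eval (c * y) = c ^ d * (H (s, w)).eval y
  dense : ∀ s ≠ 0, Dense {w | (H (s, w)).roots.Nodup}
  finite_lines : L.Finite
  line_ne_zero : ∀ b ∈ L, b ≠ 0
  card : ∀ w ∈ coneBase L, (H (0, w)).roots.toFinset.card = n

theorem MonicFamily.comp {E E' : Type*} [TopologicalSpace E] [TopologicalSpace E']
    {F : E → Polynomial ℂ} {d : ℕ} (hF : MonicFamily F d) {u : E' → E} (hu : Continuous u) :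
    MonicFamily (fun e => F (u e)) d where
  monic _ := hF.monic _
  natDegree _ := hF.natDegree _
  cont := hF.cont.comp ((hu.comp continuous_fst).prodMk continuous_snd)

theorem Sheets.ncard_fibre {X : Type*} [TopologicalSpace X] {S : Set (X × ℂ)} {N : ℕ} {O : Set X}
    {r : Fin N → X → ℂ} (h : Sheets S N O r) {x : X} (hx : x ∈ O) :
    {y | (x, y) ∈ S}.ncard = N := by
  have : {y | (x, y) ∈ S} = Set.range fun i => r i x := by
    ext y; exact h.mem_iff x hx y
  rw [this, Set.ncard_range_of_injective (h.inj x hx), Nat.card_fin]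

/-- The zero set of the members of a family. -/
def famZero {E : Type*} (F : E → Polynomial ℂ) : Set (E × ℂ) := {p | (F p.1).eval p.2 = 0}

namespace IsSheetComp

variable {X A : Set ((ℂ × ℂ) × ℂ)} {O : Set (ℂ × ℂ)} {n : ℕ}

theorem mem_of_mem_closure (hA : IsSheetComp X O A) (hX : LocSheets X n O) (hO : IsOpen O)
    {p : (ℂ × ℂ) × ℂ} (hp : p ∈ X) (hpO : p.1 ∈ O) (hpA : p ∈ closure A) : p ∈ A := by
  obtain ⟨B, hB, hpB⟩ := exists_mem hp hpO
  obtain ⟨δ, hδ, r, W, hW, -, -, -, hWX, hWB⟩ := hB.exists_graph hX hO hpB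
  obtain ⟨q, hqW, hqA⟩ := mem_closure_iff_nhds.1 hpA W hW
  have : q ∈ W ∩ B := by rw [hWB, ← hWX]; exact ⟨hqW, (hA.subset hqA).1⟩
  rwa [hA.eq_of_nonempty hB ⟨q, hqA, this.2⟩]

theorem exists_locSheets (hA : IsSheetComp X O A) (hX : LocSheets X n O) (hO : IsOpen O)
    (hOc : IsPreconnected O) : ∃ N, LocSheets A N O := by
  have key : ∀ w ∈ O, ∃ U, IsOpen U ∧ w ∈ U ∧ ∃ N r, Sheets A N U r := fun w hw => by
    obtain ⟨U, hU, hwU, r, hr⟩ := hX w hw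
    obtain ⟨δ, hδ, hball⟩ := Metric.isOpen_iff.1 (hU.inter hO) w ⟨hwU, hw⟩
    have hr' := hr.mono fun x hx => (hball hx).1
    classical
    let J := {i : Fin n // (w, r i w) ∈ A}
    let e : Fin (Fintype.card J) ≃ J := (Fintype.equivFin J).symm
    have hgraph : ∀ i, ∀ x ∈ Metric.ball w δ, ∀ x' ∈ Metric.ball w δ, (x, r i x) ∈ A →
        (x', r i x') ∈ A := fun i x hx x' hx' hxA => by
      have hconn : IsPreconnected ((fun w => (w, r i w)) '' Metric.ball w δ) :=
        (convex_ball w δ).isPreconnected.image _ (continuousOn_id.prodMk (hr'.cont i))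
      refine hA.subset_of_isPreconnected hconn ?_ ⟨_, ⟨x, hx, rfl⟩, hxA⟩ ⟨x', hx', rfl⟩
      rintro _ ⟨z, hz, rfl⟩
      exact ⟨hr'.mem hz i, (hball hz).2⟩
    have hw0 := Metric.mem_ball_self (x := w) hδ
    refine ⟨_, Metric.isOpen_ball, hw0, Fintype.card J, fun j => r (e j).1,
      fun j => hr'.cont _, fun x hx i j hij => e.injective (Subtype.ext (hr'.inj x hx hij)),
      fun x hx y => ⟨fun hy => ?_, ?_⟩⟩
    · obtain ⟨i, rfl⟩ := (hr'.mem_iff x hx y).1 (hA.subset hy).1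
      exact ⟨e.symm ⟨i, hgraph i x hx w hw0 hy⟩, by simp⟩
    · rintro ⟨j, rfl⟩
      exact hgraph _ w hw0 x hx (e j).2
  have hconst : ∀ w ∈ O, ∀ w' ∈ O, {y | (w, y) ∈ A}.ncard = {y | (w', y) ∈ A}.ncard :=
    fun w hw w' hw' => by
      refine hOc.constant (f := fun w => {y | (w, y) ∈ A}.ncard) (fun x hx => ?_) hw hw'
      obtain ⟨U, hU, hxU, N, r, hr⟩ := key x hx
      refine ContinuousAt.continuousWithinAt (ContinuousAt.congr
        (continuousAt_const (y := N)) ?_)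
      filter_upwards [hU.mem_nhds hxU] with x' hx' using (hr.ncard_fibre hx').symm
  obtain ⟨p, hp⟩ := hA.nonempty
  refine ⟨{y | (p.1, y) ∈ A}.ncard, fun w hw => ?_⟩
  obtain ⟨U, hU, hwU, N, r, hr⟩ := key w hw
  have := hr.ncard_fibre hwU
  rw [hconst w hw p.1 (hA.subset hp).2] at this
  subst this
  exact ⟨U, hU, hwU, r, hr⟩

end IsSheetComp

namespace ConicFamily

variable {H : ℂ × (ℂ × ℂ) → Polynomial ℂ} {d n : ℕ} {L : Set (ℂ × ℂ)}

theorem fam_slice (h : ConicFamily H d n L) (s : ℂ) : MonicFamily (fun w => H (s, w)) d :=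
  h.fam.comp (by fun_prop)

theorem smul_mem_iff (h : ConicFamily H d n L) {c : ℂ} (hc : c ≠ 0) {p : (ℂ × ℂ) × ℂ} :
    c • p ∈ famZero (fun w => H (0, w)) ↔ p ∈ famZero (fun w => H (0, w)) := by
  have := h.hom c 0 p.1 p.2
  rw [mul_zero] at this
  simp only [famZero, Set.mem_ofPred_eq, Prod.smul_fst, Prod.smul_snd, smul_eq_mul, this]
  simp [hc]

theorem eq_zero_of_base (h : ConicFamily H d n L) {p : (ℂ × ℂ) × ℂ}
    (hp : p ∈ famZero (fun w => H (0, w))) (h0 : p.1 = 0) : p = 0 := by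
  have key : ∀ y, (H (0, 0)).eval y = y ^ d * (H (0, 0)).eval 1 := fun y => by
    simpa using h.hom y 0 0 1
  have h1 : (H (0, 0)).eval 1 ≠ 0 := fun h1 => by
    refine (h.fam.monic (0, 0)).ne_zero (Polynomial.funext fun y => ?_)
    rw [key, h1]; simp
  refine Prod.ext h0 ?_
  have h2 : (H (0, p.1)).eval p.2 = 0 := hp
  rw [h0, key] at h2
  exact eq_zero_of_pow_eq_zero ((mul_eq_zero.1 h2).resolve_right h1)

theorem isClosed (h : ConicFamily H d n L) : IsClosed (famZero fun w => H (0, w)) :=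
  isClosed_singleton.preimage (h.fam_slice 0).cont

theorem exists_bound (h : ConicFamily H d n L) :
    ∃ M : ℝ, ∀ p ∈ famZero (fun w => H (0, w)), ‖p.2‖ ≤ M * ‖p.1‖ := by
  have hev : ∀ᶠ w in 𝓝 (0 : ℂ × ℂ), ∀ y ∈ Metric.sphere (0 : ℂ) 1,
      (w, y) ∉ famZero fun w => H (0, w) := by
    refine (isCompact_sphere (0 : ℂ) 1).eventually_forall_of_forall_eventually fun y hy => ?_
    refine h.isClosed.isOpen_compl.mem_nhds fun hmem => ?_
    have := congrArg Prod.snd (h.eq_zero_of_base hmem rfl)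
    simp only [Prod.snd_zero] at this
    simp [this] at hy
  obtain ⟨ε, hε, hball⟩ := Metric.eventually_nhds_iff_ball.1 hev
  refine ⟨ε⁻¹, fun p hp => ?_⟩
  by_cases hy : p.2 = 0
  · rw [hy, norm_zero]; positivity
  · have hmem := (h.smul_mem_iff (inv_ne_zero hy)).2 hp
    by_contra hlt
    refine hball (p.2⁻¹ • p.1) ?_ (p.2⁻¹ * p.2) ?_ hmem
    · rw [mem_ball_zero_iff, norm_smul, norm_inv, inv_mul_lt_iff₀ (norm_pos_iff.2 hy)]
      rw [not_le, inv_mul_lt_iff₀ hε] at hlt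
      linarith
    · simp [hy]

theorem locSheets (h : ConicFamily H d n L) :
    LocSheets (famZero fun w => H (0, w)) n (coneBase L) := fun w hw => by
  obtain ⟨U, hU, hwU, r, hr, -⟩ := (h.fam_slice 0).exists_sheets (e₀ := w) (n := n)
    (eventually_of_mem ((isOpen_coneBase h.finite_lines).mem_nhds hw) h.card)
  exact ⟨U, hU, hwU, r, hr⟩

variable {A : Set ((ℂ × ℂ) × ℂ)}

theorem exists_mult (h : ConicFamily H d n L)
    (hA : IsSheetComp (famZero fun w => H (0, w)) (coneBase L) A) :
    ∃ m, 0 < m ∧ ∀ p ∈ A, (H (0, p.1)).roots.count p.2 = m := by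
  obtain ⟨p, hp⟩ := hA.nonempty
  refine ⟨(H (0, p.1)).roots.count p.2,
    Multiset.count_pos.2 ((h.fam_slice 0).mem_roots.2 (hA.subset hp).1), fun q hq => ?_⟩
  refine hA.isPreconnected.constant (f := fun q => (H (0, q.1)).roots.count q.2)
    (fun x hx => ?_) hq hp
  obtain ⟨U, hU, hwU, r, hr, hcount⟩ := (h.fam_slice 0).exists_sheets (e₀ := x.1) (n := n)
    (eventually_of_mem ((isOpen_coneBase h.finite_lines).mem_nhds (hA.subset hx).2) h.card)
  obtain ⟨i, hi⟩ := (hr.mem_iff _ hwU x.2).1 (hA.subset hx).1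
  have hev : ∀ᶠ q in 𝓝[A] x, (H (0, q.1)).roots.count q.2 = (H (0, x.1)).roots.count x.2 := by
    filter_upwards [nhdsWithin_mono _ (fun q hq => (hA.subset hq).1)
      (hr.eventually_eq hU hwU hi)] with q hq
    rw [← hq.2, ← hi, hcount _ hq.1]
  exact tendsto_nhds_of_eventually_eq hev

theorem smul_mem_comp (h : ConicFamily H d n L)
    (hA : IsSheetComp (famZero fun w => H (0, w)) (coneBase L) A) {c : ℂ} (hc : c ≠ 0)
    {p : (ℂ × ℂ) × ℂ} (hp : p ∈ A) : c • p ∈ A := by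
  have hconn : IsPreconnected ((fun c : ℂ => c • p) '' {0}ᶜ) :=
    (isConnected_compl_singleton_of_one_lt_rank (by simp) (0 : ℂ)).isPreconnected.image _
      (by fun_prop)
  refine hA.subset_of_isPreconnected hconn ?_ ⟨p, ⟨1, by simp, one_smul _ _⟩, hp⟩ ⟨c, hc, rfl⟩
  rintro _ ⟨c, hc, rfl⟩
  exact ⟨(h.smul_mem_iff hc).2 (hA.subset hp).1, smul_mem_coneBase (hA.subset hp).2 hc⟩

theorem closure_comp_subset (h : ConicFamily H d n L)
    (hA : IsSheetComp (famZero fun w => H (0, w)) (coneBase L) A) :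
    closure A ⊆ famZero fun w => H (0, w) :=
  closure_minimal (fun _ hp => (hA.subset hp).1) h.isClosed

theorem mem_comp_iff (h : ConicFamily H d n L)
    (hA : IsSheetComp (famZero fun w => H (0, w)) (coneBase L) A) {p : (ℂ × ℂ) × ℂ}
    (hp : p.1 ∈ coneBase L) : p ∈ closure A \ {0} ↔ p ∈ A := by
  refine ⟨fun hpA => hA.mem_of_mem_closure h.locSheets (isOpen_coneBase h.finite_lines)
    (h.closure_comp_subset hA hpA.1) hp hpA.1, fun hpA => ⟨subset_closure hpA, ?_⟩⟩
  rintro rfl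
  exact hp.1 rfl

/-- The closures of the components of a cone are cone covers. -/
theorem exists_coneCover (h : ConicFamily H d n L)
    (hA : IsSheetComp (famZero fun w => H (0, w)) (coneBase L) A) :
    ∃ N, ConeCover (closure A \ {0}) N L ∧ LocSheets A N (coneBase L) := by
  have hO := isOpen_coneBase h.finite_lines
  obtain ⟨N, hN⟩ := hA.exists_locSheets h.locSheets hO
    (isPreconnected_coneBase h.finite_lines h.line_ne_zero)
  have hdim : ∀ b : ℂ × ℂ, b ≠ 0 → dimH (Prod.fst '' {p : (ℂ × ℂ) × ℂ |
      p.1 ∉ coneBase (insert b L)}) < 3 := fun b hb => by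
    refine (dimH_mono ?_).trans_lt ((dimH_compl_coneBase_le (h.finite_lines.insert b)
      ((Set.forall_mem_insert).2 ⟨hb, h.line_ne_zero⟩)).trans_lt (by norm_num))
    rintro _ ⟨p, hp, rfl⟩
    exact hp
  have heq : ∀ b, (closure A \ {0}) ∩ {p | p.1 ∈ coneBase (insert b L)} =
      A \ {p | p.1 ∉ coneBase (insert b L)} := fun b => by
    ext p
    constructor
    · rintro ⟨hp, hpL⟩
      exact ⟨(h.mem_comp_iff hA (mem_coneBase_insert.1 hpL).1).1 hp, not_not.2 hpL⟩
    · rintro ⟨hp, hpL⟩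
      have hpL := not_not.1 hpL
      exact ⟨(h.mem_comp_iff hA (mem_coneBase_insert.1 hpL).1).2 hp, hpL⟩
  obtain ⟨M, hM⟩ := h.exists_bound
  refine ⟨N, ⟨h.finite_lines, h.line_ne_zero, fun c hc p hp => ⟨?_, ?_⟩, fun p hp h0 => ?_, ?_,
    ⟨M, fun p hp => hM p (h.closure_comp_subset hA hp.1)⟩, fun w => ?_, fun w hw => ?_,
    fun b hb => ?_, fun b hb => ?_⟩, hN⟩
  · exact map_mem_closure (continuous_const_smul c) hp.1 fun q hq => h.smul_mem_comp hA hc hq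
  · exact smul_ne_zero hc hp.2
  · exact hp.2 (h.eq_zero_of_base (h.closure_comp_subset hA hp.1) h0)
  · rw [Set.sdiff_union_self]
    exact isClosed_closure.union isClosed_singleton
  · refine (((H (0, w)).roots.toFinset.finite_toSet).image fun y => (w, y)).subset ?_
    rintro p ⟨hp, rfl⟩
    exact ⟨p.2, Multiset.mem_toFinset.2
      ((h.fam_slice 0).mem_roots.2 (h.closure_comp_subset hA hp.1)), rfl⟩
  · obtain ⟨U, hU, hwU, r, hr⟩ := hN w hw
    have hr' := hr.mono (Set.inter_subset_left (t := coneBase L))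
    exact ⟨U ∩ coneBase L, hU.inter hO, ⟨hwU, hw⟩, r, hr'.cont, hr'.inj,
      fun x hx y => (h.mem_comp_iff hA (p := (x, y)) hx.2).trans (hr'.mem_iff x hx y)⟩
  · rw [heq]
    exact hA.isPreconnected_diff h.locSheets hO (hdim b hb)
  · rw [heq]
    exact Set.sdiff_subset.trans (closure_minimal
      (hA.subset_closure_diff h.locSheets hO (hdim b hb)) isClosed_closure)

end ConicFamily

/-- `φ` and `ψ` are mutually inverse Lipschitz bijections between the complements of two compact
sets. -/
structure BiLipEnds {E : Type*} [NormedAddCommGroup E] (K K' : Set E) (C : NNReal)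
    (φ ψ : E → E) : Prop where
  compact : IsCompact K
  compact' : IsCompact K'
  lip : LipschitzOnWith C φ Kᶜ
  lip' : LipschitzOnWith C ψ K'ᶜ
  maps : Set.MapsTo φ Kᶜ K'ᶜ
  maps' : Set.MapsTo ψ K'ᶜ Kᶜ
  left : ∀ p ∈ Kᶜ, ψ (φ p) = p
  right : ∀ p ∈ K'ᶜ, φ (ψ p) = p

theorem BiLipEnds.symm {E : Type*} [NormedAddCommGroup E] {K K' : Set E} {C : NNReal}
    {φ ψ : E → E} (h : BiLipEnds K K' C φ ψ) :
    BiLipEnds K' K C ψ φ :=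
  ⟨h.compact', h.compact, h.lip', h.lip, h.maps', h.maps, h.right, h.left⟩

section BlowDown

variable {E : Type*} [NormedAddCommGroup E] [NormedSpace ℝ E]

/-- The conjugate of a map by a dilation. -/
noncomputable def rescale (φ : E → E) (s : ℝ) (p : E) : E := s • φ (s⁻¹ • p)

theorem eventually_inv_smul_notMem {K : Set E} (hK : IsCompact K) {p : E} (hp : p ≠ 0) :
    ∀ᶠ q in 𝓝[>] (0 : ℝ) ×ˢ 𝓝 p, 0 < q.1 ∧ q.1⁻¹ • q.2 ∉ K := by
  obtain ⟨R, hR⟩ := hK.isBounded.exists_norm_le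
  have h1 : Tendsto (fun q : ℝ × E => q.1⁻¹) (𝓝[>] (0 : ℝ) ×ˢ 𝓝 p) atTop :=
    tendsto_inv_nhdsGT_zero.comp tendsto_fst
  have h2 : Tendsto (fun q : ℝ × E => ‖q.2‖) (𝓝[>] (0 : ℝ) ×ˢ 𝓝 p) (𝓝 ‖p‖) :=
    (continuous_norm.tendsto p).comp tendsto_snd
  have h3 := h1.atTop_mul_pos (norm_pos_iff.2 hp) h2
  have h4 : ∀ᶠ q in 𝓝[>] (0 : ℝ) ×ˢ 𝓝 p, 0 < q.1 :=
    tendsto_fst.eventually (eventually_mem_nhdsWithin (s := Set.Ioi (0 : ℝ)))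
  filter_upwards [h3.eventually_gt_atTop R, h4] with q hq hq0
  refine ⟨hq0, fun hmem => (hR _ hmem).not_gt ?_⟩
  rwa [norm_smul, norm_inv, Real.norm_of_nonneg hq0.le]

theorem eventually_inv_smul_notMem_left {K : Set E} (hK : IsCompact K) {p : E} (hp : p ≠ 0) :
    ∀ᶠ s in 𝓝[>] (0 : ℝ), 0 < s ∧ s⁻¹ • p ∉ K :=
  (tendsto_id.prodMk (tendsto_const_nhds (x := p))).eventually (eventually_inv_smul_notMem hK hp)

theorem dist_rescale_le {K : Set E} {C : NNReal} {φ : E → E} (hφ : LipschitzOnWith C φ Kᶜ) {s : ℝ}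
    (hs : 0 < s) {p q : E} (hp : s⁻¹ • p ∉ K) (hq : s⁻¹ • q ∉ K) :
    dist (rescale φ s p) (rescale φ s q) ≤ C * dist p q := by
  rw [rescale, rescale, dist_smul₀, Real.norm_of_nonneg hs.le]
  have := hφ.dist_le_mul _ hp _ hq
  rw [dist_smul₀, norm_inv, Real.norm_of_nonneg hs.le] at this
  calc s * dist (φ (s⁻¹ • p)) (φ (s⁻¹ • q)) ≤ s * (C * (s⁻¹ * dist p q)) := by gcongr
    _ = C * dist p q := by field_simp

/-- The rescalings of a map which is Lipschitz near infinity have a limit along an ultrafilter. -/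
theorem exists_blowDown [ProperSpace E] [Nontrivial E] {K : Set E} (hK : IsCompact K) {C : NNReal}
    {φ : E → E} (hφ : LipschitzOnWith C φ Kᶜ) {l : Ultrafilter ℝ} (hl : ↑l ≤ 𝓝[>] (0 : ℝ)) :
    ∃ φ' : E → E, LipschitzWith C φ' ∧ φ' 0 = 0 ∧ ∀ p ≠ 0,
      Tendsto (fun q : ℝ × E => rescale φ q.1 q.2) (l ×ˢ 𝓝 p) (𝓝 (φ' p)) := by
  have : NoncompactSpace E := NormedSpace.noncompactSpace ℝ E
  obtain ⟨p₀, hp₀⟩ := (Set.ne_univ_iff_exists_notMem K).1 hK.ne_univ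
  have hl0 : Tendsto (fun s : ℝ => s) l (𝓝 0) := hl.trans nhdsWithin_le_nhds
  have hbd : ∀ p ≠ 0, ∀ᶠ s in (l : Filter ℝ),
      ‖rescale φ s p‖ ≤ C * ‖p‖ + s * (C * ‖p₀‖ + ‖φ p₀‖) := fun p hp => by
    filter_upwards [hl (eventually_inv_smul_notMem_left hK hp)] with s ⟨hs, hsK⟩
    have h1 := hφ.dist_le_mul _ hsK _ hp₀
    rw [dist_eq_norm, dist_eq_norm] at h1
    have h2 : ‖s⁻¹ • p - p₀‖ ≤ s⁻¹ * ‖p‖ + ‖p₀‖ := by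
      refine (norm_sub_le _ _).trans_eq ?_
      rw [norm_smul, norm_inv, Real.norm_of_nonneg hs.le]
    rw [rescale, norm_smul, Real.norm_of_nonneg hs.le]
    have h3 : ‖φ (s⁻¹ • p)‖ ≤ C * (s⁻¹ * ‖p‖ + ‖p₀‖) + ‖φ p₀‖ := by
      have := norm_le_norm_sub_add (φ (s⁻¹ • p)) (φ p₀)
      have := mul_le_mul_of_nonneg_left h2 C.coe_nonneg
      linarith
    calc s * ‖φ (s⁻¹ • p)‖ ≤ s * (C * (s⁻¹ * ‖p‖ + ‖p₀‖) + ‖φ p₀‖) := by gcongr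
      _ = C * ‖p‖ + s * (C * ‖p₀‖ + ‖φ p₀‖) := by field_simp; ring
  have hlim : ∀ p : E, ∃ a, p ≠ 0 → Tendsto (fun s => rescale φ s p) l (𝓝 a) := fun p => by
    by_cases hp : p = 0
    · exact ⟨0, fun h => (h hp).elim⟩
    have h1 : ∀ᶠ s in (l : Filter ℝ),
        rescale φ s p ∈ Metric.closedBall (0 : E) (C * ‖p‖ + 1 * (C * ‖p₀‖ + ‖φ p₀‖)) := by
      filter_upwards [hbd p hp, hl0.eventually (gt_mem_nhds one_pos)] with s hs hs1
      rw [mem_closedBall_zero_iff]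
      exact hs.trans (by gcongr)
    obtain ⟨a, -, ha⟩ := (isCompact_closedBall (0 : E) _).ultrafilter_le_nhds
      (l.map fun s => rescale φ s p) (le_principal_iff.2 h1)
    exact ⟨a, fun _ => ha⟩
  choose φ₀ hφ₀ using hlim
  classical
  have hφ₁ : ∀ p ≠ 0, Tendsto (fun s => rescale φ s p) l (𝓝 (if p = 0 then 0 else φ₀ p)) :=
    fun p hp => by rw [if_neg hp]; exact hφ₀ p hp
  generalize hφ' : (fun p => if p = 0 then 0 else φ₀ p) = φ'
  simp only [funext_iff] at hφ'
  have h00 : φ' 0 = 0 := by rw [← hφ']; simp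
  simp only [hφ'] at hφ₁
  have hnorm : ∀ p, ‖φ' p‖ ≤ C * ‖p‖ := fun p => by
    by_cases hp : p = 0
    · simp [hp, h00]
    have h2 : Tendsto (fun s : ℝ => C * ‖p‖ + s * (C * ‖p₀‖ + ‖φ p₀‖)) l
        (𝓝 (C * ‖p‖ + 0 * (C * ‖p₀‖ + ‖φ p₀‖))) :=
      tendsto_const_nhds.add (hl0.mul tendsto_const_nhds)
    rw [zero_mul, add_zero] at h2
    exact le_of_tendsto_of_tendsto (hφ₁ p hp).norm h2 (hbd p hp)
  refine ⟨φ', LipschitzWith.of_dist_le_mul fun p q => ?_, h00, fun p hp => ?_⟩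
  · by_cases hp : p = 0
    · rw [hp, h00, dist_zero_left, dist_zero_left]; exact hnorm q
    by_cases hq : q = 0
    · rw [hq, h00, dist_zero_right, dist_zero_right]; exact hnorm p
    refine le_of_tendsto ((hφ₁ p hp).dist (hφ₁ q hq)) ?_
    filter_upwards [hl (eventually_inv_smul_notMem_left hK hp),
      hl (eventually_inv_smul_notMem_left hK hq)] with s h1 h2
    exact dist_rescale_le hφ h1.1 h1.2 h2.2
  · rw [tendsto_iff_dist_tendsto_zero]
    have h1 : Tendsto (fun q : ℝ × E => C * dist q.2 p + dist (rescale φ q.1 p) (φ' p))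
        (l ×ˢ 𝓝 p) (𝓝 (C * 0 + 0)) :=
      (((tendsto_iff_dist_tendsto_zero.1 tendsto_id).comp tendsto_snd).const_mul _).add
        ((tendsto_iff_dist_tendsto_zero.1 (hφ₁ p hp)).comp tendsto_fst)
    rw [mul_zero, add_zero] at h1
    refine squeeze_zero' (Eventually.of_forall fun _ => dist_nonneg) ?_ h1
    filter_upwards [prod_mono_left _ hl (eventually_inv_smul_notMem hK hp),
      tendsto_fst.eventually (hl (eventually_inv_smul_notMem_left hK hp))] with q h1 h2
    exact (dist_triangle _ (rescale φ q.1 p) _).trans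
      (add_le_add_left (dist_rescale_le hφ h1.1 h1.2 h2.2) _)

namespace BiLipEnds

variable {K K' : Set E} {C : NNReal} {φ ψ : E → E}

theorem rescale_rescale (h : BiLipEnds K K' C φ ψ) {s : ℝ} (hs : 0 < s) {p : E}
    (hp : s⁻¹ • p ∉ K) : rescale ψ s (rescale φ s p) = p := by
  rw [rescale, rescale, inv_smul_smul₀ hs.ne', h.left _ hp, smul_inv_smul₀ hs.ne']

theorem rescale_notMem (h : BiLipEnds K K' C φ ψ) {s : ℝ} (hs : 0 < s) {p : E}
    (hp : s⁻¹ • p ∉ K) : s⁻¹ • rescale φ s p ∉ K' := by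
  rw [rescale, inv_smul_smul₀ hs.ne']
  exact h.maps hp

theorem leftInverse_blowDown (h : BiLipEnds K K' C φ ψ) {l : Filter ℝ} [l.NeBot]
    (hl : l ≤ 𝓝[>] (0 : ℝ)) {φ' ψ' : E → E} (hφ0 : φ' 0 = 0) (hψ0 : ψ' 0 = 0)
    (hφ : ∀ p ≠ 0, Tendsto (fun q : ℝ × E => rescale φ q.1 q.2) (l ×ˢ 𝓝 p) (𝓝 (φ' p)))
    (hψ : ∀ p ≠ 0, Tendsto (fun q : ℝ × E => rescale ψ q.1 q.2) (l ×ˢ 𝓝 p) (𝓝 (ψ' p))) (p : E) :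
    ψ' (φ' p) = p := by
  by_cases hp : p = 0
  · rw [hp, hφ0, hψ0]
  have hφp : Tendsto (fun s => rescale φ s p) l (𝓝 (φ' p)) :=
    (hφ p hp).comp (tendsto_id.prodMk tendsto_const_nhds)
  have hev : ∀ᶠ s in l, 0 < s ∧ s⁻¹ • p ∉ K :=
    hl (eventually_inv_smul_notMem_left h.compact hp)
  have hl0 : Tendsto (fun s : ℝ => s) l (𝓝 0) := hl.trans nhdsWithin_le_nhds
  have hne : φ' p ≠ 0 := fun h0 => by
    obtain ⟨s₀, hs₀, hp₀⟩ := hev.exists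
    set p₀ := s₀⁻¹ • p
    have h1 : ∀ᶠ s in l, ‖p - s • p₀‖ ≤ C * ‖rescale φ s p - s • φ p₀‖ := by
      filter_upwards [hev] with s ⟨hs, hsK⟩
      have h2 := h.lip'.dist_le_mul _ (h.maps hsK) _ (h.maps hp₀)
      rw [h.left _ hsK, h.left _ hp₀, dist_eq_norm, dist_eq_norm] at h2
      have h3 : p - s • p₀ = s • (s⁻¹ • p - p₀) := by rw [smul_sub, smul_inv_smul₀ hs.ne']
      rw [h3, rescale, ← smul_sub, norm_smul, norm_smul, mul_left_comm]
      gcongr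
    have h4 : Tendsto (fun s : ℝ => ‖p - s • p₀‖) l (𝓝 ‖p - (0 : ℝ) • p₀‖) :=
      (tendsto_const_nhds.sub (hl0.smul tendsto_const_nhds)).norm
    have h5 : Tendsto (fun s : ℝ => C * ‖rescale φ s p - s • φ p₀‖) l
        (𝓝 (C * ‖φ' p - (0 : ℝ) • φ p₀‖)) :=
      ((hφp.sub (hl0.smul tendsto_const_nhds)).norm).const_mul _
    have h6 := le_of_tendsto_of_tendsto h4 h5 h1
    simp [h0, hp] at h6
  have h1 : Tendsto (fun s => rescale ψ s (rescale φ s p)) l (𝓝 (ψ' (φ' p))) :=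
    (hψ _ hne).comp (tendsto_id.prodMk hφp)
  refine tendsto_nhds_unique h1 (tendsto_nhds_of_eventually_eq ?_)
  filter_upwards [hev] with s ⟨hs, hsK⟩ using h.rescale_rescale hs hsK

end BiLipEnds

end BlowDown

theorem ConicFamily.smul_mem_famZero_iff {H : ℂ × (ℂ × ℂ) → Polynomial ℂ} {d n : ℕ}
    {L : Set (ℂ × ℂ)} (h : ConicFamily H d n L) {s : ℝ} (hs : 0 < s) (p : (ℂ × ℂ) × ℂ) :
    s • p ∈ famZero (fun w => H (s, w)) ↔ p ∈ famZero (fun w => H (1, w)) := by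
  have hc : (s : ℂ) ≠ 0 := by exact_mod_cast hs.ne'
  have h1 := h.hom s 1 p.1 p.2
  rw [mul_one] at h1
  change (H (s, s • p.1)).eval (s • p.2) = 0 ↔ (H (1, p.1)).eval p.2 = 0
  rw [show s • p.1 = (s : ℂ) • p.1 by simp, Complex.real_smul, h1]
  simp [hc]

/-- Two conic families whose zero sets at `s = 1` correspond under a bi-Lipschitz map between
neighbourhoods of infinity, together with limits of the rescalings of this map. -/
structure BlowDownPair (Hf Hg : ℂ × (ℂ × ℂ) → Polynomial ℂ) (d e n n' : ℕ) (L L' : Set (ℂ × ℂ))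
    (K K' : Set ((ℂ × ℂ) × ℂ)) (C : NNReal) (φ ψ φ' ψ' : (ℂ × ℂ) × ℂ → (ℂ × ℂ) × ℂ)
    (l : Filter ℝ) : Prop where
  conic : ConicFamily Hf d n L
  conic' : ConicFamily Hg e n' L'
  ends : BiLipEnds K K' C φ ψ
  mem_iff : ∀ p ∉ K, p ∈ famZero (fun w => Hf (1, w)) ↔ φ p ∈ famZero fun w => Hg (1, w)
  neBot : l.NeBot
  le_nhds : l ≤ 𝓝[>] (0 : ℝ)
  lip : LipschitzWith C φ'
  lip' : LipschitzWith C ψ'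
  map_zero : φ' 0 = 0
  map_zero' : ψ' 0 = 0
  tendsto : ∀ p ≠ 0,
    Tendsto (fun q : ℝ × ((ℂ × ℂ) × ℂ) => rescale φ q.1 q.2) (l ×ˢ 𝓝 p) (𝓝 (φ' p))
  tendsto' : ∀ p ≠ 0,
    Tendsto (fun q : ℝ × ((ℂ × ℂ) × ℂ) => rescale ψ q.1 q.2) (l ×ˢ 𝓝 p) (𝓝 (ψ' p))

namespace BlowDownPair

variable {Hf Hg : ℂ × (ℂ × ℂ) → Polynomial ℂ} {d e n n' : ℕ} {L L' : Set (ℂ × ℂ)}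
  {K K' : Set ((ℂ × ℂ) × ℂ)} {C : NNReal} {φ ψ φ' ψ' : (ℂ × ℂ) × ℂ → (ℂ × ℂ) × ℂ}
  {l : Filter ℝ}

theorem symm (h : BlowDownPair Hf Hg d e n n' L L' K K' C φ ψ φ' ψ' l) :
    BlowDownPair Hg Hf e d n' n L' L K' K C ψ φ ψ' φ' l :=
  ⟨h.conic', h.conic, h.ends.symm, fun p hp => by
    rw [h.mem_iff _ (h.ends.maps' hp), h.ends.right p hp], h.neBot, h.le_nhds, h.lip', h.lip,
    h.map_zero', h.map_zero, h.tendsto', h.tendsto⟩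

theorem left_inv (h : BlowDownPair Hf Hg d e n n' L L' K K' C φ ψ φ' ψ' l) (p : (ℂ × ℂ) × ℂ) :
    ψ' (φ' p) = p :=
  have := h.neBot
  h.ends.leftInverse_blowDown h.le_nhds h.map_zero h.map_zero' h.tendsto h.tendsto' p

theorem ne_zero (h : BlowDownPair Hf Hg d e n n' L L' K K' C φ ψ φ' ψ' l) {p : (ℂ × ℂ) × ℂ}
    (hp : p ≠ 0) : φ' p ≠ 0 := fun h0 => hp <| by
  rw [← h.left_inv p, h0, h.map_zero']

theorem rescale_mem_iff (h : BlowDownPair Hf Hg d e n n' L L' K K' C φ ψ φ' ψ' l) {s : ℝ}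
    (hs : 0 < s) {p : (ℂ × ℂ) × ℂ} (hp : s⁻¹ • p ∉ K) :
    p ∈ famZero (fun w => Hf (s, w)) ↔ rescale φ s p ∈ famZero fun w => Hg (s, w) := by
  rw [rescale, h.conic'.smul_mem_famZero_iff hs, ← h.mem_iff _ hp,
    ← h.conic.smul_mem_famZero_iff hs, smul_inv_smul₀ hs.ne']

theorem tendsto_eval (h : BlowDownPair Hf Hg d e n n' L L' K K' C φ ψ φ' ψ' l)
    {p : (ℂ × ℂ) × ℂ} (hp : p ≠ 0) :
    Tendsto (fun q : ℝ × ((ℂ × ℂ) × ℂ) =>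
      (Hg (q.1, (rescale φ q.1 q.2).1)).eval (rescale φ q.1 q.2).2) (l ×ˢ 𝓝 p)
      (𝓝 ((Hg (0, (φ' p).1)).eval (φ' p).2)) := by
  have h0 : Tendsto (fun s : ℝ => (s : ℂ)) l (𝓝 0) :=
    (Complex.continuous_ofReal.tendsto' 0 0 Complex.ofReal_zero).mono_left
      (h.le_nhds.trans nhdsWithin_le_nhds)
  have h1 := h.tendsto p hp
  refine (h.conic'.fam.cont.tendsto ((0, (φ' p).1), (φ' p).2)).comp
    (((h0.comp tendsto_fst).prodMk_nhds ?_).prodMk_nhds ?_)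
  · exact (continuous_fst.tendsto _).comp h1
  · exact (continuous_snd.tendsto _).comp h1

theorem eventually_notMem (h : BlowDownPair Hf Hg d e n n' L L' K K' C φ ψ φ' ψ' l)
    {p : (ℂ × ℂ) × ℂ} (hp : p ≠ 0) :
    ∀ᶠ q in l ×ˢ 𝓝 p, 0 < q.1 ∧ q.1⁻¹ • q.2 ∉ K :=
  prod_mono_left _ h.le_nhds (eventually_inv_smul_notMem h.ends.compact hp)

theorem mapsTo_famZero (h : BlowDownPair Hf Hg d e n n' L L' K K' C φ ψ φ' ψ' l)
    {p : (ℂ × ℂ) × ℂ} (hp : p ≠ 0) (hpX : p ∈ famZero fun w => Hf (0, w)) :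
    φ' p ∈ famZero fun w => Hg (0, w) := by
  by_contra hne
  have := h.neBot
  have h0 : Tendsto (fun s : ℝ => (s : ℂ)) l (𝓝 0) :=
    (Complex.continuous_ofReal.tendsto' 0 0 Complex.ofReal_zero).mono_left
      (h.le_nhds.trans nhdsWithin_le_nhds)
  have h1 := ((h.tendsto_eval hp).eventually_ne hne).and (h.eventually_notMem hp)
  obtain ⟨P, hP, Q, hQ, hPQ⟩ := eventually_prod_iff.1 h1
  have hQ' : ∀ᶠ z in 𝓝 p.2, Q (p.1, z) :=
    ((by fun_prop : Continuous fun z : ℂ => (p.1, z)).tendsto p.2).eventually hQ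
  have h2 := h.conic.fam.eventually_exists_root_near (e₀ := (0, p.1)) hpX hQ'
  have h3 : ∀ᶠ s : ℝ in l, ∃ z ∈ {z | Q (p.1, z)}, (Hf (s, p.1)).eval z = 0 :=
    (h0.prodMk_nhds tendsto_const_nhds).eventually h2
  obtain ⟨s, hs, z, hz, hfz⟩ := (hP.and h3).exists
  obtain ⟨hgs, hs0, hK⟩ := hPQ hs hz
  exact hgs ((h.rescale_mem_iff hs0 hK).1 hfz)

theorem mem_famZero_iff (h : BlowDownPair Hf Hg d e n n' L L' K K' C φ ψ φ' ψ' l)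
    {p : (ℂ × ℂ) × ℂ} (hp : p ≠ 0) :
    p ∈ famZero (fun w => Hf (0, w)) ↔ φ' p ∈ famZero fun w => Hg (0, w) :=
  ⟨h.mapsTo_famZero hp, fun hq => by
    simpa only [h.left_inv] using h.symm.mapsTo_famZero (h.ne_zero hp) hq⟩

end BlowDownPair

theorem ConicFamily.dimH_famZero_bad_le {H : ℂ × (ℂ × ℂ) → Polynomial ℂ} {d n : ℕ}
    {L : Set (ℂ × ℂ)} (h : ConicFamily H d n L) :
    dimH (famZero (fun w => H (0, w)) ∩ {q | q.1 ∉ coneBase L}) ≤ 2 := by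
  have hsub : famZero (fun w => H (0, w)) ∩ {q | q.1 ∉ coneBase L} ⊆ {0} ∪
      ⋃ b ∈ L, ⋃ y ∈ ((H (0, b)).roots.toFinset : Set ℂ),
        Set.range fun c : ℂ => c • ((b, y) : (ℂ × ℂ) × ℂ) := by
    rintro q ⟨hq, hqL⟩
    by_cases h0 : q.1 = 0
    · exact .inl (h.eq_zero_of_base hq h0)
    obtain ⟨b, hb, c, hc⟩ := exists_smul_eq_of_notMem_coneBase h.line_ne_zero h0 hqL
    have hc0 : c ≠ 0 := by
      rintro rfl
      exact h0 (by rw [← hc, zero_smul])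
    have hq' : c • ((b, c⁻¹ * q.2) : (ℂ × ℂ) × ℂ) = q :=
      Prod.ext hc (by simp [hc0])
    refine .inr (Set.mem_biUnion hb (Set.mem_biUnion (x := c⁻¹ * q.2) ?_ ⟨c, hq'⟩))
    rw [← hq', h.smul_mem_iff hc0] at hq
    rw [Finset.mem_coe, Multiset.mem_toFinset]
    exact (h.fam.mem_roots (e := (0, b))).2 hq
  refine (dimH_mono hsub).trans ?_
  rw [dimH_union, dimH_singleton, dimH_bUnion h.finite_lines.countable]
  refine max_le zero_le (iSup₂_le fun b _ => ?_)
  rw [dimH_bUnion (Finset.countable_toSet _)]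
  exact iSup₂_le fun y _ => dimH_range_smul_le _

theorem LocSheets.ncard_fibre {X : Type*} [TopologicalSpace X] {S : Set (X × ℂ)} {N : ℕ}
    {O : Set X} (h : LocSheets S N O) {x : X} (hx : x ∈ O) : {y | (x, y) ∈ S}.ncard = N := by
  obtain ⟨U, -, hxU, r, hr⟩ := h x hx
  exact hr.ncard_fibre hxU

namespace BlowDownPair

variable {Hf Hg : ℂ × (ℂ × ℂ) → Polynomial ℂ} {d e n n' : ℕ} {L L' : Set (ℂ × ℂ)}
  {K K' : Set ((ℂ × ℂ) × ℂ)} {C : NNReal} {φ ψ φ' ψ' : (ℂ × ℂ) × ℂ → (ℂ × ℂ) × ℂ}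
  {l : Filter ℝ} {A B : Set ((ℂ × ℂ) × ℂ)}

theorem exists_mapsTo_comp (h : BlowDownPair Hf Hg d e n n' L L' K K' C φ ψ φ' ψ' l)
    (hA : IsSheetComp (famZero fun w => Hf (0, w)) (coneBase L) A) :
    ∃ B, IsSheetComp (famZero fun w => Hg (0, w)) (coneBase L') B ∧
      Set.MapsTo φ' (closure A \ {0}) (closure B \ {0}) ∧ ∃ x ∈ A, φ' x ∈ B := by
  set T := φ' ⁻¹' (famZero (fun w => Hg (0, w)) ∩ {q | q.1 ∉ coneBase L'})
  have hO := isOpen_coneBase h.conic.finite_lines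
  have hT : dimH (Prod.fst '' T) < 3 := by
    have h1 : T ⊆ Set.image ψ' (famZero (fun w => Hg (0, w)) ∩ {q | q.1 ∉ coneBase L'}) :=
      fun p hp => ⟨φ' p, hp, h.left_inv p⟩
    calc dimH (Prod.fst '' T) ≤ dimH T := LipschitzWith.prod_fst.dimH_image_le T
      _ ≤ _ := dimH_mono h1
      _ ≤ _ := h.lip'.dimH_image_le _
      _ ≤ 2 := h.conic'.dimH_famZero_bad_le
      _ < 3 := by norm_num
  have hsub := hA.subset_closure_diff h.conic.locSheets hO hT
  have hne0 : ∀ p ∈ A, p ≠ 0 := fun p hp h0 => (hA.subset hp).2.1 (by rw [h0]; rfl)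
  obtain ⟨x, hx⟩ := closure_nonempty_iff.1 (hA.nonempty.mono hsub)
  obtain ⟨B, hB, hAB⟩ := IsSheetComp.exists_of_isPreconnected
    (X := famZero fun w => Hg (0, w)) (O := coneBase L')
    ((hA.isPreconnected_diff h.conic.locSheets hO hT).image φ' h.lip.continuous.continuousOn)
    ⟨φ' x, x, hx, rfl⟩ (by
      rintro _ ⟨p, ⟨hpA, hpT⟩, rfl⟩
      have hY := h.mapsTo_famZero (hne0 p hpA) (hA.subset hpA).1
      exact ⟨hY, by_contra fun hL => hpT ⟨hY, hL⟩⟩)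
  refine ⟨B, hB, fun p hp => ⟨?_, h.ne_zero hp.2⟩, x, hx.1, hAB ⟨x, hx, rfl⟩⟩
  have h1 : p ∈ closure (A \ T) := closure_minimal hsub isClosed_closure hp.1
  exact closure_mono hAB (image_closure_subset_closure_image h.lip.continuous ⟨p, h1, rfl⟩)

/-- The blow down map permutes the components of the tangent cones at infinity. -/
theorem exists_comp (h : BlowDownPair Hf Hg d e n n' L L' K K' C φ ψ φ' ψ' l)
    (hA : IsSheetComp (famZero fun w => Hf (0, w)) (coneBase L) A) :
    ∃ B, IsSheetComp (famZero fun w => Hg (0, w)) (coneBase L') B ∧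
      Set.MapsTo φ' (closure A \ {0}) (closure B \ {0}) ∧
      Set.MapsTo ψ' (closure B \ {0}) (closure A \ {0}) ∧ ∃ x ∈ A, φ' x ∈ B := by
  obtain ⟨B, hB, hAB, hx⟩ := h.exists_mapsTo_comp hA
  obtain ⟨A', hA', hBA, -⟩ := h.symm.exists_mapsTo_comp hB
  refine ⟨B, hB, hAB, ?_, hx⟩
  obtain ⟨p, hp⟩ := hA.nonempty
  have hpL := (hA.subset hp).2
  have h1 := hBA (hAB ((h.conic.mem_comp_iff hA hpL).2 hp))
  rw [h.left_inv, h.conic.mem_comp_iff hA' hpL] at h1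
  rwa [hA.eq_of_nonempty hA' ⟨p, hp, h1⟩]

theorem ncard_fibre_eq (h : BlowDownPair Hf Hg d e n n' L L' K K' C φ ψ φ' ψ' l)
    (hA : IsSheetComp (famZero fun w => Hf (0, w)) (coneBase L) A)
    (hB : IsSheetComp (famZero fun w => Hg (0, w)) (coneBase L') B)
    (hAB : Set.MapsTo φ' (closure A \ {0}) (closure B \ {0}))
    (hBA : Set.MapsTo ψ' (closure B \ {0}) (closure A \ {0})) {w w' : ℂ × ℂ}
    (hw : w ∈ coneBase L) (hw' : w' ∈ coneBase L') :
    {y | (w, y) ∈ A}.ncard = {y | (w', y) ∈ B}.ncard := by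
  obtain ⟨N, hN, hNA⟩ := h.conic.exists_coneCover hA
  obtain ⟨N', hN', hNB⟩ := h.conic'.exists_coneCover hB
  obtain ⟨p, hp⟩ := hA.nonempty
  obtain ⟨q, hq⟩ := hB.nonempty
  have hp' := (h.conic.mem_comp_iff hA (hA.subset hp).2).2 hp
  have hq' := (h.conic'.mem_comp_iff hB (hB.subset hq).2).2 hq
  rw [hNA.ncard_fibre hw, hNB.ncard_fibre hw']
  exact Nat.dvd_antisymm
    (hN.dvd hN' ⟨p, hp'⟩ h.lip.lipschitzOnWith h.lip'.continuous.continuousOn hAB hBA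
      (fun p _ => h.left_inv p) fun p _ => h.symm.left_inv p)
    (hN'.dvd hN ⟨q, hq'⟩ h.lip'.lipschitzOnWith h.lip.continuous.continuousOn hBA hAB
      (fun p _ => h.symm.left_inv p) fun p _ => h.left_inv p)

end BlowDownPair

theorem hasRes_of_continuousAt {G : ℂ → ℂ} {b : ℂ} (hG : ∀ᶠ y in 𝓝 b, ContinuousAt G y)
    (h0 : G b ≠ 0) : HasRes G b 0 := by
  obtain ⟨ε, hε, h⟩ := Metric.eventually_nhds_iff_ball.1
    (hG.and (hG.self_of_nhds.eventually_ne h0))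
  obtain ⟨g, hg, hexp⟩ := Complex.exists_log_of_convex (convex_ball b ε)
    (fun y hy => (h y hy).1.continuousWithinAt) fun y hy => (h y hy).2
  exact hasRes_of_eq_exp hε (hg.mono Set.sdiff_subset) fun x hx => (hexp x hx.1).symm

/-- A function without zeros off the graph of `r` is, near a point of the graph, a power of the
defining function of the graph up to a factor with a logarithm. -/
theorem exists_zpow_mul_exp_near_graph {E : Type*} [NormedAddCommGroup E] [NormedSpace ℝ E]
    {r : E → ℂ} {x : E × ℂ} (hrx : r x.1 = x.2) (hr : ∀ᶠ w in 𝓝 x.1, ContinuousAt r w)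
    {D : E × ℂ → ℂ} (hD : ∀ᶠ p in 𝓝 x, ContinuousAt D p ∧ (D p = 0 → p.2 = r p.1)) :
    ∃ (k : ℤ) (g : E × ℂ → ℂ), ∀ᶠ p in 𝓝 x, p.2 ≠ r p.1 →
      ContinuousAt g p ∧ D p = (p.2 - r p.1) ^ k * Complex.exp (g p) := by
  set T : E × ℂ → E × ℂ := fun q => (q.1, r q.1 + q.2)
  have hTx : T (x.1, 0) = x := Prod.ext rfl (by simp [T, hrx])
  have hTc : ∀ q : E × ℂ, ContinuousAt r q.1 → ContinuousAt T q := fun q hq =>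
    continuousAt_fst.prodMk ((hq.comp continuousAt_fst).add continuousAt_snd)
  have h1 : ∀ᶠ q in 𝓝 (x.1, (0 : ℂ)), ContinuousAt D (T q) ∧ (D (T q) = 0 → (T q).2 = r q.1) :=
    ((hTc (x.1, 0) hr.self_of_nhds).tendsto).eventually (by rwa [hTx])
  have h2 : ∀ᶠ q in 𝓝 (x.1, (0 : ℂ)), ContinuousAt r q.1 :=
    (continuous_fst.tendsto (x.1, (0 : ℂ))).eventually hr
  obtain ⟨δ, hδ, h⟩ := Metric.eventually_nhds_iff_ball.1 (h1.and h2)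
  rw [← ball_prod_same] at h
  have hmem : ∀ q ∈ Metric.ball x.1 δ ×ˢ annulus (Set.Iio δ), q ∈
      Metric.ball x.1 δ ×ˢ Metric.ball (0 : ℂ) δ ∧ q.2 ≠ 0 := fun q hq => by
    have := (mem_punctured (b := 0)).1 (by simpa using hq.2)
    exact ⟨⟨hq.1, this.1⟩, this.2⟩
  obtain ⟨k, g, hg, hk⟩ := exists_zpow_mul_exp (convex_ball x.1 δ) (Set.ordConnected_Iio (a := δ))
    (G := fun q => D (T q)) (fun q hq => by
      obtain ⟨⟨hDq, -⟩, hrq⟩ := h q (hmem q hq).1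
      exact (ContinuousAt.comp hDq (hTc q hrq)).continuousWithinAt)
    (fun q hq h0 => by
      obtain ⟨⟨-, hDq⟩, hrq⟩ := h q (hmem q hq).1
      exact (hmem q hq).2 (by simpa [T] using hDq h0))
  refine ⟨k, fun p => g (p.1, p.2 - r p.1), ?_⟩
  have h3 : Tendsto (fun p : E × ℂ => (p.1, p.2 - r p.1)) (𝓝 x) (𝓝 (x.1, 0)) := by
    have : ContinuousAt (fun p : E × ℂ => (p.1, p.2 - r p.1)) x :=
      continuousAt_fst.prodMk (continuousAt_snd.sub (hr.self_of_nhds.comp continuousAt_fst))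
    simpa [ContinuousAt, hrx] using this
  have h4 : ∀ᶠ p : E × ℂ in 𝓝 x, (p.1, p.2 - r p.1) ∈ Metric.ball (x.1, (0 : ℂ)) δ :=
    h3.eventually (Metric.ball_mem_nhds _ hδ)
  filter_upwards [h4] with p hp hne
  rw [← ball_prod_same] at hp
  have hsub : p.2 - r p.1 ≠ 0 := sub_ne_zero.2 hne
  have hopen : IsOpen (Metric.ball x.1 δ ×ˢ annulus (Set.Iio δ)) := by
    have : annulus (Set.Iio δ) = Metric.ball 0 δ \ {0} := by
      ext z
      simpa using mem_punctured (b := 0) (x := z) (ε := δ)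
    rw [this]
    exact Metric.isOpen_ball.prod (Metric.isOpen_ball.sdiff isClosed_singleton)
  have hpair : (p.1, p.2 - r p.1) ∈ Metric.ball x.1 δ ×ˢ annulus (Set.Iio δ) :=
    ⟨hp.1, by simpa using (mem_punctured (b := 0)).2 ⟨hp.2, hsub⟩⟩
  have hrp : ContinuousAt r p.1 := (h _ hp).2
  constructor
  · exact ContinuousAt.comp (f := fun p : E × ℂ => (p.1, p.2 - r p.1))
      (hg.continuousAt (hopen.mem_nhds hpair))
      (continuousAt_fst.prodMk (continuousAt_snd.sub (hrp.comp continuousAt_fst)))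
  · simpa [T] using hk _ hpair

/-- Near `x`, the function `F` is the `m`-th power of the defining function of a graph up to a
unit. -/
def GraphAt {E : Type*} [TopologicalSpace E] (F : E × ℂ → ℂ) (x : E × ℂ) (m : ℕ) : Prop :=
  ∃ (r : E → ℂ) (u : E × ℂ → ℂ), r x.1 = x.2 ∧ (∀ᶠ w in 𝓝 x.1, ContinuousAt r w) ∧
    ∀ᶠ p in 𝓝 x, ContinuousAt u p ∧ u p ≠ 0 ∧ F p = (p.2 - r p.1) ^ m * u p

/-- The order of vanishing along a graph is, up to sign, the local winding number after
composition with a homeomorphism preserving the graph. -/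
theorem GraphAt.hasRes {E : Type*} [NormedAddCommGroup E] [NormedSpace ℝ E] {F G : E × ℂ → ℂ}
    {φ ψ : E × ℂ → E × ℂ} {x : E × ℂ} {m n : ℕ} (hF : GraphAt F x m) (hG : GraphAt G (φ x) n)
    (hm : m ≠ 0) (hn : n ≠ 0) (hφ : ∀ᶠ p in 𝓝 x, ContinuousAt φ p)
    (hψ : ∀ᶠ q in 𝓝 (φ x), ContinuousAt ψ q) (hψφ : ∀ᶠ p in 𝓝 x, ψ (φ p) = p)
    (hφψ : ∀ᶠ q in 𝓝 (φ x), φ (ψ q) = q) (hFG : ∀ᶠ p in 𝓝 x, F p = 0 ↔ G (φ p) = 0) :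
    ∃ k : ℤ, (k = 1 ∨ k = -1) ∧ HasRes (fun y => G (φ (x.1, y))) x.2 (k * n) := by
  obtain ⟨r, u, hrx, hr, hu⟩ := hF
  obtain ⟨ρ, v, hρx, hρ, hv⟩ := hG
  have hφx := hφ.self_of_nhds
  have hψx := hψ.self_of_nhds
  have hx : ψ (φ x) = x := hψφ.self_of_nhds
  have hρ' : ∀ᶠ q in 𝓝 (φ x), ContinuousAt ρ q.1 := (continuous_fst.tendsto (φ x)).eventually hρ
  have hr' : ∀ᶠ p in 𝓝 x, ContinuousAt r p.1 := (continuous_fst.tendsto x).eventually hr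
  obtain ⟨k, g, hk⟩ := exists_zpow_mul_exp_near_graph hrx hr
    (D := fun p => (φ p).2 - ρ (φ p).1) (by
      filter_upwards [hφ, hφx.eventually hρ', hu, hFG, hφx.eventually hv]
        with p h1 h2 ⟨_, h3, h4⟩ h5 ⟨_, _, h6⟩
      refine ⟨h1.snd.sub (ContinuousAt.comp (f := fun p => (φ p).1) h2 h1.fst), fun h0 => ?_⟩
      rw [h4, h6, h0, zero_pow hn, zero_mul] at h5
      simpa [h3, hm, sub_eq_zero] using h5)
  have hψx' : Tendsto ψ (𝓝 (φ x)) (𝓝 x) := by simpa only [ContinuousAt, hx] using hψx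
  obtain ⟨l, g', hl⟩ := exists_zpow_mul_exp_near_graph hρx hρ
    (D := fun q => (ψ q).2 - r (ψ q).1) (by
      filter_upwards [hψ, hψx'.eventually hr', hψx'.eventually hu, hψx'.eventually hFG, hv, hφψ]
        with q h1 h2 ⟨_, _, h4⟩ h5 ⟨_, h3, h6⟩ h7
      refine ⟨h1.snd.sub (ContinuousAt.comp (f := fun p => (ψ p).1) h2 h1.fst), fun h0 => ?_⟩
      rw [h7, h4, h6, h0, zero_pow hm, zero_mul] at h5
      simpa [h3, hn, sub_eq_zero] using h5)
  have hev : ∀ᶠ p in 𝓝 x, p.2 ≠ r p.1 → ContinuousAt φ p ∧ ψ (φ p) = p ∧ ContinuousAt g p ∧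
      (φ p).2 - ρ (φ p).1 = (p.2 - r p.1) ^ k * Complex.exp (g p) ∧
      ContinuousAt g' (φ p) ∧
      p.2 - r p.1 = ((φ p).2 - ρ (φ p).1) ^ l * Complex.exp (g' (φ p)) := by
    filter_upwards [hφ, hψφ, hk, hφx.eventually hl] with p h1 h2 h3 h4 hne
    obtain ⟨h5, h6⟩ := h3 hne
    have hne' : (φ p).2 ≠ ρ (φ p).1 := fun h0 => by
      rw [h0, sub_self, eq_comm, mul_eq_zero] at h6
      exact h6.elim (zpow_ne_zero _ (sub_ne_zero.2 hne)) (Complex.exp_ne_zero _)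
    obtain ⟨h7, h8⟩ := h4 hne'
    rw [h2] at h8
    exact ⟨h1, h2, h5, h6, h7, h8⟩
  have hline : Tendsto (fun y : ℂ => (x.1, y)) (𝓝 x.2) (𝓝 x) :=
    (by fun_prop : Continuous fun y : ℂ => (x.1, y)).tendsto x.2
  obtain ⟨ε, hε, hball⟩ := Metric.eventually_nhds_iff_ball.1 (hline.eventually hev)
  have hwind : ∀ s, 0 < s → s < ε →
      HasWind (fun t => (φ (x.1, circ x.2 s t)).2 - ρ (φ (x.1, circ x.2 s t)).1) k ∧ k * l = 1 := by
    intro s hs hsε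
    have hp := fun t => hball (circ x.2 s t) (circ_mem_ball _ hs.le hsε t) (by
      rw [hrx, ← sub_ne_zero, ← norm_ne_zero_iff, norm_circ_sub _ hs.le]
      exact hs.ne')
    have hw1 : HasWind (fun t => circ x.2 s t - r x.1) 1 := by
      rw [hrx]; exact hasWind_circ_sub_self _ hs
    have hcont : Continuous fun t => (x.1, circ x.2 s t) :=
      continuous_const.prodMk (continuous_circ _ _)
    have hwk := hw1.zpow_mul_exp k (g := fun t => g (x.1, circ x.2 s t))
      (continuous_iff_continuousAt.2 fun t => ContinuousAt.comp
        (f := fun t => (x.1, circ x.2 s t)) (hp t).2.2.1 hcont.continuousAt)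
      (by rw [circ_one])
    have hwk' : HasWind (fun t => (φ (x.1, circ x.2 s t)).2 - ρ (φ (x.1, circ x.2 s t)).1) k := by
      rw [mul_one] at hwk
      convert hwk using 2 with t
      exact (hp t).2.2.2.1
    refine ⟨hwk', ?_⟩
    have hwl := hwk'.zpow_mul_exp l (g := fun t => g' (φ (x.1, circ x.2 s t)))
      (continuous_iff_continuousAt.2 fun t => ContinuousAt.comp
        (f := fun t => φ (x.1, circ x.2 s t)) (hp t).2.2.2.2.1
        (ContinuousAt.comp (f := fun t => (x.1, circ x.2 s t)) (hp t).1 hcont.continuousAt))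
      (by rw [circ_one])
    rw [mul_comm]
    refine hwl.unique ?_
    convert hw1 using 2 with t
    exact (hp t).2.2.2.2.2.symm
  refine ⟨k, Int.eq_one_or_neg_one_of_mul_eq_one (hwind (ε / 2) (half_pos hε) (half_lt_self hε)).2, ?_⟩
  have hres : HasRes (fun y => (φ (x.1, y)).2 - ρ (φ (x.1, y)).1) x.2 k := by
    filter_upwards [Ioo_mem_nhdsGT hε] with s hs using (hwind s hs.1 hs.2).1
  have hlφ : Tendsto (fun y : ℂ => φ (x.1, y)) (𝓝 x.2) (𝓝 (φ x)) :=
    Tendsto.comp (y := 𝓝 x) hφx hline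
  have hv' := hlφ.eventually hv
  have hres' : HasRes (fun y => v (φ (x.1, y))) x.2 0 := by
    refine hasRes_of_continuousAt ?_ hv'.self_of_nhds.2.1
    filter_upwards [hv', hline.eventually hφ] with y h1 h2
    exact ContinuousAt.comp (f := fun y => φ (x.1, y)) h1.1 (ContinuousAt.comp
      (f := fun y : ℂ => (x.1, y)) h2 (by fun_prop))
  have := (hres.zpow n).mul hres'
  rw [add_zero, mul_comm] at this
  refine this.congr ?_
  filter_upwards [hv'.filter_mono nhdsWithin_le_nhds] with y hy
  rw [hy.2.2, zpow_natCast]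

theorem MonicFamily.graphAt {E : Type*} [TopologicalSpace E] {F : E → Polynomial ℂ} {d n : ℕ}
    (hF : MonicFamily F d) {e : E} {y : ℂ} (hn : ∀ᶠ e in 𝓝 e, (F e).roots.toFinset.card = n)
    (hy : (F e).eval y = 0) :
    GraphAt (fun p => (F p.1).eval p.2) (e, y) ((F e).roots.count y) := by
  obtain ⟨U, hU, heU, r, hr, hcount⟩ := hF.exists_sheets hn
  obtain ⟨i, hi⟩ := (hr.mem_iff e heU y).1 hy
  have hcont : ∀ j, ∀ w ∈ U, ContinuousAt (r j) w :=
    fun j w hw => (hr.cont j).continuousAt (hU.mem_nhds hw)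
  have hcont' : ∀ p : E × ℂ, p.1 ∈ U → ContinuousAt (fun p : E × ℂ =>
      ∏ j ∈ Finset.univ.erase i, (p.2 - r j p.1) ^ (F e).roots.count (r j e)) p := fun p hp => by
    refine tendsto_finsetProd _ fun j _ => ?_
    exact (ContinuousAt.sub continuousAt_snd
      (ContinuousAt.comp (f := Prod.fst) (hcont j _ hp) continuousAt_fst)).pow _
  refine ⟨r i, fun p => ∏ j ∈ Finset.univ.erase i, (p.2 - r j p.1) ^ (F e).roots.count (r j e), hi,
    ?_, ?_⟩
  · filter_upwards [hU.mem_nhds heU] with w hw using hcont i w hw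
  · have hUx : ∀ᶠ p : E × ℂ in 𝓝 (e, y), p.1 ∈ U :=
      (continuous_fst.tendsto (e, y)).eventually (hU.mem_nhds heU)
    have hne := (hcont' (e, y) heU).eventually_ne (Finset.prod_ne_zero_iff.2 fun j hj =>
      pow_ne_zero _ (sub_ne_zero.2 fun h => (Finset.mem_erase.1 hj).1
        (hr.inj e heU (h.symm.trans hi.symm))))
    filter_upwards [hUx, hne] with p hp hnep
    refine ⟨hcont' p hp, hnep, ?_⟩
    have himg : (F p.1).roots.toFinset = Finset.univ.image fun j => r j p.1 := by
      ext z
      rw [Multiset.mem_toFinset, hF.mem_roots, Finset.mem_image]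
      simpa using hr.mem_iff p.1 hp z
    rw [(hF.monic _).eval_eq_prod_sub, Finset.prod_multiset_map_count, himg,
      Finset.prod_image (hr.inj p.1 hp).injOn, ← Finset.mul_prod_erase _ _ (Finset.mem_univ i)]
    simp only [hcount p.1 hp, hi]

theorem IsCompact.eventually_forall_prod {S X Y : Type*} [TopologicalSpace X] [TopologicalSpace Y]
    {l : Filter S} {x₀ : X} {K : Set Y} (hK : IsCompact K) {P : S × (X × Y) → Prop}
    (hP : ∀ y ∈ K, ∀ᶠ q in l ×ˢ 𝓝 (x₀, y), P q) :
    ∀ᶠ q in l ×ˢ 𝓝 x₀, ∀ y ∈ K, P (q.1, (q.2, y)) := by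
  have h1 : {q : (S × X) × Y | P (q.1.1, (q.1.2, q.2))} ∈ (l ×ˢ 𝓝 x₀) ×ˢ 𝓝ˢ K := by
    refine hK.mem_prod_nhdsSet_of_forall fun y hy => ?_
    have h2 := hP y hy
    rw [nhds_prod_eq, ← prod_assoc] at h2
    exact h2
  exact (Eventually.curry h1).mono fun q hq => hq.self_of_nhdsSet

theorem IsOpen.exists_mem_of_subset_closure {X ι : Type*} [TopologicalSpace X] [BaireSpace X]
    [Countable ι] {O : Set X} (hO : IsOpen O) (hne : O.Nonempty) {E : ι → Set X}
    (hE : ∀ i, IsOpen (E i)) (hd : ∀ i, O ⊆ closure (E i)) : ∃ x ∈ O, ∀ i, x ∈ E i := by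
  have h1 : Dense (⋂ i, E i ∪ (closure O)ᶜ) := by
    refine dense_iInter_of_isOpen (fun i => (hE i).union isClosed_closure.isOpen_compl) fun i => ?_
    rw [dense_iff_closure_eq, closure_union, Set.eq_univ_iff_forall]
    intro x
    by_cases hx : x ∈ closure O
    · exact .inl (closure_minimal (hd i) isClosed_closure hx)
    · exact .inr (subset_closure hx)
  obtain ⟨x, hx, hxO⟩ := h1.exists_mem_open hO hne
  exact ⟨x, hxO, fun i => (Set.mem_iInter.1 hx i).resolve_right fun h => h (subset_closure hxO)⟩

section Rescale

variable {E : Type*} [NormedAddCommGroup E] [NormedSpace ℝ E] {K : Set E} {C : NNReal} {φ : E → E}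
  {s : ℝ} {p : E}

theorem IsCompact.eventually_smul_notMem (hK : IsCompact K) (hp : s • p ∉ K) :
    ∀ᶠ p' in 𝓝 p, s • p' ∉ K :=
  ((continuous_const_smul s).tendsto p).eventually (hK.isClosed.isOpen_compl.mem_nhds hp)

theorem LipschitzOnWith.continuousAt_rescale (hφ : LipschitzOnWith C φ Kᶜ) (hK : IsCompact K)
    (hp : s⁻¹ • p ∉ K) : ContinuousAt (rescale φ s) p := by
  have h1 : ContinuousAt φ (s⁻¹ • p) :=
    hφ.continuousOn.continuousAt (hK.isClosed.isOpen_compl.mem_nhds hp)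
  exact (ContinuousAt.comp (f := fun p => s⁻¹ • p) h1
    (continuous_const_smul _).continuousAt).const_smul s

end Rescale

namespace BlowDownPair

variable {Hf Hg : ℂ × (ℂ × ℂ) → Polynomial ℂ} {d e n n' : ℕ} {L L' : Set (ℂ × ℂ)}
  {K K' : Set ((ℂ × ℂ) × ℂ)} {C : NNReal} {φ ψ φ' ψ' : (ℂ × ℂ) × ℂ → (ℂ × ℂ) × ℂ}
  {l : Filter ℝ}

theorem continuousAt_rescale (h : BlowDownPair Hf Hg d e n n' L L' K K' C φ ψ φ' ψ' l) {s : ℝ}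
    {p : (ℂ × ℂ) × ℂ} (hp : s⁻¹ • p ∉ K) : ContinuousAt (rescale φ s) p :=
  h.ends.lip.continuousAt_rescale h.ends.compact hp

theorem eventually_rescale (h : BlowDownPair Hf Hg d e n n' L L' K K' C φ ψ φ' ψ' l) {s : ℝ}
    (hs : 0 < s) {p : (ℂ × ℂ) × ℂ} (hp : s⁻¹ • p ∉ K) :
    ∀ᶠ p' in 𝓝 p, ContinuousAt (rescale φ s) p' ∧ rescale ψ s (rescale φ s p') = p' ∧
      (p' ∈ famZero (fun w => Hf (s, w)) ↔ rescale φ s p' ∈ famZero fun w => Hg (s, w)) := by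
  filter_upwards [h.ends.compact.eventually_smul_notMem hp] with p' hp'
  exact ⟨h.continuousAt_rescale hp', h.ends.rescale_rescale hs hp', h.rescale_mem_iff hs hp'⟩

theorem hasRes_rescale (h : BlowDownPair Hf Hg d e n n' L L' K K' C φ ψ φ' ψ' l) {s : ℝ}
    (hs : 0 < s) {x : (ℂ × ℂ) × ℂ} (hx : s⁻¹ • x ∉ K) (hxf : x ∈ famZero fun w => Hf (s, w))
    (hf : (Hf (s, x.1)).roots.Nodup) (hg : (Hg (s, (rescale φ s x).1)).roots.Nodup) :
    ∃ k : ℤ, (k = 1 ∨ k = -1) ∧ HasRes (fun y =>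
      (Hg (s, (rescale φ s (x.1, y)).1)).eval (rescale φ s (x.1, y)).2) x.2 k := by
  have hgraph : ∀ {H : ℂ × (ℂ × ℂ) → Polynomial ℂ} {d n : ℕ} {L : Set (ℂ × ℂ)},
      ConicFamily H d n L → ∀ p : (ℂ × ℂ) × ℂ, p ∈ famZero (fun w => H (s, w)) →
      (H (s, p.1)).roots.Nodup →
      GraphAt (fun p : (ℂ × ℂ) × ℂ => (H (s, p.1)).eval p.2) p 1 := by
    intro H d n L hH p hp hnd
    have hfam := hH.fam_slice s
    have hev : ∀ᶠ w in 𝓝 p.1, (H (s, w)).roots.toFinset.card = d := by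
      filter_upwards [hfam.isOpen_nodup.mem_nhds hnd] with w hw
      rw [Multiset.toFinset_card_of_nodup hw, hfam.card_roots w]
    have h1 := hfam.graphAt hev hp
    rwa [Multiset.count_eq_one_of_mem hnd ((hfam.mem_roots (e := p.1)).2 hp)] at h1
  have hev := h.eventually_rescale hs hx
  have hev' := h.symm.eventually_rescale hs (h.ends.rescale_notMem hs hx)
  obtain ⟨k, hk, hres⟩ := GraphAt.hasRes (hgraph h.conic x hxf hf)
    (hgraph h.conic' (rescale φ s x) ((h.rescale_mem_iff hs hx).1 hxf) hg) one_ne_zero one_ne_zero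
    (hev.mono fun _ h => h.1) (hev'.mono fun _ h => h.1) (hev.mono fun _ h => h.2.1)
    (hev'.mono fun _ h => h.2.1) (hev.mono fun _ h => h.2.2)
  exact ⟨k, hk, by simpa using hres⟩

theorem frequently_nodup (h : BlowDownPair Hf Hg d e n n' L L' K K' C φ ψ φ' ψ' l) {s : ℝ}
    (hs : 0 < s) {x : (ℂ × ℂ) × ℂ} (hx : s⁻¹ • x ∉ K) (hxf : x ∈ famZero fun w => Hf (s, w)) :
    ∃ᶠ p in 𝓝[famZero fun w => Hf (s, w)] x, (Hg (s, (rescale φ s p).1)).roots.Nodup := by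
  intro hbad
  rw [eventually_nhdsWithin_iff] at hbad
  set q := rescale φ s x with hq
  have hqK := h.ends.rescale_notMem hs hx
  have hqg : q ∈ famZero fun w => Hg (s, w) := (h.rescale_mem_iff hs hx).1 hxf
  have hψ : Tendsto (rescale ψ s) (𝓝 q) (𝓝 x) := by
    simpa only [ContinuousAt, hq, h.ends.rescale_rescale hs hx] using h.symm.continuousAt_rescale hqK
  have h1 : ∀ᶠ q' in 𝓝 (q.1, q.2), q' ∈ famZero (fun w => Hg (s, w)) →
      ¬ (Hg (s, q'.1)).roots.Nodup := by
    filter_upwards [hψ.eventually hbad, h.symm.eventually_rescale hs hqK] with q' h2 ⟨_, h3, h4⟩ h5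
    simpa only [h3] using h2 (h4.1 h5)
  rw [nhds_prod_eq] at h1
  obtain ⟨P, hP, Q, hQ, hPQ⟩ := eventually_prod_iff.1 h1
  have hroot := (h.conic'.fam_slice s).eventually_exists_root_near (e₀ := q.1) hqg hQ
  have hdense := mem_closure_iff_frequently.1 (h.conic'.dense s (by exact_mod_cast hs.ne') q.1)
  obtain ⟨w, hw, hPw, z, hz, hwz⟩ := (hdense.and_eventually (hP.and hroot)).exists
  exact hPQ hPw hz hwz hw

theorem exists_generic (h : BlowDownPair Hf Hg d e n n' L L' K K' C φ ψ φ' ψ' l) {s : ℝ}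
    (hs : 0 < s) {O : Set (ℂ × ℂ)} (hO : IsOpen O) (hne : O.Nonempty) {c : ℂ} {ε : ℝ}
    (hK : ∀ w ∈ O, ∀ y ∈ Metric.closedBall c ε, s⁻¹ • (w, y) ∉ K) :
    ∃ w ∈ O, (Hf (s, w)).roots.Nodup ∧ ∀ z, (Hf (s, w)).eval z = 0 → ‖z - c‖ < ε →
      (Hg (s, (rescale φ s (w, z)).1)).roots.Nodup := by
  have hs0 : (s : ℂ) ≠ 0 := by exact_mod_cast hs.ne'
  have hfam := h.conic.fam_slice s
  obtain ⟨w₁, hw₁, hw₁O⟩ := (h.conic.dense s hs0).exists_mem_open hO hne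
  obtain ⟨U, hU, hw₁U, r, hr, -⟩ := hfam.exists_sheets (e₀ := w₁) (n := d) (by
    filter_upwards [hfam.isOpen_nodup.mem_nhds hw₁] with w hw
    rw [Multiset.toFinset_card_of_nodup hw, hfam.card_roots w])
  have hOU := hO.inter hU
  have hr' : ∀ i, ∀ w ∈ O ∩ U, ContinuousAt (r i) w := fun i w hw =>
    (hr.cont i).continuousAt (hU.mem_nhds hw.2)
  set E : Fin d → Set (ℂ × ℂ) := fun i => {w | w ∈ O ∩ U ∧
    (r i w ∉ Metric.closedBall c ε ∨ (Hg (s, (rescale φ s (w, r i w)).1)).roots.Nodup)} with hEdef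
  have hpair : ∀ i, ∀ w ∈ O ∩ U, ContinuousAt (fun w => (w, r i w)) w := fun i w hw =>
    continuousAt_id.prodMk (hr' i w hw)
  have hEo : ∀ i, IsOpen (E i) := by
    intro i
    rw [isOpen_iff_mem_nhds]
    rintro w ⟨hw, hw'⟩
    by_cases hb : r i w ∈ Metric.closedBall c ε
    · have hnd := hw'.resolve_left fun hn => hn hb
      have hcont : ContinuousAt (fun w => (rescale φ s (w, r i w)).1) w :=
        (ContinuousAt.comp (f := fun w => (w, r i w)) (h.continuousAt_rescale (hK w hw.1 _ hb))
          (hpair i w hw)).fst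
      filter_upwards [hOU.mem_nhds hw,
        hcont.eventually ((h.conic'.fam_slice s).isOpen_nodup.mem_nhds hnd)] with w' h1 h2
      exact ⟨h1, .inr h2⟩
    · filter_upwards [hOU.mem_nhds hw,
        (hr' i w hw).eventually (Metric.isClosed_closedBall.isOpen_compl.mem_nhds hb)] with w' h1 h2
      exact ⟨h1, .inl h2⟩
  have hEd : ∀ i, O ∩ U ⊆ closure (E i) := by
    intro i w hw
    by_cases hb : r i w ∈ Metric.closedBall c ε
    · have hfreq := h.frequently_nodup hs (hK w hw.1 _ hb) (hr.mem hw.2 i)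
      have h2 := hr.eventually_eq hU (p := (w, r i w)) hw.2 (i := i) rfl
      have h3 : ∀ᶠ p in 𝓝[famZero fun w => Hf (s, w)] (w, r i w), p.1 ∈ O ∩ U :=
        nhdsWithin_le_nhds ((continuous_fst.tendsto (w, r i w)).eventually (hOU.mem_nhds hw))
      have h4 : Tendsto Prod.fst (𝓝[famZero fun w => Hf (s, w)] (w, r i w)) (𝓝 w) :=
        (continuous_fst.tendsto (w, r i w)).mono_left nhdsWithin_le_nhds
      refine mem_closure_iff_frequently.2 (h4.frequently ?_)
      refine (hfreq.and_eventually (h2.and h3)).mono ?_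
      rintro p ⟨hp, ⟨-, hp2⟩, hp3⟩
      refine ⟨hp3, .inr ?_⟩
      rwa [hp2]
    · exact subset_closure ⟨hw, .inl hb⟩
  obtain ⟨w, ⟨hwO, hwU⟩, hw⟩ := hOU.exists_mem_of_subset_closure ⟨w₁, hw₁O, hw₁U⟩ hEo hEd
  refine ⟨w, hwO, ?_, fun z hz hzc => ?_⟩
  · rw [hfam.nodup_iff w]
    have hsub : (Finset.univ.image fun i => r i w) ⊆ (Hf (s, w)).roots.toFinset := by
      intro z hz
      obtain ⟨i, -, rfl⟩ := Finset.mem_image.1 hz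
      exact Multiset.mem_toFinset.2 ((hfam.mem_roots (e := w)).2 (hr.mem hwU i))
    calc d = (Finset.univ.image fun i => r i w).card := by
          rw [Finset.card_image_of_injective _ (hr.inj w hwU), Finset.card_fin]
      _ ≤ _ := Finset.card_le_card hsub
  · obtain ⟨i, rfl⟩ := (hr.mem_iff w hwU z).1 hz
    refine (hw i).2.resolve_left fun hn => hn ?_
    rw [Metric.mem_closedBall, dist_eq_norm]
    exact hzc.le

end BlowDownPair

namespace BlowDownPair

variable {Hf Hg : ℂ × (ℂ × ℂ) → Polynomial ℂ} {d e n n' : ℕ} {L L' : Set (ℂ × ℂ)}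
  {K K' : Set ((ℂ × ℂ) × ℂ)} {C : NNReal} {φ ψ φ' ψ' : (ℂ × ℂ) × ℂ → (ℂ × ℂ) × ℂ}
  {l : Filter ℝ}

theorem natAbs_wind_le (h : BlowDownPair Hf Hg d e n n' L L' K K' C φ ψ φ' ψ' l) {s : ℝ}
    (hs : 0 < s) {w : ℂ × ℂ} {c : ℂ} {ε δ : ℝ} (hε : 0 < ε) (hδ : ε < δ)
    (hK : ∀ y ∈ Metric.closedBall c δ, s⁻¹ • (w, y) ∉ K) (hnd : (Hf (s, w)).roots.Nodup)
    (hcirc : ∀ z, (Hf (s, w)).eval z = 0 → ‖z - c‖ ≠ ε)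
    (hgen : ∀ z, (Hf (s, w)).eval z = 0 → ‖z - c‖ < ε →
      (Hg (s, (rescale φ s (w, z)).1)).roots.Nodup) {j : ℤ}
    (hj : HasWind (fun t => (Hg (s, (rescale φ s (w, circ c ε t)).1)).eval
      (rescale φ s (w, circ c ε t)).2) j) :
    j.natAbs ≤ (Hf (s, w)).roots.countP fun z => ‖z - c‖ < ε := by
  classical
  have hfam := h.conic.fam_slice s
  have hmem : ∀ {z}, z ∈ (Hf (s, w)).roots ↔ (Hf (s, w)).eval z = 0 := hfam.mem_roots (e := w)
  set B := (Hf (s, w)).roots.toFinset.filter fun z => ‖z - c‖ < ε with hBdef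
  have hBmem : ∀ {z}, z ∈ B ↔ (Hf (s, w)).eval z = 0 ∧ ‖z - c‖ < ε := by
    intro z
    rw [hBdef, Finset.mem_filter, Multiset.mem_toFinset, hmem]
  set G : ℂ → ℂ := fun y => (Hg (s, (rescale φ s (w, y)).1)).eval (rescale φ s (w, y)).2 with hG
  have hev : ∀ᶠ ρ in 𝓝[>] ε, ∀ z ∈ (Hf (s, w)).roots.toFinset, ε < ‖z - c‖ → ρ < ‖z - c‖ := by
    refine (Finset.eventually_all _).2 fun z _ => ?_
    by_cases hz : ε < ‖z - c‖
    · filter_upwards [nhdsWithin_le_nhds (Iio_mem_nhds hz)] with ρ hρ _ using hρ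
    · exact .of_forall fun ρ hρ => absurd hρ hz
  obtain ⟨ρ, ⟨hρ, hρδ⟩, hερ⟩ := ((hev.and (nhdsWithin_le_nhds (Iio_mem_nhds hδ))).and
    self_mem_nhdsWithin).exists
  have hKρ : ∀ y ∈ Metric.ball c ρ, s⁻¹ • (w, y) ∉ K := fun y hy =>
    hK y (Metric.ball_subset_closedBall (Metric.ball_subset_ball (le_of_lt hρδ) hy))
  have hGc : ∀ y ∈ Metric.ball c ρ, ContinuousAt G y := fun y hy =>
    (h.conic'.fam_slice s).cont.continuousAt.comp (f := fun y => rescale φ s (w, y))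
      (ContinuousAt.comp (f := fun y => (w, y)) (h.continuousAt_rescale (hKρ y hy))
        (continuousAt_const.prodMk continuousAt_id))
  have hG0 : ∀ y ∈ Metric.ball c ρ \ (B : Set ℂ), G y ≠ 0 := by
    rintro y ⟨hy, hyB⟩ h0
    have hy0 : (Hf (s, w)).eval y = 0 := (h.rescale_mem_iff hs (hKρ y hy)).2 h0
    rw [Metric.mem_ball, dist_eq_norm] at hy
    refine hyB (hBmem.2 ⟨hy0, ?_⟩)
    by_contra hlt
    exact (hρ y (Multiset.mem_toFinset.2 (hmem.2 hy0))
      (lt_of_le_of_ne (not_lt.1 hlt) (hcirc y hy0).symm)).not_gt hy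
  have hres : ∀ b ∈ B, ∃ k : ℤ, (k = 1 ∨ k = -1) ∧ HasRes G b k := fun b hb =>
    h.hasRes_rescale (x := (w, b)) hs (hKρ b (by
      rw [Metric.mem_ball, dist_eq_norm]
      exact (hBmem.1 hb).2.trans hερ)) (hBmem.1 hb).1 hnd (hgen b (hBmem.1 hb).1 (hBmem.1 hb).2)
  choose! k hk hkres using hres
  have hwind := hasWind_circ_of_hasRes hε hερ (fun b hb => by
    rw [Metric.mem_ball, dist_eq_norm]
    exact (hBmem.1 hb).2) (fun y hy => (hGc y hy.1).continuousWithinAt) hG0 hkres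
  rw [hj.unique hwind]
  calc (∑ b ∈ B, k b).natAbs ≤ ∑ b ∈ B, (k b).natAbs := Int.natAbs_sum_le _ _
    _ = B.card := by
      rw [Finset.card_eq_sum_ones]
      exact Finset.sum_congr rfl fun b hb => by rcases hk b hb with h | h <;> rw [h] <;> rfl
    _ = _ := by
      rw [hBdef, ← Multiset.toFinset_filter, Multiset.toFinset_card_of_nodup (hnd.filter _),
        Multiset.countP_eq_card_filter]

theorem _root_.ConicFamily.eventually_card (h : ConicFamily Hf d n L) {w : ℂ × ℂ} (hw : w ∈ coneBase L) :
    ∀ᶠ w in 𝓝 w, (Hf (0, w)).roots.toFinset.card = n := by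
  filter_upwards [(isOpen_coneBase h.finite_lines).mem_nhds hw] with w hw using h.card w hw

/-- The blow down map does not increase multiplicities of tangent cones at infinity. -/
theorem count_le (h : BlowDownPair Hf Hg d e n n' L L' K K' C φ ψ φ' ψ' l) {x : (ℂ × ℂ) × ℂ}
    (hx : x ∈ famZero fun w => Hf (0, w)) (hxL : x.1 ∈ coneBase L)
    (hxL' : (φ' x).1 ∈ coneBase L') :
    (Hg (0, (φ' x).1)).roots.count (φ' x).2 ≤ (Hf (0, x.1)).roots.count x.2 := by
  classical
  have hx1 : x.1 ≠ 0 := hxL.1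
  have hpt : ∀ y, (x.1, y) ≠ (0 : (ℂ × ℂ) × ℂ) := fun y hy => hx1 (congrArg Prod.fst hy)
  have hx0 : x ≠ 0 := hpt x.2
  have hfam := h.conic.fam_slice 0
  have hxg := h.mapsTo_famZero hx0 hx
  have hpos : (Hf (0, x.1)).roots.count x.2 ≠ 0 :=
    Multiset.count_ne_zero.2 ((hfam.mem_roots (e := x.1)).2 hx)
  have hpos' : (Hg (0, (φ' x).1)).roots.count (φ' x).2 ≠ 0 :=
    Multiset.count_ne_zero.2 (((h.conic'.fam_slice 0).mem_roots (e := (φ' x).1)).2 hxg)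
  obtain ⟨k, hk, hres⟩ := GraphAt.hasRes
    (hfam.graphAt (h.conic.eventually_card hxL) hx)
    ((h.conic'.fam_slice 0).graphAt (h.conic'.eventually_card hxL') hxg) hpos hpos'
    (φ := φ') (ψ := ψ') (.of_forall fun _ => h.lip.continuous.continuousAt)
    (.of_forall fun _ => h.lip'.continuous.continuousAt) (.of_forall h.left_inv)
    (.of_forall h.symm.left_inv) (by
      filter_upwards [isOpen_ne.mem_nhds hx0] with p hp using h.mem_famZero_iff hp)
  set N := (Hg (0, (φ' x).1)).roots.count (φ' x).2 with hN
  have hev : ∀ᶠ ε in 𝓝[>] (0 : ℝ), ∀ z ∈ (Hf (0, x.1)).roots.toFinset, z ≠ x.2 → ε < ‖z - x.2‖ := by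
    refine (Finset.eventually_all _).2 fun z _ => ?_
    by_cases hz : z = x.2
    · exact .of_forall fun ε hε => absurd hz hε
    · filter_upwards [nhdsWithin_le_nhds (Iio_mem_nhds (norm_pos_iff.2 (sub_ne_zero.2 hz)))]
        with ε hε _ using hε
  obtain ⟨ε, ⟨hwind, hsep⟩, hε⟩ := ((hres.and hev).and self_mem_nhdsWithin).exists
  replace hε : 0 < ε := hε
  have hsep' : ∀ z, (Hf (0, x.1)).eval z = 0 → z ≠ x.2 → ε < ‖z - x.2‖ := fun z hz =>
    hsep z (Multiset.mem_toFinset.2 ((hfam.mem_roots (e := x.1)).2 hz))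
  have hcirc0 : ∀ z, (Hf (0, x.1)).eval z = 0 → ‖z - x.2‖ ≠ ε := by
    intro z hz heq
    by_cases hzx : z = x.2
    · rw [hzx, sub_self, norm_zero] at heq
      exact hε.ne heq
    · exact (hsep' z hz hzx).ne' heq
  have hcount : (Hf (0, x.1)).roots.countP (fun z => ‖z - x.2‖ < ε) =
      (Hf (0, x.1)).roots.count x.2 := by
    rw [Multiset.count]
    refine Multiset.countP_congr rfl fun z hz => ?_
    refine propext ⟨fun hlt => ?_, fun heq => by simpa [← heq] using hε⟩
    by_contra hne
    exact (hsep' z ((hfam.mem_roots (e := x.1)).1 hz) fun h => hne h.symm).not_gt hlt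
  have hKev := (isCompact_closedBall x.2 (2 * ε)).eventually_forall_prod (l := l) (x₀ := x.1)
    fun y _ => h.eventually_notMem (hpt y)
  set G₀ : ℂ → ℂ := fun y => (Hg (0, (φ' (x.1, y)).1)).eval (φ' (x.1, y)).2 with hG₀
  have hG₀c : Continuous G₀ := (h.conic'.fam_slice 0).cont.comp
    (h.lip.continuous.comp (continuous_const.prodMk continuous_id))
  have hG₀ne : ∀ y ∈ Metric.sphere x.2 ε, G₀ y ≠ 0 := by
    intro y hy h0
    rw [mem_sphere_iff_norm] at hy
    exact hcirc0 y ((h.mem_famZero_iff (hpt y)).2 h0) hy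
  have hGev := (isCompact_sphere x.2 ε).eventually_forall_prod (l := l) (x₀ := x.1)
    (P := fun q => ‖(Hg (q.1, (rescale φ q.1 q.2).1)).eval (rescale φ q.1 q.2).2 - G₀ q.2.2‖ <
      ‖G₀ q.2.2‖) fun y hy => by
    have h1 := h.tendsto_eval (hpt y)
    have h2 : Tendsto (fun q : ℝ × ((ℂ × ℂ) × ℂ) => G₀ q.2.2) (l ×ˢ 𝓝 (x.1, y)) (𝓝 (G₀ y)) :=
      ((hG₀c.comp continuous_snd).tendsto (x.1, y)).comp tendsto_snd
    refine (h1.sub h2).norm.eventually_lt h2.norm ?_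
    rw [hG₀, sub_self, norm_zero]
    exact norm_pos_iff.2 (hG₀ne y hy)
  have hcast : Tendsto (fun q : ℝ × (ℂ × ℂ) => ((q.1 : ℂ), q.2)) (l ×ˢ 𝓝 x.1) (𝓝 (0, x.1)) := by
    have h1 : Tendsto (fun s : ℝ => (s : ℂ)) l (𝓝 0) :=
      (Complex.continuous_ofReal.tendsto' 0 0 Complex.ofReal_zero).mono_left
        (h.le_nhds.trans nhdsWithin_le_nhds)
    exact (h1.comp tendsto_fst).prodMk_nhds tendsto_snd
  have hcev := hcast.eventually (h.conic.fam.eventually_circ hε hcirc0)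
  have := h.neBot
  obtain ⟨s, hs⟩ := ((hKev.and (hGev.and hcev)).curry).exists
  obtain ⟨O, hOsub, hO, hxO⟩ := mem_nhds_iff.1 hs
  have hs0 : 0 < s := ((hOsub hxO).1 x.2 (Metric.mem_closedBall_self (by positivity))).1
  obtain ⟨w, hwO, hnd, hgen⟩ := h.exists_generic hs0 hO ⟨_, hxO⟩ (c := x.2) (ε := 2 * ε)
    fun w hw y hy => ((hOsub hw).1 y hy).2
  obtain ⟨h1, h2, h3, h4⟩ := hOsub hwO
  have hKw : ∀ y ∈ Metric.closedBall x.2 (2 * ε), s⁻¹ • (w, y) ∉ K := fun y hy => (h1 y hy).2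
  have hsph : ∀ t, circ x.2 ε t ∈ Metric.sphere x.2 ε := fun t => by
    rw [mem_sphere_iff_norm]
    exact norm_circ_sub x.2 hε.le t
  have hwind' : HasWind (fun t => (Hg (s, (rescale φ s (w, circ x.2 ε t)).1)).eval
      (rescale φ s (w, circ x.2 ε t)).2) (k * N) := by
    refine hwind.of_dist_lt ?_ (by simp only [circ_one]) fun t => h2 _ (hsph t)
    refine continuous_iff_continuousAt.2 fun t => ?_
    have hc : circ x.2 ε t ∈ Metric.closedBall x.2 (2 * ε) := by
      rw [Metric.mem_closedBall, dist_eq_norm, norm_circ_sub x.2 hε.le]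
      linarith
    exact (h.conic'.fam_slice s).cont.continuousAt.comp
      (f := fun t => rescale φ s (w, circ x.2 ε t))
      (ContinuousAt.comp (f := fun t => (w, circ x.2 ε t)) (h.continuousAt_rescale (hKw _ hc))
        (continuousAt_const.prodMk (continuous_circ x.2 ε).continuousAt))
  have hle := h.natAbs_wind_le hs0 hε (by linarith : ε < 2 * ε) hKw hnd h3
    (fun z hz hzc => hgen z hz (by linarith)) hwind'
  calc N = (k * N).natAbs := by rcases hk with rfl | rfl <;> simp
    _ ≤ _ := hle
    _ = _ := h4
    _ = _ := hcount

theorem count_eq (h : BlowDownPair Hf Hg d e n n' L L' K K' C φ ψ φ' ψ' l) {x : (ℂ × ℂ) × ℂ}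
    (hx : x ∈ famZero fun w => Hf (0, w)) (hxL : x.1 ∈ coneBase L)
    (hxL' : (φ' x).1 ∈ coneBase L') :
    (Hg (0, (φ' x).1)).roots.count (φ' x).2 = (Hf (0, x.1)).roots.count x.2 := by
  refine (h.count_le hx hxL hxL').antisymm ?_
  have h1 := h.symm.count_le (x := φ' x)
    (h.mapsTo_famZero (fun h0 => hxL.1 (congrArg Prod.fst h0)) hx) hxL' (by rwa [h.left_inv])
  rwa [h.left_inv] at h1

end BlowDownPair

open scoped Classical in
/-- The number of roots of `P`, counted with multiplicity, lying in `S`. -/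
noncomputable def rootWeight (P : Polynomial ℂ) (S : Set ℂ) : ℕ :=
  ∑ z ∈ P.roots.toFinset with z ∈ S, P.roots.count z

theorem rootWeight_eq_ncard_mul {P : Polynomial ℂ} {S : Set ℂ} {m : ℕ}
    (hS : ∀ z ∈ S, z ∈ P.roots) (hm : ∀ z ∈ S, P.roots.count z = m) :
    rootWeight P S = S.ncard * m := by
  classical
  have h1 : S = ((P.roots.toFinset.filter (· ∈ S) : Finset ℂ) : Set ℂ) := by
    ext z
    simpa using hS z
  rw [rootWeight, Finset.sum_congr rfl fun z hz => hm z (Finset.mem_filter.1 hz).2,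
    Finset.sum_const, smul_eq_mul, (congrArg Set.ncard h1).trans (Set.ncard_coe_finset _)]

theorem sum_rootWeight_le {ι : Type*} (P : Polynomial ℂ) (s : Finset ι) {S : ι → Set ℂ}
    (hS : ∀ i ∈ s, ∀ j ∈ s, i ≠ j → Disjoint (S i) (S j)) :
    ∑ i ∈ s, rootWeight P (S i) ≤ P.roots.card := by
  classical
  unfold rootWeight
  rw [← Finset.sum_biUnion, ← Multiset.toFinset_sum_count_eq]
  · refine Finset.sum_le_sum_of_subset fun z hz => ?_
    obtain ⟨i, -, hi⟩ := Finset.mem_biUnion.1 hz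
    exact (Finset.mem_filter.1 hi).1
  · intro i hi j hj hij
    refine Finset.disjoint_left.2 fun z hz hz' => ?_
    exact Set.disjoint_left.1 (hS i hi j hj hij) (Finset.mem_filter.1 hz).2
      (Finset.mem_filter.1 hz').2

theorem card_roots_le_sum_rootWeight {ι : Type*} (P : Polynomial ℂ) (s : Finset ι)
    {S : ι → Set ℂ} (hS : ∀ z ∈ P.roots, ∃ i ∈ s, z ∈ S i) :
    P.roots.card ≤ ∑ i ∈ s, rootWeight P (S i) := by
  classical
  unfold rootWeight
  rw [← Multiset.toFinset_sum_count_eq]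
  simp only [Finset.sum_filter]
  rw [Finset.sum_comm]
  refine Finset.sum_le_sum fun z hz => ?_
  obtain ⟨i, hi, hzi⟩ := hS z (Multiset.mem_toFinset.1 hz)
  refine le_trans (le_of_eq ?_) (Finset.single_le_sum (fun _ _ => Nat.zero_le _) hi)
  rw [if_pos hzi]

theorem ConicFamily.exists_rootWeight {H : ℂ × (ℂ × ℂ) → Polynomial ℂ} {d n : ℕ}
    {L : Set (ℂ × ℂ)} (h : ConicFamily H d n L) {A : Set ((ℂ × ℂ) × ℂ)}
    (hA : IsSheetComp (famZero fun w => H (0, w)) (coneBase L) A) :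
    ∃ m, (∀ p ∈ A, (H (0, p.1)).roots.count p.2 = m) ∧ ∀ w,
      rootWeight (H (0, w)) {y | (w, y) ∈ A} = {y | (w, y) ∈ A}.ncard * m := by
  obtain ⟨m, -, hm⟩ := h.exists_mult hA
  exact ⟨m, hm, fun w => rootWeight_eq_ncard_mul
    (fun z hz => ((h.fam_slice 0).mem_roots (e := w)).2 (hA.subset hz).1) fun z hz => hm _ hz⟩

namespace BlowDownPair

variable {Hf Hg : ℂ × (ℂ × ℂ) → Polynomial ℂ} {d e n n' : ℕ} {L L' : Set (ℂ × ℂ)}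
  {K K' : Set ((ℂ × ℂ) × ℂ)} {C : NNReal} {φ ψ φ' ψ' : (ℂ × ℂ) × ℂ → (ℂ × ℂ) × ℂ}
  {l : Filter ℝ}

theorem exists_rootWeight_eq (h : BlowDownPair Hf Hg d e n n' L L' K K' C φ ψ φ' ψ' l)
    {w w' : ℂ × ℂ} (hw : w ∈ coneBase L) (hw' : w' ∈ coneBase L') {A : Set ((ℂ × ℂ) × ℂ)}
    (hA : IsSheetComp (famZero fun w => Hf (0, w)) (coneBase L) A) :
    ∃ B, IsSheetComp (famZero fun w => Hg (0, w)) (coneBase L') B ∧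
      Set.MapsTo φ' (closure A \ {0}) (closure B \ {0}) ∧
      Set.MapsTo ψ' (closure B \ {0}) (closure A \ {0}) ∧
      rootWeight (Hf (0, w)) {y | (w, y) ∈ A} = rootWeight (Hg (0, w')) {y | (w', y) ∈ B} := by
  obtain ⟨B, hB, hAB, hBA, x, hxA, hxB⟩ := h.exists_comp hA
  refine ⟨B, hB, hAB, hBA, ?_⟩
  obtain ⟨m, hm, hmw⟩ := h.conic.exists_rootWeight hA
  obtain ⟨m', hm', hmw'⟩ := h.conic'.exists_rootWeight hB
  rw [hmw, hmw', h.ncard_fibre_eq hA hB hAB hBA hw hw', ← hm x hxA, ← hm' _ hxB,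
    h.count_eq (hA.subset hxA).1 (hA.subset hxA).2 (hB.subset hxB).2]

theorem degree_le (h : BlowDownPair Hf Hg d e n n' L L' K K' C φ ψ φ' ψ' l) : d ≤ e := by
  classical
  obtain ⟨w, hw⟩ := (dense_coneBase h.conic.finite_lines h.conic.line_ne_zero).nonempty
  obtain ⟨w', hw'⟩ := (dense_coneBase h.conic'.finite_lines h.conic'.line_ne_zero).nonempty
  have hcomp : ∀ z ∈ (Hf (0, w)).roots, ∃ A,
      IsSheetComp (famZero fun w => Hf (0, w)) (coneBase L) A ∧ (w, z) ∈ A := fun z hz =>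
    IsSheetComp.exists_mem (p := (w, z)) (((h.conic.fam_slice 0).mem_roots (e := w)).1 hz) hw
  choose! comp hcomp hmem using hcomp
  set T := (Hf (0, w)).roots.toFinset.image comp with hT
  have hTc : ∀ A ∈ T, IsSheetComp (famZero fun w => Hf (0, w)) (coneBase L) A := by
    intro A hA
    obtain ⟨z, hz, rfl⟩ := Finset.mem_image.1 hA
    exact hcomp z (Multiset.mem_toFinset.1 hz)
  choose! β hβ hβ1 hβ2 hβw using fun A hA => h.exists_rootWeight_eq hw hw' (hTc A hA)
  rw [← (h.conic.fam_slice 0).card_roots w, ← (h.conic'.fam_slice 0).card_roots w']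
  refine (card_roots_le_sum_rootWeight _ T (S := fun A => {y | (w, y) ∈ A}) fun z hz =>
    ⟨comp z, Finset.mem_image_of_mem _ (Multiset.mem_toFinset.2 hz), hmem z hz⟩).trans ?_
  rw [Finset.sum_congr rfl hβw]
  refine sum_rootWeight_le _ T (S := fun A => {y | (w', y) ∈ β A}) fun A hA A' hA' hne => ?_
  refine Set.disjoint_left.2 fun y hy hy' => hne ?_
  have hββ := (hβ A hA).eq_of_nonempty (hβ A' hA') ⟨_, hy, hy'⟩
  obtain ⟨p, hp⟩ := (hTc A hA).nonempty
  have hpL := ((hTc A hA).subset hp).2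
  have h1 := hβ1 A hA ((h.conic.mem_comp_iff (hTc A hA) hpL).2 hp)
  rw [hββ] at h1
  have h2 := hβ2 A' hA' h1
  rw [h.left_inv, h.conic.mem_comp_iff (hTc A' hA') hpL] at h2
  exact (hTc A hA).eq_of_nonempty (hTc A' hA') ⟨p, hp, h2⟩

theorem degree_eq (h : BlowDownPair Hf Hg d e n n' L L' K K' C φ ψ φ' ψ' l) : d = e :=
  h.degree_le.antisymm h.symm.degree_le

end BlowDownPair

namespace Polynomial

theorem Monic.squarefree_map_fraction {R : Type*} [CommRing R] [IsDomain R]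
    [IsIntegrallyClosed R] {P : R[X]} (hP : P.Monic) (hsq : Squarefree P) (K : Type*) [Field K]
    [Algebra R K] [IsFractionRing R K] : Squarefree (P.map (algebraMap R K)) := by
  intro q hq
  have hinj := IsFractionRing.injective R K
  obtain ⟨g, hg⟩ := IsIntegrallyClosed.eq_map_mul_C_of_dvd K hP ((dvd_mul_right q q).trans hq)
  have hq0 : q ≠ 0 := by
    rintro rfl
    exact (hP.map (algebraMap R K)).ne_zero (zero_dvd_iff.1 (by simpa using hq))
  have hlc : q.leadingCoeff ≠ 0 := leadingCoeff_ne_zero.2 hq0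
  have hgm : g.Monic := by
    refine (Function.Injective.monic_map_iff hinj).2 ?_
    have h1 := congrArg Polynomial.leadingCoeff hg
    rw [leadingCoeff_mul, leadingCoeff_C] at h1
    exact mul_right_cancel₀ hlc (h1.trans (one_mul _).symm)
  have hdvd : (g * g).map (algebraMap R K) ∣ P.map (algebraMap R K) := by
    rw [Polynomial.map_mul]
    refine dvd_trans ?_ hq
    rw [← hg]
    exact mul_dvd_mul (dvd_mul_right _ _) (dvd_mul_right _ _)
  have hu := hsq g ((map_dvd_map _ hinj (hgm.mul hgm)).1 hdvd)
  rw [← hg]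
  exact (hu.map (mapRingHom (algebraMap R K))).mul (isUnit_C.2 hlc.isUnit)

/-- A monic squarefree polynomial over an integrally closed domain of characteristic zero is
separable after inverting a nonzero element. -/
theorem Monic.exists_bezout_derivative {R : Type*} [CommRing R] [IsDomain R] [CharZero R]
    [IsIntegrallyClosed R] {P : R[X]} (hP : P.Monic) (hsq : Squarefree P) :
    ∃ c : R, c ≠ 0 ∧ ∃ a b : R[X], a * P + b * derivative P = C c := by
  set K := FractionRing R
  have hinj := IsFractionRing.injective R K
  have : CharZero K := charZero_of_injective_algebraMap hinj
  obtain ⟨a, b, hab⟩ := PerfectField.separable_iff_squarefree.2 (hP.squarefree_map_fraction hsq K)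
  obtain ⟨s, hs0, hs⟩ := IsLocalization.integerNormalization_spec (nonZeroDivisors R) a
  obtain ⟨t, ht0, ht⟩ := IsLocalization.integerNormalization_spec (nonZeroDivisors R) b
  set a' := IsLocalization.integerNormalization (nonZeroDivisors R) a
  set b' := IsLocalization.integerNormalization (nonZeroDivisors R) b
  refine ⟨s * t, mul_ne_zero (nonZeroDivisors.ne_zero hs0) (nonZeroDivisors.ne_zero ht0),
    C t * a', C s * b', map_injective _ hinj ?_⟩
  have hsm : ∀ (r : R) (p : K[X]), r • p = C (algebraMap R K r) * p := fun r p => by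
    rw [← Polynomial.smul_eq_C_mul, algebraMap_smul]
  rw [derivative_map] at hab
  simp only [Polynomial.map_add, Polynomial.map_mul, map_C, hs, ht, hsm, map_mul]
  linear_combination (C (algebraMap R K s) * C (algebraMap R K t)) * hab

theorem nodup_roots_map_of_bezout {R : Type*} [CommRing R] {P : R[X]} {c : R} {a b : R[X]}
    (h : a * P + b * derivative P = C c) (ρ : R →+* ℂ) (hc : ρ c ≠ 0) :
    (P.map ρ).roots.Nodup := by
  refine nodup_roots ⟨C (ρ c)⁻¹ * a.map ρ, C (ρ c)⁻¹ * b.map ρ, ?_⟩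
  have h1 := congrArg (Polynomial.map ρ) h
  simp only [Polynomial.map_add, Polynomial.map_mul, map_C, ← derivative_map] at h1
  rw [mul_assoc, mul_assoc, ← mul_add, h1, ← C_mul, inv_mul_cancel₀ hc, C_1]

/-- The number of distinct roots of a monic family of polynomials over the affine line is
constant off a finite set. -/
theorem Monic.exists_card_toFinset_roots {P : ℂ[X][X]} (hP : P.Monic) :
    ∃ (n : ℕ) (c : ℂ[X]), c ≠ 0 ∧ ∀ t, c.eval t ≠ 0 →
      (P.map (evalRingHom t)).roots.toFinset.card = n := by
  obtain ⟨Q, k, hQ, hQP, hPQ⟩ := exists_squarefree_dvd_pow_of_ne_zero hP.ne_zero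
  obtain ⟨u, hu⟩ : IsUnit Q.leadingCoeff := by
    obtain ⟨S, rfl⟩ := hQP
    refine IsUnit.of_mul_eq_one S.leadingCoeff ?_
    rw [← leadingCoeff_mul, hP.leadingCoeff]
  have huC : IsUnit (C ((u⁻¹ : ℂ[X]ˣ) : ℂ[X])) := isUnit_C.2 (Units.isUnit _)
  set T := C ((u⁻¹ : ℂ[X]ˣ) : ℂ[X]) * Q with hT
  have hass : Associated Q T := associated_unit_mul_right Q _ huC
  have hTm : T.Monic := by
    rw [Monic, hT, leadingCoeff_mul, leadingCoeff_C, ← hu, Units.inv_mul]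
  obtain ⟨c, hc, a, b, hab⟩ := hTm.exists_bezout_derivative (hass.squarefree_iff.1 hQ)
  refine ⟨T.natDegree, c, hc, fun t ht => ?_⟩
  have hnd := nodup_roots_map_of_bezout hab (evalRingHom t) ht
  have hroots : (P.map (evalRingHom t)).roots.toFinset = (T.map (evalRingHom t)).roots.toFinset := by
    have hP0 := (hP.map (evalRingHom t)).ne_zero
    have hT0 := (hTm.map (evalRingHom t)).ne_zero
    have hTP := Polynomial.map_dvd (evalRingHom t) (hass.dvd'.trans hQP)
    have hPT := Polynomial.map_dvd (evalRingHom t) (hPQ.trans (pow_dvd_pow_of_dvd hass.dvd k))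
    ext z
    rw [Multiset.mem_toFinset, Multiset.mem_toFinset, mem_roots hP0, mem_roots hT0]
    refine ⟨fun hz => ?_, fun hz => hz.dvd hTP⟩
    have h1 := hz.dvd hPT
    rw [Polynomial.map_pow, IsRoot, eval_pow] at h1
    exact eq_zero_of_pow_eq_zero h1
  rw [hroots, Multiset.toFinset_card_of_nodup hnd,
    ← (IsAlgClosed.splits (T.map (evalRingHom t))).natDegree_eq_card_roots, hTm.natDegree_map]

end Polynomial

section LineSubst

open scoped Polynomial

variable {σ R S : Type*} [CommRing R] [Algebra ℂ R] [CommRing S] [Algebra ℂ S]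

/-- The restriction of a polynomial to the parametrized line `a + v Polynomial.X`. -/
noncomputable def lineSubst (a v : σ → R) : MvPolynomial σ ℂ →ₐ[ℂ] R[X] :=
  MvPolynomial.aeval fun i => Polynomial.C (a i) + Polynomial.C (v i) * Polynomial.X

@[simp] theorem lineSubst_X (a v : σ → R) (i : σ) :
    lineSubst a v (MvPolynomial.X i) = Polynomial.C (a i) + Polynomial.C (v i) * Polynomial.X :=
  MvPolynomial.aeval_X _ _

theorem eval_lineSubst (a v : σ → R) (p : MvPolynomial σ ℂ) (y : R) :
    (lineSubst a v p).eval y = MvPolynomial.aeval (fun i => a i + v i * y) p := by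
  induction p using MvPolynomial.induction_on with
  | C c => simp [Polynomial.algebraMap_apply]
  | add p q hp hq => simp only [map_add, Polynomial.eval_add, hp, hq]
  | mul_X p i hp => simp [hp]

theorem map_lineSubst (ρ : R →ₐ[ℂ] S) (a v : σ → R) (p : MvPolynomial σ ℂ) :
    (lineSubst a v p).map (ρ : R →+* S) =
      lineSubst (fun i => ρ (a i)) (fun i => ρ (v i)) p := by
  induction p using MvPolynomial.induction_on with
  | C c => simp [Polynomial.algebraMap_apply]
  | add p q hp hq => simp only [map_add, Polynomial.map_add, hp, hq]
  | mul_X p i hp => simp [hp]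

theorem natDegree_coeff_prod_linear {R : Type*} [CommRing R] (a v : σ → R) (m : σ → ℕ)
    (s : Finset σ) :
    (∏ i ∈ s, (Polynomial.C (a i) + Polynomial.C (v i) * Polynomial.X) ^ m i).natDegree ≤
        ∑ i ∈ s, m i ∧
      (∏ i ∈ s, (Polynomial.C (a i) + Polynomial.C (v i) * Polynomial.X) ^ m i).coeff
        (∑ i ∈ s, m i) = ∏ i ∈ s, v i ^ m i := by
  classical
  induction s using Finset.induction_on with
  | empty => simp
  | insert i s hi ih =>
    have h1 : (Polynomial.C (a i) + Polynomial.C (v i) * Polynomial.X).natDegree ≤ 1 := by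
      compute_degree
    have h2 : ((Polynomial.C (a i) + Polynomial.C (v i) * Polynomial.X) ^ m i).natDegree ≤ m i := by
      simpa using Polynomial.natDegree_pow_le_of_le (m i) h1
    have h3 := Polynomial.coeff_pow_of_natDegree_le (m := m i) h1
    rw [mul_one] at h3
    simp only [Finset.prod_insert hi, Finset.sum_insert hi]
    refine ⟨Polynomial.natDegree_mul_le_of_le h2 ih.1, ?_⟩
    rw [Polynomial.coeff_mul_add_eq_of_natDegree_le h2 ih.1, ih.2, h3]
    simp

theorem natDegree_coeff_lineSubst {p : MvPolynomial σ ℂ} {k : ℕ}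
    (hp : p.IsHomogeneous k) (a v : σ → R) :
    (lineSubst a v p).natDegree ≤ k ∧ (lineSubst a v p).coeff k = MvPolynomial.aeval v p := by
  have h1 : ∀ m ∈ p.support, (lineSubst a v (MvPolynomial.monomial m (p.coeff m))).natDegree ≤ k ∧
      (lineSubst a v (MvPolynomial.monomial m (p.coeff m))).coeff k =
        MvPolynomial.aeval v (MvPolynomial.monomial m (p.coeff m)) := by
    intro m hm
    have hk : ∑ i ∈ m.support, m i = k := by
      rw [← hp (MvPolynomial.mem_support_iff.1 hm), Finsupp.weight_apply]
      simp [Finsupp.sum]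
    obtain ⟨h2, h3⟩ := natDegree_coeff_prod_linear a v m m.support
    rw [hk] at h2 h3
    rw [lineSubst, MvPolynomial.aeval_monomial, MvPolynomial.aeval_monomial,
      Polynomial.algebraMap_apply, Polynomial.coeff_C_mul, Finsupp.prod, Finsupp.prod, h3]
    exact ⟨(Polynomial.natDegree_C_mul_le _ _).trans h2, rfl⟩
  rw [p.as_sum, map_sum, map_sum, Polynomial.finsetSum_coeff]
  exact ⟨Polynomial.natDegree_sum_le_of_forall_le _ _ fun m hm => (h1 m hm).1,
    Finset.sum_congr rfl fun m hm => (h1 m hm).2⟩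

/-- The restriction of the homogenization of `f` in degree `d` to a line. -/
noncomputable def homogLine (f : MvPolynomial σ ℂ) (d : ℕ) (a v : σ → R) (s : R) : R[X] :=
  ∑ k ∈ Finset.range (d + 1), Polynomial.C (s ^ (d - k)) *
    lineSubst a v (MvPolynomial.homogeneousComponent k f)

variable {f : MvPolynomial σ ℂ} {d : ℕ} {a v : σ → R} {s : R}

theorem homogLine_monic [Nontrivial R]
    (hv : MvPolynomial.aeval v (MvPolynomial.homogeneousComponent d f) = (1 : R)) :
    (homogLine f d a v s).Monic ∧ (homogLine f d a v s).natDegree = d := by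
  have haux := fun k =>
    natDegree_coeff_lineSubst (MvPolynomial.homogeneousComponent_isHomogeneous k f) a v
  have hle : (homogLine f d a v s).natDegree ≤ d :=
    Polynomial.natDegree_sum_le_of_forall_le _ _ fun k hk => (Polynomial.natDegree_C_mul_le _ _).trans
      ((haux k).1.trans (Nat.lt_succ_iff.1 (Finset.mem_range.1 hk)))
  have hco : (homogLine f d a v s).coeff d = 1 := by
    rw [homogLine, Polynomial.finsetSum_coeff,
      Finset.sum_eq_single_of_mem d (Finset.self_mem_range_succ d)]
    · simp [(haux d).2, hv]
    · intro k hk hkd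
      rw [Polynomial.coeff_C_mul, Polynomial.coeff_eq_zero_of_natDegree_lt, mul_zero]
      have := Finset.mem_range.1 hk
      exact (haux k).1.trans_lt (by omega)
  exact ⟨Polynomial.monic_of_natDegree_le_of_coeff_eq_one d hle hco,
    hle.antisymm (Polynomial.le_natDegree_of_ne_zero (by rw [hco]; exact one_ne_zero))⟩

theorem eval_homogLine (y : R) : (homogLine f d a v s).eval y =
    ∑ k ∈ Finset.range (d + 1), s ^ (d - k) * MvPolynomial.aeval (fun i => a i + v i * y)
      (MvPolynomial.homogeneousComponent k f) := by
  simp only [homogLine, Polynomial.eval_finsetSum, Polynomial.eval_mul,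
    Polynomial.eval_C, eval_lineSubst]

theorem map_homogLine (ρ : R →ₐ[ℂ] S) : (homogLine f d a v s).map (ρ : R →+* S) =
    homogLine f d (fun i => ρ (a i)) (fun i => ρ (v i)) (ρ s) := by
  simp only [homogLine, Polynomial.map_sum, Polynomial.map_mul, map_lineSubst, Polynomial.map_C,
    RingHom.coe_coe, map_pow, Polynomial.map_pow]

theorem homogLine_one (hd : f.totalDegree = d) : homogLine f d a v 1 = lineSubst a v f := by
  conv_rhs => rw [← f.sum_homogeneousComponent, hd, map_sum]
  simp [homogLine]

end LineSubst

/-- The nonvanishing set of a nonzero polynomial is dense. -/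
theorem MvPolynomial.dense_eval_ne_zero {σ : Type*} {c : MvPolynomial σ ℂ} (hc : c ≠ 0) :
    Dense {w : σ → ℂ | MvPolynomial.eval w c ≠ 0} := by
  obtain ⟨w₁, hw₁⟩ : ∃ w, MvPolynomial.eval w c ≠ 0 := by
    by_contra! h
    exact hc (MvPolynomial.funext fun w => by rw [h w, map_zero])
  intro w₀
  set q := lineSubst w₀ (w₁ - w₀) c with hq
  have heval : ∀ t, q.eval t = MvPolynomial.eval (fun i => w₀ i + (w₁ i - w₀ i) * t) c :=
    fun t => eval_lineSubst w₀ (w₁ - w₀) c t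
  have hq0 : q ≠ 0 := by
    intro h0
    have := heval 1
    rw [h0, Polynomial.eval_zero] at this
    exact hw₁ (by simpa using this.symm)
  have hfin : {t | q.eval t = 0}.Finite := by
    refine q.roots.toFinset.finite_toSet.subset fun t ht => ?_
    simpa [hq0] using ht
  have hev : ∀ᶠ t in 𝓝[≠] (0 : ℂ), q.eval t ≠ 0 := by
    have h1 : ∀ᶠ t in 𝓝[≠] (0 : ℂ), t ∉ {t | q.eval t = 0} \ {0} :=
      nhdsWithin_le_nhds ((hfin.subset Set.sdiff_subset).isClosed.isOpen_compl.mem_nhds (by simp))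
    filter_upwards [h1, self_mem_nhdsWithin] with t h2 h3 h4
    exact h2 ⟨h4, h3⟩
  have hlim : Tendsto (fun (t : ℂ) i => w₀ i + (w₁ i - w₀ i) * t) (𝓝[≠] 0) (𝓝 w₀) := by
    refine Tendsto.mono_left ?_ nhdsWithin_le_nhds
    exact Continuous.tendsto' (by fun_prop) _ _ (by simp)
  refine mem_closure_of_tendsto hlim (hev.mono fun t ht => ?_)
  rwa [heval] at ht

theorem MvPolynomial.IsHomogeneous.eval_mul {σ : Type*} {p : MvPolynomial σ ℂ} {k : ℕ}
    (hp : p.IsHomogeneous k) (c : ℂ) (x : σ → ℂ) :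
    eval (fun i => c * x i) p = c ^ k * eval x p := by
  rw [eval_eq, eval_eq, Finset.mul_sum]
  refine Finset.sum_congr rfl fun m hm => ?_
  have hk : ∑ i ∈ m.support, m i = k := by
    rw [← hp (mem_support_iff.1 hm), Finsupp.weight_apply]
    simp [Finsupp.sum]
  simp only [mul_pow, Finset.prod_mul_distrib, Finset.prod_pow_eq_pow_sum, hk]
  ring

theorem Squarefree.map_mulEquiv {M N : Type*} [CommMonoid M] [CommMonoid N] {a : M}
    (ha : Squarefree a) (e : M ≃* N) : Squarefree (e a) := by
  intro q hq
  have h1 : e.symm q * e.symm q ∣ a := by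
    have h2 := map_dvd e.symm hq
    rwa [map_mul, e.symm_apply_apply] at h2
  simpa using (ha _ h1).map e

/-- The linear substitution `x i ↦ x i + u i * x 0`. -/
noncomputable def shearHom (u : Fin 3 → ℂ) : MvPolynomial (Fin 3) ℂ →ₐ[ℂ] MvPolynomial (Fin 3) ℂ :=
  aeval fun i => X i + C (u i) * X 0

theorem shearHom_comp_neg {u : Fin 3 → ℂ} (hu : u 0 = 0) :
    (shearHom u).comp (shearHom (-u)) = AlgHom.id ℂ (MvPolynomial (Fin 3) ℂ) := by
  refine algHom_ext fun i => ?_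
  simp [shearHom, hu, algHom_C, algebraMap_eq]

/-- The linear substitution `x i ↦ x i + u i * x 0` as an automorphism. -/
noncomputable def shearEquiv (u : Fin 3 → ℂ) (hu : u 0 = 0) :
    MvPolynomial (Fin 3) ℂ ≃ₐ[ℂ] MvPolynomial (Fin 3) ℂ :=
  AlgEquiv.ofAlgHom (shearHom u) (shearHom (-u)) (shearHom_comp_neg hu)
    (by simpa using shearHom_comp_neg (u := -u) (by simp [hu]))

theorem squarefree_lineSubst {f : MvPolynomial (Fin 3) ℂ} (hf : Squarefree f) {v : Fin 3 → ℂ}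
    (hv : v 0 = 1) :
    Squarefree (lineSubst (R := MvPolynomial (Fin 2) ℂ) ![0, X 0, X 1] (fun i => C (v i)) f) := by
  set e := (shearEquiv (Function.update v 0 0) (by simp)).trans (finSuccEquiv ℂ 2) with he
  have h1 : lineSubst (R := MvPolynomial (Fin 2) ℂ) ![0, X 0, X 1] (fun i => C (v i)) =
      (e : MvPolynomial (Fin 3) ℂ →ₐ[ℂ] Polynomial (MvPolynomial (Fin 2) ℂ)) := by
    refine algHom_ext fun i => ?_
    have h2 : ∀ c, finSuccEquiv ℂ 2 (C c) = Polynomial.C (C c) := fun c => by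
      simp [finSuccEquiv_apply]
    have h3 : e (X i) = finSuccEquiv ℂ 2 (shearHom (Function.update v 0 0) (X i)) := rfl
    have hX1 : finSuccEquiv ℂ 2 (X 1) = Polynomial.C (X 0) := finSuccEquiv_X_succ (j := 0)
    have hX2 : finSuccEquiv ℂ 2 (X 2) = Polynomial.C (X 1) := finSuccEquiv_X_succ (j := 1)
    rw [AlgEquiv.coe_toAlgHom, h3, lineSubst_X, shearHom, aeval_X, map_add, map_mul, h2,
      finSuccEquiv_X_zero]
    fin_cases i
    · simp [hv, finSuccEquiv_X_zero]
    · simp [hX1]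
    · simp [hX2]
  rw [h1]
  exact hf.map_mulEquiv (e : MvPolynomial (Fin 3) ℂ ≃* Polynomial (MvPolynomial (Fin 2) ℂ))

/-- The family of restrictions of the homogenization of `f` to the lines parallel to `v`. -/
noncomputable def conicOf (f : MvPolynomial (Fin 3) ℂ) (v : Fin 3 → ℂ)
    (q : ℂ × (ℂ × ℂ)) : Polynomial ℂ :=
  homogLine f f.totalDegree ![0, q.2.1, q.2.2] v q.1

section ConicOf

variable {f : MvPolynomial (Fin 3) ℂ} {v : Fin 3 → ℂ}

theorem monicFamily_conicOf (hv : eval v (homogeneousComponent f.totalDegree f) = 1) :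
    MonicFamily (conicOf f v) f.totalDegree := by
  have hv' : aeval v (homogeneousComponent f.totalDegree f) = (1 : ℂ) := hv
  refine ⟨fun q => (homogLine_monic hv').1, fun q => (homogLine_monic hv').2, ?_⟩
  simp only [conicOf, eval_homogLine]
  refine continuous_finsetSum _ fun k _ => ?_
  refine (by fun_prop : Continuous fun p : (ℂ × (ℂ × ℂ)) × ℂ => p.1.1 ^ (f.totalDegree - k)).mul ?_
  refine (MvPolynomial.continuous_eval (homogeneousComponent k f)).comp
    (continuous_pi fun i => ?_)
  fin_cases i <;> simp <;> fun_prop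

theorem eval_conicOf_mul (c s : ℂ) (w : ℂ × ℂ) (y : ℂ) :
    (conicOf f v (c * s, c • w)).eval (c * y) =
      c ^ f.totalDegree * (conicOf f v (s, w)).eval y := by
  simp only [conicOf, eval_homogLine, Finset.mul_sum]
  refine Finset.sum_congr rfl fun k hk => ?_
  have h1 : (fun i => (![0, (c • w).1, (c • w).2] : Fin 3 → ℂ) i + v i * (c * y)) =
      fun i => c * ((![0, w.1, w.2] : Fin 3 → ℂ) i + v i * y) := by
    funext i
    fin_cases i <;> simp <;> ring
  have h2 : f.totalDegree = (f.totalDegree - k) + k := by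
    have := Finset.mem_range.1 hk
    omega
  have h3 := (homogeneousComponent_isHomogeneous k f).eval_mul c
    (fun i => (![0, w.1, w.2] : Fin 3 → ℂ) i + v i * y)
  rw [h1]
  change (c * s) ^ _ * eval _ _ = c ^ _ * (s ^ _ * eval _ _)
  rw [h3, mul_pow]
  conv_rhs => rw [h2, pow_add, Nat.add_sub_cancel]
  ring

theorem card_roots_conicOf_mul (hv : eval v (homogeneousComponent f.totalDegree f) = 1) {c : ℂ}
    (hc : c ≠ 0) (s : ℂ) (w : ℂ × ℂ) :
    (conicOf f v (c * s, c • w)).roots.toFinset.card =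
      (conicOf f v (s, w)).roots.toFinset.card := by
  have hF := monicFamily_conicOf hv
  refine Eq.trans (congrArg Finset.card ?_)
    (Finset.card_image_of_injective _ (mul_right_injective₀ hc))
  ext y
  rw [Finset.mem_image, Multiset.mem_toFinset, hF.mem_roots]
  constructor
  · intro hy
    refine ⟨c⁻¹ * y, ?_, mul_inv_cancel_left₀ hc y⟩
    rw [Multiset.mem_toFinset, hF.mem_roots]
    have h1 := eval_conicOf_mul (f := f) (v := v) c s w (c⁻¹ * y)
    rw [mul_inv_cancel_left₀ hc, hy] at h1
    exact (mul_eq_zero.1 h1.symm).resolve_left (pow_ne_zero _ hc)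
  · rintro ⟨y, hy, rfl⟩
    rw [Multiset.mem_toFinset, hF.mem_roots] at hy
    simp only [eval_conicOf_mul, hy, mul_zero]

theorem dense_nodup_conicOf_one (hf : Squarefree f) (hv0 : v 0 = 1)
    (hv : eval v (homogeneousComponent f.totalDegree f) = 1) :
    Dense {w | (conicOf f v (1, w)).roots.Nodup} := by
  set P := homogLine (R := MvPolynomial (Fin 2) ℂ) f f.totalDegree ![0, X 0, X 1]
    (fun i => C (v i)) 1 with hP
  have hPm : P.Monic := by
    refine (homogLine_monic ?_).1
    refine (aeval_algebraMap_apply (MvPolynomial (Fin 2) ℂ) v _).trans ?_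
    exact (congrArg _ hv).trans (map_one _)
  have hPs : Squarefree P := by
    rw [hP, homogLine_one rfl]
    exact squarefree_lineSubst hf hv0
  obtain ⟨c, hc, a, b, hab⟩ := hPm.exists_bezout_derivative hPs
  have h1 : Dense {w : ℂ × ℂ | eval ![w.1, w.2] c ≠ 0} :=
    (dense_eval_ne_zero hc).preimage (Homeomorph.finTwoArrow (X := ℂ)).symm.isOpenMap
  refine h1.mono fun w hw => ?_
  have h2 := Polynomial.nodup_roots_map_of_bezout hab
    ((aeval ![w.1, w.2] : MvPolynomial (Fin 2) ℂ →ₐ[ℂ] ℂ) : MvPolynomial (Fin 2) ℂ →+* ℂ) hw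
  have h3 : P.map ((aeval ![w.1, w.2] : MvPolynomial (Fin 2) ℂ →ₐ[ℂ] ℂ) :
      MvPolynomial (Fin 2) ℂ →+* ℂ) = conicOf f v (1, w) := by
    rw [hP, map_homogLine, conicOf]
    congr 1
    · funext i
      fin_cases i <;> simp
    · funext i
      simp
    · simp
  rwa [h3] at h2

theorem dense_nodup_conicOf (hf : Squarefree f) (hv0 : v 0 = 1)
    (hv : eval v (homogeneousComponent f.totalDegree f) = 1) {s : ℂ} (hs : s ≠ 0) :
    Dense {w | (conicOf f v (s, w)).roots.Nodup} := by
  have hF := monicFamily_conicOf hv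
  refine ((dense_nodup_conicOf_one hf hv0 hv).preimage
    (Homeomorph.smulOfNeZero s⁻¹ (inv_ne_zero hs)).isOpenMap).mono fun w hw => ?_
  have h1 : (conicOf f v (1, s⁻¹ • w)).roots.Nodup := hw
  have h2 := card_roots_conicOf_mul hv hs 1 (s⁻¹ • w)
  rw [mul_one, smul_inv_smul₀ hs] at h2
  refine (hF.nodup_iff (s, w)).2 ?_
  rw [h2]
  exact (hF.nodup_iff (1, s⁻¹ • w)).1 h1

theorem exists_card_conicOf (hv : eval v (homogeneousComponent f.totalDegree f) = 1) :
    ∃ (n : ℕ) (L : Set (ℂ × ℂ)), L.Finite ∧ (∀ b ∈ L, b ≠ 0) ∧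
      ∀ w ∈ coneBase L, (conicOf f v (0, w)).roots.toFinset.card = n := by
  set P := homogLine (R := Polynomial ℂ) f f.totalDegree ![0, 1, Polynomial.X]
    (fun i => Polynomial.C (v i)) 0 with hP
  have hPm : P.Monic := by
    refine (homogLine_monic ?_).1
    refine (aeval_algebraMap_apply (Polynomial ℂ) v _).trans ?_
    exact (congrArg _ hv).trans (map_one _)
  obtain ⟨n, c, hc, hcard⟩ := hPm.exists_card_toFinset_roots
  refine ⟨n, insert (0, 1) ((fun t => (1, t)) '' (c.roots.toFinset : Set ℂ)),
    (c.roots.toFinset.finite_toSet.image _).insert _, ?_, ?_⟩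
  · rintro b (rfl | ⟨t, -, rfl⟩) <;> simp
  · rintro w ⟨-, hw⟩
    have hw1 : w.1 ≠ 0 := by simpa using hw (0, 1) (Set.mem_insert _ _)
    have hroot : c.eval (w.2 / w.1) ≠ 0 := by
      intro h0
      refine hw (1, w.2 / w.1) (Set.mem_insert_of_mem _ ⟨_, ?_, rfl⟩) ?_
      · simpa [hc] using h0
      · simp [mul_div_cancel₀ _ hw1]
    have h1 := hcard _ hroot
    have h2 : P.map (Polynomial.evalRingHom (w.2 / w.1)) = conicOf f v (0, (1, w.2 / w.1)) := by
      rw [← Polynomial.coe_aeval_eq_evalRingHom, hP, map_homogLine, conicOf]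
      congr 1
      · funext i
        fin_cases i <;> simp
      · funext i
        simp
      · simp
    rw [h2, ← card_roots_conicOf_mul hv hw1, mul_zero] at h1
    convert h1 using 6
    ext <;> simp [mul_div_cancel₀ _ hw1]

theorem exists_conicFamily_conicOf (hf : Squarefree f) (hv0 : v 0 = 1)
    (hv : eval v (homogeneousComponent f.totalDegree f) = 1) :
    ∃ (n : ℕ) (L : Set (ℂ × ℂ)), ConicFamily (conicOf f v) f.totalDegree n L := by
  obtain ⟨n, L, hL, hL0, hcard⟩ := exists_card_conicOf hv
  exact ⟨n, L, monicFamily_conicOf hv, eval_conicOf_mul,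
    fun s hs => dense_nodup_conicOf hf hv0 hv hs, hL, hL0, hcard⟩

theorem eval_conicOf_one (w : ℂ × ℂ) (y : ℂ) :
    (conicOf f v (1, w)).eval y = eval (fun i => (![0, w.1, w.2] : Fin 3 → ℂ) i + v i * y) f := by
  rw [conicOf, homogLine_one rfl, eval_lineSubst]
  rfl

end ConicOf

/-- The linear coordinates on `ℂ³` in which `v` spans the last axis, for `v 0 = 1`. -/
noncomputable def lineCoordinates (v : Fin 3 → ℂ) (hv : v 0 = 1) :
    EuclideanSpace ℂ (Fin 3) ≃L[ℂ] (ℂ × ℂ) × ℂ :=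
  (EuclideanSpace.equiv (Fin 3) ℂ).trans <| LinearEquiv.toContinuousLinearEquiv
    { toFun := fun x => ((x 1 - v 1 * x 0, x 2 - v 2 * x 0), x 0)
      map_add' := fun x y => by ext <;> simp <;> ring
      map_smul' := fun c x => by ext <;> simp <;> ring
      invFun := fun p i => (![0, p.1.1, p.1.2] : Fin 3 → ℂ) i + v i * p.2
      left_inv := fun x => by
        funext i
        fin_cases i <;> simp [hv]
      right_inv := fun p => by ext <;> simp [hv] }

theorem lineCoordinates_symm_apply {v : Fin 3 → ℂ} (hv : v 0 = 1) (p : (ℂ × ℂ) × ℂ) (i : Fin 3) :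
    (lineCoordinates v hv).symm p i = (![0, p.1.1, p.1.2] : Fin 3 → ℂ) i + v i * p.2 :=
  rfl

theorem exists_eval_homogeneousComponent_ne_zero {f : MvPolynomial (Fin 3) ℂ} (hf : f ≠ 0) :
    ∃ v : Fin 3 → ℂ, v 0 = 1 ∧ eval v (homogeneousComponent f.totalDegree f) ≠ 0 := by
  have h0 : homogeneousComponent f.totalDegree f ≠ 0 := by
    obtain ⟨m, hm, hd⟩ := Finset.exists_mem_eq_sup f.support (support_nonempty.2 hf)
      fun m => m.sum fun _ e => e
    intro h
    have h1 := congrArg (coeff m) h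
    rw [coeff_homogeneousComponent, if_pos, coeff_zero] at h1
    · exact mem_support_iff.1 hm h1
    · exact hd.symm
  obtain ⟨x, hx⟩ : ∃ x, eval x (homogeneousComponent f.totalDegree f * X 0) ≠ 0 := by
    by_contra! h
    exact mul_ne_zero h0 (X_ne_zero _) (MvPolynomial.funext fun w => by rw [h w, map_zero])
  rw [map_mul, eval_X] at hx
  refine ⟨fun i => (x 0)⁻¹ * x i, inv_mul_cancel₀ (right_ne_zero_of_mul hx), ?_⟩
  rw [(homogeneousComponent_isHomogeneous _ f).eval_mul]
  exact mul_ne_zero (pow_ne_zero _ (inv_ne_zero (right_ne_zero_of_mul hx)))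
    (left_ne_zero_of_mul hx)

theorem exists_conicFamily {f : MvPolynomial (Fin 3) ℂ} (hf : Squarefree f) :
    ∃ (T : EuclideanSpace ℂ (Fin 3) ≃L[ℂ] (ℂ × ℂ) × ℂ) (H : ℂ × (ℂ × ℂ) → Polynomial ℂ) (n : ℕ)
      (L : Set (ℂ × ℂ)), ConicFamily H f.totalDegree n L ∧
        ∀ p, T.symm p ∈ mvZeroSet f ↔ p ∈ famZero fun w => H (1, w) := by
  obtain ⟨v, hv0, hv⟩ := exists_eval_homogeneousComponent_ne_zero hf.ne_zero
  set α := (eval v (homogeneousComponent f.totalDegree f))⁻¹ with hα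
  have hα0 : α ≠ 0 := inv_ne_zero hv
  have hu : IsUnit (C α : MvPolynomial (Fin 3) ℂ) := hα0.isUnit.map C
  have hdeg : (C α * f).totalDegree = f.totalDegree := by
    rw [totalDegree_mul_of_isDomain hu.ne_zero hf.ne_zero, totalDegree_C, zero_add]
  have hsq : Squarefree (C α * f) :=
    ((associated_isUnit_mul_left_iff hu).2 (Associated.refl f)).squarefree_iff.2 hf
  have hv' : eval v (homogeneousComponent (C α * f).totalDegree (C α * f)) = 1 := by
    rw [hdeg, homogeneousComponent_C_mul, map_mul, eval_C, hα, inv_mul_cancel₀ hv]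
  obtain ⟨n, L, h⟩ := exists_conicFamily_conicOf hsq hv0 hv'
  rw [hdeg] at h
  refine ⟨lineCoordinates v hv0, _, n, L, h, fun p => ?_⟩
  change eval (fun i => (lineCoordinates v hv0).symm p i) f = 0 ↔
    (conicOf (C α * f) v (1, p.1)).eval p.2 = 0
  simp only [lineCoordinates_symm_apply]
  rw [eval_conicOf_one, map_mul, eval_C, mul_eq_zero, or_iff_right hα0]

theorem exists_biLipEnds {E F : Type*} [NormedAddCommGroup E] [NormedSpace ℂ E]
    [NormedAddCommGroup F] [NormedSpace ℂ F] [Nonempty E] (T T' : E ≃L[ℂ] F) {K K' : Set E}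
    (hK : IsCompact K) (hK' : IsCompact K') {φ : E → E} (hbij : Set.BijOn φ Kᶜ K'ᶜ)
    {C D : ℝ} (hC : ∀ a ∈ Kᶜ, ∀ b ∈ Kᶜ, dist (φ a) (φ b) ≤ C * dist a b)
    (hD : ∀ a ∈ Kᶜ, ∀ b ∈ Kᶜ, dist a b ≤ D * dist (φ a) (φ b)) :
    ∃ B ψ, BiLipEnds (T '' K) (Set.image T' K') B (fun p => T' (φ (T.symm p))) ψ := by
  set θ := Function.invFunOn φ Kᶜ with hθ
  have hinv : Set.InvOn θ φ Kᶜ K'ᶜ := hbij.invOn_invFunOn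
  have hmaps : Set.MapsTo θ K'ᶜ Kᶜ := hbij.surjOn.mapsTo_invFunOn
  have hmem : ∀ {S : E ≃L[ℂ] F} {A : Set E} {p : F}, p ∈ (S '' A)ᶜ → S.symm p ∈ Aᶜ :=
    fun hp h => hp ⟨_, h, ContinuousLinearEquiv.apply_symm_apply _ _⟩
  have hmem' : ∀ {S : E ≃L[ℂ] F} {A : Set E} {x : E}, x ∈ Aᶜ → S x ∈ (S '' A)ᶜ := by
    rintro S A x hx ⟨y, hy, hxy⟩
    exact hx (S.injective hxy ▸ hy)
  have hφ : LipschitzOnWith C.toNNReal φ Kᶜ := LipschitzOnWith.of_dist_le_mul fun a ha b hb =>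
    (hC a ha b hb).trans (mul_le_mul_of_nonneg_right (Real.le_coe_toNNReal C) dist_nonneg)
  have hθ' : LipschitzOnWith D.toNNReal θ K'ᶜ := LipschitzOnWith.of_dist_le_mul fun a ha b hb => by
    have h1 := hD _ (hmaps ha) _ (hmaps hb)
    rw [hinv.2 ha, hinv.2 hb] at h1
    exact h1.trans (mul_le_mul_of_nonneg_right (Real.le_coe_toNNReal D) dist_nonneg)
  obtain ⟨M, hM⟩ : ∃ M, ∀ S ∈ ({T, T'} : Set (E ≃L[ℂ] F)),
      LipschitzWith M S ∧ LipschitzWith M S.symm := by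
    refine ⟨‖(T : E →L[ℂ] F)‖₊ ⊔ ‖(T.symm : F →L[ℂ] E)‖₊ ⊔ ‖(T' : E →L[ℂ] F)‖₊ ⊔
      ‖(T'.symm : F →L[ℂ] E)‖₊, ?_⟩
    rintro S (rfl | rfl)
    · exact ⟨(ContinuousLinearMap.lipschitz (S : E →L[ℂ] F)).weaken (by simp),
        (ContinuousLinearMap.lipschitz (S.symm : F →L[ℂ] E)).weaken (by simp)⟩
    · exact ⟨(ContinuousLinearMap.lipschitz (S : E →L[ℂ] F)).weaken (by simp),
        (ContinuousLinearMap.lipschitz (S.symm : F →L[ℂ] E)).weaken (by simp)⟩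
  have hT := hM T (by simp)
  have hT' := hM T' (by simp)
  refine ⟨(M * (C.toNNReal * M)) ⊔ (M * (D.toNNReal * M)), fun p => T (θ (T'.symm p)), ?_⟩
  exact {
    compact := hK.image T.continuous
    compact' := hK'.image T'.continuous
    lip := ((hT'.1.comp_lipschitzOnWith
      (hφ.comp (hT.2.lipschitzOnWith) fun p hp => hmem hp))).weaken le_sup_left
    lip' := ((hT.1.comp_lipschitzOnWith
      (hθ'.comp (hT'.2.lipschitzOnWith) fun p hp => hmem hp))).weaken le_sup_right
    maps := fun p hp => hmem' (hbij.mapsTo (hmem hp))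
    maps' := fun p hp => hmem' (hmaps (hmem hp))
    left := fun p hp => by
      simp only [ContinuousLinearEquiv.symm_apply_apply, hinv.1 (hmem hp),
        ContinuousLinearEquiv.apply_symm_apply]
    right := fun p hp => by
      simp only [ContinuousLinearEquiv.symm_apply_apply, hinv.2 (hmem hp),
        ContinuousLinearEquiv.apply_symm_apply] }

/-- the degree of complex algebraic surfaces in `ℂ³` is an embedded
bi-Lipschitz invariant at infinity: if an ambient bi-Lipschitz bijection
`φ : ℂ³ \ K → ℂ³ \ K̃` carries `V(f) \ K` onto `V(g) \ K̃`, then `deg f = deg g`. -/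
theorem degree_surfaces_embedded_biLipschitz_invariant_at_infinity
    (f g : MvPolynomial (Fin 3) ℂ)
    (hfdeg : 0 < f.totalDegree) (hgdeg : 0 < g.totalDegree)
    (hfsqf : Squarefree f) (hgsqf : Squarefree g)
    (K K' : Set (EuclideanSpace ℂ (Fin 3)))
    (hK : IsCompact K) (hK' : IsCompact K')
    (φ : EuclideanSpace ℂ (Fin 3) → EuclideanSpace ℂ (Fin 3))
    (hbij : Set.BijOn φ (Set.univ \ K) (Set.univ \ K'))
    (hlip : ∃ C > (0:ℝ), ∀ a ∈ Set.univ \ K, ∀ b ∈ Set.univ \ K,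
      dist (φ a) (φ b) ≤ C * dist a b)
    (hlipinv : ∃ c > (0:ℝ), ∀ a ∈ Set.univ \ K, ∀ b ∈ Set.univ \ K,
      dist a b ≤ c * dist (φ a) (φ b))
    (himg : φ '' (mvZeroSet f \ K) = mvZeroSet g \ K') :
    f.totalDegree = g.totalDegree := by
  simp only [← Set.compl_eq_univ_sdiff] at hbij hlip hlipinv
  obtain ⟨C, -, hC⟩ := hlip
  obtain ⟨D, -, hD⟩ := hlipinv
  obtain ⟨T, Hf, n, L, hf, hTf⟩ := exists_conicFamily hfsqf
  obtain ⟨T', Hg, n', L', hg, hTg⟩ := exists_conicFamily hgsqf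
  obtain ⟨B, ψ, hends⟩ := exists_biLipEnds T T' hK hK' hbij hC hD
  have hl : (Ultrafilter.of (𝓝[>] (0 : ℝ)) : Filter ℝ) ≤ 𝓝[>] 0 := Ultrafilter.of_le _
  obtain ⟨φ', hφ', hφ0, hφt⟩ := exists_blowDown hends.compact hends.lip hl
  obtain ⟨ψ', hψ', hψ0, hψt⟩ := exists_blowDown hends.compact' hends.lip' hl
  refine BlowDownPair.degree_eq (Hf := Hf) (Hg := Hg)
    ⟨hf, hg, hends, fun p hp => ?_, inferInstance, hl, hφ', hψ', hφ0, hψ0, hφt, hψt⟩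
  have hpK : T.symm p ∉ K := fun h => hp ⟨_, h, T.apply_symm_apply p⟩
  rw [← hTf, ← hTg, T'.symm_apply_apply]
  constructor
  · exact fun h => (himg.subset ⟨_, ⟨h, hpK⟩, rfl⟩).1
  · intro h
    obtain ⟨x, hx, hxp⟩ := himg.superset ⟨h, hbij.mapsTo hpK⟩
    rw [← hbij.injOn hx.2 hpK hxp]
    exact hx.1
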